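/- Upper bound in the main theorem (dilute Fermi gas): Fix an integer q ≥ 1 and a potential v with scattering length a_v as in the context. For every ε > 0 there exists ρ₀ > 0 such that for all 0 < ρ < ρ₀, limsup_{L→∞} E(⌊ρL³⌋, L)/L³ ≤ (3/5)(6π²/q)^{2/3} ρ^{5/3} + 4π(1 − 1/q) a_v ρ² + ε ρ². -/

import Mathlib

/-!
STATEMENT 1: Upper bound in the main theorem (dilute Fermi gas).
For a nonnegative, bounded, measurable, radial, compactly supported pair
potential `v` with scattering length `a`, and `q ≥ 1` spin states:
for every `ε > 0` there is `ρ₀ > 0` such that for all `0 < ρ < ρ₀`,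
`limsup_{L→∞} E(⌊ρL³⌋, L)/L³
   ≤ (3/5)(6π²/q)^{2/3} ρ^{5/3} + 4π(1 - 1/q) a ρ² + ε ρ²`.

The ground state energy `E(N,L)` is the infimum of the energy quadratic form
over normalized antisymmetric wave functions `Ψ(x₁,σ₁,…,x_N,σ_N)` with each
spin component a smooth function compactly supported in the open box
`(0,L)^{3N}` (a form core for the Dirichlet (H¹₀) realization).
-/

open MeasureTheory Real Filter
open scoped RealInnerProductSpace

noncomputable section

abbrev R3 := EuclideanSpace ℝ (Fin 3)

/-- `|∇f|²(x) = ∑_j |∂_j f(x)|²` for a complex-valued function on ℝ³. -/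
def gradSq (f : R3 → ℂ) (x : R3) : ℝ :=
  ∑ j : Fin 3, ‖fderiv ℝ f x (EuclideanSpace.single j 1)‖ ^ 2

/-- The open cube `(0,L)³`. -/
def openCube (L : ℝ) : Set R3 := {x | ∀ j, x j ∈ Set.Ioo 0 L}

/-- Admissible `N`-fermion wave functions with `q` spin states in the box `[0,L]³`:
each spin component smooth with (compact) support inside the open box (Dirichlet
boundary conditions), totally antisymmetric under simultaneous exchange of
position-spin pairs, and normalized in `L²`. -/
def IsFermionicState (N q : ℕ) (L : ℝ)
    (Ψ : (Fin N → R3) → (Fin N → Fin q) → ℂ) : Prop :=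
  (∀ σ, ContDiff ℝ (⊤ : ℕ∞) (fun X => Ψ X σ)) ∧
  (∀ σ, tsupport (fun X => Ψ X σ) ⊆ {X | ∀ i, X i ∈ openCube L}) ∧
  (∀ (i j : Fin N), i ≠ j → ∀ X σ,
      Ψ (X ∘ Equiv.swap i j) (σ ∘ Equiv.swap i j) = - Ψ X σ) ∧
  (∑ σ : Fin N → Fin q, ∫ X : Fin N → R3, ‖Ψ X σ‖ ^ 2) = 1

/-- The energy `Q(Ψ)` of a wave function: kinetic energy plus interaction. -/
def energyForm (N q : ℕ) (v : R3 → ℝ)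
    (Ψ : (Fin N → R3) → (Fin N → Fin q) → ℂ) : ℝ :=
  ∑ σ : Fin N → Fin q, ∫ X : Fin N → R3,
    ((∑ i, gradSq (fun y => Ψ (Function.update X i y) σ) (X i)) +
      ∑ i, ∑ j, if i < j then v (X i - X j) * ‖Ψ X σ‖ ^ 2 else 0)

/-- The ground state energy `E(N,L)`. -/
def groundEnergy (N q : ℕ) (L : ℝ) (v : R3 → ℝ) : ℝ :=
  sInf {E | ∃ Ψ, IsFermionicState N q L Ψ ∧ energyForm N q v Ψ = E}

set_option linter.unusedSectionVars false
set_option linter.unusedVariables false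
set_option linter.unusedSimpArgs false

section LinearAlgebra
open Matrix
open scoped ComplexOrder

variable {n : Type*} [Fintype n] [DecidableEq n]

theorem sum_det_updateRow_eq_trace (A B : Matrix n n ℂ) :
    ∑ j, (A.updateRow j (B j)).det = (B * A.adjugate).trace := by
  simp only [Matrix.trace, Matrix.diag, Matrix.mul_apply]
  refine Finset.sum_congr rfl fun j _ => ?_
  rw [← Matrix.cramer_transpose_apply, Matrix.cramer_eq_adjugate_mulVec,
    ← Matrix.adjugate_transpose]
  simp [Matrix.mulVec, dotProduct, mul_comm]

theorem re_trace_mul_conjTranspose_self (M : Matrix n n ℂ) :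
    (M * Mᴴ).trace.re = ∑ k, ∑ l, ‖M k l‖ ^ 2 := by
  simp only [Matrix.trace, Matrix.diag, Matrix.mul_apply, conjTranspose_apply, Complex.re_sum]
  refine Finset.sum_congr rfl fun k _ => Finset.sum_congr rfl fun l _ => ?_
  rw [Complex.star_def, Complex.mul_conj, Complex.normSq_eq_norm_sq, Complex.ofReal_re]

theorem frobenius_unitary_conj (U M : Matrix n n ℂ) (hU : U * Uᴴ = 1) :
    ∑ k, ∑ l, ‖(Uᴴ * M * U) k l‖ ^ 2 = ∑ k, ∑ l, ‖M k l‖ ^ 2 := by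
  rw [← re_trace_mul_conjTranspose_self, ← re_trace_mul_conjTranspose_self]
  congr 1
  have : (Uᴴ * M * U) * (Uᴴ * M * U)ᴴ = Uᴴ * (M * Mᴴ) * U := by
    simp only [conjTranspose_mul, conjTranspose_conjTranspose]
    calc Uᴴ * M * U * (Uᴴ * (Mᴴ * U)) = Uᴴ * M * (U * Uᴴ) * (Mᴴ * U) := by
          simp only [Matrix.mul_assoc]
      _ = _ := by rw [hU]; simp only [Matrix.mul_assoc, Matrix.one_mul]
  rw [this, Matrix.trace_mul_cycle, hU, Matrix.one_mul]

theorem re_sum_det_updateRow_le (A B H : Matrix n n ℂ) (hA : A.PosSemidef)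
    (hA1 : (1 - A).PosSemidef) (hB : B.PosSemidef) (hH : (H - (1 - A)).PosSemidef)
    {δ : ℝ} (hδ : 0 < δ) (hδ1 : δ < 1) :
    (∑ j, (A.updateRow j (B j)).det).re ≤
      B.trace.re * ((1 - δ)⁻¹ * A.det.re + (δ ^ 2)⁻¹ * ∑ k, ∑ l, ‖H k l‖ ^ 2) := by
  classical
  set μ := hA.isHermitian.eigenvalues with hμ
  set U : Matrix n n ℂ := (hA.isHermitian.eigenvectorUnitary : Matrix n n ℂ) with hUdef
  have hU1 : U * Uᴴ = 1 := Unitary.mul_star_self_of_mem hA.isHermitian.eigenvectorUnitary.2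
  have hU2 : Uᴴ * U = 1 := Unitary.star_mul_self_of_mem hA.isHermitian.eigenvectorUnitary.2
  have hspec : A = U * diagonal (fun i => (μ i : ℂ)) * Uᴴ := by
    have := hA.isHermitian.spectral_theorem
    rw [Unitary.conjStarAlgAut_apply] at this
    exact this
  have hdet : A.det.re = ∏ i, μ i := by
    rw [hA.isHermitian.det_eq_prod_eigenvalues]
    simp [← Complex.ofReal_prod, hμ]
  set c : n → ℝ := fun k => ∏ l ∈ Finset.univ.erase k, μ l with hc
  have hdU : Uᴴ.det * U.det = 1 := by rw [← det_mul, hU2, det_one]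
  have hadjU : U.adjugate = U.det • Uᴴ := by
    calc U.adjugate = U.adjugate * (U * Uᴴ) := by rw [hU1, Matrix.mul_one]
      _ = _ := by rw [← Matrix.mul_assoc, adjugate_mul, smul_mul, Matrix.one_mul]
  have hadjU' : Uᴴ.adjugate = Uᴴ.det • U := by
    calc Uᴴ.adjugate = Uᴴ.adjugate * (Uᴴ * U) := by rw [hU2, Matrix.mul_one]
      _ = _ := by rw [← Matrix.mul_assoc, adjugate_mul, smul_mul, Matrix.one_mul]
  have hadj : A.adjugate = U * diagonal (fun i => (c i : ℂ)) * Uᴴ := by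
    conv_lhs => rw [hspec]
    rw [adjugate_mul_distrib, adjugate_mul_distrib, hadjU, hadjU', adjugate_diagonal]
    simp only [Matrix.smul_mul, Matrix.mul_smul, smul_smul, hc, Complex.ofReal_prod,
      ← Matrix.mul_assoc]
    rw [mul_comm U.det, hdU, one_smul]
  set B' := Uᴴ * B * U with hB'
  have hB'p : B'.PosSemidef := hB.conjTranspose_mul_mul_same U
  have hdiag : ∀ k, 0 ≤ (B' k k).re := fun k => (Complex.le_def.1 (hB'p.diag_nonneg (i := k))).1
  have htrB : B.trace.re = ∑ k, (B' k k).re := by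
    have : B'.trace = B.trace := by
      rw [hB', Matrix.trace_mul_cycle, hU1, Matrix.one_mul]
    rw [← this, Matrix.trace, Complex.re_sum]; rfl
  have hμ0 : ∀ k, 0 ≤ μ k := hA.eigenvalues_nonneg
  have hA1' : Uᴴ * (1 - A) * U = diagonal (fun i => ((1 - μ i : ℝ) : ℂ)) := by
    rw [Matrix.mul_sub, Matrix.sub_mul, Matrix.mul_one, hU2]
    have : Uᴴ * A * U = diagonal (fun i => (μ i : ℂ)) := by
      rw [hspec]
      calc Uᴴ * (U * diagonal (fun i => (μ i : ℂ)) * Uᴴ) * U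
          = (Uᴴ * U) * diagonal (fun i => (μ i : ℂ)) * (Uᴴ * U) := by
            simp only [Matrix.mul_assoc]
        _ = _ := by rw [hU2, Matrix.one_mul, Matrix.mul_one]
    rw [this, ← diagonal_one, diagonal_sub]
    simp
  have hμ1 : ∀ k, μ k ≤ 1 := fun k => by
    have := (Complex.le_def.1 ((hA1.conjTranspose_mul_mul_same U).diag_nonneg (i := k))).1
    rw [hA1', diagonal_apply_eq] at this
    simpa using this
  have hs : ∀ k, (1 - μ k) ^ 2 ≤ ∑ k, ∑ l, ‖H k l‖ ^ 2 := fun k => by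
    have h1 := (Complex.le_def.1 ((hH.conjTranspose_mul_mul_same U).diag_nonneg (i := k))).1
    rw [Matrix.mul_sub, Matrix.sub_mul, hA1', Matrix.sub_apply, diagonal_apply_eq] at h1
    simp only [Complex.sub_re, Complex.ofReal_re, Complex.zero_re] at h1
    rw [← frobenius_unitary_conj U H hU1]
    calc (1 - μ k) ^ 2 ≤ ‖(Uᴴ * H * U) k k‖ ^ 2 := by
          have := Complex.re_le_norm ((Uᴴ * H * U) k k)
          have := hμ1 k
          gcongr
          linarith
      _ ≤ ∑ l, ‖(Uᴴ * H * U) k l‖ ^ 2 :=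
          Finset.single_le_sum (f := fun l => ‖(Uᴴ * H * U) k l‖ ^ 2)
            (fun _ _ => by positivity) (Finset.mem_univ k)
      _ ≤ _ := Finset.single_le_sum (f := fun k => ∑ l, ‖(Uᴴ * H * U) k l‖ ^ 2)
            (fun _ _ => by positivity) (Finset.mem_univ k)
  have hcb : ∀ k, c k ≤ (1 - δ)⁻¹ * ∏ i, μ i + (δ ^ 2)⁻¹ * ∑ k, ∑ l, ‖H k l‖ ^ 2 := fun k => by
    have hc0 : 0 ≤ c k := Finset.prod_nonneg fun i _ => hμ0 i
    have hprod : ∏ i, μ i = μ k * c k := (Finset.mul_prod_erase _ _ (Finset.mem_univ k)).symm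
    have hF : 0 ≤ ∑ k, ∑ l, ‖H k l‖ ^ 2 := by positivity
    rcases le_or_gt (1 - μ k) δ with h | h
    · have : c k ≤ (1 - δ)⁻¹ * ∏ i, μ i := by
        rw [hprod, inv_mul_eq_div, le_div_iff₀ (by linarith), mul_comm]
        gcongr; linarith
      have : 0 ≤ (δ ^ 2)⁻¹ * ∑ k, ∑ l, ‖H k l‖ ^ 2 := by positivity
      linarith
    · have h1 : c k ≤ 1 := Finset.prod_le_one (fun i _ => hμ0 i) (fun i _ => hμ1 i)
      have h2 : 1 ≤ (δ ^ 2)⁻¹ * ∑ k, ∑ l, ‖H k l‖ ^ 2 := by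
        rw [inv_mul_eq_div, le_div_iff₀ (by positivity), one_mul]
        refine le_trans ?_ (hs k)
        gcongr
      have h3 : 0 ≤ (1 - δ)⁻¹ * ∏ i, μ i :=
        mul_nonneg (inv_nonneg.2 (by linarith)) (Finset.prod_nonneg fun i _ => hμ0 i)
      linarith
  rw [sum_det_updateRow_eq_trace, hadj, hdet, htrB, Finset.sum_mul]
  have : (B * (U * diagonal (fun i => (c i : ℂ)) * Uᴴ)).trace
      = (B' * diagonal (fun i => (c i : ℂ))).trace := by
    rw [← Matrix.mul_assoc, ← Matrix.mul_assoc, Matrix.trace_mul_cycle, hB',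
      ← Matrix.mul_assoc]
  rw [this, Matrix.trace, Complex.re_sum]
  refine Finset.sum_le_sum fun k _ => ?_
  rw [diag_apply, mul_diagonal, Complex.re_mul_ofReal]
  exact mul_le_mul_of_nonneg_left (hcb k) (hdiag k)

end LinearAlgebra

section Slater
open Matrix
open scoped ComplexOrder ComplexConjugate

variable {E O : Type*} [MeasurableSpace E] [Fintype O] [DecidableEq O]

/-- The (unnormalized) Slater determinant of the orbitals `e`. -/
def slater (e : O → E → ℂ) (x : O → E) : ℂ := (Matrix.of fun k i => e k (x i)).det

/-- The matrix of the multiplication operator `f` in the orbitals `e`. -/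
def gramMat (γ : Measure E) (e : O → E → ℂ) (f : E → ℝ) : Matrix O O ℂ :=
  Matrix.of fun k l => ∫ x, conj (e k x) * e l x * f x ∂γ

/-- A family of measurable unimodular functions, orthonormal with respect to `γ`. -/
structure Orbitals (γ : Measure E) (e : O → E → ℂ) : Prop where
  meas : ∀ k, Measurable (e k)
  norm_eq_one : ∀ k x, ‖e k x‖ = 1
  ortho : ∀ k l, ∫ x, conj (e k x) * e l x ∂γ = if k = l then 1 else 0

variable {γ : Measure E} [IsProbabilityMeasure γ] {e : O → E → ℂ}

theorem Orbitals.integrable (he : Orbitals γ e) {f : E → ℝ} (hf : Integrable f γ) (k l : O) :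
    Integrable (fun x => conj (e k x) * e l x * f x) γ := by
  refine Integrable.bdd_mul (c := 1) hf.ofReal ?_ (Filter.Eventually.of_forall fun x => ?_)
  · exact ((Complex.continuous_conj.measurable.comp (he.meas k)).mul
      (he.meas l)).aestronglyMeasurable
  · rw [norm_mul, RCLike.norm_conj, he.norm_eq_one, he.norm_eq_one, mul_one]

theorem Orbitals.measurable_slater (he : Orbitals γ e) : Measurable (slater e) := by
  unfold slater
  simp only [Matrix.det_apply']
  refine Finset.measurable_sum _ fun σ _ => Measurable.const_mul ?_ _
  exact Finset.measurable_prod _ fun i _ => (he.meas _).comp (measurable_pi_apply i)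

theorem Orbitals.slater_sq (x : O → E) : ((‖slater e x‖ ^ 2 : ℝ) : ℂ) =
    ∑ σ : Equiv.Perm O, ∑ τ : Equiv.Perm O, ((Equiv.Perm.sign σ : ℤ) : ℂ) *
      ((Equiv.Perm.sign τ : ℤ) : ℂ) * ∏ i, (conj (e (σ i) (x i)) * e (τ i) (x i)) := by
  rw [Complex.ofReal_pow, ← Complex.conj_mul', slater, Matrix.det_apply', map_sum,
    Finset.sum_mul_sum]
  refine Finset.sum_congr rfl fun σ _ => Finset.sum_congr rfl fun τ _ => ?_
  rw [map_mul, map_prod, Finset.prod_mul_distrib, map_intCast]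
  simp only [Matrix.of_apply]
  ring

theorem Orbitals.norm_slater_sq_le (he : Orbitals γ e) (x : O → E) :
    ‖slater e x‖ ^ 2 ≤ ((Fintype.card O).factorial : ℝ) ^ 2 := by
  refine pow_le_pow_left₀ (norm_nonneg _) ?_ 2
  rw [slater, Matrix.det_apply']
  refine (norm_sum_le _ _).trans ?_
  have : ∀ σ : Equiv.Perm O, ‖((Equiv.Perm.sign σ : ℤ) : ℂ) *
      ∏ i, (Matrix.of fun k i => e k (x i)) (σ i) i‖ = 1 := fun σ => by
    rw [norm_mul, norm_prod]
    rcases Int.units_eq_one_or (Equiv.Perm.sign σ) with h | h <;> simp [h, he.norm_eq_one]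
  simp only [this]
  simp [Fintype.card_perm]

/-- Expansion of the Slater density integrated against a product function. -/
theorem Orbitals.integral_slater_prod (he : Orbitals γ e) (a : O → E → ℝ)
    (ha : ∀ i, Integrable (a i) γ) :
    ((∫ x, ‖slater e x‖ ^ 2 * ∏ i, a i (x i) ∂Measure.pi (fun _ => γ) : ℝ) : ℂ) =
      ∑ σ : Equiv.Perm O, ∑ τ : Equiv.Perm O, ((Equiv.Perm.sign σ : ℤ) : ℂ) *
        ((Equiv.Perm.sign τ : ℤ) : ℂ) * ∏ i, gramMat γ e (a i) (σ i) (τ i) := by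
  have hinteg : ∀ σ τ : Equiv.Perm O, Integrable (fun x : O → E =>
      ((Equiv.Perm.sign σ : ℤ) : ℂ) * ((Equiv.Perm.sign τ : ℤ) : ℂ) *
      ∏ i, (conj (e (σ i) (x i)) * e (τ i) (x i) * a i (x i))) (Measure.pi (fun _ => γ)) :=
    fun σ τ => (Integrable.fintype_prod fun i => he.integrable (ha i) (σ i) (τ i)).const_mul _
  rw [← integral_complex_ofReal]
  have : ∀ x : O → E, ((‖slater e x‖ ^ 2 * ∏ i, a i (x i) : ℝ) : ℂ) =
      ∑ σ : Equiv.Perm O, ∑ τ : Equiv.Perm O, ((Equiv.Perm.sign σ : ℤ) : ℂ) *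
      ((Equiv.Perm.sign τ : ℤ) : ℂ) *
        ∏ i, (conj (e (σ i) (x i)) * e (τ i) (x i) * a i (x i)) := fun x => by
    rw [Complex.ofReal_mul, Orbitals.slater_sq, Finset.sum_mul]
    refine Finset.sum_congr rfl fun σ _ => ?_
    rw [Finset.sum_mul]
    refine Finset.sum_congr rfl fun τ _ => ?_
    rw [Finset.prod_mul_distrib (g := fun i => (a i (x i) : ℂ)), Complex.ofReal_prod, mul_assoc]
  simp only [this]
  rw [integral_finsetSum _ fun σ _ => integrable_finsetSum _ fun τ _ => hinteg σ τ]
  refine Finset.sum_congr rfl fun σ _ => ?_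
  rw [integral_finsetSum _ fun τ _ => hinteg σ τ]
  refine Finset.sum_congr rfl fun τ _ => ?_
  rw [integral_const_mul]
  congr 1
  exact integral_fintype_prod_eq_prod (𝕜 := ℂ)
    (fun i x => conj (e (σ i) x) * e (τ i) x * (a i x : ℂ))

theorem sum_perm_sign_mul_prod (A : O → Matrix O O ℂ) (σ : Equiv.Perm O) :
    ∑ τ : Equiv.Perm O, ((Equiv.Perm.sign σ : ℤ) : ℂ) *
        ((Equiv.Perm.sign τ : ℤ) : ℂ) * ∏ i, A i (σ i) (τ i) =
      (Matrix.of fun j l => A (σ.symm j) j l).det := by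
  have h := Matrix.det_permute σ (Matrix.of fun j l => A (σ.symm j) j l)
  have h1 : (((Equiv.Perm.sign σ : ℤ) : ℂ)) * ((Equiv.Perm.sign σ : ℤ) : ℂ) = 1 := by
    rcases Int.units_eq_one_or (Equiv.Perm.sign σ) with h | h <;> simp [h]
  rw [← one_mul (Matrix.det _), ← h1, mul_assoc, ← h, ← Matrix.det_transpose,
    Matrix.det_apply', Finset.mul_sum]
  refine Finset.sum_congr rfl fun τ _ => ?_
  simp [mul_assoc]

theorem Orbitals.integral_slater_prod_eq_det (he : Orbitals γ e) (f : E → ℝ)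
    (hf : Integrable f γ) :
    ((∫ x, ‖slater e x‖ ^ 2 * ∏ i, f (x i) ∂Measure.pi (fun _ => γ) : ℝ) : ℂ) =
      ((Fintype.card O).factorial : ℂ) * (gramMat γ e f).det := by
  rw [he.integral_slater_prod (fun _ => f) (fun _ => hf)]
  simp only [sum_perm_sign_mul_prod (fun _ => gramMat γ e f)]
  simp [Fintype.card_perm]
  left; rfl

theorem Orbitals.sum_integral_slater_eq (he : Orbitals γ e) (w f : E → ℝ)
    (hw : Integrable w γ) (hf : Integrable f γ) :
    ((∑ i, ∫ x, ‖slater e x‖ ^ 2 * (w (x i) * ∏ j ∈ Finset.univ.erase i, f (x j))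
        ∂Measure.pi (fun _ => γ) : ℝ) : ℂ) =
      ((Fintype.card O).factorial : ℂ) *
        ∑ j, ((gramMat γ e f).updateRow j (gramMat γ e w j)).det := by
  have h1 : ∀ i : O, ∀ x : O → E, w (x i) * ∏ j ∈ Finset.univ.erase i, f (x j) =
      ∏ j, (if j = i then w else f) (x j) := fun i x => by
    rw [← Finset.mul_prod_erase _ _ (Finset.mem_univ i)]
    simp only [if_true]
    congr 1
    refine Finset.prod_congr rfl fun j hj => ?_
    rw [if_neg (Finset.ne_of_mem_erase hj)]
  simp only [h1]
  rw [Complex.ofReal_sum]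
  have h2 : ∀ i : O, ((∫ x, ‖slater e x‖ ^ 2 * ∏ j, (if j = i then w else f) (x j)
      ∂Measure.pi (fun _ => γ) : ℝ) : ℂ) = ∑ σ : Equiv.Perm O,
        ((gramMat γ e f).updateRow (σ i) (gramMat γ e w (σ i))).det := fun i => by
    rw [he.integral_slater_prod (fun j => if j = i then w else f)
      (fun j => by split_ifs <;> assumption)]
    simp only [sum_perm_sign_mul_prod (fun j => gramMat γ e (if j = i then w else f))]
    refine Finset.sum_congr rfl fun σ _ => ?_
    congr 1
    ext j l
    rw [Matrix.updateRow_apply]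
    by_cases hj : j = σ i
    · subst hj; simp
    · have : σ.symm j ≠ i := fun h => hj (by rw [← h]; simp)
      simp [hj, this]
  simp only [h2]
  rw [Finset.sum_comm]
  have h3 : ∀ σ : Equiv.Perm O,
      ∑ i, ((gramMat γ e f).updateRow (σ i) (gramMat γ e w (σ i))).det =
      ∑ j, ((gramMat γ e f).updateRow j (gramMat γ e w j)).det := fun σ =>
    Equiv.sum_comp σ fun j => ((gramMat γ e f).updateRow j (gramMat γ e w j)).det
  simp only [h3]
  simp [Fintype.card_perm]

theorem Orbitals.gramMat_one (he : Orbitals γ e) : gramMat γ e (fun _ => 1) = 1 := by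
  ext k l
  simp [gramMat, he.ortho, Matrix.one_apply]

theorem Orbitals.gramMat_sub (he : Orbitals γ e) {f g : E → ℝ} (hf : Integrable f γ)
    (hg : Integrable g γ) : gramMat γ e (fun x => f x - g x) = gramMat γ e f - gramMat γ e g := by
  ext k l
  simp only [gramMat, Matrix.of_apply, Matrix.sub_apply]
  rw [← integral_sub (he.integrable hf k l) (he.integrable hg k l)]
  simp [mul_sub]

theorem Orbitals.gramMat_posSemidef (he : Orbitals γ e) {f : E → ℝ} (hf : Integrable f γ)
    (h0 : ∀ x, 0 ≤ f x) : (gramMat γ e f).PosSemidef := by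
  refine PosSemidef.of_dotProduct_mulVec_nonneg ?_ fun z => ?_
  · ext k l
    simp only [gramMat, conjTranspose_apply, Matrix.of_apply, Complex.star_def, ← integral_conj]
    congr 1; ext x
    simp only [map_mul, Complex.conj_conj, Complex.conj_ofReal]; ring
  · have : star z ⬝ᵥ gramMat γ e f *ᵥ z = ((∫ x, ‖∑ k, z k * e k x‖ ^ 2 * f x ∂γ : ℝ) : ℂ) := by
      rw [← integral_complex_ofReal]
      have hx : ∀ x, ((‖∑ k, z k * e k x‖ ^ 2 * f x : ℝ) : ℂ) =
          ∑ k, ∑ l, star (z k) * (z l * (conj (e k x) * e l x * f x)) := fun x => by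
        rw [Complex.ofReal_mul, Complex.ofReal_pow, ← Complex.conj_mul', map_sum,
          Finset.sum_mul_sum, Finset.sum_mul]
        refine Finset.sum_congr rfl fun k _ => ?_
        rw [Finset.sum_mul]
        refine Finset.sum_congr rfl fun l _ => ?_
        simp; ring
      simp only [hx]
      have hi : ∀ k l, Integrable (fun x => star (z k) * (z l * (conj (e k x) * e l x * f x))) γ :=
        fun k l => ((he.integrable hf k l).const_mul _).const_mul _
      rw [integral_finsetSum _ fun k _ => integrable_finsetSum _ fun l _ => hi k l]
      simp only [dotProduct, Matrix.mulVec, Finset.mul_sum]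
      refine Finset.sum_congr rfl fun k _ => ?_
      rw [integral_finsetSum _ fun l _ => hi k l]
      refine Finset.sum_congr rfl fun l _ => ?_
      rw [integral_const_mul, integral_const_mul]
      simp only [gramMat, Matrix.of_apply, Pi.star_apply, Complex.star_def]; ring
    rw [this, Complex.zero_le_real]
    exact integral_nonneg fun x => mul_nonneg (by positivity) (h0 x)

theorem Orbitals.trace_gramMat (he : Orbitals γ e) (f : E → ℝ) :
    (gramMat γ e f).trace = ((Fintype.card O * ∫ x, f x ∂γ : ℝ) : ℂ) := by
  have : ∀ k, gramMat γ e f k k = ((∫ x, f x ∂γ : ℝ) : ℂ) := fun k => by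
    simp only [gramMat, Matrix.of_apply, ← integral_complex_ofReal]
    congr 1; ext x
    rw [Complex.conj_mul', he.norm_eq_one]; simp
  simp [Matrix.trace, this]

/-- The probability measure with density `|slater|² / m!`. -/
def slaterMeasure (γ : Measure E) (e : O → E → ℂ) : Measure (O → E) :=
  (Measure.pi fun _ => γ).withDensity fun x =>
    ENNReal.ofReal (‖slater e x‖ ^ 2 / (Fintype.card O).factorial)

theorem Orbitals.measurable_density (he : Orbitals γ e) :
    Measurable fun x => ‖slater e x‖ ^ 2 / ((Fintype.card O).factorial : ℝ) :=
  (he.measurable_slater.norm.pow_const 2).div_const _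

theorem Orbitals.integral_slaterMeasure (he : Orbitals γ e) (f : (O → E) → ℝ) :
    ∫ x, f x ∂slaterMeasure γ e = ((Fintype.card O).factorial : ℝ)⁻¹ *
      ∫ x, ‖slater e x‖ ^ 2 * f x ∂Measure.pi (fun _ => γ) := by
  rw [slaterMeasure, integral_withDensity_eq_integral_toReal_smul
    he.measurable_density.ennreal_ofReal (by simp), ← integral_const_mul]
  congr 1; ext x
  rw [ENNReal.toReal_ofReal (by positivity), smul_eq_mul]
  ring

theorem Orbitals.isProbabilityMeasure (he : Orbitals γ e) :
    IsProbabilityMeasure (slaterMeasure γ e) := by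
  have h := he.integral_slater_prod_eq_det (fun _ => 1) (integrable_const 1)
  rw [he.gramMat_one, Matrix.det_one, mul_one] at h
  simp only [Finset.prod_const_one, mul_one] at h
  have h' : ∫ x, ‖slater e x‖ ^ 2 ∂Measure.pi (fun _ : O => γ) = (Fintype.card O).factorial := by
    exact_mod_cast h
  constructor
  rw [slaterMeasure, withDensity_apply _ MeasurableSet.univ, Measure.restrict_univ,
    ← ofReal_integral_eq_lintegral_ofReal, integral_div, h', div_self (by positivity),
    ENNReal.ofReal_one]
  · refine Integrable.of_bound he.measurable_density.aestronglyMeasurable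
      (((Fintype.card O).factorial : ℝ) ^ 2 / (Fintype.card O).factorial)
      (Filter.Eventually.of_forall fun x => ?_)
    rw [Real.norm_of_nonneg (by positivity)]
    exact div_le_div_of_nonneg_right (he.norm_slater_sq_le x) (by positivity)
  · exact Filter.Eventually.of_forall fun x => by positivity

end Slater

section SlaterEstimates
open Matrix
open scoped ComplexOrder ComplexConjugate

variable {E O : Type*} [MeasurableSpace E] [Fintype O] [DecidableEq O]
variable {γ : Measure E} [IsProbabilityMeasure γ] {e : O → E → ℂ}

theorem Orbitals.sum_integral_mul_prod_le (he : Orbitals γ e) {w ψ h : E → ℝ}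
    (hw : Integrable w γ) (hw0 : ∀ x, 0 ≤ w x) (hψ : Measurable ψ) (hψ0 : ∀ x, 0 ≤ ψ x)
    (hψ1 : ∀ x, ψ x ≤ 1) (hh : Integrable h γ) (hhψ : ∀ x, 1 - ψ x ≤ h x)
    {δ : ℝ} (hδ : 0 < δ) (hδ1 : δ < 1) :
    ∑ i, ∫ x, w (x i) * ∏ j ∈ Finset.univ.erase i, ψ (x j) ∂slaterMeasure γ e ≤
      (Fintype.card O * ∫ x, w x ∂γ) * ((1 - δ)⁻¹ * ∫ x, ∏ j, ψ (x j) ∂slaterMeasure γ e +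
        (δ ^ 2)⁻¹ * ∑ k, ∑ l, ‖gramMat γ e h k l‖ ^ 2) := by
  have hψi : Integrable ψ γ := Integrable.of_bound hψ.aestronglyMeasurable 1
    (Filter.Eventually.of_forall fun x => by
      rw [Real.norm_of_nonneg (hψ0 x)]; exact hψ1 x)
  have h1 : (∑ i, ∫ x, w (x i) * ∏ j ∈ Finset.univ.erase i, ψ (x j) ∂slaterMeasure γ e) =
      (∑ j, ((gramMat γ e ψ).updateRow j (gramMat γ e w j)).det).re := by
    have := he.sum_integral_slater_eq w ψ hw hψi
    simp only [he.integral_slaterMeasure, ← Finset.mul_sum]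
    rw [inv_mul_eq_iff_eq_mul₀ (by positivity), ← Complex.ofReal_re (∑ i, _), this]
    rw [← Complex.ofReal_natCast, Complex.re_ofReal_mul]
  have h2 : ∫ x, ∏ j, ψ (x j) ∂slaterMeasure γ e = (gramMat γ e ψ).det.re := by
    have := he.integral_slater_prod_eq_det ψ hψi
    rw [he.integral_slaterMeasure]
    rw [inv_mul_eq_iff_eq_mul₀ (by positivity), ← Complex.ofReal_re (∫ _, _ ∂_), this]
    rw [← Complex.ofReal_natCast, Complex.re_ofReal_mul]
  have h3 : (Fintype.card O * ∫ x, w x ∂γ) = (gramMat γ e w).trace.re := by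
    rw [he.trace_gramMat, Complex.ofReal_re]
  rw [h1, h2, h3]
  have hψi' : Integrable (fun x => 1 - ψ x) γ := (integrable_const 1).sub hψi
  have h4 : 1 - gramMat γ e ψ = gramMat γ e (fun x => 1 - ψ x) := by
    rw [he.gramMat_sub (integrable_const 1) hψi, he.gramMat_one]
  refine re_sum_det_updateRow_le _ _ _ (he.gramMat_posSemidef hψi hψ0) ?_
    (he.gramMat_posSemidef hw hw0) ?_ hδ hδ1
  · rw [h4]
    exact he.gramMat_posSemidef hψi' fun x => by linarith [hψ1 x]
  · rw [h4, ← he.gramMat_sub hh hψi']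
    exact he.gramMat_posSemidef (hh.sub hψi')
      fun x => by linarith [hhψ x]

theorem Orbitals.sum_integral_eval (he : Orbitals γ e) {w : E → ℝ} (hw : Integrable w γ) :
    ∑ i, ∫ x, w (x i) ∂slaterMeasure γ e = Fintype.card O * ∫ x, w x ∂γ := by
  have := he.sum_integral_slater_eq w (fun _ => 1) hw (integrable_const 1)
  simp only [he.integral_slaterMeasure, ← Finset.mul_sum]
  simp only [Finset.prod_const_one, mul_one] at this
  rw [inv_mul_eq_iff_eq_mul₀ (by positivity), ← Complex.ofReal_re (∑ i, _), this]
  rw [← Complex.ofReal_natCast, Complex.re_ofReal_mul, he.gramMat_one]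
  congr 1
  rw [sum_det_updateRow_eq_trace, adjugate_one, Matrix.mul_one, he.trace_gramMat,
    Complex.ofReal_re]

/-- The squared modulus of the reproducing kernel of the orbitals. -/
def kerSq (e : O → E → ℂ) (x y : E) : ℝ := ‖∑ k, conj (e k x) * e k y‖ ^ 2

theorem kerSq_nonneg (x y : E) : 0 ≤ kerSq e x y := by unfold kerSq; positivity

theorem Orbitals.kerSq_le (he : Orbitals γ e) (x y : E) :
    kerSq e x y ≤ (Fintype.card O : ℝ) ^ 2 := by
  unfold kerSq
  refine pow_le_pow_left₀ (norm_nonneg _) ((norm_sum_le _ _).trans ?_) 2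
  simp [he.norm_eq_one]

theorem kerSq_eq (x y : E) : ((kerSq e x y : ℝ) : ℂ) =
    ∑ k, ∑ l, (conj (e k x) * e l x) * (conj (e l y) * e k y) := by
  rw [kerSq, Complex.ofReal_pow, ← Complex.mul_conj', map_sum, Finset.sum_mul_sum]
  refine Finset.sum_congr rfl fun k _ => Finset.sum_congr rfl fun l _ => ?_
  rw [map_mul, Complex.conj_conj]; ring

theorem Orbitals.measurable_kerSq (he : Orbitals γ e) :
    Measurable fun z : E × E => kerSq e z.1 z.2 := by
  unfold kerSq
  refine Measurable.pow_const (Measurable.norm ?_) 2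
  refine Finset.measurable_sum _ fun k _ => Measurable.mul ?_ ?_
  · exact Complex.continuous_conj.measurable.comp ((he.meas k).comp measurable_fst)
  · exact (he.meas k).comp measurable_snd

theorem Orbitals.integral_kerSq (he : Orbitals γ e) (x : E) :
    ∫ y, kerSq e x y ∂γ = Fintype.card O := by
  have hi : ∀ k l, Integrable (fun y => conj (e l y) * e k y) γ := fun k l => by
    simpa using he.integrable (integrable_const 1) l k
  have : ((∫ y, kerSq e x y ∂γ : ℝ) : ℂ) = (Fintype.card O : ℂ) := by
    rw [← integral_complex_ofReal]
    simp only [kerSq_eq]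
    rw [integral_finsetSum _ fun k _ => integrable_finsetSum _ fun l _ => (hi k l).const_mul _]
    have : ∀ k, ∫ y, ∑ l, (conj (e k x) * e l x) * (conj (e l y) * e k y) ∂γ = 1 := fun k => by
      rw [integral_finsetSum _ fun l _ => (hi k l).const_mul _]
      simp only [integral_const_mul, he.ortho]
      simp [Complex.conj_mul', he.norm_eq_one]
    simp [this]
  exact_mod_cast this

theorem Orbitals.frobenius_gramMat (he : Orbitals γ e) {h : E → ℝ} (hh : Integrable h γ) :
    ∑ k, ∑ l, ‖gramMat γ e h k l‖ ^ 2 =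
      ∫ z, h z.1 * h z.2 * kerSq e z.1 z.2 ∂(γ.prod γ) := by
  have : ((∑ k, ∑ l, ‖gramMat γ e h k l‖ ^ 2 : ℝ) : ℂ) =
      ((∫ z, h z.1 * h z.2 * kerSq e z.1 z.2 ∂(γ.prod γ) : ℝ) : ℂ) := by
    rw [← integral_complex_ofReal]
    have hz : ∀ z : E × E, ((h z.1 * h z.2 * kerSq e z.1 z.2 : ℝ) : ℂ) = ∑ k, ∑ l,
        (conj (e k z.1) * e l z.1 * h z.1) * (conj (e l z.2) * e k z.2 * h z.2) := fun z => by
      rw [Complex.ofReal_mul, kerSq_eq, Finset.mul_sum]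
      refine Finset.sum_congr rfl fun k _ => ?_
      rw [Finset.mul_sum]
      refine Finset.sum_congr rfl fun l _ => ?_
      push_cast; ring
    have hi : ∀ k l, Integrable (fun z : E × E => (conj (e k z.1) * e l z.1 * h z.1) *
        (conj (e l z.2) * e k z.2 * h z.2)) (γ.prod γ) := fun k l =>
      (he.integrable hh k l).mul_prod (he.integrable hh l k)
    simp only [hz]
    rw [integral_finsetSum _ fun k _ => integrable_finsetSum _ fun l _ => hi k l,
      Complex.ofReal_sum]
    refine Finset.sum_congr rfl fun k _ => ?_
    rw [integral_finsetSum _ fun l _ => hi k l, Complex.ofReal_sum]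
    refine Finset.sum_congr rfl fun l _ => ?_
    rw [integral_prod_mul (fun x => conj (e k x) * e l x * (h x : ℂ))
      (fun x => conj (e l x) * e k x * (h x : ℂ)), Complex.ofReal_pow, ← Complex.mul_conj']
    congr 1
    simp only [gramMat, Matrix.of_apply, ← integral_conj]
    refine integral_congr_ae (Filter.Eventually.of_forall fun x => ?_)
    simp only [map_mul, Complex.conj_conj, Complex.conj_ofReal]; ring
  exact_mod_cast this

/-- The exchange factor of a pair of plane waves. -/
def exch (e : O → E → ℂ) (k l : O) (z : E × E) : ℝ :=
  (conj (e k z.1) * e l z.1 * (conj (e l z.2) * e k z.2)).re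

theorem Orbitals.exch_le (he : Orbitals γ e) (k l : O) (z : E × E) : |exch e k l z| ≤ 1 := by
  refine (Complex.abs_re_le_norm _).trans ?_
  simp [he.norm_eq_one]

theorem Orbitals.measurable_exch (he : Orbitals γ e) (k l : O) : Measurable (exch e k l) := by
  have h1 : ∀ k, Measurable fun z : E × E => e k z.1 := fun k => (he.meas k).comp measurable_fst
  have h2 : ∀ k, Measurable fun z : E × E => e k z.2 := fun k => (he.meas k).comp measurable_snd
  have hc := Complex.continuous_conj.measurable
  exact Complex.measurable_re.comp
    (((hc.comp (h1 k)).mul (h1 l)).mul ((hc.comp (h2 l)).mul (h2 k)))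

theorem Orbitals.integral_pair_prod (he : Orbitals γ e) {i j : O} (hij : i ≠ j) {f g : E → ℝ}
    (hf : Integrable f γ) (hg : Integrable g γ) :
    ∫ x, f (x i) * g (x j) ∂slaterMeasure γ e =
      ∫ z, f z.1 * g z.2 * (((Fintype.card O).factorial : ℝ)⁻¹ *
        ∑ σ : Equiv.Perm O, (1 - exch e (σ i) (σ j) z)) ∂(γ.prod γ) := by
  set a : O → E → ℝ := fun l => if l = i then f else if l = j then g else fun _ => 1 with ha
  have hai : ∀ l, Integrable (a l) γ := fun l => by
    simp only [ha]; split_ifs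
    exacts [hf, hg, integrable_const 1]
  have hprod : ∀ x : O → E, ∏ l, a l (x l) = f (x i) * g (x j) := fun x => by
    rw [← Finset.mul_prod_erase _ _ (Finset.mem_univ i),
      ← Finset.mul_prod_erase _ _ (Finset.mem_erase.2 ⟨hij.symm, Finset.mem_univ j⟩),
      Finset.prod_eq_one, mul_one]
    · simp [ha, hij.symm]
    · intro l hl
      simp only [Finset.mem_erase] at hl
      simp [ha, hl.1, hl.2.1]
  have hfg : Integrable (fun z : E × E => f z.1 * g z.2) (γ.prod γ) := hf.mul_prod hg
  have hfge : ∀ k l, Integrable (fun z : E × E => f z.1 * g z.2 * exch e k l z) (γ.prod γ) :=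
    fun k l => hfg.mul_bdd (c := 1) (he.measurable_exch k l).aestronglyMeasurable
      (Filter.Eventually.of_forall (he.exch_le k l))
  have hre : ∀ k l, ∫ z, f z.1 * g z.2 * exch e k l z ∂(γ.prod γ) =
      (gramMat γ e f k l * gramMat γ e g l k).re := fun k l => by
    simp only [gramMat, Matrix.of_apply]
    rw [← integral_prod_mul (fun x => conj (e k x) * e l x * (f x : ℂ))
      (fun x => conj (e l x) * e k x * (g x : ℂ)), ← RCLike.re_eq_complex_re, ← integral_re]
    · refine integral_congr_ae (Filter.Eventually.of_forall fun z => ?_)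
      simp only [exch, RCLike.re_eq_complex_re]
      rw [← Complex.re_ofReal_mul]
      congr 1
      push_cast; ring
    · exact (he.integrable hf k l).mul_prod (he.integrable hg l k)
  have key : ∀ σ : Equiv.Perm O, ∑ τ : Equiv.Perm O, ((Equiv.Perm.sign σ : ℤ) : ℂ) *
        ((Equiv.Perm.sign τ : ℤ) : ℂ) * ∏ l, gramMat γ e (a l) (σ l) (τ l) =
      (∫ x, f x ∂γ : ℝ) * (∫ x, g x ∂γ : ℝ) -
        gramMat γ e f (σ i) (σ j) * gramMat γ e g (σ j) (σ i) := fun σ => by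
    have hne : σ ≠ σ * Equiv.swap i j := fun h => by
      have : Equiv.swap i j = 1 := by simpa using h.symm
      exact hij (Equiv.swap_eq_one_iff.1 this)
    have hG : ∀ k, ∀ f' : E → ℝ, gramMat γ e f' k k = (∫ x, f' x ∂γ : ℝ) := fun k f' => by
      simp only [gramMat, Matrix.of_apply, ← integral_complex_ofReal]
      refine integral_congr_ae (Filter.Eventually.of_forall fun x => ?_)
      simp only [Complex.conj_mul', he.norm_eq_one]; simp
    have hai' : a i = f := by simp [ha]
    have haj' : a j = g := by simp [ha, hij.symm]
    have hal' : ∀ l, l ≠ i → l ≠ j → a l = fun _ => 1 := fun l h1 h2 => by simp [ha, h1, h2]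
    have hs : ((Equiv.Perm.sign σ : ℤ) : ℂ) * ((Equiv.Perm.sign σ : ℤ) : ℂ) = 1 := by
      rcases Int.units_eq_one_or (Equiv.Perm.sign σ) with h | h <;> simp [h]
    have hsplit : ∀ τ : Equiv.Perm O, ∏ l, gramMat γ e (a l) (σ l) (τ l) =
        gramMat γ e f (σ i) (τ i) * (gramMat γ e g (σ j) (τ j) *
          ∏ l ∈ (Finset.univ.erase i).erase j, if σ l = τ l then 1 else 0) := fun τ => by
      rw [← Finset.mul_prod_erase _ _ (Finset.mem_univ i),
        ← Finset.mul_prod_erase _ _ (Finset.mem_erase.2 ⟨hij.symm, Finset.mem_univ j⟩),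
        hai', haj']
      congr 2
      refine Finset.prod_congr rfl fun l hl => ?_
      simp only [Finset.mem_erase] at hl
      rw [hal' l hl.2.1 hl.1, he.gramMat_one, Matrix.one_apply]
    rw [← Finset.sum_subset (Finset.subset_univ {σ, σ * Equiv.swap i j}),
      Finset.sum_pair hne]
    · rw [hsplit, hsplit, hs, Finset.prod_eq_one, Finset.prod_eq_one, hG, hG, Equiv.Perm.sign_mul,
        Equiv.Perm.sign_swap hij]
      · simp only [Equiv.Perm.mul_apply, Equiv.swap_apply_left, Equiv.swap_apply_right]
        push_cast
        linear_combination (-gramMat γ e f (σ i) (σ j) * gramMat γ e g (σ j) (σ i)) * hs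
      · intro l hl
        simp only [Finset.mem_erase] at hl
        simp [Equiv.swap_apply_of_ne_of_ne hl.2.1 hl.1]
      · intro l hl; simp
    · intro τ _ hτ
      rw [hsplit]
      by_cases hall : ∀ l, l ≠ i → l ≠ j → σ l = τ l
      · exfalso
        apply hτ
        simp only [Finset.mem_insert, Finset.mem_singleton]
        have hi : τ i = σ i ∨ τ i = σ j := by
          by_contra! hc
          have h1 := hall (σ.symm (τ i)) (fun h => hc.1 (σ.symm_apply_eq.1 h))
            (fun h => hc.2 (σ.symm_apply_eq.1 h))
          rw [Equiv.apply_symm_apply] at h1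
          have h2 := τ.injective h1
          exact hc.1 (σ.symm_apply_eq.1 h2.symm)
        have hj : τ j = σ i ∨ τ j = σ j := by
          by_contra! hc
          have h1 := hall (σ.symm (τ j)) (fun h => hc.1 (σ.symm_apply_eq.1 h))
            (fun h => hc.2 (σ.symm_apply_eq.1 h))
          rw [Equiv.apply_symm_apply] at h1
          have h2 := τ.injective h1
          exact hc.2 (σ.symm_apply_eq.1 h2.symm)
        have hne' : τ i ≠ τ j := fun h => hij (τ.injective h)
        rcases hi with hi | hi
        · have hj' : τ j = σ j := hj.resolve_left fun h => hne' (hi.trans h.symm)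
          left
          ext l
          by_cases h1 : l = i
          · rw [h1, hi]
          · by_cases h2 : l = j
            · rw [h2, hj']
            · exact (hall l h1 h2).symm
        · have hj' : τ j = σ i := hj.resolve_right fun h => hne' (hi.trans h.symm)
          right
          ext l
          by_cases h1 : l = i
          · rw [h1, hi]; simp
          · by_cases h2 : l = j
            · rw [h2, hj']; simp
            · rw [Equiv.Perm.mul_apply, Equiv.swap_apply_of_ne_of_ne h1 h2]
              exact (hall l h1 h2).symm
      · push Not at hall
        obtain ⟨l, h1, h2, h3⟩ := hall
        rw [Finset.prod_eq_zero (i := l) (by simp [h1, h2]) (by simp [h3])]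
        simp
  have hL := he.integral_slater_prod a hai
  simp only [key, hprod] at hL
  rw [he.integral_slaterMeasure]
  have hR : ∫ z, f z.1 * g z.2 * (((Fintype.card O).factorial : ℝ)⁻¹ *
        ∑ σ : Equiv.Perm O, (1 - exch e (σ i) (σ j) z)) ∂(γ.prod γ) =
      ((Fintype.card O).factorial : ℝ)⁻¹ * ∑ σ : Equiv.Perm O,
        ((∫ x, f x ∂γ) * (∫ x, g x ∂γ) -
          (gramMat γ e f (σ i) (σ j) * gramMat γ e g (σ j) (σ i)).re) := by
    have : ∀ z : E × E, f z.1 * g z.2 * (((Fintype.card O).factorial : ℝ)⁻¹ *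
        ∑ σ : Equiv.Perm O, (1 - exch e (σ i) (σ j) z)) = ((Fintype.card O).factorial : ℝ)⁻¹ *
        ∑ σ : Equiv.Perm O, (f z.1 * g z.2 - f z.1 * g z.2 * exch e (σ i) (σ j) z) := fun z => by
      rw [mul_left_comm, Finset.mul_sum]
      congr 1
      exact Finset.sum_congr rfl fun σ _ => by ring
    simp only [this]
    have hi : ∀ σ : Equiv.Perm O, Integrable (fun z : E × E => f z.1 * g z.2 -
        f z.1 * g z.2 * exch e (σ i) (σ j) z) (γ.prod γ) := fun σ => hfg.sub (hfge _ _)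
    rw [integral_const_mul, integral_finsetSum _ fun σ _ => hi σ]
    congr 1
    refine Finset.sum_congr rfl fun σ _ => ?_
    rw [integral_sub hfg (hfge _ _), hre, integral_prod_mul]
  rw [hR]
  congr 1
  rw [← Complex.ofReal_re (∫ _, _ ∂_), hL, Complex.re_sum]
  refine Finset.sum_congr rfl fun σ _ => ?_
  rw [Complex.sub_re, Complex.re_ofReal_mul, Complex.ofReal_re]

theorem Orbitals.map_pair (he : Orbitals γ e) {i j : O} (hij : i ≠ j) :
    (slaterMeasure γ e).map (fun x => (x i, x j)) = (γ.prod γ).withDensity fun z =>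
      ENNReal.ofReal (((Fintype.card O).factorial : ℝ)⁻¹ *
        ∑ σ : Equiv.Perm O, (1 - exch e (σ i) (σ j) z)) := by
  have := he.isProbabilityMeasure
  have hm : Measurable fun x : O → E => (x i, x j) :=
    (measurable_pi_apply i).prodMk (measurable_pi_apply j)
  have hdm : Measurable fun z : E × E => ((Fintype.card O).factorial : ℝ)⁻¹ *
        ∑ σ : Equiv.Perm O, (1 - exch e (σ i) (σ j) z) :=
    (Finset.measurable_sum _ fun σ _ => (he.measurable_exch _ _).const_sub 1).const_mul _
  have hd0 : ∀ z : E × E, 0 ≤ ((Fintype.card O).factorial : ℝ)⁻¹ *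
        ∑ σ : Equiv.Perm O, (1 - exch e (σ i) (σ j) z) := fun z =>
    mul_nonneg (by positivity) (Finset.sum_nonneg fun σ _ => by
      linarith [(abs_le.1 (he.exch_le (σ i) (σ j) z)).2])
  have hdb : ∀ z : E × E, ((Fintype.card O).factorial : ℝ)⁻¹ *
        ∑ σ : Equiv.Perm O, (1 - exch e (σ i) (σ j) z) ≤ 2 := fun z => by
    rw [inv_mul_le_iff₀ (by positivity)]
    calc ∑ σ : Equiv.Perm O, (1 - exch e (σ i) (σ j) z) ≤ ∑ σ : Equiv.Perm O, (2:ℝ) :=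
          Finset.sum_le_sum fun σ _ => by linarith [(abs_le.1 (he.exch_le (σ i) (σ j) z)).1]
      _ = _ := by simp [Fintype.card_perm]
  have : IsFiniteMeasure ((slaterMeasure γ e).map fun x => (x i, x j)) :=
    Measure.isFiniteMeasure_map _ _
  refine Measure.ext_prod fun {s t} hs ht => ?_
  rw [Measure.map_apply hm (hs.prod ht), withDensity_apply _ (hs.prod ht),
    ← ofReal_integral_eq_lintegral_ofReal]
  · rw [← ENNReal.ofReal_toReal (measure_ne_top (slaterMeasure γ e) _)]
    congr 1
    have h := he.integral_pair_prod hij (f := s.indicator fun _ => 1) (g := t.indicator fun _ => 1)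
      ((integrable_const 1).indicator hs) ((integrable_const 1).indicator ht)
    have h1 : ∀ x : O → E, s.indicator (fun _ => (1:ℝ)) (x i) * t.indicator (fun _ => (1:ℝ)) (x j) =
        ((fun x : O → E => (x i, x j)) ⁻¹' s ×ˢ t).indicator (fun _ => 1) x := fun x => by
      by_cases h1 : x i ∈ s <;> by_cases h2 : x j ∈ t <;> simp [h1, h2, Set.indicator]
    have h2 : ∀ (z : E × E) (c : ℝ), s.indicator (fun _ => (1:ℝ)) z.1 *
        t.indicator (fun _ => (1:ℝ)) z.2 * c = (s ×ˢ t).indicator (fun _ => c) z := fun z c => by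
      by_cases h1 : z.1 ∈ s <;> by_cases h2 : z.2 ∈ t <;> simp [h1, h2, Set.indicator]
    simp only [h1, h2] at h
    rw [integral_indicator_const _ (hm (hs.prod ht))] at h
    have h3 : ∀ z : E × E, (s ×ˢ t).indicator (fun _ : E × E => ((Fintype.card O).factorial : ℝ)⁻¹ *
        ∑ σ : Equiv.Perm O, (1 - exch e (σ i) (σ j) z)) z =
        (s ×ˢ t).indicator (fun z : E × E => ((Fintype.card O).factorial : ℝ)⁻¹ *
        ∑ σ : Equiv.Perm O, (1 - exch e (σ i) (σ j) z)) z := fun z => by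
      simp [Set.indicator]
    simp only [h3] at h
    rw [integral_indicator (hs.prod ht)] at h
    rw [← h]; simp [Measure.real]
  · refine Integrable.of_bound hdm.aestronglyMeasurable 2 (Filter.Eventually.of_forall fun z => ?_)
    rw [Real.norm_of_nonneg (hd0 z)]; exact hdb z
  · exact Filter.Eventually.of_forall hd0

theorem Orbitals.integral_pair_le (he : Orbitals γ e) {i j : O} (hij : i ≠ j)
    {A B : E × E → ℝ} (hA : Measurable A) (hA0 : ∀ z, 0 ≤ A z)
    (hAB : Integrable (fun z => A z * B z) (γ.prod γ))
    (hB : ∀ k l z, 1 - exch e k l z ≤ B z) :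
    ∫ x, A (x i, x j) ∂slaterMeasure γ e ≤ ∫ z, A z * B z ∂(γ.prod γ) := by
  have hm : Measurable fun x : O → E => (x i, x j) :=
    (measurable_pi_apply i).prodMk (measurable_pi_apply j)
  have hdm : Measurable fun z : E × E => ((Fintype.card O).factorial : ℝ)⁻¹ *
        ∑ σ : Equiv.Perm O, (1 - exch e (σ i) (σ j) z) :=
    (Finset.measurable_sum _ fun σ _ => (he.measurable_exch _ _).const_sub 1).const_mul _
  have hd0 : ∀ z : E × E, 0 ≤ ((Fintype.card O).factorial : ℝ)⁻¹ *
        ∑ σ : Equiv.Perm O, (1 - exch e (σ i) (σ j) z) := fun z =>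
    mul_nonneg (by positivity) (Finset.sum_nonneg fun σ _ => by
      linarith [(abs_le.1 (he.exch_le (σ i) (σ j) z)).2])
  rw [← integral_map (φ := fun x : O → E => (x i, x j)) (f := A) hm.aemeasurable
    hA.aestronglyMeasurable, he.map_pair hij,
    integral_withDensity_eq_integral_toReal_smul hdm.ennreal_ofReal
      (Filter.Eventually.of_forall fun z => ENNReal.ofReal_lt_top)]
  refine integral_mono_of_nonneg (Filter.Eventually.of_forall fun z => ?_) hAB
    (Filter.Eventually.of_forall fun z => ?_)
  · exact smul_nonneg ENNReal.toReal_nonneg (hA0 z)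
  · simp only [smul_eq_mul]
    rw [ENNReal.toReal_ofReal (hd0 z), mul_comm]
    refine mul_le_mul_of_nonneg_left ?_ (hA0 z)
    rw [inv_mul_le_iff₀ (by positivity)]
    calc ∑ σ : Equiv.Perm O, (1 - exch e (σ i) (σ j) z) ≤ ∑ σ : Equiv.Perm O, B z :=
          Finset.sum_le_sum fun σ _ => hB _ _ z
      _ = _ := by rw [Finset.sum_const, Finset.card_univ, Fintype.card_perm, nsmul_eq_mul]

end SlaterEstimates

section Resampling

variable {S B : Type*} [Fintype S] [DecidableEq S] [MeasurableSpace B]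

theorem measurable_update_pair (α : S) :
    Measurable fun z : (S → B) × B => Function.update z.1 α z.2 := by
  refine measurable_pi_iff.2 fun β => ?_
  by_cases h : β = α
  · subst h; simpa using measurable_snd
  · simp only [Function.update_of_ne h]
    exact (measurable_pi_apply β).comp measurable_fst

theorem map_update_pi (μ : S → Measure B) [∀ β, IsProbabilityMeasure (μ β)] (α : S) :
    ((Measure.pi μ).prod (μ α)).map (fun z => Function.update z.1 α z.2) = Measure.pi μ := by
  symm
  refine Measure.pi_eq fun s hs => ?_
  rw [Measure.map_apply (measurable_update_pair α) (MeasurableSet.univ_pi hs)]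
  have : (fun z : (S → B) × B => Function.update z.1 α z.2) ⁻¹' Set.univ.pi s =
      (Set.univ.pi (Function.update s α Set.univ)) ×ˢ s α := by
    ext ⟨X, x⟩
    simp only [Set.mem_preimage, Set.mem_univ_pi, Set.mem_prod]
    constructor
    · intro h
      refine ⟨fun β => ?_, by simpa using h α⟩
      by_cases hβ : β = α
      · subst hβ; simp
      · simpa [hβ] using h β
    · rintro ⟨h1, h2⟩ β
      by_cases hβ : β = α
      · subst hβ; simpa using h2
      · simpa [hβ] using h1 β
  rw [this, Measure.prod_prod, Measure.pi_pi, ← Finset.prod_erase_mul _ _ (Finset.mem_univ α),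
    ← Finset.prod_erase_mul _ _ (Finset.mem_univ α)]
  congr 1
  simp only [Function.update_self, measure_univ, mul_one]
  exact Finset.prod_congr rfl fun β hβ => by
    rw [Function.update_of_ne (Finset.ne_of_mem_erase hβ)]

theorem integrable_update {μ : S → Measure B} [∀ β, IsProbabilityMeasure (μ β)] (α : S)
    {G : (S → B) → ℝ} (hG : Integrable G (Measure.pi μ)) :
    Integrable (fun z : (S → B) × B => G (Function.update z.1 α z.2))
      ((Measure.pi μ).prod (μ α)) := by
  rw [← map_update_pi μ α] at hG
  exact hG.comp_measurable (measurable_update_pair α)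

theorem integral_update {μ : S → Measure B} [∀ β, IsProbabilityMeasure (μ β)] (α : S)
    {G : (S → B) → ℝ} (hG : Integrable G (Measure.pi μ)) :
    ∫ Y, G Y ∂Measure.pi μ = ∫ X, ∫ x, G (Function.update X α x) ∂μ α ∂Measure.pi μ := by
  rw [← integral_prod (fun z : (S → B) × B => G (Function.update z.1 α z.2))
    (integrable_update α hG)]
  conv_lhs => rw [← map_update_pi μ α]
  rw [integral_map (measurable_update_pair α).aemeasurable]
  rw [map_update_pi]
  exact hG.aestronglyMeasurable

/-- Comparison of integrals block by block. -/
theorem integral_le_of_update {μ : S → Measure B} [∀ β, IsProbabilityMeasure (μ β)] (α : S)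
    {G G' : (S → B) → ℝ} (hG : Integrable G (Measure.pi μ)) (hG' : Integrable G' (Measure.pi μ))
    (h : ∀ X, ∫ x, G (Function.update X α x) ∂μ α ≤ ∫ x, G' (Function.update X α x) ∂μ α) :
    ∫ Y, G Y ∂Measure.pi μ ≤ ∫ Y, G' Y ∂Measure.pi μ := by
  rw [integral_update α hG, integral_update α hG']
  exact integral_mono (integrable_update α hG).integral_prod_left
    (integrable_update α hG').integral_prod_left h

end Resampling

section MultiSpecies
open Matrix
open scoped ComplexConjugate

variable {E O S : Type*} [MeasurableSpace E] [Fintype O] [DecidableEq O] [Fintype S] [DecidableEq S]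
variable {γ : Measure E} [IsProbabilityMeasure γ] {e : O → E → ℂ}

/-- The law of independent species, each distributed like a Slater determinant. -/
def speciesMeasure (S : Type*) [Fintype S] (γ : Measure E) (e : O → E → ℂ) :
    Measure (S → O → E) :=
  Measure.pi fun _ : S => slaterMeasure γ e

theorem Orbitals.isProbabilityMeasure_species (he : Orbitals γ e) :
    IsProbabilityMeasure (speciesMeasure S γ e) := by
  have := he.isProbabilityMeasure
  unfold speciesMeasure; infer_instance

theorem measurable_particle (a : S × O) : Measurable fun Y : S → O → E => Y a.1 a.2 :=
  (measurable_pi_apply a.2).comp (measurable_pi_apply a.1)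

theorem measurable_particle_pair (a b : S × O) :
    Measurable fun Y : S → O → E => (Y a.1 a.2, Y b.1 b.2) :=
  (measurable_particle a).prodMk (measurable_particle b)

theorem integrable_of_measurable_of_bound {X : Type*} [MeasurableSpace X] {μ : Measure X}
    [IsFiniteMeasure μ] {f : X → ℝ} (hf : Measurable f) (C : ℝ) (h : ∀ x, |f x| ≤ C) :
    Integrable f μ :=
  Integrable.of_bound hf.aestronglyMeasurable C (Filter.Eventually.of_forall h)

theorem Orbitals.integrable_eval (he : Orbitals γ e) {w : E → ℝ} (hw : Integrable w γ) (i : O) :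
    Integrable (fun x => w (x i)) (slaterMeasure γ e) := by
  have h1 : Integrable (fun x : O → E => w (x i)) (Measure.pi fun _ => γ) :=
    integrable_comp_eval (μ := fun _ => γ) hw
  rw [slaterMeasure, integrable_withDensity_iff_integrable_smul' he.measurable_density.ennreal_ofReal
    (Filter.Eventually.of_forall fun z => ENNReal.ofReal_lt_top)]
  refine Integrable.bdd_mul (c := ((Fintype.card O).factorial : ℝ) ^ 2 / (Fintype.card O).factorial)
    h1 he.measurable_density.ennreal_ofReal.ennreal_toReal.aestronglyMeasurable
    (Filter.Eventually.of_forall fun x => ?_)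
  rw [ENNReal.toReal_ofReal (by positivity), Real.norm_of_nonneg (by positivity)]
  exact div_le_div_of_nonneg_right (he.norm_slater_sq_le x) (by positivity)

theorem Orbitals.integrable_particle (he : Orbitals γ e) {w : E → ℝ} (hw : Integrable w γ)
    (a : S × O) : Integrable (fun Y : S → O → E => w (Y a.1 a.2)) (speciesMeasure S γ e) := by
  have := he.isProbabilityMeasure
  exact integrable_comp_eval (μ := fun _ : S => slaterMeasure γ e) (i := a.1)
    (f := fun x : O → E => w (x a.2)) (he.integrable_eval hw a.2)

/-- Two-body functions have expectation bounded as for independent particles. -/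
theorem Orbitals.integral_two_body_le (he : Orbitals γ e) {A : E × E → ℝ} (hA : Measurable A)
    (hA0 : ∀ z, 0 ≤ A z) {C : ℝ} (hAC : ∀ z, A z ≤ C) {c : ℝ}
    (hc : ∀ y, ∫ y', A (y, y') ∂γ ≤ c) :
    ∫ Y, ∑ a : S × O, ∑ b : S × O, (if a ≠ b then A (Y a.1 a.2, Y b.1 b.2) else 0)
      ∂speciesMeasure S γ e ≤ 2 * (Fintype.card S * Fintype.card O : ℝ) ^ 2 * c := by
  have hp0 := he.isProbabilityMeasure
  have hp := he.isProbabilityMeasure_species (S := S)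
  have hAi : ∀ a b : S × O, Integrable (fun Y : S → O → E => A (Y a.1 a.2, Y b.1 b.2))
      (speciesMeasure S γ e) := fun a b =>
    integrable_of_measurable_of_bound (hA.comp (measurable_particle_pair a b)) C
      fun Y => by rw [abs_of_nonneg (hA0 _)]; exact hAC _
  have hAi' : ∀ a b : S × O, Integrable (fun Y : S → O → E =>
      if a ≠ b then A (Y a.1 a.2, Y b.1 b.2) else 0) (speciesMeasure S γ e) := fun a b => by
    split_ifs
    exacts [hAi a b, integrable_zero _ _ _]
  have hAy : ∀ y, Integrable (fun y' => A (y, y')) γ := fun y =>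
    integrable_of_measurable_of_bound (hA.comp measurable_prodMk_left) C
      fun Y => by rw [abs_of_nonneg (hA0 _)]; exact hAC _
  have hc0 : 0 ≤ c := by
    have ⟨y⟩ : Nonempty E := nonempty_of_isProbabilityMeasure γ
    exact (integral_nonneg fun y' => hA0 _).trans (hc y)
  have hAp : Integrable A (γ.prod γ) := integrable_of_measurable_of_bound hA C
      fun Y => by rw [abs_of_nonneg (hA0 _)]; exact hAC _
  have hAA : ∫ z, A z ∂(γ.prod γ) ≤ c := by
    rw [integral_prod _ hAp]
    calc ∫ x, ∫ y, A (x, y) ∂γ ∂γ ≤ ∫ x, c ∂γ :=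
          integral_mono hAp.integral_prod_left (integrable_const c) hc
      _ = c := by simp
  rw [integral_finsetSum _ fun a _ => integrable_finsetSum _ fun b _ => hAi' a b]
  simp only [Fintype.sum_prod_type]
  have hblock : ∀ α β : S, ∑ i, ∑ j, ∫ Y, (if ((α, i) : S × O) ≠ (β, j) then
      A (Y α i, Y β j) else 0) ∂speciesMeasure S γ e ≤ 2 * (Fintype.card O : ℝ) ^ 2 * c := by
    intro α β
    by_cases hαβ : α = β
    · subst hαβ
      have : ∀ i j : O, ∫ Y, (if ((α, i) : S × O) ≠ (α, j) then
          A (Y α i, Y α j) else 0) ∂speciesMeasure S γ e ≤ 2 * c := fun i j => by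
        by_cases hij : i = j
        · simp [hij, hc0]
        · have h1 : ((α, i) : S × O) ≠ (α, j) := fun h => hij (Prod.ext_iff.1 h).2
          simp only [if_pos h1]
          have h2 : ∫ Y, A (Y α i, Y α j) ∂speciesMeasure S γ e =
              ∫ x, A (x i, x j) ∂slaterMeasure γ e :=
            integral_comp_eval (μ := fun _ : S => slaterMeasure γ e) (i := α)
              (f := fun x : O → E => A (x i, x j)) (hA.comp
                ((measurable_pi_apply i).prodMk (measurable_pi_apply j))).aestronglyMeasurable
          rw [h2]
          refine (he.integral_pair_le hij hA hA0 (B := fun _ => 2) (hAp.mul_const 2)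
            fun k l z => by linarith [(abs_le.1 (he.exch_le k l z)).1]).trans ?_
          rw [integral_mul_const]; linarith
      calc ∑ i, ∑ j, ∫ Y, (if ((α, i) : S × O) ≠ (α, j) then
          A (Y α i, Y α j) else 0) ∂speciesMeasure S γ e ≤ ∑ i : O, ∑ j : O, 2 * c :=
            Finset.sum_le_sum fun i _ => Finset.sum_le_sum fun j _ => this i j
        _ = _ := by simp; ring
    · have h1 : ∀ i j : O, ((α, i) : S × O) ≠ (β, j) := fun i j h => hαβ (Prod.ext_iff.1 h).1
      simp only [h1, ne_eq, not_false_eq_true, if_true]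
      have h2 : ∀ i : O, ∑ j, ∫ Y, A (Y α i, Y β j) ∂speciesMeasure S γ e ≤
          Fintype.card O * c := fun i => by
        rw [← integral_finsetSum _ fun j _ => hAi (α, i) (β, j)]
        calc ∫ Y, ∑ j, A (Y α i, Y β j) ∂speciesMeasure S γ e
            ≤ ∫ Y : S → O → E, (Fintype.card O * c) ∂speciesMeasure S γ e := by
              refine integral_le_of_update (μ := fun _ : S => slaterMeasure γ e) β
                (integrable_finsetSum _ fun j _ => hAi (α, i) (β, j)) (integrable_const _)
                fun X => ?_
              simp only [Function.update_self, Function.update_of_ne hαβ]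
              rw [integral_finsetSum _ fun j _ => he.integrable_eval (hAy (X α i)) j,
                he.sum_integral_eval (hAy _)]
              simp only [integral_const, probReal_univ, one_smul]
              exact mul_le_mul_of_nonneg_left (hc _) (by positivity)
          _ = _ := by simp
      calc ∑ i, ∑ j, ∫ Y, A (Y α i, Y β j) ∂speciesMeasure S γ e
          ≤ ∑ i : O, Fintype.card O * c := Finset.sum_le_sum fun i _ => h2 i
        _ = (Fintype.card O : ℝ) ^ 2 * c := by simp; ring
        _ ≤ _ := by nlinarith [mul_nonneg (sq_nonneg (Fintype.card O : ℝ)) hc0]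
  have hswap : ∀ (α : S) (i : O), ∫ Y, ∑ β, ∑ j, (if ((α, i) : S × O) ≠ (β, j) then
      A (Y α i, Y β j) else 0) ∂speciesMeasure S γ e = ∑ β, ∑ j, ∫ Y, (if ((α, i) : S × O) ≠ (β, j)
      then A (Y α i, Y β j) else 0) ∂speciesMeasure S γ e := fun α i => by
    rw [integral_finsetSum _ fun β _ => integrable_finsetSum _ fun j _ => hAi' (α, i) (β, j)]
    refine Finset.sum_congr rfl fun β _ => ?_
    rw [integral_finsetSum _ fun j _ => hAi' (α, i) (β, j)]
  simp only [hswap]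
  calc ∑ α : S, ∑ i : O, ∑ β : S, ∑ j : O, ∫ Y, (if ((α, i) : S × O) ≠ (β, j)
      then A (Y α i, Y β j) else 0) ∂speciesMeasure S γ e
      = ∑ α : S, ∑ β : S, ∑ i : O, ∑ j : O, ∫ Y, (if ((α, i) : S × O) ≠ (β, j)
      then A (Y α i, Y β j) else 0) ∂speciesMeasure S γ e :=
        Finset.sum_congr rfl fun α _ => Finset.sum_comm
    _ ≤ ∑ α : S, ∑ β : S, 2 * (Fintype.card O : ℝ) ^ 2 * c :=
        Finset.sum_le_sum fun α _ => Finset.sum_le_sum fun β _ => hblock α β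
    _ = _ := by simp; ring

end MultiSpecies

section BoxEstimates
open Matrix
open scoped ComplexConjugate

variable {E O S : Type*} [MeasurableSpace E] [Fintype O] [DecidableEq O] [Fintype S] [DecidableEq S]
variable {γ : Measure E} [IsProbabilityMeasure γ] {e : O → E → ℂ}

/-- A bounded symmetric nonnegative pair function whose marginals are at most `c`. -/
structure PairBound (γ : Measure E) (A : E → E → ℝ) (c : ℝ) : Prop where
  meas : Measurable fun z : E × E => A z.1 z.2
  nonneg : ∀ x y, 0 ≤ A x y
  symm : ∀ x y, A x y = A y x
  bdd : ∃ C, ∀ x y, A x y ≤ C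
  int_le : ∀ y, ∫ x, A x y ∂γ ≤ c

/-- The sum of a pair function over ordered pairs of particles of different species. -/
def crossSum (A : E → E → ℝ) (Y : S → O → E) : ℝ :=
  ∑ a : S × O, ∑ b : S × O, if a.1 ≠ b.1 then A (Y a.1 a.2) (Y b.1 b.2) else 0

/-- The sum of a pair function over the particles of species different from `α`. -/
def nbSum (A : E → E → ℝ) (α : S) (Y : S → O → E) (x : E) : ℝ :=
  ∑ b : S × O, if b.1 ≠ α then A x (Y b.1 b.2) else 0

/-- The part of `crossSum` not involving the species `α`. -/
def restSum (A : E → E → ℝ) (α : S) (Y : S → O → E) : ℝ :=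
  ∑ a : S × O, ∑ b : S × O,
    if a.1 ≠ α ∧ b.1 ≠ α ∧ a.1 ≠ b.1 then A (Y a.1 a.2) (Y b.1 b.2) else 0

theorem nbSum_update (A : E → E → ℝ) (α : S) (Y : S → O → E) (x : O → E) (z : E) :
    nbSum A α (Function.update Y α x) z = nbSum A α Y z := by
  unfold nbSum
  refine Finset.sum_congr rfl fun b _ => ?_
  split_ifs with h
  · rw [Function.update_of_ne h]
  · rfl

theorem restSum_update (A : E → E → ℝ) (α : S) (Y : S → O → E) (x : O → E) :
    restSum A α (Function.update Y α x) = restSum A α Y := by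
  unfold restSum
  refine Finset.sum_congr rfl fun a _ => Finset.sum_congr rfl fun b _ => ?_
  split_ifs with h
  · rw [Function.update_of_ne h.1, Function.update_of_ne h.2.1]
  · rfl

theorem crossSum_split {A : E → E → ℝ} (hs : ∀ x y, A x y = A y x) (α : S) (Y : S → O → E) :
    crossSum A Y = 2 * ∑ i, nbSum A α Y (Y α i) + restSum A α Y := by
  have h1 : ∑ a : S × O, ∑ b : S × O, (if a.1 = α ∧ b.1 ≠ α then A (Y a.1 a.2) (Y b.1 b.2) else 0)
      = ∑ i, nbSum A α Y (Y α i) := by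
    rw [Fintype.sum_prod_type, Finset.sum_eq_single α]
    · refine Finset.sum_congr rfl fun i _ => ?_
      simp [nbSum]
    · intro β _ hβ
      simp [hβ]
    · simp
  have h2 : ∑ a : S × O, ∑ b : S × O, (if b.1 = α ∧ a.1 ≠ α then A (Y a.1 a.2) (Y b.1 b.2) else 0)
      = ∑ i, nbSum A α Y (Y α i) := by
    rw [Finset.sum_comm, ← h1]
    simp only [hs]
  have h3 : crossSum A Y = ∑ a : S × O, ∑ b : S × O,
      ((if a.1 = α ∧ b.1 ≠ α then A (Y a.1 a.2) (Y b.1 b.2) else 0) +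
      (if b.1 = α ∧ a.1 ≠ α then A (Y a.1 a.2) (Y b.1 b.2) else 0) +
      (if a.1 ≠ α ∧ b.1 ≠ α ∧ a.1 ≠ b.1 then A (Y a.1 a.2) (Y b.1 b.2) else 0)) := by
    unfold crossSum
    refine Finset.sum_congr rfl fun a _ => Finset.sum_congr rfl fun b _ => ?_
    by_cases ha : a.1 = α <;> by_cases hb : b.1 = α <;> simp [ha, hb]
    · exact fun h => absurd h.symm hb
  rw [h3]
  simp only [Finset.sum_add_distrib]
  rw [h1, h2, restSum]
  ring

theorem nbSum_nonneg {A : E → E → ℝ} (h : ∀ x y, 0 ≤ A x y) (α : S) (Y : S → O → E) (x : E) :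
    0 ≤ nbSum A α Y x :=
  Finset.sum_nonneg fun b _ => by split_ifs; exacts [h _ _, le_rfl]

theorem restSum_nonneg {A : E → E → ℝ} (h : ∀ x y, 0 ≤ A x y) (α : S) (Y : S → O → E) :
    0 ≤ restSum A α Y :=
  Finset.sum_nonneg fun a _ => Finset.sum_nonneg fun b _ => by split_ifs; exacts [h _ _, le_rfl]

theorem crossSum_nonneg {A : E → E → ℝ} (h : ∀ x y, 0 ≤ A x y) (Y : S → O → E) :
    0 ≤ crossSum A Y :=
  Finset.sum_nonneg fun a _ => Finset.sum_nonneg fun b _ => by split_ifs; exacts [h _ _, le_rfl]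

/-- The squared Jastrow factor. -/
def jastrow (A : E → E → ℝ) (Y : S → O → E) : ℝ := exp (-((1 / 2) * crossSum A Y))

theorem jastrow_nonneg (A : E → E → ℝ) (Y : S → O → E) : 0 ≤ jastrow A Y := (exp_pos _).le

theorem jastrow_le_one {A : E → E → ℝ} (h : ∀ x y, 0 ≤ A x y) (Y : S → O → E) :
    jastrow A Y ≤ 1 := by
  unfold jastrow
  have := crossSum_nonneg h Y
  exact exp_le_one_iff.2 (by linarith)

theorem jastrow_split {A : E → E → ℝ} (hs : ∀ x y, A x y = A y x) (α : S) (Y : S → O → E) :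
    jastrow A Y = exp (-((1 / 2) * restSum A α Y)) * ∏ i, exp (-nbSum A α Y (Y α i)) := by
  unfold jastrow
  rw [crossSum_split hs α, ← exp_sum, ← exp_add, Finset.sum_neg_distrib]
  congr 1; ring

theorem measurable_pairTerm {A : E → E → ℝ} (hA : Measurable fun z : E × E => A z.1 z.2)
    (a b : S × O) : Measurable fun Y : S → O → E => A (Y a.1 a.2) (Y b.1 b.2) :=
  hA.comp (measurable_particle_pair a b)

theorem measurable_crossSum {A : E → E → ℝ} (hA : Measurable fun z : E × E => A z.1 z.2) :
    Measurable (crossSum (S := S) (O := O) A) := by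
  unfold crossSum
  refine Finset.measurable_sum _ fun a _ => Finset.measurable_sum _ fun b _ => ?_
  split_ifs
  exacts [measurable_pairTerm hA a b, measurable_const]

theorem measurable_jastrow {A : E → E → ℝ} (hA : Measurable fun z : E × E => A z.1 z.2) :
    Measurable (jastrow (S := S) (O := O) A) :=
  ((measurable_crossSum hA).const_mul _).neg.exp

theorem measurable_nbSum {A : E → E → ℝ} (hA : Measurable fun z : E × E => A z.1 z.2) (α : S) :
    Measurable fun p : (S → O → E) × E => nbSum A α p.1 p.2 := by
  unfold nbSum
  refine Finset.measurable_sum _ fun b _ => ?_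
  split_ifs
  · exact hA.comp (measurable_snd.prodMk ((measurable_particle b).comp measurable_fst))
  · exact measurable_const

theorem measurable_nbSum_right {A : E → E → ℝ} (hA : Measurable fun z : E × E => A z.1 z.2) (α : S)
    (Y : S → O → E) : Measurable fun x => nbSum A α Y x :=
  (measurable_nbSum hA α).comp measurable_prodMk_left

theorem nbSum_le {A : E → E → ℝ} {C : ℝ} (h0 : ∀ x y, 0 ≤ A x y) (h : ∀ x y, A x y ≤ C) (α : S)
    (Y : S → O → E) (x : E) : nbSum A α Y x ≤ Fintype.card (S × O) * C := by
  unfold nbSum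
  calc _ ≤ ∑ b : S × O, C := Finset.sum_le_sum fun b _ => by
        split_ifs
        exacts [h _ _, (h0 x x).trans (h x x)]
    _ = _ := by simp

theorem crossSum_le {A : E → E → ℝ} {C : ℝ} (h0 : ∀ x y, 0 ≤ A x y) (h : ∀ x y, A x y ≤ C)
    (Y : S → O → E) : crossSum A Y ≤ Fintype.card (S × O) * (Fintype.card (S × O) * C) := by
  unfold crossSum
  calc _ ≤ ∑ a : S × O, ∑ b : S × O, C := Finset.sum_le_sum fun a _ => Finset.sum_le_sum fun b _ => by
        split_ifs
        exacts [h _ _, (h0 (Y a.1 a.2) (Y a.1 a.2)).trans (h _ _)]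
    _ = _ := by simp

theorem PairBound.integrable_left {A : E → E → ℝ} {c : ℝ} (hA : PairBound γ A c) (y : E) :
    Integrable (fun x => A x y) γ := by
  obtain ⟨C, hC⟩ := hA.bdd
  exact integrable_of_measurable_of_bound (hA.meas.comp measurable_prodMk_right) C
    fun x => by rw [abs_of_nonneg (hA.nonneg _ _)]; exact hC _ _

theorem PairBound.int_le' {A : E → E → ℝ} {c : ℝ} (hA : PairBound γ A c) (x : E) :
    ∫ y, A x y ∂γ ≤ c := by
  simpa only [hA.symm x] using hA.int_le x

theorem PairBound.const_nonneg {A : E → E → ℝ} {c : ℝ} (hA : PairBound γ A c) : 0 ≤ c := by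
  have ⟨y⟩ : Nonempty E := nonempty_of_isProbabilityMeasure γ
  exact (integral_nonneg fun x => hA.nonneg x y).trans (hA.int_le y)

/-- Lower bound on the normalization of the Jastrow factor (Jensen's inequality). -/
theorem Orbitals.le_integral_jastrow (he : Orbitals γ e) {ω : E → E → ℝ} {Ω : ℝ}
    (hω : PairBound γ ω Ω) :
    exp (-((Fintype.card S * Fintype.card O : ℝ) ^ 2 * Ω)) ≤
      ∫ Y, jastrow ω Y ∂speciesMeasure S γ e := by
  have hp := he.isProbabilityMeasure_species (S := S)
  obtain ⟨C, hC⟩ := hω.bdd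
  have hTB := he.integral_two_body_le (S := S) hω.meas (fun z => hω.nonneg _ _) (fun z => hC _ _)
    hω.int_le'
  have hci : Integrable (crossSum (S := S) (O := O) ω) (speciesMeasure S γ e) :=
    integrable_of_measurable_of_bound (measurable_crossSum hω.meas) _ fun Y => by
      rw [abs_of_nonneg (crossSum_nonneg hω.nonneg Y)]; exact crossSum_le hω.nonneg hC Y
  have h1 : ∫ Y, crossSum ω Y ∂speciesMeasure S γ e ≤
      2 * ((Fintype.card S * Fintype.card O : ℝ) ^ 2 * Ω) := by
    refine le_trans (integral_mono hci ?_ fun Y => ?_) (hTB.trans_eq (by ring))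
    · refine integrable_finsetSum _ fun a _ => integrable_finsetSum _ fun b _ => ?_
      split_ifs
      · exact integrable_of_measurable_of_bound (measurable_pairTerm hω.meas a b) C
          fun Y => by rw [abs_of_nonneg (hω.nonneg _ _)]; exact hC _ _
      · exact integrable_zero _ _ _
    · refine Finset.sum_le_sum fun a _ => Finset.sum_le_sum fun b _ => ?_
      by_cases h : a.1 = b.1
      · simp only [h, ne_eq, not_true, if_false]
        split_ifs
        exacts [le_rfl, hω.nonneg _ _]
      · rw [if_pos h, if_pos fun h' => h (congrArg Prod.fst h')]
  set M := (Fintype.card S * Fintype.card O : ℝ) ^ 2 * Ω with hM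
  have hji : Integrable (jastrow (S := S) (O := O) ω) (speciesMeasure S γ e) :=
    integrable_of_measurable_of_bound (measurable_jastrow hω.meas) 1 fun Y => by
      rw [abs_of_nonneg (jastrow_nonneg _ Y)]; exact jastrow_le_one hω.nonneg Y
  have h2 : ∀ Y : S → O → E, exp (-M) * (1 + M - (1 / 2) * crossSum ω Y) ≤ jastrow ω Y := fun Y => by
    have := add_one_le_exp (M - (1 / 2) * crossSum ω Y)
    calc _ ≤ exp (-M) * exp (M - (1 / 2) * crossSum ω Y) :=
          mul_le_mul_of_nonneg_left (by linarith) (exp_nonneg _)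
      _ = _ := by rw [← exp_add, jastrow]; congr 1; ring
  calc exp (-M) ≤ exp (-M) * (1 + M - (1 / 2) * ∫ Y, crossSum ω Y ∂speciesMeasure S γ e) :=
        le_mul_of_one_le_right (exp_nonneg _) (by linarith)
    _ = ∫ Y, exp (-M) * (1 + M - (1 / 2) * crossSum ω Y) ∂speciesMeasure S γ e := by
        rw [integral_const_mul, integral_sub (integrable_const _) (hci.const_mul _),
          integral_const_mul]
        simp
    _ ≤ _ := integral_mono (((integrable_const _).sub (hci.const_mul _)).const_mul _) hji h2

end BoxEstimates

section BoxMain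
open Matrix
open scoped ComplexConjugate

variable {E O S : Type*} [MeasurableSpace E] [Fintype O] [DecidableEq O] [Fintype S] [DecidableEq S]
variable {γ : Measure E} [IsProbabilityMeasure γ] {e : O → E → ℂ}

/-- The squared Hilbert–Schmidt norm of the one-body operator `nbSum ω α Y`. -/
def hsSum (γ : Measure E) (e : O → E → ℂ) (A : E → E → ℝ) (α : S) (Y : S → O → E) : ℝ :=
  ∫ z, nbSum A α Y z.1 * nbSum A α Y z.2 * kerSq e z.1 z.2 ∂(γ.prod γ)

/-- The exchange-weighted two-point function of a pair potential. -/
def kerPair (γ : Measure E) (e : O → E → ℂ) (A : E → E → ℝ) (y y' : E) : ℝ :=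
  ∫ z, A z.1 y * A z.2 y' * kerSq e z.1 z.2 ∂(γ.prod γ)

attribute [local irreducible] kerSq

theorem PairBound.measurable_comp {X : Type*} [MeasurableSpace X] {A : E → E → ℝ} {c : ℝ}
    (hA : PairBound γ A c) {f g : X → E} (hf : Measurable f) (hg : Measurable g) :
    Measurable fun x => A (f x) (g x) :=
  hA.meas.comp (hf.prodMk hg)

theorem measurable_kerSq_comp {X : Type*} [MeasurableSpace X] (he : Orbitals γ e) {f g : X → E}
    (hf : Measurable f) (hg : Measurable g) : Measurable fun x => kerSq e (f x) (g x) :=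
  he.measurable_kerSq.comp (hf.prodMk hg)

theorem crossSum_eq_sum_nbSum (A : E → E → ℝ) (Y : S → O → E) :
    crossSum A Y = ∑ a : S × O, nbSum A a.1 Y (Y a.1 a.2) := by
  unfold crossSum nbSum
  refine Finset.sum_congr rfl fun a _ => Finset.sum_congr rfl fun b _ => ?_
  simp only [ne_comm]

theorem integrable_kerPair (he : Orbitals γ e) {A : E → E → ℝ} {c : ℝ} (hA : PairBound γ A c)
    (y y' : E) : Integrable (fun z : E × E => A z.1 y * A z.2 y' * kerSq e z.1 z.2)
      (γ.prod γ) := by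
  obtain ⟨C, hC⟩ := hA.bdd
  have hm : Measurable fun z : E × E => A z.1 y * A z.2 y' * kerSq e z.1 z.2 :=
    ((hA.measurable_comp measurable_fst measurable_const).mul
      (hA.measurable_comp measurable_snd measurable_const)).mul he.measurable_kerSq
  refine integrable_of_measurable_of_bound hm (C * C * (Fintype.card O : ℝ) ^ 2) fun z => ?_
  have hC0 : 0 ≤ C := (hA.nonneg z.1 z.1).trans (hC _ _)
  rw [abs_of_nonneg (mul_nonneg (mul_nonneg (hA.nonneg _ _) (hA.nonneg _ _)) (kerSq_nonneg _ _))]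
  exact mul_le_mul (mul_le_mul (hC _ _) (hC _ _) (hA.nonneg _ _) hC0) (he.kerSq_le _ _)
    (kerSq_nonneg _ _) (by positivity)

theorem kerPair_nonneg {A : E → E → ℝ} {c : ℝ} (hA : PairBound γ A c) (y y' : E) :
    0 ≤ kerPair γ e A y y' :=
  integral_nonneg fun z => mul_nonneg (mul_nonneg (hA.nonneg _ _) (hA.nonneg _ _))
    (kerSq_nonneg _ _)

theorem kerPair_le (he : Orbitals γ e) {A : E → E → ℝ} {c : ℝ} (hA : PairBound γ A c)
    (y y' : E) : kerPair γ e A y y' ≤ (Fintype.card O : ℝ) ^ 2 * c ^ 2 := by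
  calc kerPair γ e A y y' ≤ ∫ z : E × E, A z.1 y * A z.2 y' * (Fintype.card O : ℝ) ^ 2
        ∂(γ.prod γ) := by
        refine integral_mono (integrable_kerPair he hA y y')
          (((hA.integrable_left y).mul_prod (hA.integrable_left y')).mul_const _) fun z => ?_
        exact mul_le_mul_of_nonneg_left (he.kerSq_le _ _)
          (mul_nonneg (hA.nonneg _ _) (hA.nonneg _ _))
    _ = (∫ x, A x y ∂γ) * (∫ x, A x y' ∂γ) * (Fintype.card O : ℝ) ^ 2 := by
        rw [integral_mul_const, integral_prod_mul (fun x => A x y) (fun x => A x y')]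
    _ ≤ c * c * (Fintype.card O : ℝ) ^ 2 := by
        have h1 := hA.int_le y
        have h2 := hA.int_le y'
        have h0 : 0 ≤ ∫ x, A x y' ∂γ := integral_nonneg fun x => hA.nonneg _ _
        have hc := hA.const_nonneg
        gcongr
    _ = _ := by ring

theorem measurable_kerPair (he : Orbitals γ e) {A : E → E → ℝ} {c : ℝ} (hA : PairBound γ A c) :
    Measurable fun z : E × E => kerPair γ e A z.1 z.2 := by
  unfold kerPair
  refine (StronglyMeasurable.integral_prod_right (f := fun (p : E × E) (z : E × E) =>
    A z.1 p.1 * A z.2 p.2 * kerSq e z.1 z.2) (Measurable.stronglyMeasurable ?_)).measurable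
  have h1 : Measurable fun p : (E × E) × (E × E) => p.2.1 := measurable_snd.fst
  have h2 : Measurable fun p : (E × E) × (E × E) => p.2.2 := measurable_snd.snd
  have h3 : Measurable fun p : (E × E) × (E × E) => p.1.1 := measurable_fst.fst
  have h4 : Measurable fun p : (E × E) × (E × E) => p.1.2 := measurable_fst.snd
  exact ((hA.measurable_comp h1 h3).mul (hA.measurable_comp h2 h4)).mul
    (measurable_kerSq_comp he h1 h2)

theorem integral_kerPair_le (he : Orbitals γ e) {A : E → E → ℝ} {c : ℝ} (hA : PairBound γ A c)
    (y : E) : ∫ y', kerPair γ e A y y' ∂γ ≤ Fintype.card O * c ^ 2 := by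
  obtain ⟨C, hC⟩ := hA.bdd
  have hc := hA.const_nonneg
  unfold kerPair
  rw [integral_integral_swap]
  · have hk : ∀ x, Integrable (fun x' => kerSq e x x') γ := fun x =>
      integrable_of_measurable_of_bound (he.measurable_kerSq.comp measurable_prodMk_left)
        ((Fintype.card O : ℝ) ^ 2) fun x' => by
          rw [abs_of_nonneg (kerSq_nonneg _ _)]; exact he.kerSq_le _ _
    have hi : Integrable (fun z : E × E => A z.1 y * c * kerSq e z.1 z.2) (γ.prod γ) := by
      refine Integrable.mul_bdd (c := (Fintype.card O : ℝ) ^ 2) ?_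
        he.measurable_kerSq.aestronglyMeasurable (Filter.Eventually.of_forall fun z => ?_)
      · have := (hA.integrable_left y).mul_prod (ν := γ) (integrable_const c)
        exact this
      · rw [Real.norm_of_nonneg (kerSq_nonneg _ _)]; exact he.kerSq_le _ _
    calc ∫ z : E × E, ∫ y', A z.1 y * A z.2 y' * kerSq e z.1 z.2 ∂γ ∂(γ.prod γ)
        = ∫ z : E × E, A z.1 y * (∫ y', A z.2 y' ∂γ) * kerSq e z.1 z.2 ∂(γ.prod γ) := by
          congr 1; ext z
          rw [integral_mul_const, integral_const_mul]
      _ ≤ ∫ z : E × E, A z.1 y * c * kerSq e z.1 z.2 ∂(γ.prod γ) := by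
          refine integral_mono_of_nonneg (Filter.Eventually.of_forall fun z => ?_) hi
            (Filter.Eventually.of_forall fun z => ?_)
          · exact mul_nonneg (mul_nonneg (hA.nonneg _ _) (integral_nonneg fun _ => hA.nonneg _ _))
              (kerSq_nonneg _ _)
          · exact mul_le_mul_of_nonneg_right (mul_le_mul_of_nonneg_left (hA.int_le' _)
              (hA.nonneg _ _)) (kerSq_nonneg _ _)
      _ = ∫ x, A x y * c * Fintype.card O ∂γ := by
          rw [integral_prod _ hi]
          congr 1; ext x
          show ∫ y', A x y * c * kerSq e x y' ∂γ = _
          rw [integral_const_mul, he.integral_kerSq]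
      _ = (∫ x, A x y ∂γ) * c * Fintype.card O := by
          rw [integral_mul_const, integral_mul_const]
      _ ≤ c * c * Fintype.card O := by
          have := hA.int_le y
          gcongr
      _ = _ := by ring
  · refine integrable_of_measurable_of_bound ?_ (C * C * (Fintype.card O : ℝ) ^ 2) fun z => ?_
    · have h1 : Measurable fun p : E × (E × E) => p.2.1 := measurable_snd.fst
      have h2 : Measurable fun p : E × (E × E) => p.2.2 := measurable_snd.snd
      exact ((hA.measurable_comp h1 measurable_const).mul (hA.measurable_comp h2
        measurable_fst)).mul (measurable_kerSq_comp he h1 h2)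
    · have hC0 : 0 ≤ C := (hA.nonneg y y).trans (hC _ _)
      simp only [Function.uncurry]
      rw [abs_of_nonneg (mul_nonneg (mul_nonneg (hA.nonneg _ _) (hA.nonneg _ _))
        (kerSq_nonneg _ _))]
      exact mul_le_mul (mul_le_mul (hC _ _) (hC _ _) (hA.nonneg _ _) hC0) (he.kerSq_le _ _)
        (kerSq_nonneg _ _) (by positivity)

theorem hsSum_eq (he : Orbitals γ e) {A : E → E → ℝ} {c : ℝ} (hA : PairBound γ A c) (α : S)
    (Y : S → O → E) : hsSum γ e A α Y = ∑ b : S × O, ∑ b' : S × O,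
      if b.1 ≠ α ∧ b'.1 ≠ α then kerPair γ e A (Y b.1 b.2) (Y b'.1 b'.2) else 0 := by
  unfold hsSum nbSum
  simp only [Finset.sum_mul_sum]
  simp only [Finset.sum_mul]
  rw [integral_finsetSum]
  · refine Finset.sum_congr rfl fun b _ => ?_
    rw [integral_finsetSum]
    · refine Finset.sum_congr rfl fun b' _ => ?_
      by_cases hb : b.1 = α <;> by_cases hb' : b'.1 = α <;> simp [hb, hb', kerPair]
    · intro b' _
      by_cases hb : b.1 = α <;> by_cases hb' : b'.1 = α <;> simp [hb, hb']
      exact integrable_kerPair he hA _ _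
  · refine fun b _ => integrable_finsetSum _ fun b' _ => ?_
    by_cases hb : b.1 = α <;> by_cases hb' : b'.1 = α <;> simp [hb, hb']
    exact integrable_kerPair he hA _ _

theorem hsSum_update (A : E → E → ℝ) (α : S) (Y : S → O → E) (x : O → E) :
    hsSum γ e A α (Function.update Y α x) = hsSum γ e A α Y := by
  unfold hsSum
  simp only [nbSum_update]

theorem hsSum_nonneg {A : E → E → ℝ} (h : ∀ x y, 0 ≤ A x y) (α : S) (Y : S → O → E) :
    0 ≤ hsSum γ e A α Y :=
  integral_nonneg fun z => mul_nonneg (mul_nonneg (nbSum_nonneg h _ _ _) (nbSum_nonneg h _ _ _))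
    (kerSq_nonneg _ _)

theorem integrable_kerPair_particle (he : Orbitals γ e) {A : E → E → ℝ} {c : ℝ}
    (hA : PairBound γ A c) (b b' : S × O) :
    Integrable (fun Y : S → O → E => kerPair γ e A (Y b.1 b.2) (Y b'.1 b'.2))
      (speciesMeasure S γ e) := by
  have hp := he.isProbabilityMeasure_species (S := S)
  exact integrable_of_measurable_of_bound ((measurable_kerPair he hA).comp
    (measurable_particle_pair b b')) ((Fintype.card O : ℝ) ^ 2 * c ^ 2) fun Y => by
      rw [abs_of_nonneg (kerPair_nonneg hA _ _)]; exact kerPair_le he hA _ _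

theorem integrable_hsSum (he : Orbitals γ e) {A : E → E → ℝ} {c : ℝ} (hA : PairBound γ A c)
    (α : S) : Integrable (hsSum γ e A α) (speciesMeasure S γ e) := by
  have : hsSum γ e A α = fun Y : S → O → E => ∑ b : S × O, ∑ b' : S × O,
      if b.1 ≠ α ∧ b'.1 ≠ α then kerPair γ e A (Y b.1 b.2) (Y b'.1 b'.2) else 0 :=
    funext fun Y => hsSum_eq he hA α Y
  rw [this]
  refine integrable_finsetSum _ fun b _ => integrable_finsetSum _ fun b' _ => ?_
  split_ifs
  exacts [integrable_kerPair_particle he hA b b', integrable_zero _ _ _]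

theorem integral_hsSum_le (he : Orbitals γ e) {A : E → E → ℝ} {c : ℝ} (hA : PairBound γ A c)
    (α : S) : ∫ Y, hsSum γ e A α Y ∂speciesMeasure S γ e ≤
      3 * (Fintype.card S * Fintype.card O : ℝ) ^ 3 * c ^ 2 := by
  have hp := he.isProbabilityMeasure_species (S := S)
  have hTB := he.integral_two_body_le (S := S) (measurable_kerPair he hA)
    (fun z => kerPair_nonneg hA _ _) (fun z => kerPair_le he hA _ _) (integral_kerPair_le he hA)
  have hi : Integrable (fun Y : S → O → E => ∑ a : S × O, ∑ b : S × O,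
      if a ≠ b then kerPair γ e A (Y a.1 a.2) (Y b.1 b.2) else 0) (speciesMeasure S γ e) := by
    refine integrable_finsetSum _ fun b _ => integrable_finsetSum _ fun b' _ => ?_
    split_ifs
    exacts [integrable_kerPair_particle he hA b b', integrable_zero _ _ _]
  have h1 : ∀ Y : S → O → E, hsSum γ e A α Y ≤ (∑ a : S × O, ∑ b : S × O,
      if a ≠ b then kerPair γ e A (Y a.1 a.2) (Y b.1 b.2) else 0) +
      (Fintype.card S * Fintype.card O : ℝ) * ((Fintype.card O : ℝ) ^ 2 * c ^ 2) := fun Y => by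
    rw [hsSum_eq he hA]
    calc _ ≤ ∑ a : S × O, ∑ b : S × O, ((if a ≠ b then kerPair γ e A (Y a.1 a.2) (Y b.1 b.2) else 0)
          + if a = b then (Fintype.card O : ℝ) ^ 2 * c ^ 2 else 0) := by
          refine Finset.sum_le_sum fun a _ => Finset.sum_le_sum fun b _ => ?_
          have h1 := kerPair_nonneg (e := e) hA (Y a.1 a.2) (Y b.1 b.2)
          have h2 := kerPair_le he hA (Y a.1 a.2) (Y b.1 b.2)
          by_cases h : a = b
          · simp only [h, ne_eq, not_true, if_false, if_true, zero_add] at *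
            split_ifs <;> linarith
          · simp only [h, ne_eq, not_false_eq_true, if_false, if_true, add_zero] at *
            split_ifs <;> linarith
      _ = _ := by
          simp only [Finset.sum_add_distrib, Finset.sum_ite_eq, Finset.mem_univ, if_true]
          simp [Fintype.card_prod]
  have hN : (Fintype.card O : ℝ) ≤ Fintype.card S * Fintype.card O := by
    have : (1 : ℝ) ≤ Fintype.card S := by
      exact_mod_cast Fintype.card_pos_iff.2 ⟨α⟩
    exact le_mul_of_one_le_left (by positivity) this
  set N := (Fintype.card S * Fintype.card O : ℝ)
  have hm0 : (0 : ℝ) ≤ Fintype.card O := by positivity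
  calc ∫ Y, hsSum γ e A α Y ∂speciesMeasure S γ e
      ≤ 2 * N ^ 2 * (Fintype.card O * c ^ 2) + N * ((Fintype.card O : ℝ) ^ 2 * c ^ 2) := by
        refine (integral_mono (integrable_hsSum he hA α) (hi.add (integrable_const _)) h1).trans ?_
        rw [integral_add' hi (integrable_const _)]
        simp only [integral_const, probReal_univ, one_smul]
        linarith
    _ ≤ 2 * N ^ 2 * (N * c ^ 2) + N * (N ^ 2 * c ^ 2) := by gcongr
    _ = _ := by ring

end BoxMain

section BoxEnergy
open Matrix
open scoped ComplexConjugate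

variable {E O S : Type*} [MeasurableSpace E] [Fintype O] [DecidableEq O] [Fintype S] [DecidableEq S]
variable {γ : Measure E} [IsProbabilityMeasure γ] {e : O → E → ℂ}

theorem integrable_jastrow (he : Orbitals γ e) {ω : E → E → ℝ}
    (hm : Measurable fun z : E × E => ω z.1 z.2) (h0 : ∀ x y, 0 ≤ ω x y) :
    Integrable (jastrow (S := S) (O := O) ω) (speciesMeasure S γ e) := by
  have hp := he.isProbabilityMeasure_species (S := S)
  exact integrable_of_measurable_of_bound (measurable_jastrow hm) 1 fun Y => by
    rw [abs_of_nonneg (jastrow_nonneg _ Y)]; exact jastrow_le_one h0 Y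

theorem measurable_nbSum_particle {A : E → E → ℝ} (hA : Measurable fun z : E × E => A z.1 z.2)
    (α : S) (a : S × O) : Measurable fun Y : S → O → E => nbSum A α Y (Y a.1 a.2) :=
  (measurable_nbSum hA α).comp (measurable_id.prodMk (measurable_particle a))

theorem integrable_mainTerm (he : Orbitals γ e) {ω g : E → E → ℝ} {Ω G : ℝ}
    (hω : PairBound γ ω Ω) (hg : PairBound γ g G) {w : E → ℝ} (hw : Integrable w γ) (a : S × O) :
    Integrable (fun Y : S → O → E => jastrow ω Y *
      (w (Y a.1 a.2) + (1 / 2) * nbSum g a.1 Y (Y a.1 a.2))) (speciesMeasure S γ e) := by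
  have hp := he.isProbabilityMeasure_species (S := S)
  obtain ⟨C, hC⟩ := hg.bdd
  refine Integrable.bdd_mul (c := 1) ((he.integrable_particle hw a).add (Integrable.const_mul
    (integrable_of_measurable_of_bound (measurable_nbSum_particle hg.meas a.1 a)
      (Fintype.card (S × O) * C) fun Y => ?_) _))
    (measurable_jastrow hω.meas).aestronglyMeasurable (Filter.Eventually.of_forall fun Y => ?_)
  · rw [abs_of_nonneg (nbSum_nonneg hg.nonneg _ _ _)]
    exact nbSum_le hg.nonneg hC _ _ _
  · rw [Real.norm_of_nonneg (jastrow_nonneg _ Y)]; exact jastrow_le_one hω.nonneg Y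

theorem Orbitals.integral_mainTerm_species_le (he : Orbitals γ e) {ω g : E → E → ℝ} {Ω G J : ℝ}
    (hω : PairBound γ ω Ω) (hg : PairBound γ g G) {w : E → ℝ} (hw : Integrable w γ)
    (hw0 : ∀ x, 0 ≤ w x) (hJ : ∀ y, ∫ x, g x y * exp (-ω x y) ∂γ ≤ J) {δ : ℝ} (hδ : 0 < δ)
    (hδ1 : δ < 1) (α : S) :
    ∫ Y : S → O → E, ∑ i, jastrow ω Y * (w (Y α i) + (1 / 2) * nbSum g α Y (Y α i))
      ∂speciesMeasure S γ e ≤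
    (Fintype.card O * (∫ x, w x ∂γ + (1 / 2) * ((Fintype.card S - 1) * Fintype.card O) * J)) *
      ((1 - δ)⁻¹ * ∫ Y, jastrow ω Y ∂speciesMeasure S γ e +
        (δ ^ 2)⁻¹ * (3 * (Fintype.card S * Fintype.card O : ℝ) ^ 3 * Ω ^ 2)) := by
  have hp0 := he.isProbabilityMeasure
  have hp := he.isProbabilityMeasure_species (S := S)
  obtain ⟨C, hC⟩ := hg.bdd
  have hδ' : 0 < (1 - δ)⁻¹ := inv_pos.2 (by linarith)
  have hJ0 : 0 ≤ J := by
    have ⟨y⟩ : Nonempty E := nonempty_of_isProbabilityMeasure γ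
    exact (integral_nonneg fun x => mul_nonneg (hg.nonneg x y) (exp_nonneg _)).trans (hJ y)
  have hS : (1 : ℝ) ≤ Fintype.card S := by exact_mod_cast Fintype.card_pos_iff.2 ⟨α⟩
  have hW0 : 0 ≤ ∫ x, w x ∂γ := integral_nonneg hw0
  set W' := ∫ x, w x ∂γ + (1 / 2) * ((Fintype.card S - 1) * Fintype.card O : ℝ) * J with hW'
  have hS' : (0 : ℝ) ≤ Fintype.card S - 1 := by linarith
  have hW'0 : 0 ≤ W' := by positivity
  have hji := integrable_jastrow (S := S) he hω.meas hω.nonneg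
  have hhi := integrable_hsSum he hω α
  have key : ∫ Y : S → O → E, ∑ i, jastrow ω Y * (w (Y α i) + (1 / 2) * nbSum g α Y (Y α i))
      ∂speciesMeasure S γ e ≤ ∫ Y, (Fintype.card O * W') * ((1 - δ)⁻¹ * jastrow ω Y +
        (δ ^ 2)⁻¹ * hsSum γ e ω α Y) ∂speciesMeasure S γ e := by
    refine integral_le_of_update (μ := fun _ : S => slaterMeasure γ e) α
      (integrable_finsetSum _ fun i _ => integrable_mainTerm he hω hg hw (α, i))
      (((hji.const_mul _).add (hhi.const_mul _)).const_mul _) fun X => ?_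
    set r := exp (-((1 / 2) * restSum ω α X)) with hr
    have hr0 : 0 ≤ r := (exp_pos _).le
    have hr1 : r ≤ 1 := exp_le_one_iff.2 (by linarith [restSum_nonneg hω.nonneg α X])
    set ψ : E → ℝ := fun x => exp (-nbSum ω α X x) with hψ
    have hψm : Measurable ψ := (measurable_nbSum_right hω.meas α X).neg.exp
    have hψ0 : ∀ x, 0 ≤ ψ x := fun x => (exp_pos _).le
    have hψ1 : ∀ x, ψ x ≤ 1 := fun x =>
      exp_le_one_iff.2 (by linarith [nbSum_nonneg hω.nonneg α X x])
    have hjX : ∀ x : O → E, jastrow ω (Function.update X α x) = r * ∏ i, ψ (x i) := fun x => by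
      rw [jastrow_split hω.symm α, restSum_update]
      simp only [Function.update_self, nbSum_update, hψ, hr]
    have hnbm := measurable_nbSum_right hg.meas α X
    have hnbi : Integrable (fun x => nbSum g α X x) γ :=
      integrable_of_measurable_of_bound hnbm (Fintype.card (S × O) * C) fun x => by
        rw [abs_of_nonneg (nbSum_nonneg hg.nonneg _ _ _)]
        exact nbSum_le hg.nonneg hC _ _ _
    set wX : E → ℝ := fun x => (w x + (1 / 2) * nbSum g α X x) * ψ x with hwX
    have hwXi : Integrable wX γ := by
      refine Integrable.mul_bdd (c := 1) (hw.add (hnbi.const_mul _)) hψm.aestronglyMeasurable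
        (Filter.Eventually.of_forall fun x => ?_)
      rw [Real.norm_of_nonneg (hψ0 x)]; exact hψ1 x
    have hwX0 : ∀ x, 0 ≤ wX x := fun x => mul_nonneg (add_nonneg (hw0 x)
      (mul_nonneg (by norm_num) (nbSum_nonneg hg.nonneg _ _ _))) (hψ0 x)
    have hωi : Integrable (fun x => nbSum ω α X x) γ := by
      obtain ⟨C', hC'⟩ := hω.bdd
      exact integrable_of_measurable_of_bound (measurable_nbSum_right hω.meas α X)
        (Fintype.card (S × O) * C') fun x => by
        rw [abs_of_nonneg (nbSum_nonneg hω.nonneg _ _ _)]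
        exact nbSum_le hω.nonneg hC' _ _ _
    have hB1 := he.sum_integral_mul_prod_le hwXi hwX0 hψm hψ0 hψ1 hωi
      (fun x => by linarith [add_one_le_exp (-nbSum ω α X x)]) hδ hδ1
    rw [he.frobenius_gramMat hωi] at hB1
    have hge : ∀ y, Integrable (fun x => g x y * exp (-ω x y)) γ := fun y => by
      refine Integrable.mul_bdd (c := 1) (hg.integrable_left y)
        (hω.measurable_comp measurable_id measurable_const).neg.exp.aestronglyMeasurable
        (Filter.Eventually.of_forall fun x => ?_)
      rw [Real.norm_of_nonneg (exp_nonneg _)]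
      exact exp_le_one_iff.2 (by linarith [hω.nonneg x y])
    have hwXle : ∫ x, wX x ∂γ ≤ W' := by
      have h1 : ∀ x, wX x ≤ w x + (1 / 2) * ∑ b : S × O,
          if b.1 ≠ α then g x (X b.1 b.2) * exp (-ω x (X b.1 b.2)) else 0 := fun x => by
        have h2 : w x * ψ x ≤ w x := mul_le_of_le_one_right (hw0 x) (hψ1 x)
        have h3 : nbSum g α X x * ψ x ≤ ∑ b : S × O,
            if b.1 ≠ α then g x (X b.1 b.2) * exp (-ω x (X b.1 b.2)) else 0 := by
          unfold nbSum
          rw [Finset.sum_mul]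
          refine Finset.sum_le_sum fun b _ => ?_
          split_ifs with hb
          · refine mul_le_mul_of_nonneg_left (exp_le_exp.2 (neg_le_neg ?_)) (hg.nonneg _ _)
            have := Finset.single_le_sum (f := fun b : S × O =>
              if b.1 ≠ α then ω x (X b.1 b.2) else 0) (fun b _ => by
                split_ifs; exacts [hω.nonneg _ _, le_rfl]) (Finset.mem_univ b)
            simp only [if_pos hb] at this
            exact this
          · simp
        simp only [hwX]
        linarith
      have hi2 : ∀ b : S × O, Integrable (fun x =>
          if b.1 ≠ α then g x (X b.1 b.2) * exp (-ω x (X b.1 b.2)) else 0) γ := fun b => by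
        split_ifs
        exacts [hge _, integrable_zero _ _ _]
      calc ∫ x, wX x ∂γ ≤ ∫ x, (w x + (1 / 2) * ∑ b : S × O,
          if b.1 ≠ α then g x (X b.1 b.2) * exp (-ω x (X b.1 b.2)) else 0) ∂γ :=
            integral_mono hwXi (hw.add ((integrable_finsetSum _ fun b _ => hi2 b).const_mul _)) h1
        _ = ∫ x, w x ∂γ + (1 / 2) * ∑ b : S × O,
          ∫ x, (if b.1 ≠ α then g x (X b.1 b.2) * exp (-ω x (X b.1 b.2)) else 0) ∂γ := by
            rw [integral_add hw ((integrable_finsetSum _ fun b _ => hi2 b).const_mul _),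
              integral_const_mul, integral_finsetSum _ fun b _ => hi2 b]
        _ ≤ ∫ x, w x ∂γ + (1 / 2) * ∑ b : S × O, if b.1 ≠ α then J else 0 := by
            gcongr with b
            split_ifs
            exacts [hJ _, by simp]
        _ = W' := by
            rw [hW', Fintype.sum_prod_type]
            have : ∀ β : S, ∑ i : O, (if ((β, i) : S × O).1 ≠ α then J else 0) =
                Fintype.card O * J - if β = α then Fintype.card O * J else 0 := fun β => by
              by_cases h : β = α <;> simp [h]
            simp only [this, Finset.sum_sub_distrib, Finset.sum_ite_eq', Finset.mem_univ, if_true]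
            simp only [Finset.sum_const, Finset.card_univ, nsmul_eq_mul]
            ring
    have hL : ∀ x : O → E, ∑ i, jastrow ω (Function.update X α x) *
        (w (Function.update X α x α i) + (1 / 2) * nbSum g α (Function.update X α x)
          (Function.update X α x α i)) =
        r * ∑ i, wX (x i) * ∏ j ∈ Finset.univ.erase i, ψ (x j) := fun x => by
      rw [Finset.mul_sum]
      refine Finset.sum_congr rfl fun i _ => ?_
      rw [hjX, nbSum_update, Function.update_self, ← Finset.mul_prod_erase _ _ (Finset.mem_univ i)]
      simp only [hwX]
      ring
    have hwi : ∀ i, Integrable (fun x : O → E => wX (x i) * ∏ j ∈ Finset.univ.erase i, ψ (x j))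
        (slaterMeasure γ e) := fun i => by
      refine Integrable.mul_bdd (c := 1) (he.integrable_eval hwXi i) (Finset.measurable_prod _
        fun j _ => hψm.comp (measurable_pi_apply j)).aestronglyMeasurable
        (Filter.Eventually.of_forall fun x => ?_)
      rw [Real.norm_of_nonneg (Finset.prod_nonneg fun j _ => hψ0 _)]
      exact Finset.prod_le_one (fun j _ => hψ0 _) fun j _ => hψ1 _
    have hpi : Integrable (fun x : O → E => ∏ j, ψ (x j)) (slaterMeasure γ e) :=
      integrable_of_measurable_of_bound (Finset.measurable_prod _
        fun j _ => hψm.comp (measurable_pi_apply j)) 1 fun x => by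
        rw [abs_of_nonneg (Finset.prod_nonneg fun j _ => hψ0 _)]
        exact Finset.prod_le_one (fun j _ => hψ0 _) fun j _ => hψ1 _
    simp only [hL]
    simp only [hjX, hsSum_update]
    rw [integral_const_mul, integral_finsetSum _ fun i _ => hwi i, integral_const_mul,
      integral_add ((hpi.const_mul r).const_mul _) (integrable_const _), integral_const_mul,
      integral_const_mul]
    simp only [integral_const, probReal_univ, one_smul]
    set P := ∫ x : O → E, ∏ j, ψ (x j) ∂slaterMeasure γ e with hP
    have hP0 : 0 ≤ P := integral_nonneg fun x => Finset.prod_nonneg fun j _ => hψ0 _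
    have hH0 := hsSum_nonneg (γ := γ) (e := e) hω.nonneg α X
    calc r * ∑ i, ∫ x : O → E, wX (x i) * ∏ j ∈ Finset.univ.erase i, ψ (x j) ∂slaterMeasure γ e
        ≤ r * ((Fintype.card O * ∫ x, wX x ∂γ) * ((1 - δ)⁻¹ * P +
          (δ ^ 2)⁻¹ * hsSum γ e ω α X)) := mul_le_mul_of_nonneg_left hB1 hr0
      _ ≤ r * ((Fintype.card O * W') * ((1 - δ)⁻¹ * P + (δ ^ 2)⁻¹ * hsSum γ e ω α X)) := by
          gcongr
      _ = (Fintype.card O * W') * ((1 - δ)⁻¹ * (r * P) + r * ((δ ^ 2)⁻¹ * hsSum γ e ω α X)) := by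
          ring
      _ ≤ _ := by
          have : r * ((δ ^ 2)⁻¹ * hsSum γ e ω α X) ≤ (δ ^ 2)⁻¹ * hsSum γ e ω α X :=
            mul_le_of_le_one_left (by positivity) hr1
          gcongr
  refine key.trans ?_
  rw [integral_const_mul, integral_add (hji.const_mul _) (hhi.const_mul _), integral_const_mul,
    integral_const_mul]
  have := integral_hsSum_le he hω α
  gcongr

/-- The energy of a Jastrow–Slater state, up to three-body and exchange terms. -/
theorem Orbitals.integral_mainTerm_le (he : Orbitals γ e) {ω g : E → E → ℝ} {Ω G J : ℝ}
    (hω : PairBound γ ω Ω) (hg : PairBound γ g G) {w : E → ℝ} (hw : Integrable w γ)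
    (hw0 : ∀ x, 0 ≤ w x) (hJ : ∀ y, ∫ x, g x y * exp (-ω x y) ∂γ ≤ J) {δ : ℝ} (hδ : 0 < δ)
    (hδ1 : δ < 1) :
    ∫ Y : S → O → E, jastrow ω Y * (∑ a : S × O, w (Y a.1 a.2) + (1 / 2) * crossSum g Y)
      ∂speciesMeasure S γ e ≤
    Fintype.card S * ((Fintype.card O * (∫ x, w x ∂γ +
        (1 / 2) * ((Fintype.card S - 1) * Fintype.card O) * J)) *
      ((1 - δ)⁻¹ * ∫ Y, jastrow ω Y ∂speciesMeasure S γ e +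
        (δ ^ 2)⁻¹ * (3 * (Fintype.card S * Fintype.card O : ℝ) ^ 3 * Ω ^ 2))) := by
  have h : ∀ Y : S → O → E, jastrow ω Y * (∑ a : S × O, w (Y a.1 a.2) + (1 / 2) * crossSum g Y) =
      ∑ α, ∑ i, jastrow ω Y * (w (Y α i) + (1 / 2) * nbSum g α Y (Y α i)) := fun Y => by
    rw [crossSum_eq_sum_nbSum, Finset.mul_sum, ← Finset.sum_add_distrib, Finset.mul_sum,
      Fintype.sum_prod_type]
  simp only [h]
  rw [integral_finsetSum _ fun α _ => integrable_finsetSum _ fun i _ =>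
    integrable_mainTerm he hω hg hw (α, i)]
  calc _ ≤ ∑ α : S, _ := Finset.sum_le_sum fun α _ =>
        he.integral_mainTerm_species_le hω hg hw hw0 hJ hδ hδ1 α
    _ = _ := by rw [Finset.sum_const, Finset.card_univ, nsmul_eq_mul]

end BoxEnergy

section ThreeBody
open Matrix
open scoped ComplexConjugate

variable {E O S : Type*} [MeasurableSpace E] [Fintype O] [DecidableEq O] [Fintype S] [DecidableEq S]
variable {γ : Measure E} [IsProbabilityMeasure γ] {e : O → E → ℂ}

/-- The three-body sum around each particle, over pairs of distinct particles of other species. -/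
def triSum (u : E → E → ℝ) (Y : S → O → E) : ℝ :=
  ∑ a : S × O, ∑ b : S × O, ∑ b' : S × O, if b.1 ≠ a.1 ∧ b'.1 ≠ a.1 ∧ b ≠ b' then
    u (Y a.1 a.2) (Y b.1 b.2) * u (Y a.1 a.2) (Y b'.1 b'.2) else 0

/-- The sum of a pair function over ordered pairs of distinct particles of equal species. -/
def selfSum (v : E → E → ℝ) (Y : S → O → E) : ℝ :=
  ∑ α : S, ∑ i : O, ∑ j : O, if i ≠ j then v (Y α i) (Y α j) else 0

theorem PairBound.integrable_particle (he : Orbitals γ e) {v : E → E → ℝ} {c : ℝ}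
    (hv : PairBound γ v c) (a b : S × O) :
    Integrable (fun Y : S → O → E => v (Y a.1 a.2) (Y b.1 b.2)) (speciesMeasure S γ e) := by
  have hp := he.isProbabilityMeasure_species (S := S)
  obtain ⟨C, hC⟩ := hv.bdd
  exact integrable_of_measurable_of_bound (measurable_pairTerm hv.meas a b) C fun Y => by
    rw [abs_of_nonneg (hv.nonneg _ _)]; exact hC _ _

theorem integrable_selfSum (he : Orbitals γ e) {v : E → E → ℝ} {c : ℝ} (hv : PairBound γ v c) :
    Integrable (selfSum (S := S) (O := O) v) (speciesMeasure S γ e) := by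
  unfold selfSum
  refine integrable_finsetSum _ fun α _ => integrable_finsetSum _ fun i _ =>
    integrable_finsetSum _ fun j _ => ?_
  split_ifs
  exacts [hv.integrable_particle he (α, i) (α, j), integrable_zero _ _ _]

theorem Orbitals.integral_selfSum_le (he : Orbitals γ e) {v : E → E → ℝ} {c : ℝ}
    (hv : PairBound γ v c) {B : E × E → ℝ}
    (hAB : Integrable (fun z => v z.1 z.2 * B z) (γ.prod γ))
    (hB0 : ∀ z, 0 ≤ B z) (hB : ∀ k l z, 1 - exch e k l z ≤ B z) :
    ∫ Y, selfSum (S := S) v Y ∂speciesMeasure S γ e ≤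
      Fintype.card S * (Fintype.card O : ℝ) ^ 2 * ∫ z, v z.1 z.2 * B z ∂(γ.prod γ) := by
  have hp0 := he.isProbabilityMeasure
  have hp := he.isProbabilityMeasure_species (S := S)
  have hi : ∀ (α : S) (i j : O), Integrable (fun Y : S → O → E =>
      if i ≠ j then v (Y α i) (Y α j) else 0) (speciesMeasure S γ e) := fun α i j => by
    split_ifs
    exacts [hv.integrable_particle he (α, i) (α, j), integrable_zero _ _ _]
  unfold selfSum
  rw [integral_finsetSum _ fun α _ => integrable_finsetSum _ fun i _ =>
    integrable_finsetSum _ fun j _ => hi α i j]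
  have h0 : 0 ≤ ∫ z, v z.1 z.2 * B z ∂(γ.prod γ) :=
    integral_nonneg fun z => mul_nonneg (hv.nonneg _ _) (hB0 _)
  calc _ ≤ ∑ α : S, (Fintype.card O : ℝ) ^ 2 * ∫ z, v z.1 z.2 * B z ∂(γ.prod γ) := by
        refine Finset.sum_le_sum fun α _ => ?_
        rw [integral_finsetSum _ fun i _ => integrable_finsetSum _ fun j _ => hi α i j]
        calc _ ≤ ∑ i : O, ∑ j : O, ∫ z, v z.1 z.2 * B z ∂(γ.prod γ) := by
              refine Finset.sum_le_sum fun i _ => ?_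
              rw [integral_finsetSum _ fun j _ => hi α i j]
              refine Finset.sum_le_sum fun j _ => ?_
              by_cases hij : i = j
              · simpa [hij] using h0
              · simp only [ne_eq, hij, not_false_eq_true, if_true]
                have h2 : ∫ Y : S → O → E, v (Y α i) (Y α j) ∂speciesMeasure S γ e =
                    ∫ x, v (x i) (x j) ∂slaterMeasure γ e :=
                  integral_comp_eval (μ := fun _ : S => slaterMeasure γ e) (i := α)
                    (f := fun x : O → E => v (x i) (x j)) (hv.measurable_comp
                      (measurable_pi_apply i) (measurable_pi_apply j)).aestronglyMeasurable
                rw [h2]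
                exact he.integral_pair_le hij hv.meas (fun z => hv.nonneg _ _) hAB hB
          _ = _ := by simp; ring
    _ = _ := by simp; ring

/-- The pair function obtained by integrating out the central particle of a triple. -/
theorem PairBound.compose {u : E → E → ℝ} {U : ℝ} (hu : PairBound γ u U) :
    PairBound γ (fun y y' => ∫ x, u x y * u x y' ∂γ) (U ^ 2) := by
  obtain ⟨C, hC⟩ := hu.bdd
  have hinteg : ∀ y y', Integrable (fun x => u x y * u x y') γ := fun y y' => by
    refine Integrable.mul_bdd (c := C) (hu.integrable_left y)
      (hu.measurable_comp measurable_id measurable_const).aestronglyMeasurable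
      (Filter.Eventually.of_forall fun x => ?_)
    rw [Real.norm_of_nonneg (hu.nonneg _ _)]; exact hC _ _
  have hU := hu.const_nonneg
  have hm : Measurable fun p : (E × E) × E => u p.2 p.1.1 * u p.2 p.1.2 :=
    (hu.measurable_comp measurable_snd measurable_fst.fst).mul
      (hu.measurable_comp measurable_snd measurable_fst.snd)
  refine ⟨?_, ?_, ?_, ⟨C * U, ?_⟩, ?_⟩
  · exact (StronglyMeasurable.integral_prod_right (f := fun (p : E × E) (x : E) =>
      u x p.1 * u x p.2) hm.stronglyMeasurable).measurable
  · exact fun y y' => integral_nonneg fun x => mul_nonneg (hu.nonneg _ _) (hu.nonneg _ _)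
  · intro y y'
    simp only [mul_comm]
  · intro y y'
    have hC0 : 0 ≤ C := (hu.nonneg y y).trans (hC _ _)
    calc ∫ x, u x y * u x y' ∂γ ≤ ∫ x, C * u x y' ∂γ :=
          integral_mono (hinteg y y') ((hu.integrable_left y').const_mul _) fun x =>
            mul_le_mul_of_nonneg_right (hC _ _) (hu.nonneg _ _)
      _ ≤ C * U := by
          rw [integral_const_mul]
          exact mul_le_mul_of_nonneg_left (hu.int_le y') hC0
  · intro y'
    rw [integral_integral_swap]
    · calc ∫ x, ∫ y, u x y * u x y' ∂γ ∂γ = ∫ x, (∫ y, u x y ∂γ) * u x y' ∂γ := by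
            congr 1; ext x
            rw [integral_mul_const]
        _ ≤ ∫ x, U * u x y' ∂γ := by
            refine integral_mono_of_nonneg (Filter.Eventually.of_forall fun x =>
              mul_nonneg (integral_nonneg fun y => hu.nonneg _ _) (hu.nonneg _ _))
              ((hu.integrable_left y').const_mul _) (Filter.Eventually.of_forall fun x => ?_)
            exact mul_le_mul_of_nonneg_right (hu.int_le' x) (hu.nonneg _ _)
        _ ≤ U * U := by
            rw [integral_const_mul]
            exact mul_le_mul_of_nonneg_left (hu.int_le y') hU
        _ = U ^ 2 := by ring
    · refine integrable_of_measurable_of_bound ((hu.measurable_comp measurable_snd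
        measurable_fst).mul (hu.measurable_comp measurable_snd measurable_const)) (C * C)
        fun z => ?_
      have hC0 : 0 ≤ C := (hu.nonneg y' y').trans (hC _ _)
      simp only [Function.uncurry, Pi.mul_apply]
      rw [abs_of_nonneg (mul_nonneg (hu.nonneg _ _) (hu.nonneg _ _))]
      exact mul_le_mul (hC _ _) (hC _ _) (hu.nonneg _ _) hC0

theorem integrable_triTerm (he : Orbitals γ e) {u : E → E → ℝ} {U : ℝ} (hu : PairBound γ u U)
    (a b b' : S × O) : Integrable (fun Y : S → O → E =>
      if b.1 ≠ a.1 ∧ b'.1 ≠ a.1 ∧ b ≠ b' then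
        u (Y a.1 a.2) (Y b.1 b.2) * u (Y a.1 a.2) (Y b'.1 b'.2) else 0)
      (speciesMeasure S γ e) := by
  split_ifs
  · obtain ⟨C, hC⟩ := hu.bdd
    refine Integrable.mul_bdd (c := C) (hu.integrable_particle he a b)
      (measurable_pairTerm hu.meas a b').aestronglyMeasurable
      (Filter.Eventually.of_forall fun x => ?_)
    rw [Real.norm_of_nonneg (hu.nonneg _ _)]; exact hC _ _
  · exact integrable_zero _ _ _

theorem integrable_triSum (he : Orbitals γ e) {u : E → E → ℝ} {U : ℝ} (hu : PairBound γ u U) :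
    Integrable (triSum (S := S) (O := O) u) (speciesMeasure S γ e) :=
  integrable_finsetSum _ fun a _ => integrable_finsetSum _ fun b _ =>
    integrable_finsetSum _ fun b' _ => integrable_triTerm he hu a b b'

theorem Orbitals.integral_triSum_le (he : Orbitals γ e) {u : E → E → ℝ} {U : ℝ}
    (hu : PairBound γ u U) :
    ∫ Y, triSum (S := S) u Y ∂speciesMeasure S γ e ≤
      2 * (Fintype.card S * Fintype.card O : ℝ) ^ 3 * U ^ 2 := by
  have hp0 := he.isProbabilityMeasure
  have hp := he.isProbabilityMeasure_species (S := S)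
  set A : E → E → ℝ := fun y y' => ∫ x, u x y * u x y' ∂γ with hA
  have hAb : PairBound γ A (U ^ 2) := hu.compose
  obtain ⟨C, hC⟩ := hAb.bdd
  have hTB := he.integral_two_body_le (S := S) hAb.meas (fun z => hAb.nonneg _ _)
    (fun z => hC _ _) hAb.int_le'
  have hAi : Integrable (fun Y : S → O → E => ∑ b : S × O, ∑ b' : S × O,
      if b ≠ b' then A (Y b.1 b.2) (Y b'.1 b'.2) else 0) (speciesMeasure S γ e) := by
    refine integrable_finsetSum _ fun b _ => integrable_finsetSum _ fun b' _ => ?_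
    split_ifs
    exacts [hAb.integrable_particle he b b', integrable_zero _ _ _]
  have hArest : ∀ α : S, Integrable (fun Y : S → O → E => ∑ b : S × O, ∑ b' : S × O,
      if b.1 ≠ α ∧ b'.1 ≠ α ∧ b ≠ b' then A (Y b.1 b.2) (Y b'.1 b'.2) else 0)
      (speciesMeasure S γ e) := fun α => by
    refine integrable_finsetSum _ fun b _ => integrable_finsetSum _ fun b' _ => ?_
    split_ifs
    exacts [hAb.integrable_particle he b b', integrable_zero _ _ _]
  have hsp : ∀ α : S, ∫ Y : S → O → E, ∑ i : O, ∑ b : S × O, ∑ b' : S × O,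
      (if b.1 ≠ α ∧ b'.1 ≠ α ∧ b ≠ b' then u (Y α i) (Y b.1 b.2) * u (Y α i) (Y b'.1 b'.2) else 0)
      ∂speciesMeasure S γ e ≤
      Fintype.card O * (2 * (Fintype.card S * Fintype.card O : ℝ) ^ 2 * U ^ 2) := by
    intro α
    calc _ ≤ ∫ Y : S → O → E, Fintype.card O * ∑ b : S × O, ∑ b' : S × O,
          (if b.1 ≠ α ∧ b'.1 ≠ α ∧ b ≠ b' then A (Y b.1 b.2) (Y b'.1 b'.2) else 0)
          ∂speciesMeasure S γ e := by
          refine integral_le_of_update (μ := fun _ : S => slaterMeasure γ e) α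
            (integrable_finsetSum _ fun i _ => integrable_finsetSum _ fun b _ =>
              integrable_finsetSum _ fun b' _ => integrable_triTerm he hu (α, i) b b')
            ((hArest α).const_mul _) fun X => ?_
          have hXL : ∀ x : O → E, (∑ i : O, ∑ b : S × O, ∑ b' : S × O,
              (if b.1 ≠ α ∧ b'.1 ≠ α ∧ b ≠ b' then
                u (Function.update X α x α i) (Function.update X α x b.1 b.2) *
                u (Function.update X α x α i) (Function.update X α x b'.1 b'.2) else 0)) =
              ∑ i : O, (fun z => ∑ b : S × O, ∑ b' : S × O,
              if b.1 ≠ α ∧ b'.1 ≠ α ∧ b ≠ b' then u z (X b.1 b.2) * u z (X b'.1 b'.2) else 0)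
              (x i) := fun x => by
            refine Finset.sum_congr rfl fun i _ => Finset.sum_congr rfl fun b _ =>
              Finset.sum_congr rfl fun b' _ => ?_
            split_ifs with h
            · rw [Function.update_self, Function.update_of_ne h.1, Function.update_of_ne h.2.1]
            · rfl
          have hXR : ∀ x : O → E, (∑ b : S × O, ∑ b' : S × O,
              (if b.1 ≠ α ∧ b'.1 ≠ α ∧ b ≠ b' then A (Function.update X α x b.1 b.2)
                (Function.update X α x b'.1 b'.2) else 0)) = ∑ b : S × O, ∑ b' : S × O,
              (if b.1 ≠ α ∧ b'.1 ≠ α ∧ b ≠ b' then A (X b.1 b.2) (X b'.1 b'.2) else 0) := fun x => by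
            refine Finset.sum_congr rfl fun b _ => Finset.sum_congr rfl fun b' _ => ?_
            split_ifs with h
            · rw [Function.update_of_ne h.1, Function.update_of_ne h.2.1]
            · rfl
          have huu : ∀ b b' : S × O, Integrable (fun z => if b.1 ≠ α ∧ b'.1 ≠ α ∧ b ≠ b' then
              u z (X b.1 b.2) * u z (X b'.1 b'.2) else 0) γ := fun b b' => by
            split_ifs
            · obtain ⟨C, hC⟩ := hu.bdd
              refine Integrable.mul_bdd (c := C) (hu.integrable_left _)
                (hu.measurable_comp measurable_id measurable_const).aestronglyMeasurable
                (Filter.Eventually.of_forall fun x => ?_)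
              rw [Real.norm_of_nonneg (hu.nonneg _ _)]; exact hC _ _
            · exact integrable_zero _ _ _
          have hF : Integrable (fun z => ∑ b : S × O, ∑ b' : S × O,
              if b.1 ≠ α ∧ b'.1 ≠ α ∧ b ≠ b' then u z (X b.1 b.2) * u z (X b'.1 b'.2) else 0) γ :=
            integrable_finsetSum _ fun b _ => integrable_finsetSum _ fun b' _ => huu b b'
          simp only [hXL, hXR]
          rw [integral_finsetSum _ fun i _ => he.integrable_eval hF i, he.sum_integral_eval hF]
          simp only [integral_const, probReal_univ, one_smul]
          refine le_of_eq ?_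
          congr 1
          rw [integral_finsetSum _ fun b _ => integrable_finsetSum _ fun b' _ => huu b b']
          refine Finset.sum_congr rfl fun b _ => ?_
          rw [integral_finsetSum _ fun b' _ => huu b b']
          refine Finset.sum_congr rfl fun b' _ => ?_
          split_ifs
          · rfl
          · simp
      _ ≤ ∫ Y : S → O → E, Fintype.card O * ∑ b : S × O, ∑ b' : S × O,
          (if b ≠ b' then A (Y b.1 b.2) (Y b'.1 b'.2) else 0) ∂speciesMeasure S γ e := by
          refine integral_mono ((hArest α).const_mul _) (hAi.const_mul _) fun Y => ?_
          refine mul_le_mul_of_nonneg_left (Finset.sum_le_sum fun b _ =>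
            Finset.sum_le_sum fun b' _ => ?_) (by positivity)
          by_cases hb : b = b'
          · simp [hb]
          · simp only [hb, ne_eq, not_false_eq_true, and_true, if_true]
            split_ifs
            exacts [le_rfl, hAb.nonneg _ _]
      _ ≤ _ := by
          rw [integral_const_mul]
          exact mul_le_mul_of_nonneg_left hTB (by positivity)
  have htri : ∀ Y : S → O → E, triSum u Y = ∑ α : S, ∑ i : O, ∑ b : S × O, ∑ b' : S × O,
      (if b.1 ≠ α ∧ b'.1 ≠ α ∧ b ≠ b' then u (Y α i) (Y b.1 b.2) * u (Y α i) (Y b'.1 b'.2)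
        else 0) := fun Y => by
    unfold triSum
    rw [Fintype.sum_prod_type]
  simp only [htri]
  rw [integral_finsetSum]
  · calc _ ≤ ∑ α : S, Fintype.card O * (2 * (Fintype.card S * Fintype.card O : ℝ) ^ 2 * U ^ 2) :=
          Finset.sum_le_sum fun α _ => hsp α
      _ = _ := by
          rw [Finset.sum_const, Finset.card_univ, nsmul_eq_mul]; ring
  · exact fun α _ => integrable_finsetSum _ fun i _ => integrable_finsetSum _ fun b _ =>
      integrable_finsetSum _ fun b' _ => integrable_triTerm he hu (α, i) b b'

end ThreeBody

section Cutoff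
open scoped ComplexConjugate

/-- A smooth cutoff on `[0, ℓ + d]` whose squares form a partition of unity under translations
by multiples of `ℓ`. -/
def cut (ℓ d t : ℝ) : ℝ :=
  sin (π / 2 * smoothTransition (t / d)) * cos (π / 2 * smoothTransition ((t - ℓ) / d))

theorem contDiff_cut (ℓ d : ℝ) : ContDiff ℝ (⊤ : ℕ∞) (cut ℓ d) := by
  unfold cut
  have h : ContDiff ℝ (⊤ : ℕ∞) smoothTransition := smoothTransition.contDiff
  exact (Real.contDiff_sin.comp (contDiff_const.mul (h.comp (contDiff_id.div_const d)))).mul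
    (Real.contDiff_cos.comp (contDiff_const.mul
      (h.comp ((contDiff_id.sub contDiff_const).div_const d))))

theorem abs_cut_le (ℓ d t : ℝ) : |cut ℓ d t| ≤ 1 := by
  unfold cut
  rw [abs_mul]
  exact mul_le_one₀ (abs_sin_le_one _) (abs_nonneg _) (abs_cos_le_one _)

theorem cut_eq_zero {ℓ d t : ℝ} (hd : 0 < d) (h : t ≤ 0 ∨ ℓ + d ≤ t) : cut ℓ d t = 0 := by
  unfold cut
  rcases h with h | h
  · rw [smoothTransition.zero_of_nonpos (div_nonpos_of_nonpos_of_nonneg h hd.le)]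
    simp
  · rw [smoothTransition.one_of_one_le (x := (t - ℓ) / d) ((one_le_div hd).2 (by linarith))]
    simp

theorem cut_sq_add {ℓ d t : ℝ} (hd : 0 < d) (hdl : d ≤ ℓ) (h0 : 0 ≤ t) (h1 : t ≤ ℓ) :
    cut ℓ d t ^ 2 + cut ℓ d (t + ℓ) ^ 2 = 1 := by
  unfold cut
  rw [smoothTransition.zero_of_nonpos (x := (t - ℓ) / d)
    (div_nonpos_of_nonpos_of_nonneg (by linarith) hd.le),
    smoothTransition.one_of_one_le (x := (t + ℓ) / d) ((one_le_div hd).2 (by linarith))]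
  simp [add_sub_cancel_right, mul_pow]

theorem integral_cut_sq_mul {ℓ d : ℝ} (hd : 0 < d) (hdl : d ≤ ℓ) {f : ℝ → ℂ} (hf : Continuous f)
    (hper : ∀ t, f (t + ℓ) = f t) :
    ∫ t, ((cut ℓ d t ^ 2 : ℝ) : ℂ) * f t = ∫ t in (0 : ℝ)..ℓ, f t := by
  have hc : Continuous fun t => ((cut ℓ d t ^ 2 : ℝ) : ℂ) * f t :=
    (Complex.continuous_ofReal.comp ((contDiff_cut ℓ d).continuous.pow 2)).mul hf
  have hl : 0 < ℓ := hd.trans_le hdl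
  have hsupp : Function.support (fun t => ((cut ℓ d t ^ 2 : ℝ) : ℂ) * f t) ⊆ Set.Ioc 0 (2 * ℓ) := by
    intro t ht
    by_contra h
    refine ht ?_
    have : cut ℓ d t = 0 := cut_eq_zero hd (by
      by_contra! h'
      exact h ⟨h'.1, by linarith⟩)
    simp [this]
  rw [← intervalIntegral.integral_eq_integral_of_support_subset hsupp,
    ← intervalIntegral.integral_add_adjacent_intervals (hc.intervalIntegrable 0 ℓ)
      (hc.intervalIntegrable ℓ (2 * ℓ))]
  have h2 : ∫ t in ℓ..2 * ℓ, ((cut ℓ d t ^ 2 : ℝ) : ℂ) * f t =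
      ∫ t in (0 : ℝ)..ℓ, ((cut ℓ d (t + ℓ) ^ 2 : ℝ) : ℂ) * f t := by
    have := intervalIntegral.integral_comp_add_right (a := 0) (b := ℓ)
      (fun t => ((cut ℓ d t ^ 2 : ℝ) : ℂ) * f t) ℓ
    rw [zero_add, ← two_mul] at this
    rw [← this]
    simp only [hper]
  have hc' : Continuous fun t => ((cut ℓ d (t + ℓ) ^ 2 : ℝ) : ℂ) * f t :=
    (Complex.continuous_ofReal.comp (((contDiff_cut ℓ d).continuous.comp
      (continuous_id.add continuous_const)).pow 2)).mul hf
  rw [h2, ← intervalIntegral.integral_add (hc.intervalIntegrable 0 ℓ)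
    (hc'.intervalIntegrable 0 ℓ)]
  refine intervalIntegral.integral_congr fun t ht => ?_
  rw [Set.uIcc_of_le hl.le] at ht
  have := cut_sq_add hd hdl ht.1 ht.2
  rw [← add_mul, ← Complex.ofReal_add, this]
  simp

theorem integral_exp_int {ℓ : ℝ} (hl : 0 < ℓ) (n : ℤ) :
    ∫ t in (0 : ℝ)..ℓ, Complex.exp ((2 * π * n / ℓ : ℝ) * t * Complex.I) =
      if n = 0 then (ℓ : ℂ) else 0 := by
  split_ifs with h
  · simp [h]
  · have hc : ((2 * π * n / ℓ : ℝ) : ℂ) * Complex.I ≠ 0 := by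
      have : (2 * π * n / ℓ : ℝ) ≠ 0 := by
        have : (n : ℝ) ≠ 0 := by exact_mod_cast h
        have := pi_ne_zero
        positivity
      exact mul_ne_zero (by exact_mod_cast this) Complex.I_ne_zero
    have h1 : ∀ t : ℝ, Complex.exp ((2 * π * n / ℓ : ℝ) * t * Complex.I) =
        Complex.exp (((2 * π * n / ℓ : ℝ) * Complex.I) * t) := fun t => by ring_nf
    simp only [h1]
    rw [integral_exp_mul_complex hc]
    have h2 : ((2 * π * n / ℓ : ℝ) : ℂ) * Complex.I * ℓ = n * (2 * π * Complex.I) := by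
      have : (ℓ : ℂ) ≠ 0 := by exact_mod_cast hl.ne'
      push_cast
      field_simp
    rw [h2, Complex.exp_int_mul_two_pi_mul_I]
    simp

theorem integral_cut_sq_exp {ℓ d : ℝ} (hd : 0 < d) (hdl : d ≤ ℓ) (n : ℤ) :
    ∫ t, ((cut ℓ d t ^ 2 : ℝ) : ℂ) * Complex.exp ((2 * π * n / ℓ : ℝ) * t * Complex.I) =
      if n = 0 then (ℓ : ℂ) else 0 := by
  have hl : 0 < ℓ := hd.trans_le hdl
  rw [integral_cut_sq_mul hd hdl (by fun_prop), integral_exp_int hl]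
  intro t
  have h2 : ((2 * π * n / ℓ : ℝ) : ℂ) * ((t + ℓ : ℝ) : ℂ) * Complex.I =
      (2 * π * n / ℓ : ℝ) * t * Complex.I + n * (2 * π * Complex.I) := by
    have : (ℓ : ℂ) ≠ 0 := by exact_mod_cast hl.ne'
    push_cast
    field_simp
  rw [h2, Complex.exp_add, Complex.exp_int_mul_two_pi_mul_I, mul_one]

theorem integral_cut_sq {ℓ d : ℝ} (hd : 0 < d) (hdl : d ≤ ℓ) : ∫ t, cut ℓ d t ^ 2 = ℓ := by
  have := integral_cut_sq_exp hd hdl 0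
  simp only [Int.cast_zero, mul_zero, zero_div, Complex.ofReal_zero, zero_mul, Complex.exp_zero,
    mul_one, if_true, integral_complex_ofReal] at this
  exact_mod_cast this

/-- The Dirichlet energy of the smooth transition function. -/
def stepEnergy : ℝ := ∫ t, deriv smoothTransition t ^ 2

theorem hasCompactSupport_deriv_smoothTransition : HasCompactSupport (deriv smoothTransition) := by
  refine HasCompactSupport.intro (isCompact_Icc (a := 0) (b := 1)) fun t ht => ?_
  rcases lt_or_ge t 0 with h | h
  · have : smoothTransition =ᶠ[nhds t] fun _ => 0 :=
      Filter.eventually_of_mem (Iio_mem_nhds h) fun s hs =>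
        smoothTransition.zero_of_nonpos (le_of_lt hs)
    rw [this.deriv_eq]; simp
  · have h1 : 1 < t := by
      by_contra! h'
      exact ht ⟨h, h'⟩
    have : smoothTransition =ᶠ[nhds t] fun _ => 1 :=
      Filter.eventually_of_mem (Ioi_mem_nhds h1) fun s hs =>
        smoothTransition.one_of_one_le (le_of_lt hs)
    rw [this.deriv_eq]; simp

theorem integrable_deriv_smoothTransition_sq :
    Integrable fun t => deriv smoothTransition t ^ 2 := by
  have hc : Continuous (deriv smoothTransition) :=
    (smoothTransition.contDiff (n := 1)).continuous_deriv (by norm_num)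
  have h := hasCompactSupport_deriv_smoothTransition
  revert hc h
  generalize deriv smoothTransition = f
  intro hc h
  exact (hc.pow 2).integrable_of_hasCompactSupport (h.mono fun t ht => by
    intro h0
    exact ht (by simp [h0]))

theorem hasDerivAt_sin_mul_cos {S S' : ℝ → ℝ} (hS : ∀ s, HasDerivAt S (S' s) s) (ℓ d t : ℝ) :
    HasDerivAt (fun t => sin (π / 2 * S (t / d)) * cos (π / 2 * S ((t - ℓ) / d)))
      (cos (π / 2 * S (t / d)) * (π / 2 * (S' (t / d) * (1 / d))) *
        cos (π / 2 * S ((t - ℓ) / d)) +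
      sin (π / 2 * S (t / d)) *
        (-sin (π / 2 * S ((t - ℓ) / d)) * (π / 2 * (S' ((t - ℓ) / d) * (1 / d))))) t := by
  have h1 : HasDerivAt (fun t => S (t / d)) (S' (t / d) * (1 / d)) t :=
    HasDerivAt.comp (h := fun t => t / d) t (hS (t / d)) ((hasDerivAt_id t).div_const d)
  have h2 : HasDerivAt (fun t => S ((t - ℓ) / d)) (S' ((t - ℓ) / d) * (1 / d)) t :=
    HasDerivAt.comp (h := fun t => (t - ℓ) / d) t (hS ((t - ℓ) / d))
      (((hasDerivAt_id t).sub_const ℓ).div_const d)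
  exact ((h1.const_mul (π / 2)).sin).mul ((h2.const_mul (π / 2)).cos)

theorem sq_sin_cos_le (A B α β : ℝ) {d : ℝ} (hd : 0 < d) :
    (cos α * (π / 2 * (A * (1 / d))) * cos β + sin α * (-sin β * (π / 2 * (B * (1 / d))))) ^ 2 ≤
    (π ^ 2 / (2 * d ^ 2)) * (A ^ 2 + B ^ 2) := by
  have ha : (A * (cos α * cos β)) ^ 2 ≤ A ^ 2 := by
    rw [mul_pow]
    refine mul_le_of_le_one_right (sq_nonneg _) ?_
    rw [mul_pow]
    exact mul_le_one₀ (cos_sq_le_one α) (sq_nonneg _) (cos_sq_le_one β)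
  have hb : (B * (sin α * sin β)) ^ 2 ≤ B ^ 2 := by
    rw [mul_pow]
    refine mul_le_of_le_one_right (sq_nonneg _) ?_
    rw [mul_pow]
    exact mul_le_one₀ (sin_sq_le_one α) (sq_nonneg _) (sin_sq_le_one β)
  have hab : (A * (cos α * cos β) - B * (sin α * sin β)) ^ 2 ≤ 2 * (A ^ 2 + B ^ 2) := by
    nlinarith [sq_nonneg (A * (cos α * cos β) + B * (sin α * sin β))]
  calc _ = (π ^ 2 / (4 * d ^ 2)) * (A * (cos α * cos β) - B * (sin α * sin β)) ^ 2 := by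
        field_simp
        ring
    _ ≤ (π ^ 2 / (4 * d ^ 2)) * (2 * (A ^ 2 + B ^ 2)) :=
        mul_le_mul_of_nonneg_left hab (by positivity)
    _ = _ := by field_simp; ring

theorem deriv_cut_sq_le (ℓ : ℝ) {d : ℝ} (hd : 0 < d) (t : ℝ) : deriv (cut ℓ d) t ^ 2 ≤
    (π ^ 2 / (2 * d ^ 2)) * (deriv smoothTransition (t / d) ^ 2 +
      deriv smoothTransition ((t - ℓ) / d) ^ 2) := by
  have hS : ∀ s, HasDerivAt smoothTransition (deriv smoothTransition s) s := fun s =>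
    ((smoothTransition.contDiff (n := 1)).differentiable (by norm_num) s).hasDerivAt
  rw [show cut ℓ d = _ from funext fun t => cut.eq_1 ℓ d t,
    (hasDerivAt_sin_mul_cos hS ℓ d t).deriv]
  exact sq_sin_cos_le _ _ _ _ hd

theorem integral_deriv_cut_sq_le (ℓ : ℝ) {d : ℝ} (hd : 0 < d) :
    ∫ t, deriv (cut ℓ d) t ^ 2 ≤ π ^ 2 * stepEnergy / d := by
  have hi := integrable_deriv_smoothTransition_sq
  have hi1 : Integrable fun t => deriv smoothTransition (t / d) ^ 2 := hi.comp_div hd.ne'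
  have hi2 : Integrable fun t => deriv smoothTransition ((t - ℓ) / d) ^ 2 :=
    hi1.comp_sub_right ℓ
  calc ∫ t, deriv (cut ℓ d) t ^ 2 ≤ ∫ t, (π ^ 2 / (2 * d ^ 2)) * (deriv smoothTransition (t / d) ^ 2 +
      deriv smoothTransition ((t - ℓ) / d) ^ 2) :=
        integral_mono_of_nonneg (Filter.Eventually.of_forall fun t => sq_nonneg _)
          ((hi1.add hi2).const_mul _) (Filter.Eventually.of_forall fun t => deriv_cut_sq_le ℓ hd t)
    _ = _ := by
        rw [integral_const_mul, integral_add hi1 hi2,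
          integral_sub_right_eq_self (fun t => deriv smoothTransition (t / d) ^ 2),
          Measure.integral_comp_div (fun t => deriv smoothTransition t ^ 2), abs_of_pos hd,
          stepEnergy, smul_eq_mul]
        field_simp
        ring

end Cutoff

section BoxMeasure
open scoped ComplexConjugate

theorem integral_prod_coord {𝕜 : Type*} [RCLike 𝕜] (f : Fin 3 → ℝ → 𝕜) :
    ∫ x : R3, ∏ j, f j (x j) = ∏ j, ∫ t, f j t := by
  rw [← integral_fintype_prod_volume_eq_prod]
  exact (PiLp.volume_preserving_ofLp (Fin 3)).integral_comp
    (MeasurableEquiv.toLp 2 (Fin 3 → ℝ)).symm.measurableEmbedding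
    (fun x : Fin 3 → ℝ => ∏ j, f j (x j))

/-- The smooth cutoff of the cube `[0, ℓ + d]³`. -/
def boxCut (ℓ d : ℝ) (x : R3) : ℝ := ∏ j, cut ℓ d (x j)

theorem contDiff_boxCut (ℓ d : ℝ) : ContDiff ℝ (⊤ : ℕ∞) (boxCut ℓ d) :=
  contDiff_prod fun j _ => (contDiff_cut ℓ d).comp (contDiff_piLp_apply (p := 2) (i := j))

theorem abs_boxCut_le (ℓ d : ℝ) (x : R3) : |boxCut ℓ d x| ≤ 1 := by
  rw [boxCut, Finset.abs_prod]
  exact Finset.prod_le_one (fun _ _ => abs_nonneg _) fun _ _ => abs_cut_le _ _ _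

theorem mem_Ioo_of_boxCut_ne_zero {ℓ d : ℝ} (hd : 0 < d) {x : R3} (h : boxCut ℓ d x ≠ 0) (j : Fin 3) :
    x j ∈ Set.Ioo 0 (ℓ + d) := by
  by_contra h'
  refine h (Finset.prod_eq_zero (Finset.mem_univ j) (cut_eq_zero hd ?_))
  by_contra! h2
  exact h' h2

theorem hasCompactSupport_boxCut {ℓ d : ℝ} (hd : 0 < d) : HasCompactSupport (boxCut ℓ d) := by
  have hc : IsCompact (Set.image (MeasurableEquiv.toLp 2 (Fin 3 → ℝ)) (Set.univ.pi fun _ : Fin 3 =>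
      Set.Icc (0 : ℝ) (ℓ + d))) :=
    (isCompact_univ_pi fun _ => isCompact_Icc).image (PiLp.continuous_toLp 2 _)
  refine HasCompactSupport.intro hc fun x hx => ?_
  by_contra h
  refine hx ⟨x.ofLp, fun j _ => ?_, rfl⟩
  exact Set.Ioo_subset_Icc_self (mem_Ioo_of_boxCut_ne_zero hd h j)

/-- The probability measure on the cube with density proportional to the squared cutoff. -/
def boxMeasure (ℓ d : ℝ) : Measure R3 :=
  volume.withDensity fun x => ENNReal.ofReal (boxCut ℓ d x ^ 2 / ℓ ^ 3)

/-- The plane wave with momentum `2πk/ℓ`. -/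
def planeWave (ℓ : ℝ) (k : Fin 3 → ℤ) (x : R3) : ℂ :=
  Complex.exp ((2 * π / ℓ * ∑ j, k j * x j : ℝ) * Complex.I)

theorem measurable_boxCut (ℓ d : ℝ) : Measurable (boxCut ℓ d) :=
  (contDiff_boxCut ℓ d).continuous.measurable

theorem integral_boxMeasure {F : Type*} [NormedAddCommGroup F] [NormedSpace ℝ F] {ℓ : ℝ}
    (hl : 0 < ℓ) (d : ℝ) (f : R3 → F) :
    ∫ x, f x ∂boxMeasure ℓ d = ∫ x, (boxCut ℓ d x ^ 2 / ℓ ^ 3) • f x := by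
  rw [boxMeasure, integral_withDensity_eq_integral_toReal_smul
    (((measurable_boxCut ℓ d).pow_const 2).div_const _).ennreal_ofReal (by simp)]
  refine integral_congr_ae (Filter.Eventually.of_forall fun x => ?_)
  simp only
  rw [ENNReal.toReal_ofReal (by positivity)]

theorem integrable_boxMeasure_iff {F : Type*} [NormedAddCommGroup F] [NormedSpace ℝ F] {ℓ : ℝ}
    (hl : 0 < ℓ) (d : ℝ) (f : R3 → F) :
    Integrable f (boxMeasure ℓ d) ↔ Integrable fun x => (boxCut ℓ d x ^ 2 / ℓ ^ 3) • f x := by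
  rw [boxMeasure, integrable_withDensity_iff_integrable_smul'
    (((measurable_boxCut ℓ d).pow_const 2).div_const _).ennreal_ofReal (by simp)]
  refine integrable_congr (Filter.Eventually.of_forall fun x => ?_)
  simp only
  rw [ENNReal.toReal_ofReal (by positivity)]

theorem planeWave_prod (ℓ d : ℝ) (k l : Fin 3 → ℤ) (x : R3) :
    ((boxCut ℓ d x ^ 2 : ℝ) : ℂ) * (conj (planeWave ℓ k x) * planeWave ℓ l x) =
      ∏ j, (((cut ℓ d (x j) ^ 2 : ℝ) : ℂ) *
        Complex.exp ((2 * π * ((l j - k j : ℤ) : ℝ) / ℓ : ℝ) * (x j) * Complex.I)) := by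
  rw [Finset.prod_mul_distrib, ← Complex.exp_sum, boxCut, ← Finset.prod_pow, Complex.ofReal_prod]
  congr 1
  unfold planeWave
  rw [← Complex.exp_conj, ← Complex.exp_add]
  congr 1
  simp only [map_mul, Complex.conj_ofReal, Complex.conj_I, Fin.sum_univ_three]
  push_cast
  ring

theorem integral_planeWave {ℓ d : ℝ} (hd : 0 < d) (hdl : d ≤ ℓ) (k l : Fin 3 → ℤ) :
    ∫ x, conj (planeWave ℓ k x) * planeWave ℓ l x ∂boxMeasure ℓ d = if k = l then 1 else 0 := by
  have hl : 0 < ℓ := hd.trans_le hdl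
  rw [integral_boxMeasure hl]
  have h : ∀ x, (boxCut ℓ d x ^ 2 / ℓ ^ 3) • (conj (planeWave ℓ k x) * planeWave ℓ l x) =
      ((ℓ ^ 3)⁻¹ : ℂ) * ∏ j, (((cut ℓ d (x j) ^ 2 : ℝ) : ℂ) *
        Complex.exp ((2 * π * ((l j - k j : ℤ) : ℝ) / ℓ : ℝ) * (x j) * Complex.I)) := fun x => by
    rw [← planeWave_prod, Complex.real_smul]
    push_cast
    ring
  simp only [h]
  rw [integral_const_mul, integral_prod_coord (fun j t => ((cut ℓ d t ^ 2 : ℝ) : ℂ) *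
        Complex.exp ((2 * π * ((l j - k j : ℤ) : ℝ) / ℓ : ℝ) * t * Complex.I))]
  simp only [integral_cut_sq_exp hd hdl]
  have hl' : (ℓ : ℂ) ≠ 0 := by exact_mod_cast hl.ne'
  split_ifs with hkl
  · subst hkl
    simp
    field_simp
  · obtain ⟨j, hj⟩ := Function.ne_iff.1 hkl
    rw [Finset.prod_eq_zero (Finset.mem_univ j), mul_zero]
    rw [if_neg]
    exact fun h' => hj (by linarith [sub_eq_zero.1 h'])

theorem norm_planeWave (ℓ : ℝ) (k : Fin 3 → ℤ) (x : R3) : ‖planeWave ℓ k x‖ = 1 :=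
  Complex.norm_exp_ofReal_mul_I _

theorem contDiff_planeWave (ℓ : ℝ) (k : Fin 3 → ℤ) :
    ContDiff ℝ (⊤ : ℕ∞) (planeWave ℓ k) := by
  unfold planeWave
  refine Complex.contDiff_exp.comp ((Complex.ofRealCLM.contDiff.comp (contDiff_const.mul
    (ContDiff.sum fun j _ => contDiff_const.mul (contDiff_piLp_apply (p := 2)
      (i := j))))).mul contDiff_const)

theorem isProbabilityMeasure_boxMeasure {ℓ d : ℝ} (hd : 0 < d) (hdl : d ≤ ℓ) :
    IsProbabilityMeasure (boxMeasure ℓ d) := by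
  have hl : 0 < ℓ := hd.trans_le hdl
  have hi : Integrable fun x => boxCut ℓ d x ^ 2 / ℓ ^ 3 := by
    refine Integrable.div_const (Continuous.integrable_of_hasCompactSupport
      ((contDiff_boxCut ℓ d).continuous.pow 2) ((hasCompactSupport_boxCut (ℓ := ℓ) hd).mono fun t ht => ?_)) _
    intro h0
    exact ht (by simp [h0])
  constructor
  rw [boxMeasure, withDensity_apply _ MeasurableSet.univ, Measure.restrict_univ,
    ← ofReal_integral_eq_lintegral_ofReal hi (Filter.Eventually.of_forall fun x => by positivity),
    integral_div]
  have h : ∀ x, boxCut ℓ d x ^ 2 = ∏ j, cut ℓ d (x j) ^ 2 := fun x => by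
    rw [boxCut, Finset.prod_pow]
  simp only [h]
  rw [integral_prod_coord (fun j t => cut ℓ d t ^ 2)]
  simp only [integral_cut_sq hd hdl, Finset.prod_const, Finset.card_univ, Fintype.card_fin]
  rw [div_self (by positivity), ENNReal.ofReal_one]

theorem orbitals_planeWave {ℓ d : ℝ} (hd : 0 < d) (hdl : d ≤ ℓ) (K : Finset (Fin 3 → ℤ)) :
    Orbitals (boxMeasure ℓ d) fun (k : K) => planeWave ℓ k.1 where
  meas k := (contDiff_planeWave ℓ k.1).continuous.measurable
  norm_eq_one k x := norm_planeWave _ _ _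
  ortho k l := by
    rw [integral_planeWave hd hdl]
    exact if_congr Subtype.ext_iff.symm rfl rfl

theorem integral_boxMeasure_le {ℓ : ℝ} (hl : 0 < ℓ) (d : ℝ) {f : R3 → ℝ} (hf : ∀ x, 0 ≤ f x)
    (hi : Integrable f) : ∫ x, f x ∂boxMeasure ℓ d ≤ (∫ x, f x) / ℓ ^ 3 := by
  rw [integral_boxMeasure hl, ← integral_div]
  refine integral_mono_of_nonneg (Filter.Eventually.of_forall fun x => ?_) (hi.div_const _)
    (Filter.Eventually.of_forall fun x => ?_)
  · exact mul_nonneg (by positivity) (hf x)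
  · have : boxCut ℓ d x ^ 2 ≤ 1 := (sq_le_one_iff_abs_le_one _).2 (abs_boxCut_le ℓ d x)
    simp only [smul_eq_mul]
    rw [div_mul_eq_mul_div]
    gcongr
    exact mul_le_of_le_one_left (hf x) this

theorem pairBound_boxMeasure {ℓ : ℝ} (hl : 0 < ℓ) (d : ℝ) {f : R3 → ℝ} (hm : Measurable f)
    (hf : ∀ x, 0 ≤ f x) (hs : ∀ x, f (-x) = f x) (hb : ∃ C, ∀ x, f x ≤ C) (hi : Integrable f) :
    PairBound (boxMeasure ℓ d) (fun x y => f (x - y)) ((∫ x, f x) / ℓ ^ 3) where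
  meas := hm.comp (measurable_fst.sub measurable_snd)
  nonneg x y := hf _
  symm x y := by rw [← hs, neg_sub]
  bdd := hb.imp fun C hC x y => hC _
  int_le y := by
    refine (integral_boxMeasure_le hl d (fun x => hf _) (hi.comp_sub_right y)).trans_eq ?_
    rw [integral_sub_right_eq_self f y]

/-- The squared length of the gradient of a real function. -/
def realGradSq (f : R3 → ℝ) (x : R3) : ℝ :=
  ∑ j : Fin 3, fderiv ℝ f x (EuclideanSpace.single j 1) ^ 2

theorem fderiv_boxCut (ℓ d : ℝ) (x : R3) (j : Fin 3) :
    fderiv ℝ (boxCut ℓ d) x (EuclideanSpace.single j 1) =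
      ∏ i, (if i = j then deriv (cut ℓ d) else cut ℓ d) (x i) := by
  have h : ∀ i ∈ Finset.univ, HasFDerivAt (fun x : R3 => cut ℓ d (x i))
      (deriv (cut ℓ d) (x i) • (EuclideanSpace.proj i : R3 →L[ℝ] ℝ)) x := fun i _ => by
    have hp : HasFDerivAt (fun x : R3 => x i) (EuclideanSpace.proj i : R3 →L[ℝ] ℝ) x :=
      (EuclideanSpace.proj i : R3 →L[ℝ] ℝ).hasFDerivAt
    exact HasDerivAt.comp_hasFDerivAt (f := fun x : R3 => x i) x
      (((contDiff_cut ℓ d).differentiable (by simp) (x i)).hasDerivAt) hp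
  have h2 := (HasFDerivAt.finsetProd h).fderiv
  rw [show boxCut ℓ d = fun x : R3 => ∏ i, cut ℓ d (x i) from rfl, h2]
  have hproj : ∀ i : Fin 3, (EuclideanSpace.proj i : R3 →L[ℝ] ℝ) (EuclideanSpace.single j 1) =
      if i = j then 1 else 0 := fun i => PiLp.single_apply 2 ℝ j 1 i
  simp only [sum_apply, smul_apply, hproj, smul_eq_mul]
  rw [Finset.sum_eq_single j]
  · rw [← Finset.mul_prod_erase Finset.univ _ (Finset.mem_univ j), if_pos rfl, if_pos rfl, mul_one,
      mul_comm]
    congr 1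
    refine Finset.prod_congr rfl fun i hi => ?_
    rw [if_neg (Finset.ne_of_mem_erase hi)]
  · intro i _ hij
    rw [if_neg hij]
    simp
  · simp

theorem integrable_realGradSq {f : R3 → ℝ} (hf : ContDiff ℝ (⊤ : ℕ∞) f) (hs : HasCompactSupport f) :
    Integrable (realGradSq f) := by
  refine integrable_finsetSum _ fun j _ => ?_
  have hc : Continuous fun x => fderiv ℝ f x (EuclideanSpace.single j 1) :=
    (hf.continuous_fderiv (by simp)).clm_apply continuous_const
  refine (hc.pow 2).integrable_of_hasCompactSupport ((hs.fderiv ℝ).mono fun t ht h0 => ht ?_)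
  simp [h0]

theorem integral_realGradSq_boxCut_le {ℓ d : ℝ} (hd : 0 < d) (hdl : d ≤ ℓ) :
    ∫ x, realGradSq (boxCut ℓ d) x ≤ 3 * (π ^ 2 * stepEnergy / d * ℓ ^ 2) := by
  unfold realGradSq
  have hinteg : ∀ j : Fin 3, Integrable fun x : R3 =>
      fderiv ℝ (boxCut ℓ d) x (EuclideanSpace.single j 1) ^ 2 := fun j => by
    have hc : Continuous fun x => fderiv ℝ (boxCut ℓ d) x (EuclideanSpace.single j 1) :=
      ((contDiff_boxCut ℓ d).continuous_fderiv (by simp)).clm_apply continuous_const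
    refine (hc.pow 2).integrable_of_hasCompactSupport
      (((hasCompactSupport_boxCut (ℓ := ℓ) hd).fderiv ℝ).mono fun t ht h0 => ht ?_)
    simp [h0]
  rw [integral_finsetSum _ fun j _ => hinteg j]
  refine (Finset.sum_le_card_nsmul _ _ (π ^ 2 * stepEnergy / d * ℓ ^ 2) fun j _ => ?_).trans_eq
    (by simp)
  have h : ∀ x : R3, fderiv ℝ (boxCut ℓ d) x (EuclideanSpace.single j 1) ^ 2 =
      ∏ i, (fun t => (if i = j then deriv (cut ℓ d) else cut ℓ d) t ^ 2) (x i) := fun x => by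
    rw [fderiv_boxCut, Finset.prod_pow]
  simp only [h]
  rw [integral_prod_coord (fun i t => (if i = j then deriv (cut ℓ d) else cut ℓ d) t ^ 2),
    ← Finset.mul_prod_erase Finset.univ _ (Finset.mem_univ j), if_pos rfl]
  have h3 : ∏ i ∈ Finset.univ.erase j, ∫ t, (if i = j then deriv (cut ℓ d) else cut ℓ d) t ^ 2 =
      ℓ ^ 2 := by
    rw [Finset.prod_congr rfl (g := fun _ => ℓ) fun i hi => by
      rw [if_neg (Finset.ne_of_mem_erase hi), integral_cut_sq hd hdl]]
    simp
  rw [h3]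
  exact mul_le_mul_of_nonneg_right (integral_deriv_cut_sq_le ℓ hd) (by positivity)

/-- The kinetic energy density of the cutoff relative to its square. -/
def boxKinetic (ℓ d : ℝ) (x : R3) : ℝ := realGradSq (boxCut ℓ d) x / boxCut ℓ d x ^ 2

theorem realGradSq_nonneg (f : R3 → ℝ) (x : R3) : 0 ≤ realGradSq f x :=
  Finset.sum_nonneg fun _ _ => sq_nonneg _

theorem continuous_realGradSq {f : R3 → ℝ} (hf : ContDiff ℝ (⊤ : ℕ∞) f) :
    Continuous (realGradSq f) :=
  continuous_finsetSum _ fun j _ => ((hf.continuous_fderiv (by simp)).clm_apply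
    continuous_const).pow 2

theorem boxKinetic_nonneg (ℓ d : ℝ) (x : R3) : 0 ≤ boxKinetic ℓ d x :=
  div_nonneg (realGradSq_nonneg _ _) (sq_nonneg _)

theorem boxKinetic_smul_le {ℓ : ℝ} (hl : 0 < ℓ) (d : ℝ) (x : R3) :
    (boxCut ℓ d x ^ 2 / ℓ ^ 3) • boxKinetic ℓ d x ≤ realGradSq (boxCut ℓ d) x / ℓ ^ 3 := by
  rw [boxKinetic, smul_eq_mul]
  rcases eq_or_ne (boxCut ℓ d x) 0 with h | h
  · rw [h]
    simp
    exact div_nonneg (realGradSq_nonneg _ _) (by positivity)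
  · apply le_of_eq
    field_simp

theorem measurable_boxKinetic (ℓ d : ℝ) : Measurable (boxKinetic ℓ d) :=
  (continuous_realGradSq (contDiff_boxCut ℓ d)).measurable.div
    ((measurable_boxCut ℓ d).pow_const 2)

theorem integrable_boxKinetic {ℓ d : ℝ} (hd : 0 < d) (hdl : d ≤ ℓ) :
    Integrable (boxKinetic ℓ d) (boxMeasure ℓ d) := by
  have hl : 0 < ℓ := hd.trans_le hdl
  rw [integrable_boxMeasure_iff hl]
  refine ((integrable_realGradSq (contDiff_boxCut ℓ d)
    (hasCompactSupport_boxCut hd)).div_const (ℓ ^ 3)).mono'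
    (((measurable_boxCut ℓ d).pow_const 2).div_const _ |>.smul
      (measurable_boxKinetic ℓ d)).aestronglyMeasurable (Filter.Eventually.of_forall fun x => ?_)
  rw [Real.norm_of_nonneg (smul_nonneg (by positivity) (boxKinetic_nonneg ℓ d x))]
  exact boxKinetic_smul_le hl d x

theorem integral_boxKinetic_le {ℓ d : ℝ} (hd : 0 < d) (hdl : d ≤ ℓ) :
    ∫ x, boxKinetic ℓ d x ∂boxMeasure ℓ d ≤ 3 * π ^ 2 * stepEnergy / (d * ℓ) := by
  have hl : 0 < ℓ := hd.trans_le hdl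
  rw [integral_boxMeasure hl]
  calc _ ≤ ∫ x, realGradSq (boxCut ℓ d) x / ℓ ^ 3 :=
        integral_mono_of_nonneg (Filter.Eventually.of_forall fun x =>
          mul_nonneg (by positivity) (boxKinetic_nonneg ℓ d x))
          ((integrable_realGradSq (contDiff_boxCut ℓ d) (hasCompactSupport_boxCut hd)).div_const _)
          (Filter.Eventually.of_forall fun x => boxKinetic_smul_le hl d x)
    _ ≤ 3 * (π ^ 2 * stepEnergy / d * ℓ ^ 2) / ℓ ^ 3 := by
        rw [integral_div]
        gcongr
        exact integral_realGradSq_boxCut_le hd hdl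
    _ = _ := by field_simp

theorem exch_planeWave (ℓ : ℝ) {K : Finset (Fin 3 → ℤ)} (k l : K) (z : R3 × R3) :
    exch (fun (k : K) => planeWave ℓ k.1) k l z =
      cos (2 * π / ℓ * ∑ j, ((l.1 j : ℝ) - k.1 j) * (z.1 j - z.2 j)) := by
  unfold exch planeWave
  simp only
  rw [← Complex.exp_conj, ← Complex.exp_conj, ← Complex.exp_add, ← Complex.exp_add,
    ← Complex.exp_add, ← Complex.exp_ofReal_mul_I_re]
  congr 2
  simp only [map_mul, Complex.conj_ofReal, Complex.conj_I, Fin.sum_univ_three]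
  push_cast
  ring

theorem one_sub_exch_planeWave_le {ℓ R : ℝ} (hl : 0 < ℓ) {K : Finset (Fin 3 → ℤ)}
    (hK : ∀ k ∈ K, ∑ j, (k j : ℝ) ^ 2 ≤ R ^ 2) (k l : K) (z : R3 × R3) :
    1 - exch (fun (k : K) => planeWave ℓ k.1) k l z ≤ 2 * (2 * π * R / ℓ) ^ 2 * ‖z.1 - z.2‖ ^ 2 := by
  rw [exch_planeWave]
  have h1 := Real.one_sub_sq_div_two_le_cos
    (x := 2 * π / ℓ * ∑ j, ((l.1 j : ℝ) - k.1 j) * (z.1 j - z.2 j))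
  have h2 : (∑ j, ((l.1 j : ℝ) - k.1 j) * (z.1 j - z.2 j)) ^ 2 ≤
      (∑ j, ((l.1 j : ℝ) - k.1 j) ^ 2) * ∑ j, (z.1 j - z.2 j) ^ 2 :=
    Finset.sum_mul_sq_le_sq_mul_sq _ _ _
  have h3 : ∑ j, ((l.1 j : ℝ) - k.1 j) ^ 2 ≤ 4 * R ^ 2 := by
    have hk := hK k.1 k.2
    have hl := hK l.1 l.2
    calc ∑ j, ((l.1 j : ℝ) - k.1 j) ^ 2 ≤ ∑ j, (2 * (l.1 j : ℝ) ^ 2 + 2 * (k.1 j : ℝ) ^ 2) :=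
          Finset.sum_le_sum fun j _ => by nlinarith [sq_nonneg ((l.1 j : ℝ) + k.1 j)]
      _ ≤ _ := by
          rw [Finset.sum_add_distrib, ← Finset.mul_sum, ← Finset.mul_sum]
          linarith
  have h4 : ∑ j, (z.1 j - z.2 j) ^ 2 = ‖z.1 - z.2‖ ^ 2 := by
    rw [EuclideanSpace.norm_sq_eq]
    simp
  rw [h4] at h2
  have h5 : (2 * π / ℓ * ∑ j, ((l.1 j : ℝ) - k.1 j) * (z.1 j - z.2 j)) ^ 2 ≤
      (2 * π / ℓ) ^ 2 * (4 * R ^ 2 * ‖z.1 - z.2‖ ^ 2) := by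
    rw [mul_pow]
    refine mul_le_mul_of_nonneg_left (h2.trans ?_) (by positivity)
    exact mul_le_mul_of_nonneg_right h3 (by positivity)
  have h6 : 2 * (2 * π * R / ℓ) ^ 2 * ‖z.1 - z.2‖ ^ 2 =
      (2 * π / ℓ) ^ 2 * (4 * R ^ 2 * ‖z.1 - z.2‖ ^ 2) / 2 := by
    ring
  rw [h6]
  linarith

theorem selfInteraction_boxMeasure_le {ℓ d : ℝ} (hd : 0 < d) (hdl : d ≤ ℓ) {v : R3 → ℝ}
    {R0 c : ℝ} (hm : Measurable v) (hv : ∀ x, 0 ≤ v x) (hb : ∃ C, ∀ x, v x ≤ C)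
    (hs : ∀ x, R0 < ‖x‖ → v x = 0) (hi : Integrable v) (hR : 0 ≤ R0) (hc : 0 ≤ c) :
    Integrable (fun z : R3 × R3 => v (z.1 - z.2) * (c * ‖z.1 - z.2‖ ^ 2))
      ((boxMeasure ℓ d).prod (boxMeasure ℓ d)) ∧
    ∫ z : R3 × R3, v (z.1 - z.2) * (c * ‖z.1 - z.2‖ ^ 2)
      ∂((boxMeasure ℓ d).prod (boxMeasure ℓ d)) ≤ c * R0 ^ 2 * (∫ x, v x) / ℓ ^ 3 := by
  have hl : 0 < ℓ := hd.trans_le hdl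
  have := isProbabilityMeasure_boxMeasure hd hdl
  obtain ⟨C, hC⟩ := hb
  have hle : ∀ x : R3, v x * (c * ‖x‖ ^ 2) ≤ c * R0 ^ 2 * v x := fun x => by
    rcases lt_or_ge R0 ‖x‖ with h | h
    · simp [hs x h]
    · have : ‖x‖ ^ 2 ≤ R0 ^ 2 := by gcongr
      nlinarith [mul_nonneg (mul_nonneg hc (hv x)) (sub_nonneg.2 this)]
  have h0 : ∀ x : R3, 0 ≤ v x * (c * ‖x‖ ^ 2) := fun x => mul_nonneg (hv x) (by positivity)
  have hmeas : Measurable fun z : R3 × R3 => v (z.1 - z.2) * (c * ‖z.1 - z.2‖ ^ 2) :=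
    (hm.comp (measurable_fst.sub measurable_snd)).mul
      (((measurable_fst.sub measurable_snd).norm.pow_const 2).const_mul c)
  have hinteg : Integrable (fun z : R3 × R3 => v (z.1 - z.2) * (c * ‖z.1 - z.2‖ ^ 2))
      ((boxMeasure ℓ d).prod (boxMeasure ℓ d)) := by
    refine Integrable.of_bound hmeas.aestronglyMeasurable (c * R0 ^ 2 * C)
      (Filter.Eventually.of_forall fun z => ?_)
    rw [Real.norm_of_nonneg (h0 _)]
    exact (hle _).trans (mul_le_mul_of_nonneg_left (hC _) (by positivity))
  refine ⟨hinteg, ?_⟩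
  have hmv : Measurable fun z : R3 × R3 => v (z.1 - z.2) := hm.comp (measurable_fst.sub measurable_snd)
  have hint2 : Integrable (fun z : R3 × R3 => c * R0 ^ 2 * v (z.1 - z.2))
      ((boxMeasure ℓ d).prod (boxMeasure ℓ d)) := by
    refine (Integrable.of_bound hmv.aestronglyMeasurable C
      (Filter.Eventually.of_forall fun z => ?_)).const_mul _
    rw [Real.norm_of_nonneg (hv _)]
    exact hC _
  refine (integral_mono hinteg hint2 fun z => hle (z.1 - z.2)).trans ?_
  rw [integral_prod_symm _ hint2]
  have hb : ∀ y : R3, ∫ x, c * R0 ^ 2 * v (x - y) ∂boxMeasure ℓ d ≤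
      c * R0 ^ 2 * (∫ x, v x) / ℓ ^ 3 := fun y => by
    rw [integral_const_mul, mul_div_assoc]
    refine mul_le_mul_of_nonneg_left ?_ (by positivity)
    refine (integral_boxMeasure_le hl d (fun x => hv _) (hi.comp_sub_right y)).trans_eq ?_
    rw [integral_sub_right_eq_self v y]
  refine (integral_mono_of_nonneg (Filter.Eventually.of_forall fun y =>
    integral_nonneg fun x => mul_nonneg (by positivity) (hv _)) (integrable_const _)
    (Filter.Eventually.of_forall hb)).trans_eq ?_
  simp

end BoxMeasure

section Mollify
open scoped Convolution ContDiff

theorem exists_smooth_approx {g : R3 → ℝ} (hg : ContDiff ℝ 1 g) {R : ℝ}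
    (hR : ∀ x, R ≤ ‖x‖ → g x = 0) (hg0 : ∀ x, 0 ≤ g x) {δ : ℝ} (hδ : 0 < δ) :
    ∃ g' : R3 → ℝ, ContDiff ℝ (⊤ : ℕ∞) g' ∧ (∀ x, R + 1 ≤ ‖x‖ → g' x = 0) ∧ (∀ x, 0 ≤ g' x) ∧
      (∀ x, |g' x - g x| ≤ δ) ∧
      ∀ x, ‖fderiv ℝ g' x - fderiv ℝ g x‖ ≤ (Metric.closedBall 0 (R + 1)).indicator (fun _ => δ) x := by
  have hs : HasCompactSupport g := by
    refine HasCompactSupport.intro (isCompact_closedBall 0 R) fun x hx => hR x ?_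
    simp only [Metric.mem_closedBall, dist_zero_right, not_le] at hx
    exact hx.le
  have hgc := hg.continuous
  have hg'c : Continuous (fderiv ℝ g) := hg.continuous_fderiv (by simp)
  obtain ⟨r₁, hr₁, h₁⟩ := Metric.uniformContinuous_iff.1
    (hs.uniformContinuous_of_continuous hgc) δ hδ
  obtain ⟨r₂, hr₂, h₂⟩ := Metric.uniformContinuous_iff.1
    ((hs.fderiv ℝ).uniformContinuous_of_continuous hg'c) δ hδ
  set r := min 1 (min r₁ r₂) with hr
  have hrpos : 0 < r := lt_min one_pos (lt_min hr₁ hr₂)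
  let χ : ContDiffBump (0 : R3) := ⟨r / 2, r, half_pos hrpos, half_lt_self hrpos⟩
  set g' : R3 → ℝ := χ.normed volume ⋆[ContinuousLinearMap.lsmul ℝ ℝ, volume] g with hg'
  have hχi : LocallyIntegrable (χ.normed volume : R3 → ℝ) volume :=
    χ.integrable_normed.locallyIntegrable
  have hg's : ContDiff ℝ (⊤ : ℕ∞) g' :=
    χ.hasCompactSupport_normed.contDiff_convolution_left _ χ.contDiff_normed hgc.locallyIntegrable
  have hder : ∀ x, fderiv ℝ g' x =
      (χ.normed volume ⋆[ContinuousLinearMap.lsmul ℝ ℝ, volume] fderiv ℝ g) x := fun x => by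
    rw [(hs.hasFDerivAt_convolution_right (ContinuousLinearMap.lsmul ℝ ℝ) hχi hg x).fderiv]
    rfl
  have hzero : ∀ x, R + 1 ≤ ‖x‖ → g' x = 0 := fun x hx => by
    rw [hg', convolution_def]
    refine integral_eq_zero_of_ae (Filter.Eventually.of_forall fun t => ?_)
    simp only [ContinuousLinearMap.lsmul_apply, smul_eq_mul, Pi.zero_apply, mul_eq_zero]
    by_cases ht : t ∈ Metric.ball (0 : R3) χ.rOut
    · right
      have h1 : ‖t‖ < r := by simpa using ht
      have h2 := norm_sub_norm_le x t
      have h3 : r ≤ 1 := min_le_left _ _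
      exact hR _ (by linarith)
    · left
      rw [← χ.support_normed_eq (μ := volume)] at ht
      exact Function.notMem_support.1 ht
  refine ⟨g', hg's, hzero, fun x => ?_, fun x => ?_, fun x => ?_⟩
  · rw [hg', convolution_def]
    exact integral_nonneg fun t => mul_nonneg (χ.nonneg_normed t) (hg0 _)
  · rw [← Real.dist_eq]
    refine ContDiffBump.dist_normed_convolution_le hgc.aestronglyMeasurable fun y hy => ?_
    exact (h₁ (lt_of_lt_of_le hy ((min_le_right _ _).trans (min_le_left _ _)))).le
  · by_cases hx : x ∈ Metric.closedBall (0 : R3) (R + 1)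
    · rw [Set.indicator_of_mem hx, hder, ← dist_eq_norm]
      refine ContDiffBump.dist_normed_convolution_le hg'c.aestronglyMeasurable fun y hy => ?_
      exact (h₂ (lt_of_lt_of_le hy ((min_le_right _ _).trans (min_le_right _ _)))).le
    · rw [Set.indicator_of_notMem hx]
      simp only [Metric.mem_closedBall, dist_zero_right, not_le] at hx
      have hn : {y : R3 | R + 1 < ‖y‖} ∈ nhds x :=
        (isOpen_lt continuous_const continuous_norm).mem_nhds hx
      have e1 : g' =ᶠ[nhds x] fun _ => 0 := Filter.eventually_of_mem hn fun y hy =>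
        hzero y (le_of_lt hy)
      have e2 : g =ᶠ[nhds x] fun _ => 0 := Filter.eventually_of_mem hn fun y hy =>
        hR y (by linarith [show R + 1 < ‖y‖ from hy])
      rw [e1.fderiv_eq, e2.fderiv_eq]
      simp

theorem realGradSq_eq_norm_sq (f : R3 → ℝ) (x : R3) : realGradSq f x = ‖gradient f x‖ ^ 2 := by
  rw [EuclideanSpace.norm_sq_eq, realGradSq]
  refine Finset.sum_congr rfl fun j _ => ?_
  rw [← inner_gradient_left, EuclideanSpace.inner_single_right]
  simp

theorem norm_gradient (f : R3 → ℝ) (x : R3) : ‖gradient f x‖ = ‖fderiv ℝ f x‖ :=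
  ((InnerProductSpace.toDual ℝ R3).symm.norm_map _)

theorem gradient_sub_eq (f g : R3 → ℝ) (x : R3) :
    ‖gradient f x - gradient g x‖ = ‖fderiv ℝ f x - fderiv ℝ g x‖ := by
  rw [gradient, gradient, ← map_sub]
  exact ((InnerProductSpace.toDual ℝ R3).symm.norm_map _)

end Mollify

section RadialCutoff

/-- A smooth radial cutoff, equal to `1` on the ball of radius `b` and to `0` outside the ball of
radius `2 * b`. -/
def radCut (b : ℝ) (x : R3) : ℝ := 1 - smoothTransition ((‖x‖ ^ 2 - b ^ 2) / b ^ 2)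

theorem contDiff_radCut (b : ℝ) : ContDiff ℝ (⊤ : ℕ∞) (radCut b) :=
  contDiff_const.sub ((smoothTransition.contDiff (n := ⊤)).comp
    (((contDiff_norm_sq ℝ).sub contDiff_const).div_const _))

theorem radCut_nonneg (b : ℝ) (x : R3) : 0 ≤ radCut b x := sub_nonneg.2 (smoothTransition.le_one _)

theorem radCut_le_one (b : ℝ) (x : R3) : radCut b x ≤ 1 := by
  have := smoothTransition.nonneg ((‖x‖ ^ 2 - b ^ 2) / b ^ 2)
  unfold radCut
  linarith

theorem radCut_eq_one {b : ℝ} {x : R3} (h : ‖x‖ ≤ b) : radCut b x = 1 := by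
  have : ‖x‖ ^ 2 ≤ b ^ 2 := by gcongr
  rw [radCut, smoothTransition.zero_of_nonpos
    (div_nonpos_of_nonpos_of_nonneg (by linarith) (sq_nonneg b)), sub_zero]

theorem radCut_eq_zero {b : ℝ} (hb : 0 < b) {x : R3} (h : 2 * b ≤ ‖x‖) : radCut b x = 0 := by
  have : (2 * b) ^ 2 ≤ ‖x‖ ^ 2 := by gcongr
  rw [radCut, smoothTransition.one_of_one_le, sub_self]
  rw [one_le_div (by positivity)]
  nlinarith [sq_nonneg b]

theorem hasCompactSupport_radCut {b : ℝ} (hb : 0 < b) : HasCompactSupport (radCut b) := by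
  refine HasCompactSupport.intro (isCompact_closedBall 0 (2 * b)) fun x hx => radCut_eq_zero hb ?_
  simp only [Metric.mem_closedBall, dist_zero_right, not_le] at hx
  exact hx.le

theorem deriv_smoothTransition_nonneg (t : ℝ) : 0 ≤ deriv smoothTransition t :=
  smoothTransition.monotone.deriv_nonneg

theorem deriv_smoothTransition_of_neg {t : ℝ} (ht : t < 0) : deriv smoothTransition t = 0 := by
  have : smoothTransition =ᶠ[nhds t] fun _ => 0 :=
    Filter.eventually_of_mem (Iio_mem_nhds ht) fun s hs =>
      smoothTransition.zero_of_nonpos (le_of_lt hs)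
  rw [this.deriv_eq]
  simp

theorem continuous_deriv_smoothTransition : Continuous (deriv smoothTransition) :=
  (smoothTransition.contDiff (n := 1)).continuous_deriv (by norm_num)

theorem gradient_radCut (b : ℝ) (x : R3) : gradient (radCut b) x =
    -(2 * deriv smoothTransition ((‖x‖ ^ 2 - b ^ 2) / b ^ 2) / b ^ 2) • x := by
  refine HasGradientAt.gradient ?_
  rw [hasGradientAt_iff_hasFDerivAt]
  have h1 : HasFDerivAt (fun x : R3 => (‖x‖ ^ 2 - b ^ 2) / b ^ 2)
      ((b ^ 2)⁻¹ • (2 • (innerSL ℝ x))) x := by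
    have h := ((hasStrictFDerivAt_norm_sq x).hasFDerivAt.sub_const (b ^ 2)).const_mul ((b ^ 2)⁻¹)
    simpa [div_eq_inv_mul] using h
  have h2 := (((smoothTransition.contDiff (n := 1)).differentiable (by norm_num)
    ((‖x‖ ^ 2 - b ^ 2) / b ^ 2)).hasDerivAt).comp_hasFDerivAt
      (f := fun x : R3 => (‖x‖ ^ 2 - b ^ 2) / b ^ 2) x h1
  refine (h2.const_sub 1).congr_fderiv ?_
  ext y
  simp only [neg_apply, smul_apply, innerSL_apply_apply, InnerProductSpace.toDual_apply_apply,
    inner_smul_left, smul_eq_mul, map_neg, neg_smul, inner_neg_left, conj_trivial, nsmul_eq_mul]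
  push_cast
  ring

theorem exists_norm_gradient_radCut_le : ∃ C : ℝ, 0 ≤ C ∧ ∀ b : ℝ, 0 < b → ∀ x : R3,
    ‖gradient (radCut b) x‖ ≤ C / b := by
  obtain ⟨C, hC⟩ := continuous_deriv_smoothTransition.bounded_above_of_compact_support
    hasCompactSupport_deriv_smoothTransition
  have hC0 : 0 ≤ C := (norm_nonneg _).trans (hC 0)
  refine ⟨4 * C, by positivity, fun b hb x => ?_⟩
  rcases le_or_gt ‖x‖ (2 * b) with h | h
  · rw [gradient_radCut, norm_smul, norm_neg, norm_div, norm_mul]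
    have h1 := hC ((‖x‖ ^ 2 - b ^ 2) / b ^ 2)
    rw [Real.norm_of_nonneg (zero_le_two), Real.norm_of_nonneg (sq_nonneg b)]
    calc 2 * ‖deriv smoothTransition ((‖x‖ ^ 2 - b ^ 2) / b ^ 2)‖ / b ^ 2 * ‖x‖
        ≤ 2 * C / b ^ 2 * (2 * b) := by gcongr
      _ = _ := by field_simp; ring
  · have : radCut b =ᶠ[nhds x] fun _ => 0 :=
      Filter.eventually_of_mem ((isOpen_lt continuous_const continuous_norm).mem_nhds h)
        fun y hy => radCut_eq_zero hb (le_of_lt hy)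
    rw [norm_gradient, this.fderiv_eq]
    simp
    positivity

theorem volume_real_ball_one : (volume : Measure R3).real (Metric.ball 0 1) = π * 4 / 3 := by
  rw [measureReal_def, EuclideanSpace.volume_ball_fin_three]
  simp [ENNReal.toReal_ofReal (by positivity : 0 ≤ π * 4 / 3)]

/-- The flux of a Coulomb field through the cutoff. -/
theorem integral_radial_flux {b : ℝ} (hb : 0 < b) (a : ℝ) :
    ∫ x : R3, a * (2 * deriv smoothTransition ((‖x‖ ^ 2 - b ^ 2) / b ^ 2) / b ^ 2) / ‖x‖ =
      4 * π * a := by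
  rw [integral_fun_norm_addHaar volume
    (fun r : ℝ => a * (2 * deriv smoothTransition ((r ^ 2 - b ^ 2) / b ^ 2) / b ^ 2) / r)]
  have hder : ∀ r : ℝ, HasDerivAt (fun r : ℝ => a * smoothTransition ((r ^ 2 - b ^ 2) / b ^ 2))
      (a * (deriv smoothTransition ((r ^ 2 - b ^ 2) / b ^ 2) * (2 * r / b ^ 2))) r := fun r => by
    have h1 : HasDerivAt (fun r : ℝ => (r ^ 2 - b ^ 2) / b ^ 2) (2 * r / b ^ 2) r := by
      simpa using ((hasDerivAt_pow 2 r).sub_const (b ^ 2)).div_const (b ^ 2)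
    exact (HasDerivAt.comp (h := fun r : ℝ => (r ^ 2 - b ^ 2) / b ^ 2) r
      (((smoothTransition.contDiff (n := 1)).differentiable (by norm_num) _).hasDerivAt)
      h1).const_mul a
  have hI : IntegrableOn (fun r : ℝ => a * (deriv smoothTransition ((r ^ 2 - b ^ 2) / b ^ 2) *
      (2 * r / b ^ 2))) (Set.Ioi 0) := by
    refine Integrable.integrableOn (Continuous.integrable_of_hasCompactSupport ?_ ?_)
    · have := continuous_deriv_smoothTransition.comp
        (show Continuous fun r : ℝ => (r ^ 2 - b ^ 2) / b ^ 2 by fun_prop)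
      exact continuous_const.mul (this.mul (by fun_prop))
    · refine HasCompactSupport.intro (isCompact_Icc (a := -(2 * b)) (b := 2 * b)) fun r hr => ?_
      have h1 : (2 * b) ^ 2 < r ^ 2 := by
        by_contra! h
        exact hr (abs_le.1 ((sq_le_sq₀ (abs_nonneg r) (by positivity)).1 (by rwa [sq_abs])))
      have h2 : 1 < (r ^ 2 - b ^ 2) / b ^ 2 := by
        rw [one_lt_div (by positivity)]
        nlinarith [sq_pos_of_pos hb]
      have : smoothTransition =ᶠ[nhds ((r ^ 2 - b ^ 2) / b ^ 2)] fun _ => 1 :=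
        Filter.eventually_of_mem (Ioi_mem_nhds h2) fun s hs =>
          smoothTransition.one_of_one_le (le_of_lt hs)
      rw [this.deriv_eq]
      simp
  have hlim : Tendsto (fun r : ℝ => a * smoothTransition ((r ^ 2 - b ^ 2) / b ^ 2)) atTop
      (nhds a) := by
    refine tendsto_const_nhds.congr' ?_
    filter_upwards [eventually_ge_atTop (2 * b)] with r hr
    have : (2 * b) ^ 2 ≤ r ^ 2 := by gcongr
    rw [smoothTransition.one_of_one_le, mul_one]
    rw [one_le_div (by positivity)]
    nlinarith [sq_nonneg b]
  have hFTC := integral_Ioi_of_hasDerivAt_of_tendsto' (fun r _ => hder r) hI hlim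
  have hcongr : ∫ y in Set.Ioi (0 : ℝ), y ^ (Module.finrank ℝ R3 - 1) •
      (a * (2 * deriv smoothTransition ((y ^ 2 - b ^ 2) / b ^ 2) / b ^ 2) / y) =
      ∫ r in Set.Ioi (0 : ℝ), a * (deriv smoothTransition ((r ^ 2 - b ^ 2) / b ^ 2) *
      (2 * r / b ^ 2)) := by
    refine setIntegral_congr_fun measurableSet_Ioi fun y hy => ?_
    have hy0 : y ≠ 0 := ne_of_gt hy
    simp only [finrank_euclideanSpace, Fintype.card_fin, smul_eq_mul]
    rw [show 3 - 1 = 2 from rfl]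
    field_simp
  rw [hcongr, hFTC, volume_real_ball_one, smoothTransition.zero_of_nonpos]
  · simp
    ring
  · refine div_nonpos_of_nonpos_of_nonneg ?_ (sq_nonneg b)
    nlinarith [sq_nonneg b]

end RadialCutoff

section Scattering

/-- A potential together with its zero-energy scattering solution. -/
structure Scattering (v φ : R3 → ℝ) (R0 a : ℝ) : Prop where
  R0_pos : 0 < R0
  v_meas : Measurable v
  v_nonneg : ∀ x, 0 ≤ v x
  v_bdd : ∃ C, ∀ x, v x ≤ C
  v_radial : ∀ x y : R3, ‖x‖ = ‖y‖ → v x = v y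
  v_supp : ∀ x : R3, R0 < ‖x‖ → v x = 0
  φ_C1 : ContDiff ℝ 1 φ
  φ_nonneg : ∀ x, 0 ≤ φ x
  φ_le_one : ∀ x, φ x ≤ 1
  φ_eq : ∀ x : R3, R0 ≤ ‖x‖ → φ x = 1 - a / ‖x‖
  weak : ∀ g : R3 → ℝ, ContDiff ℝ (⊤ : ℕ∞) g → HasCompactSupport g →
      (∫ x : R3, ⟪gradient φ x, gradient g x⟫) + (1/2) * ∫ x : R3, v x * φ x * g x = 0

theorem continuous_gradient {f : R3 → ℝ} (hf : ContDiff ℝ 1 f) : Continuous (gradient f) :=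
  (InnerProductSpace.toDual ℝ R3).symm.continuous.comp (hf.continuous_fderiv (by simp))

theorem hasCompactSupport_of_norm {F : Type*} [Zero F] {g : R3 → F} {R : ℝ}
    (hR : ∀ x, R ≤ ‖x‖ → g x = 0) : HasCompactSupport g := by
  refine HasCompactSupport.intro (isCompact_closedBall 0 R) fun x hx => hR x ?_
  simp only [Metric.mem_closedBall, dist_zero_right, not_le] at hx
  exact hx.le

theorem hasCompactSupport_gradient {f : R3 → ℝ} (hf : HasCompactSupport f) :
    HasCompactSupport (gradient f) :=
  (hf.fderiv ℝ).mono fun t ht h0 => ht (by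
    have := norm_gradient f t
    rw [h0, norm_zero, norm_eq_zero] at this
    exact this)

variable {v φ : R3 → ℝ} {R0 a : ℝ}

theorem Scattering.integrable_v (S : Scattering v φ R0 a) : Integrable v := by
  obtain ⟨C, hC⟩ := S.v_bdd
  have hC0 : 0 ≤ C := (S.v_nonneg 0).trans (hC 0)
  have hi : Integrable ((Metric.closedBall (0 : R3) R0).indicator fun _ => C) :=
    (integrable_indicator_iff measurableSet_closedBall).2
      (integrableOn_const measure_closedBall_lt_top.ne)
  refine hi.mono' S.v_meas.aestronglyMeasurable (Filter.Eventually.of_forall fun x => ?_)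
  rw [Real.norm_of_nonneg (S.v_nonneg x)]
  by_cases hx : x ∈ Metric.closedBall (0 : R3) R0
  · rw [Set.indicator_of_mem hx]
    exact hC x
  · rw [Set.indicator_of_notMem hx, S.v_supp x]
    simpa using hx

theorem Scattering.integrable_v_mul (S : Scattering v φ R0 a) {h : R3 → ℝ} (hm : Measurable h)
    {C : ℝ} (hC : ∀ x, |h x| ≤ C) : Integrable fun x => v x * h x :=
  S.integrable_v.mul_bdd (c := C) hm.aestronglyMeasurable (Filter.Eventually.of_forall hC)

theorem Scattering.a_nonneg (S : Scattering v φ R0 a) : 0 ≤ a := by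
  have hR := S.R0_pos
  have hn : ‖(EuclideanSpace.single 0 R0 : R3)‖ = R0 := by
    rw [PiLp.norm_single, Real.norm_of_nonneg hR.le]
  have h := S.φ_eq (EuclideanSpace.single 0 R0) hn.ge
  have h1 := S.φ_le_one (EuclideanSpace.single 0 R0)
  rw [h, hn] at h1
  have : 0 ≤ a / R0 := by linarith
  rwa [le_div_iff₀ hR, zero_mul] at this

theorem Scattering.weak_C1 (S : Scattering v φ R0 a) {g : R3 → ℝ} (hg : ContDiff ℝ 1 g) {R : ℝ}
    (hR : ∀ x, R ≤ ‖x‖ → g x = 0) (hg0 : ∀ x, 0 ≤ g x) :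
    (∫ x : R3, ⟪gradient φ x, gradient g x⟫) + (1 / 2) * ∫ x : R3, v x * φ x * g x = 0 := by
  set C := (∫ x in Metric.closedBall (0 : R3) (R + 1), ‖gradient φ x‖) + (1 / 2) * ∫ x, v x with hC
  have hφg := continuous_gradient S.φ_C1
  have hgi : ∀ h : R3 → ℝ, ContDiff ℝ 1 h → HasCompactSupport h →
      Integrable fun x => ⟪gradient φ x, gradient h x⟫ := fun h hh hs =>
    (hφg.inner (continuous_gradient hh)).integrable_of_hasCompactSupport
      ((hasCompactSupport_gradient hs).mono fun t ht h0 => ht (by simp [h0]))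
  have hvi : ∀ h : R3 → ℝ, ContDiff ℝ 1 h → HasCompactSupport h →
      Integrable fun x => v x * φ x * h x := fun h hh hs => by
    obtain ⟨K, hK⟩ := hh.continuous.bounded_above_of_compact_support hs
    simp_rw [mul_assoc]
    refine S.integrable_v_mul (S.φ_C1.continuous.mul hh.continuous).measurable (C := K) fun x => ?_
    rw [abs_mul, abs_of_nonneg (S.φ_nonneg x)]
    exact (mul_le_of_le_one_left (abs_nonneg _) (S.φ_le_one x)).trans (hK x)
  have key : ∀ δ > 0, |(∫ x : R3, ⟪gradient φ x, gradient g x⟫) +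
      (1 / 2) * ∫ x : R3, v x * φ x * g x| ≤ δ * C := fun δ hδ => by
    obtain ⟨g', hg', hz, -, hd, hdd⟩ := exists_smooth_approx hg hR hg0 hδ
    have hgs : HasCompactSupport g := hasCompactSupport_of_norm hR
    have hgs' : HasCompactSupport g' := hasCompactSupport_of_norm hz
    have hg'1 : ContDiff ℝ 1 g' := hg'.of_le (by simp)
    have hw := S.weak g' hg' hgs'
    have e1 : |(∫ x : R3, ⟪gradient φ x, gradient g x⟫) - ∫ x : R3, ⟪gradient φ x, gradient g' x⟫| ≤
        δ * ∫ x in Metric.closedBall (0 : R3) (R + 1), ‖gradient φ x‖ := by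
      rw [← integral_sub (hgi g hg hgs) (hgi g' hg'1 hgs'), ← integral_const_mul,
        ← integral_indicator measurableSet_closedBall, ← Real.norm_eq_abs]
      refine norm_integral_le_of_norm_le ?_ (Filter.Eventually.of_forall fun x => ?_)
      · rw [integrable_indicator_iff measurableSet_closedBall]
        exact (continuous_const.mul hφg.norm).continuousOn.integrableOn_compact
          (isCompact_closedBall _ _)
      · rw [← inner_sub_right]
        refine (norm_inner_le_norm _ _).trans ?_
        have := hdd x
        rw [← gradient_sub_eq, norm_sub_rev] at this
        by_cases hx : x ∈ Metric.closedBall (0 : R3) (R + 1)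
        · rw [Set.indicator_of_mem hx] at this ⊢
          rw [mul_comm]
          exact mul_le_mul_of_nonneg_right this (norm_nonneg _)
        · rw [Set.indicator_of_notMem hx] at this ⊢
          nlinarith [norm_nonneg (gradient φ x), norm_nonneg (gradient g x - gradient g' x)]
    have e2 : |(∫ x : R3, v x * φ x * g x) - ∫ x : R3, v x * φ x * g' x| ≤ δ * ∫ x, v x := by
      rw [← integral_sub (hvi g hg hgs) (hvi g' hg'1 hgs'), ← integral_const_mul,
        ← Real.norm_eq_abs]
      refine norm_integral_le_of_norm_le (S.integrable_v.const_mul _)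
        (Filter.Eventually.of_forall fun x => ?_)
      rw [← mul_sub, norm_mul, norm_mul, Real.norm_of_nonneg (S.v_nonneg x),
        Real.norm_of_nonneg (S.φ_nonneg x), Real.norm_eq_abs, abs_sub_comm, mul_comm δ]
      exact mul_le_mul (mul_le_of_le_one_right (S.v_nonneg x) (S.φ_le_one x)) (hd x)
        (abs_nonneg _) (S.v_nonneg x)
    rw [abs_le] at e1 e2 ⊢
    constructor <;> rw [hC] <;> nlinarith
  have hC0 : 0 ≤ C := add_nonneg (integral_nonneg fun x => norm_nonneg _)
    (mul_nonneg (by norm_num) (integral_nonneg S.v_nonneg))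
  refine abs_nonpos_iff.1 (le_of_forall_pos_le_add fun ε hε => ?_)
  refine (key (ε / (C + 1)) (by positivity)).trans ?_
  rw [zero_add, div_mul_eq_mul_div, div_le_iff₀ (by positivity)]
  nlinarith

theorem Scattering.fderiv_φ_self (S : Scattering v φ R0 a) {x : R3} (hx : R0 < ‖x‖) :
    ⟪gradient φ x, x⟫ = a / ‖x‖ := by
  rw [inner_gradient_left]
  have hx0 : 0 < ‖x‖ := S.R0_pos.trans hx
  have h1 : HasDerivAt (fun t : ℝ => φ (x + t • x)) (fderiv ℝ φ x x) 0 := by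
    have hφ : HasFDerivAt φ (fderiv ℝ φ x) (x + (0 : ℝ) • x) := by
      simpa using (S.φ_C1.differentiable (by simp) x).hasFDerivAt
    have hl : HasDerivAt (fun t : ℝ => x + t • x) x 0 := by
      simpa using ((hasDerivAt_id (0 : ℝ)).smul_const x).const_add x
    exact hφ.comp_hasDerivAt 0 hl
  have hf : HasDerivAt (fun t : ℝ => 1 - a / ‖x‖ * (1 + t)⁻¹) (a / ‖x‖) 0 := by
    have h3 : HasDerivAt (fun t : ℝ => (1 + t)⁻¹) (-1) 0 := by
      have := ((hasDerivAt_id (0 : ℝ)).const_add 1).fun_inv (by norm_num)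
      simpa using this
    simpa using (h3.const_mul (a / ‖x‖)).const_sub 1
  have hev : (fun t : ℝ => φ (x + t • x)) =ᶠ[nhds 0] fun t : ℝ => 1 - a / ‖x‖ * (1 + t)⁻¹ := by
    have hc : ContinuousAt (fun t : ℝ => ‖x + t • x‖) 0 := by fun_prop
    have h0 : R0 < ‖x + (0 : ℝ) • x‖ := by simpa using hx
    filter_upwards [hc.eventually (lt_mem_nhds h0), lt_mem_nhds (show (-1 : ℝ) < 0 by norm_num)]
      with t ht ht'
    rw [S.φ_eq _ ht.le]
    have : x + t • x = (1 + t) • x := by rw [add_smul, one_smul]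
    have h1t : 0 < 1 + t := by linarith
    rw [this, norm_smul, Real.norm_of_nonneg h1t.le]
    field_simp
  exact h1.unique (hf.congr_of_eventuallyEq hev)

theorem gradient_mul_eq {f g : R3 → ℝ} {x : R3} (hf : DifferentiableAt ℝ f x)
    (hg : DifferentiableAt ℝ g x) :
    gradient (fun y => f y * g y) x = f x • gradient g x + g x • gradient f x := by
  refine HasGradientAt.gradient ?_
  rw [hasGradientAt_iff_hasFDerivAt]
  refine (hf.hasFDerivAt.mul hg.hasFDerivAt).congr_fderiv ?_
  ext y
  simp [← inner_gradient_left, inner_add_left, inner_smul_left]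

theorem Scattering.inner_gradient_radCut (S : Scattering v φ R0 a) {b : ℝ} (hb : R0 < b) (x : R3) :
    -⟪gradient φ x, gradient (radCut b) x⟫ =
      a * (2 * deriv smoothTransition ((‖x‖ ^ 2 - b ^ 2) / b ^ 2) / b ^ 2) / ‖x‖ := by
  have hb0 : 0 < b := S.R0_pos.trans hb
  rw [gradient_radCut, inner_smul_right]
  rcases lt_or_ge ‖x‖ b with h | h
  · have : deriv smoothTransition ((‖x‖ ^ 2 - b ^ 2) / b ^ 2) = 0 := by
      refine deriv_smoothTransition_of_neg (div_neg_of_neg_of_pos ?_ (by positivity))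
      nlinarith [norm_nonneg x]
    simp [this]
  · rw [S.fderiv_φ_self (hb.trans_le h)]
    ring

theorem Scattering.localEnergy_le (S : Scattering v φ R0 a) {b : ℝ} (hb : R0 < b) :
    (∫ x, radCut b x * ‖gradient φ x‖ ^ 2) + (1 / 2) * ∫ x, v x * φ x ^ 2 ≤ 4 * π * a := by
  have hb0 : 0 < b := S.R0_pos.trans hb
  have hζ1 : ContDiff ℝ 1 (radCut b) := (contDiff_radCut b).of_le (by simp)
  have hw := S.weak_C1 (g := fun x => radCut b x * φ x) (hζ1.mul S.φ_C1) (R := 2 * b)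
    (fun x hx => by simp [radCut_eq_zero hb0 hx])
    (fun x => mul_nonneg (radCut_nonneg b x) (S.φ_nonneg x))
  have hg : ∀ x, ⟪gradient φ x, gradient (fun x => radCut b x * φ x) x⟫ =
      radCut b x * ‖gradient φ x‖ ^ 2 + φ x * ⟪gradient φ x, gradient (radCut b) x⟫ := fun x => by
    rw [gradient_mul_eq (hζ1.differentiable (by simp) x) (S.φ_C1.differentiable (by simp) x),
      inner_add_right, inner_smul_right, inner_smul_right, real_inner_self_eq_norm_sq]
  have hcφ := continuous_gradient S.φ_C1
  have hs := hasCompactSupport_radCut hb0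
  have hsupp2 : HasCompactSupport fun x => φ x * ⟪gradient φ x, gradient (radCut b) x⟫ :=
    (hasCompactSupport_gradient hs).mono fun t ht h0 => ht (by simp [h0])
  have i1 : Integrable fun x => radCut b x * ‖gradient φ x‖ ^ 2 :=
    (hζ1.continuous.mul (hcφ.norm.pow 2)).integrable_of_hasCompactSupport
      (hs.mono fun t ht h0 => ht (by simp [h0]))
  have i2 : Integrable fun x => φ x * ⟪gradient φ x, gradient (radCut b) x⟫ :=
    (S.φ_C1.continuous.mul (hcφ.inner (continuous_gradient hζ1))).integrable_of_hasCompactSupport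
      hsupp2
  simp only [hg] at hw
  rw [integral_add i1 i2] at hw
  have hv : ∀ x, v x * φ x * (radCut b x * φ x) = v x * φ x ^ 2 := fun x => by
    rcases le_or_gt ‖x‖ b with h | h
    · rw [radCut_eq_one h]
      ring
    · rw [S.v_supp x (hb.trans h)]
      ring
  simp only [hv] at hw
  have hflux : -∫ x, φ x * ⟪gradient φ x, gradient (radCut b) x⟫ ≤ 4 * π * a := by
    rw [← integral_radial_flux hb0 a, ← integral_neg]
    simp_rw [← S.inner_gradient_radCut hb]
    have h0 : ∀ x, 0 ≤ -⟪gradient φ x, gradient (radCut b) x⟫ := fun x => by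
      rw [S.inner_gradient_radCut hb]
      have := deriv_smoothTransition_nonneg ((‖x‖ ^ 2 - b ^ 2) / b ^ 2)
      have := S.a_nonneg
      positivity
    refine integral_mono i2.neg ?_ fun x => ?_
    · refine Integrable.neg ?_
      exact (hcφ.inner (continuous_gradient hζ1)).integrable_of_hasCompactSupport
        ((hasCompactSupport_gradient hs).mono fun t ht h0 => ht (by simp [h0]))
    · show -(φ x * _) ≤ _
      rw [← mul_neg]
      exact mul_le_of_le_one_left (h0 x) (S.φ_le_one x)
  linarith

end Scattering

section ScatteringTrial

variable {v φ : R3 → ℝ} {R0 a : ℝ}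

theorem Scattering.one_sub_φ_sq_mul_le (S : Scattering v φ R0 a) {b C : ℝ} (hb : R0 < b)
    (hC : ∀ x, ‖gradient (radCut b) x‖ ≤ C / b) (hC0 : 0 ≤ C) (x : R3) :
    (1 - φ x) ^ 2 * ‖gradient (radCut b) x‖ ^ 2 ≤
      (Metric.closedBall (0 : R3) (2 * b)).indicator (fun _ => (a / b) ^ 2 * (C / b) ^ 2) x := by
  have hb0 : 0 < b := S.R0_pos.trans hb
  by_cases hx : x ∈ Metric.closedBall (0 : R3) (2 * b)
  · rw [Set.indicator_of_mem hx]
    rcases lt_or_ge ‖x‖ b with h | h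
    · have : gradient (radCut b) x = 0 := by
        rw [gradient_radCut, deriv_smoothTransition_of_neg]
        · simp
        · refine div_neg_of_neg_of_pos ?_ (by positivity)
          nlinarith [norm_nonneg x]
      rw [this, norm_zero, zero_pow two_ne_zero, mul_zero]
      positivity
    · have hx0 : 0 < ‖x‖ := hb0.trans_le h
      rw [S.φ_eq x (hb.le.trans h)]
      have ha := S.a_nonneg
      have h1 : a / ‖x‖ ≤ a / b := div_le_div_of_nonneg_left ha hb0 h
      have h2 : 0 ≤ a / ‖x‖ := by positivity
      rw [sub_sub_cancel]
      gcongr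
      exact hC x
  · rw [Set.indicator_of_notMem hx]
    simp only [Metric.mem_closedBall, dist_zero_right, not_le] at hx
    have h0 : (fun y => radCut b y) =ᶠ[nhds x] fun _ => 0 := by
      filter_upwards [continuous_norm.continuousAt.eventually (lt_mem_nhds hx)] with y hy
      exact radCut_eq_zero hb0 hy.le
    have : gradient (radCut b) x = 0 := by
      rw [← norm_eq_zero, norm_gradient, h0.fderiv_eq]
      simp
    simp [this]

theorem norm_add_sq_le_weighted {E : Type*} [NormedAddCommGroup E] (x y : E) {η : ℝ} (hη : 0 < η) :
    ‖x + y‖ ^ 2 ≤ (1 + η) * ‖x‖ ^ 2 + (1 + 1 / η) * ‖y‖ ^ 2 := by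
  have h1 : ‖x + y‖ ^ 2 ≤ (‖x‖ + ‖y‖) ^ 2 := by
    gcongr
    exact norm_add_le x y
  have h2 : 0 ≤ (η * ‖x‖ - ‖y‖) ^ 2 / η := by positivity
  have h3 : (η * ‖x‖ - ‖y‖) ^ 2 / η = η * ‖x‖ ^ 2 - 2 * ‖x‖ * ‖y‖ + 1 / η * ‖y‖ ^ 2 := by
    field_simp
    ring
  nlinarith

theorem Scattering.exists_truncation (S : Scattering v φ R0 a) {ε : ℝ} (hε : 0 < ε) :
    ∃ (g : R3 → ℝ) (R : ℝ), ContDiff ℝ 1 g ∧ (∀ x, R ≤ ‖x‖ → g x = 0) ∧ (∀ x, 0 ≤ g x) ∧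
      (∀ x, g x ≤ 1) ∧
      ∫ x, (2 * ‖gradient g x‖ ^ 2 + v x * (1 - g x) ^ 2) ≤ 8 * π * a + ε := by
  obtain ⟨C, hC0, hC⟩ := exists_norm_gradient_radCut_le
  have ha := S.a_nonneg
  set η := ε / (2 * (8 * π * a + 1)) with hη
  have hη0 : 0 < η := by positivity
  set V := volume.real (Metric.ball (0 : R3) 1) with hV
  set K := 2 * (1 + 1 / η) * (8 * V * a ^ 2 * C ^ 2) with hK
  have hV0 : 0 ≤ V := measureReal_nonneg
  have hK0 : 0 ≤ K := by positivity
  set b := max (R0 + 1) (2 * K / ε) with hbdef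
  have hb : R0 < b := (lt_add_one R0).trans_le (le_max_left _ _)
  have hb0 : 0 < b := S.R0_pos.trans hb
  have hζ1 : ContDiff ℝ 1 (radCut b) := (contDiff_radCut b).of_le (by simp)
  have hζd := hζ1.differentiable (by simp)
  have h1φ : ContDiff ℝ 1 fun x => 1 - φ x := contDiff_const.sub S.φ_C1
  have hg1 : ContDiff ℝ 1 fun x => radCut b x * (1 - φ x) := hζ1.mul h1φ
  refine ⟨fun x => radCut b x * (1 - φ x), 2 * b, hg1,
    fun x hx => by simp [radCut_eq_zero hb0 hx],
    fun x => mul_nonneg (radCut_nonneg b x) (sub_nonneg.2 (S.φ_le_one x)),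
    fun x => mul_le_one₀ (radCut_le_one b x) (sub_nonneg.2 (S.φ_le_one x))
      (by linarith [S.φ_nonneg x]), ?_⟩
  have hs := hasCompactSupport_radCut hb0
  have i1 : Integrable fun x => radCut b x * ‖gradient φ x‖ ^ 2 :=
    (hζ1.continuous.mul ((continuous_gradient S.φ_C1).norm.pow 2)).integrable_of_hasCompactSupport
      (hs.mono fun t ht h0 => ht (by simp [h0]))
  have i2 : Integrable ((Metric.closedBall (0 : R3) (2 * b)).indicator
      fun _ => (a / b) ^ 2 * (C / b) ^ 2) :=
    (integrable_indicator_iff measurableSet_closedBall).2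
      (integrableOn_const measure_closedBall_lt_top.ne)
  have i3 : Integrable fun x => v x * φ x ^ 2 :=
    S.integrable_v_mul (S.φ_C1.continuous.pow 2).measurable (C := 1) fun x => by
      rw [abs_of_nonneg (by positivity)]
      exact pow_le_one₀ (S.φ_nonneg x) (S.φ_le_one x)
  have hgr : ∀ x, gradient (fun x => 1 - φ x) x = -gradient φ x := fun x => by
    rw [gradient, fderiv_const_sub, map_neg, gradient]
  have hle : ∀ x, 2 * ‖gradient (fun x => radCut b x * (1 - φ x)) x‖ ^ 2 +
      v x * (1 - radCut b x * (1 - φ x)) ^ 2 ≤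
      2 * (1 + η) * (radCut b x * ‖gradient φ x‖ ^ 2) + 2 * (1 + 1 / η) *
        (Metric.closedBall (0 : R3) (2 * b)).indicator (fun _ => (a / b) ^ 2 * (C / b) ^ 2) x +
        v x * φ x ^ 2 := fun x => by
    rw [gradient_mul_eq (hζd x) (h1φ.differentiable (by simp) x), hgr]
    have e1 := norm_add_sq_le_weighted (radCut b x • -gradient φ x)
      ((1 - φ x) • gradient (radCut b) x) hη0
    have e2 := S.one_sub_φ_sq_mul_le hb (hC b hb0) hC0 x
    rw [norm_smul, norm_smul, mul_pow, mul_pow, norm_neg, Real.norm_eq_abs, Real.norm_eq_abs,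
      sq_abs, sq_abs] at e1
    have e3 : radCut b x ^ 2 ≤ radCut b x := by
      rw [sq]
      exact mul_le_of_le_one_left (radCut_nonneg b x) (radCut_le_one b x)
    have e4 : v x * (1 - radCut b x * (1 - φ x)) ^ 2 = v x * φ x ^ 2 := by
      rcases le_or_gt ‖x‖ b with h | h
      · rw [radCut_eq_one h]
        ring
      · rw [S.v_supp x (hb.trans h)]
        ring
    rw [e4]
    have e5 : (1 + η) * (radCut b x ^ 2 * ‖gradient φ x‖ ^ 2) ≤
        (1 + η) * (radCut b x * ‖gradient φ x‖ ^ 2) := by gcongr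
    have e6 := mul_le_mul_of_nonneg_left e2 (show (0 : ℝ) ≤ 1 + 1 / η by positivity)
    linarith
  have hE := S.localEnergy_le hb
  have hI2 : ∫ x, (Metric.closedBall (0 : R3) (2 * b)).indicator
      (fun _ => (a / b) ^ 2 * (C / b) ^ 2) x = 8 * V * a ^ 2 * C ^ 2 / b := by
    rw [integral_indicator measurableSet_closedBall, setIntegral_const, smul_eq_mul,
      Measure.addHaar_real_closedBall _ _ (by positivity), finrank_euclideanSpace, Fintype.card_fin,
      ← hV]
    field_simp
    ring
  refine (integral_mono_of_nonneg (Filter.Eventually.of_forall fun x => ?_)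
    (((i1.const_mul _).add (i2.const_mul _)).add i3)
    (Filter.Eventually.of_forall hle)).trans ?_
  · have := S.v_nonneg x
    show 0 ≤ _
    positivity
  · rw [integral_add' ((i1.const_mul _).add (i2.const_mul _)) i3,
      integral_add' (i1.const_mul _) (i2.const_mul _), integral_const_mul, integral_const_mul, hI2]
    have e1 : K / b ≤ ε / 2 := by
      rw [div_le_iff₀ hb0]
      have := le_max_right (R0 + 1) (2 * K / ε)
      rw [← hbdef, div_le_iff₀ hε] at this
      linarith
    have e2 : 2 * (1 + 1 / η) * (8 * V * a ^ 2 * C ^ 2 / b) = K / b := by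
      rw [hK]
      ring
    have e3 : 0 ≤ ∫ x, v x * φ x ^ 2 := integral_nonneg fun x =>
      mul_nonneg (S.v_nonneg x) (sq_nonneg _)
    have e4 : η * (8 * π * a) ≤ ε / 2 := by
      rw [hη, div_mul_eq_mul_div, div_le_div_iff₀ (by positivity) (by positivity)]
      nlinarith
    have e5 : 0 ≤ η * ∫ x, v x * φ x ^ 2 := by positivity
    rw [e2]
    nlinarith

theorem Scattering.exists_smooth_trial (S : Scattering v φ R0 a) {ε : ℝ} (hε : 0 < ε) :
    ∃ (f : R3 → ℝ) (R : ℝ), ContDiff ℝ (⊤ : ℕ∞) f ∧ (∀ x, R ≤ ‖x‖ → f x = 1) ∧ (∀ x, 0 < f x) ∧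
      (∀ x, f x ≤ 1) ∧
      ∫ x, (2 * ‖gradient f x‖ ^ 2 + v x * f x ^ 2) ≤ 8 * π * a + ε := by
  obtain ⟨g, R, hg, hR, hg0, hg1, hgE⟩ := S.exists_truncation (half_pos hε)
  have hgs : HasCompactSupport g := hasCompactSupport_of_norm hR
  have iG : Integrable fun x => 2 * ‖gradient g x‖ ^ 2 :=
    (((continuous_gradient hg).norm.pow 2).const_mul 2).integrable_of_hasCompactSupport
      ((hasCompactSupport_gradient hgs).mono fun t ht h0 => ht (by simp [h0]))
  have iv : Integrable fun x => v x * (1 - g x) ^ 2 :=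
    S.integrable_v_mul ((continuous_const.sub hg.continuous).pow 2).measurable (C := 1) fun x => by
      rw [abs_of_nonneg (by positivity)]
      exact pow_le_one₀ (by linarith [hg1 x]) (by linarith [hg0 x])
  have iB : Integrable ((Metric.closedBall (0 : R3) (R + 1)).indicator
      fun x => 4 * ‖gradient g x‖ + 2) := by
    rw [integrable_indicator_iff measurableSet_closedBall]
    exact (((continuous_gradient hg).norm.const_mul 4).add
      continuous_const).continuousOn.integrableOn_compact (isCompact_closedBall _ _)
  set K := (∫ x, (Metric.closedBall (0 : R3) (R + 1)).indicator
    (fun x => 4 * ‖gradient g x‖ + 2) x) + 15 * ∫ x, v x with hK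
  have hK0 : 0 ≤ K := add_nonneg (integral_nonneg fun x => Set.indicator_nonneg
    (fun y _ => by positivity) x) (mul_nonneg (by norm_num) (integral_nonneg S.v_nonneg))
  set δ := min 1 (ε / (2 * (K + 1))) with hδ
  have hδ0 : 0 < δ := lt_min one_pos (by positivity)
  have hδ1 : δ ≤ 1 := min_le_left _ _
  have hδK : δ * K ≤ ε / 2 := by
    have : δ ≤ ε / (2 * (K + 1)) := min_le_right _ _
    rw [le_div_iff₀ (by positivity)] at this
    nlinarith
  obtain ⟨g', hg', hz, hg'0, hd, hdd⟩ := exists_smooth_approx hg hR hg0 hδ0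
  have h2δ : 0 < 1 + 2 * δ := by positivity
  have hg'1 : ∀ x, g' x ≤ 1 + δ := fun x => by
    have := abs_le.1 (hd x)
    linarith [hg1 x]
  set f : R3 → ℝ := fun x => 1 - (1 + 2 * δ)⁻¹ * g' x with hf
  have hfle : ∀ x, f x ≤ 1 := fun x => by
    have := hg'0 x
    have : 0 ≤ (1 + 2 * δ)⁻¹ * g' x := by positivity
    simp only [hf]
    linarith
  have hfpos : ∀ x, 0 < f x := fun x => by
    have : (1 + 2 * δ)⁻¹ * g' x < 1 := by
      rw [inv_mul_lt_iff₀ h2δ]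
      linarith [hg'1 x]
    simp only [hf]
    linarith
  have hfg : ∀ x, f x ≤ 1 - g x + 3 * δ := fun x => by
    have : g x - 3 * δ ≤ (1 + 2 * δ)⁻¹ * g' x := by
      rw [le_inv_mul_iff₀ h2δ]
      have := abs_le.1 (hd x)
      nlinarith [hg1 x, hg0 x]
    simp only [hf]
    linarith
  have hgf : ∀ x, ‖gradient f x‖ ≤ ‖gradient g x‖ +
      (Metric.closedBall (0 : R3) (R + 1)).indicator (fun _ => δ) x := fun x => by
    have e1 : ‖gradient f x‖ = (1 + 2 * δ)⁻¹ * ‖gradient g' x‖ := by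
      rw [norm_gradient, norm_gradient, hf, fderiv_const_sub, norm_neg,
        fderiv_const_mul (hg'.differentiable (by simp) x), norm_smul, Real.norm_of_nonneg
        (by positivity)]
    have e2 : (1 + 2 * δ)⁻¹ ≤ 1 := inv_le_one_of_one_le₀ (by linarith)
    rw [e1]
    refine (mul_le_of_le_one_left (norm_nonneg _) e2).trans ?_
    have := hdd x
    rw [← gradient_sub_eq] at this
    have h3 := norm_le_norm_add_norm_sub' (gradient g' x) (gradient g x)
    linarith
  refine ⟨f, R + 1, contDiff_const.sub (contDiff_const.mul hg'), fun x hx => by simp [hf, hz x hx],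
    hfpos, hfle, ?_⟩
  have hle : ∀ x, 2 * ‖gradient f x‖ ^ 2 + v x * f x ^ 2 ≤
      (2 * ‖gradient g x‖ ^ 2 + v x * (1 - g x) ^ 2) + δ *
        ((Metric.closedBall (0 : R3) (R + 1)).indicator (fun x => 4 * ‖gradient g x‖ + 2) x +
          15 * v x) := fun x => by
    have e1 : ‖gradient f x‖ ^ 2 ≤ (‖gradient g x‖ +
      (Metric.closedBall (0 : R3) (R + 1)).indicator (fun _ => δ) x) ^ 2 :=
      pow_le_pow_left₀ (norm_nonneg _) (hgf x) 2
    have e2 : f x ^ 2 ≤ (1 - g x + 3 * δ) ^ 2 := pow_le_pow_left₀ (hfpos x).le (hfg x) 2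
    have e3 : (1 - g x + 3 * δ) ^ 2 ≤ (1 - g x) ^ 2 + 15 * δ := by nlinarith [hg0 x, hg1 x]
    have e4 := mul_le_mul_of_nonneg_left (e2.trans e3) (S.v_nonneg x)
    by_cases hx : x ∈ Metric.closedBall (0 : R3) (R + 1)
    · rw [Set.indicator_of_mem hx] at e1 ⊢
      nlinarith [norm_nonneg (gradient g x)]
    · rw [Set.indicator_of_notMem hx] at e1 ⊢
      nlinarith [norm_nonneg (gradient g x)]
  refine (integral_mono_of_nonneg (Filter.Eventually.of_forall fun x => ?_)
    ((iG.add iv).add ((iB.add (S.integrable_v.const_mul 15)).const_mul δ))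
    (Filter.Eventually.of_forall hle)).trans ?_
  · have := S.v_nonneg x
    show 0 ≤ _
    positivity
  · rw [integral_add' (iG.add iv) ((iB.add (S.integrable_v.const_mul 15)).const_mul δ),
      integral_const_mul, integral_add' iB (S.integrable_v.const_mul 15), integral_const_mul 15,
      ← hK]
    simp only [Pi.add_apply]
    linarith

theorem gradient_comp_neg {f : R3 → ℝ} (hf : Differentiable ℝ f) (x : R3) :
    gradient (fun y => f (-y)) x = -gradient f (-x) := by
  refine HasGradientAt.gradient ?_
  rw [hasGradientAt_iff_hasFDerivAt]
  refine ((hf (-x)).hasFDerivAt.comp x (hasFDerivAt_id x).neg).congr_fderiv ?_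
  ext y
  simp [← inner_gradient_left]

theorem Scattering.exists_even_trial (S : Scattering v φ R0 a) {ε : ℝ} (hε : 0 < ε) :
    ∃ (f : R3 → ℝ) (R : ℝ), ContDiff ℝ (⊤ : ℕ∞) f ∧ (∀ x, R ≤ ‖x‖ → f x = 1) ∧ (∀ x, 0 < f x) ∧
      (∀ x, f x ≤ 1) ∧ (∀ x, f (-x) = f x) ∧
      ∫ x, (2 * ‖gradient f x‖ ^ 2 + v x * f x ^ 2) ≤ 8 * π * a + ε := by
  obtain ⟨f, R, hf, hR, h0, h1, hE⟩ := S.exists_smooth_trial hε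
  have hfd := hf.differentiable (by simp)
  have hf1 : ContDiff ℝ 1 f := hf.of_le (by simp)
  have hfn : ContDiff ℝ (⊤ : ℕ∞) fun x => f (-x) := hf.comp contDiff_neg
  refine ⟨fun x => 2⁻¹ * (f x + f (-x)), R, contDiff_const.mul (hf.add hfn), fun x hx => ?_,
    fun x => by have := h0 x; have := h0 (-x); positivity,
    fun x => by linarith [h1 x, h1 (-x)], fun x => by simp only [neg_neg]; rw [add_comm], ?_⟩
  · simp only [hR x hx, hR (-x) (by rwa [norm_neg])]
    norm_num
  have hgr : ∀ x, gradient (fun x => 2⁻¹ * (f x + f (-x))) x =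
      (2⁻¹ : ℝ) • (gradient f x - gradient f (-x)) := fun x => by
    have := gradient_comp_neg hfd x
    rw [sub_eq_add_neg, ← this]
    refine HasGradientAt.gradient ?_
    rw [hasGradientAt_iff_hasFDerivAt]
    refine (((hfd x).hasFDerivAt.add
      (hfn.differentiable (by simp) x).hasFDerivAt).const_mul (2⁻¹ : ℝ)).congr_fderiv ?_
    ext y
    simp [← inner_gradient_left, inner_add_left, inner_smul_left]
  have hc : HasCompactSupport (gradient f) := by
    have h : HasCompactSupport fun x => 1 - f x :=
      hasCompactSupport_of_norm (R := R) fun x hx => by simp [hR x hx]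
    refine (hasCompactSupport_gradient h).mono fun t ht h0 => ht ?_
    rw [← norm_eq_zero, norm_gradient, fderiv_const_sub, norm_neg, ← norm_gradient] at h0
    exact norm_eq_zero.1 h0
  have i1 : Integrable fun x => 2 * ‖gradient f x‖ ^ 2 :=
    (((continuous_gradient hf1).norm.pow 2).const_mul 2).integrable_of_hasCompactSupport
      (hc.mono fun t ht h0 => ht (by simp [h0]))
  have i2 : Integrable fun x => v x * f x ^ 2 :=
    S.integrable_v_mul (hf.continuous.pow 2).measurable (C := 1) fun x => by
      rw [abs_of_nonneg (by positivity)]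
      exact pow_le_one₀ (h0 x).le (h1 x)
  set H : R3 → ℝ := fun x => 2 * ‖gradient f x‖ ^ 2 + v x * f x ^ 2 with hH
  have iH : Integrable H := i1.add i2
  have hle : ∀ x, 2 * ‖gradient (fun x => 2⁻¹ * (f x + f (-x))) x‖ ^ 2 +
      v x * (2⁻¹ * (f x + f (-x))) ^ 2 ≤ 2⁻¹ * (H x + H (-x)) := fun x => by
    rw [hgr, norm_smul, mul_pow, Real.norm_of_nonneg (by norm_num)]
    simp only [hH]
    rw [S.v_radial (-x) x (norm_neg x)]
    have e1 := parallelogram_law_with_norm ℝ (gradient f x) (gradient f (-x))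
    have e2 := mul_nonneg (S.v_nonneg x) (sq_nonneg (f x - f (-x)))
    nlinarith [norm_nonneg (gradient f x + gradient f (-x))]
  refine (integral_mono_of_nonneg (Filter.Eventually.of_forall fun x => ?_)
    ((iH.add iH.comp_neg).const_mul 2⁻¹) (Filter.Eventually.of_forall hle)).trans ?_
  · have := S.v_nonneg x
    show 0 ≤ _
    positivity
  · rw [integral_const_mul, integral_add' iH iH.comp_neg, integral_neg_eq_self]
    linarith

/-- A smooth pair correlation exponent whose two-body energy is close to `8πa`. -/
theorem Scattering.exists_correlation (S : Scattering v φ R0 a) {ε : ℝ} (hε : 0 < ε) :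
    ∃ ω : R3 → ℝ, ContDiff ℝ (⊤ : ℕ∞) ω ∧ HasCompactSupport ω ∧ (∀ x, 0 ≤ ω x) ∧
      (∀ x, ω (-x) = ω x) ∧
      ∫ x, ((1 / 2) * realGradSq ω x + v x) * exp (-ω x) ≤ 8 * π * a + ε := by
  obtain ⟨f, R, hf, hR, h0, h1, he, hE⟩ := S.exists_even_trial hε
  have hfd := hf.differentiable (by simp)
  refine ⟨fun x => -2 * log (f x), contDiff_const.mul (hf.log fun x => (h0 x).ne'),
    hasCompactSupport_of_norm (R := R) fun x hx => by simp [hR x hx],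
    fun x => by have := log_nonpos (h0 x).le (h1 x); linarith, fun x => by simp only [he], ?_⟩
  refine le_of_eq_of_le ?_ hE
  congr 1
  ext x
  have hexp : exp (-(-2 * log (f x))) = f x ^ 2 := by
    rw [show -(-2 * log (f x)) = log (f x) + log (f x) by ring, exp_add, exp_log (h0 x), sq]
  have hgr : gradient (fun x => -2 * log (f x)) x = (-2 * (f x)⁻¹) • gradient f x := by
    refine HasGradientAt.gradient ?_
    rw [hasGradientAt_iff_hasFDerivAt]
    refine (((hfd x).hasFDerivAt.log (h0 x).ne').const_mul (-2 : ℝ)).congr_fderiv ?_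
    ext y
    simp [← inner_gradient_left, inner_smul_left, mul_assoc]
  have := h0 x
  rw [hexp, realGradSq_eq_norm_sq, hgr, norm_smul, mul_pow, Real.norm_eq_abs, sq_abs]
  field_simp

end ScatteringTrial

section Densities

theorem pi_withDensity_ofReal {ι : Type*} [Fintype ι] {X : ι → Type*} [∀ i, MeasurableSpace (X i)]
    (μ : ∀ i, Measure (X i)) [∀ i, SigmaFinite (μ i)] {f : ∀ i, X i → ℝ}
    (hf0 : ∀ i x, 0 ≤ f i x) (hfi : ∀ i, Integrable (f i) (μ i)) :
    Measure.pi (fun i => (μ i).withDensity fun x => ENNReal.ofReal (f i x)) =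
      (Measure.pi μ).withDensity fun x => ENNReal.ofReal (∏ i, f i (x i)) := by
  have hfin : ∀ i, IsFiniteMeasure ((μ i).withDensity fun x => ENNReal.ofReal (f i x)) :=
    fun i => isFiniteMeasure_withDensity_ofReal (hfi i).2
  refine Measure.pi_eq fun s hs => ?_
  rw [withDensity_apply _ (MeasurableSet.univ_pi hs), Measure.restrict_pi_pi,
    ← ofReal_integral_eq_lintegral_ofReal (Integrable.fintype_prod_dep fun i => (hfi i).restrict)
      (Filter.Eventually.of_forall fun x => Finset.prod_nonneg fun i _ => hf0 i _),
    integral_fintype_prod_eq_prod,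
    ENNReal.ofReal_prod_of_nonneg fun i _ => integral_nonneg (hf0 i)]
  refine Finset.prod_congr rfl fun i _ => ?_
  rw [withDensity_apply _ (hs i), ofReal_integral_eq_lintegral_ofReal (hfi i).restrict
    (Filter.Eventually.of_forall (hf0 i))]

theorem measurePreserving_curry {S O E : Type*} [Fintype S] [Fintype O] [MeasurableSpace E]
    (μ : Measure E) [SigmaFinite μ] :
    MeasurePreserving (MeasurableEquiv.curry S O E) (Measure.pi fun _ => μ)
      (Measure.pi fun _ => Measure.pi fun _ => μ) := by
  refine ⟨(MeasurableEquiv.curry S O E).measurable, ?_⟩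
  refine (Measure.pi_eq_generateFrom
    (C := fun _ => Set.image Set.univ.pi (Set.univ.pi fun _ : O => {s : Set E | MeasurableSet s}))
    (fun _ => generateFrom_pi) (fun _ => isPiSystem_pi)
    (fun _ => Measure.FiniteSpanningSetsIn.pi fun _ => Measure.toFiniteSpanningSetsIn μ)
    fun s hs => ?_).symm
  choose t ht hts using hs
  rw [MeasurableEquiv.map_apply]
  have : MeasurableEquiv.curry S O E ⁻¹' Set.univ.pi s = Set.univ.pi fun a : S × O => t a.1 a.2 := by
    ext X
    simp only [Set.mem_preimage, Set.mem_pi, Set.mem_univ, true_implies, ← hts, Prod.forall]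
    rfl
  rw [this, Measure.pi_pi, Fintype.prod_prod_type]
  refine Finset.prod_congr rfl fun α _ => ?_
  rw [← hts, Measure.pi_pi]

variable {E O S : Type*} [MeasurableSpace E] [Fintype O] [DecidableEq O] [Fintype S]
  {μ : Measure E} [SigmaFinite μ]

/-- The Lebesgue density of the distribution of independent species. -/
def speciesDensity (ρ : E → ℝ) (e : O → E → ℂ) (X : S × O → E) : ℝ :=
  (∏ a, ρ (X a)) * ∏ α, (‖slater e fun i => X (α, i)‖ ^ 2 / ((Fintype.card O).factorial : ℝ))

theorem Orbitals.speciesMeasure_eq {ρ : E → ℝ} (hρ0 : ∀ x, 0 ≤ ρ x) (hρm : Measurable ρ)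
    (hρ : Integrable ρ μ) {e : O → E → ℂ}
    [IsProbabilityMeasure (μ.withDensity fun x => ENNReal.ofReal (ρ x))]
    (he : Orbitals (μ.withDensity fun x => ENNReal.ofReal (ρ x)) e) :
    speciesMeasure S (μ.withDensity fun x => ENNReal.ofReal (ρ x)) e =
      ((Measure.pi fun _ => μ).withDensity fun X =>
        ENNReal.ofReal (speciesDensity ρ e X)).map (MeasurableEquiv.curry S O E) := by
  have hsl : slaterMeasure (μ.withDensity fun x => ENNReal.ofReal (ρ x)) e =
      (Measure.pi fun _ => μ).withDensity fun x => ENNReal.ofReal ((∏ i, ρ (x i)) *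
        (‖slater e x‖ ^ 2 / ((Fintype.card O).factorial : ℝ))) := by
    rw [slaterMeasure, pi_withDensity_ofReal (fun _ : O => μ) (fun _ => hρ0) (fun _ => hρ),
      ← withDensity_mul]
    · congr 1
      ext x
      rw [Pi.mul_apply, ENNReal.ofReal_mul (Finset.prod_nonneg fun i _ => hρ0 _)]
    · exact (Finset.measurable_prod _ fun i _ =>
        hρm.comp (measurable_pi_apply i)).ennreal_ofReal
    · exact he.measurable_density.ennreal_ofReal
  have hm : Measurable fun x : O → E => (∏ i, ρ (x i)) *
      (‖slater e x‖ ^ 2 / ((Fintype.card O).factorial : ℝ)) :=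
    (Finset.measurable_prod _ fun i _ => hρm.comp (measurable_pi_apply i)).mul he.measurable_density
  have h0 : ∀ x : O → E, 0 ≤ (∏ i, ρ (x i)) *
      (‖slater e x‖ ^ 2 / ((Fintype.card O).factorial : ℝ)) := fun x =>
    mul_nonneg (Finset.prod_nonneg fun i _ => hρ0 _) (by positivity)
  have hinteg : Integrable (fun x : O → E => (∏ i, ρ (x i)) *
      (‖slater e x‖ ^ 2 / ((Fintype.card O).factorial : ℝ))) (Measure.pi fun _ => μ) := by
    have := he.isProbabilityMeasure
    refine ⟨hm.aestronglyMeasurable, ?_⟩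
    rw [hasFiniteIntegral_iff_ofReal (Filter.Eventually.of_forall h0)]
    have h1 : slaterMeasure (μ.withDensity fun x => ENNReal.ofReal (ρ x)) e Set.univ < ⊤ :=
      measure_lt_top _ _
    rwa [hsl, withDensity_apply _ MeasurableSet.univ, Measure.restrict_univ] at h1
  rw [speciesMeasure, hsl, pi_withDensity_ofReal (fun _ : S => Measure.pi fun _ : O => μ)
    (fun _ => h0) (fun _ => hinteg), ← (measurePreserving_curry (S := S) (O := O) μ).map_eq]
  ext s hs
  rw [withDensity_apply _ hs, MeasurableEquiv.map_apply,
    withDensity_apply _ ((MeasurableEquiv.curry S O E).measurable hs),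
    (MeasurableEquiv.curry S O E).restrict_map, lintegral_map_equiv]
  refine lintegral_congr fun X => ?_
  congr 1
  rw [speciesDensity, Fintype.prod_prod_type, Finset.prod_mul_distrib]
  rfl

theorem Orbitals.integral_speciesMeasure {ρ : E → ℝ} (hρ0 : ∀ x, 0 ≤ ρ x) (hρm : Measurable ρ)
    (hρ : Integrable ρ μ) {e : O → E → ℂ}
    [IsProbabilityMeasure (μ.withDensity fun x => ENNReal.ofReal (ρ x))]
    (he : Orbitals (μ.withDensity fun x => ENNReal.ofReal (ρ x)) e) (f : (S → O → E) → ℝ) :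
    ∫ Y, f Y ∂speciesMeasure S (μ.withDensity fun x => ENNReal.ofReal (ρ x)) e =
      ∫ X : S × O → E, speciesDensity ρ e X * f (fun α i => X (α, i)) ∂Measure.pi fun _ => μ := by
  rw [he.speciesMeasure_eq hρ0 hρm hρ, integral_map_equiv,
    integral_withDensity_eq_integral_toReal_smul _ (by simp)]
  · refine integral_congr_ae (Filter.Eventually.of_forall fun X => ?_)
    have h0 : 0 ≤ speciesDensity ρ e X := mul_nonneg (Finset.prod_nonneg fun a _ => hρ0 _)
      (Finset.prod_nonneg fun α _ => by positivity)
    simp only [ENNReal.toReal_ofReal h0, smul_eq_mul]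
    rfl
  · refine Measurable.ennreal_ofReal ?_
    refine (Finset.measurable_prod _ fun a _ => hρm.comp (measurable_pi_apply a)).mul
      (Finset.measurable_prod _ fun α _ => ?_)
    exact he.measurable_density.comp (measurable_pi_lambda _ fun i => measurable_pi_apply _)

end Densities

section KineticIdentity

variable {V : Type*} [NormedAddCommGroup V] [NormedSpace ℝ V] [MeasurableSpace V] [BorelSpace V]
  [FiniteDimensional ℝ V] {μ : Measure V} [μ.IsAddHaarMeasure]

theorem integral_fderiv_eq_zero {G : V → ℝ} (hG : ContDiff ℝ 1 G) (hs : HasCompactSupport G)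
    (e : V) : ∫ x, fderiv ℝ G x e ∂μ = 0 := by
  have i1 : Integrable (fun x => fderiv ℝ G x e) μ :=
    ((hG.continuous_fderiv (by simp)).clm_apply continuous_const).integrable_of_hasCompactSupport
      ((hs.fderiv ℝ).mono fun t ht h0 => ht (by simp [h0]))
  have := integral_mul_fderiv_eq_neg_fderiv_mul_of_integrable (μ := μ) (f := fun _ : V => (1 : ℝ))
    (g := G) (v := e) (by simp) (by simpa using i1)
    (by simpa using hG.continuous.integrable_of_hasCompactSupport hs) (fun x _ => by fun_prop)
    (fun x _ => hG.differentiable (by simp) x)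
  simpa using this

theorem contDiff_fderiv_apply {F : Type*} [NormedAddCommGroup F] [NormedSpace ℝ F] {D : V → F}
    (hD : ContDiff ℝ (⊤ : ℕ∞) D) (e : V) : ContDiff ℝ (⊤ : ℕ∞) fun x => fderiv ℝ D x e :=
  (hD.fderiv_right (m := (⊤ : ℕ∞)) (by simp)).clm_apply contDiff_const

theorem hasCompactSupport_fderiv_sq_mul {u : V → ℝ} (hs : HasCompactSupport u) (e : V) (f : V → ℝ) :
    HasCompactSupport fun x => fderiv ℝ u x e ^ 2 * f x :=
  (hs.fderiv ℝ).mono fun t ht h0 => ht (by simp [h0])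

theorem integral_norm_fderiv_smul_sq {u : V → ℝ} (hu : ContDiff ℝ (⊤ : ℕ∞) u)
    (hs : HasCompactSupport u) {D : V → ℂ} (hD : ContDiff ℝ (⊤ : ℕ∞) D) (e : V) :
    ∫ x, ‖fderiv ℝ (fun y => u y • D y) x e‖ ^ 2 ∂μ =
      (∫ x, fderiv ℝ u x e ^ 2 * ‖D x‖ ^ 2 ∂μ) -
        ∫ x, u x ^ 2 * ⟪D x, fderiv ℝ (fun y => fderiv ℝ D y e) x e⟫ ∂μ := by
  set D' : V → ℂ := fun y => fderiv ℝ D y e with hD'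
  have hD's : ContDiff ℝ (⊤ : ℕ∞) D' := contDiff_fderiv_apply hD e
  have hD'' : ContDiff ℝ (⊤ : ℕ∞) fun x => fderiv ℝ D' x e := contDiff_fderiv_apply hD's e
  have hu' : ContDiff ℝ (⊤ : ℕ∞) fun x => fderiv ℝ u x e := contDiff_fderiv_apply hu e
  have hud := hu.differentiable (by simp)
  have hDd := hD.differentiable (by simp)
  have hD'd := hD's.differentiable (by simp)
  set G : V → ℝ := fun x => u x ^ 2 * ⟪D x, D' x⟫ with hG
  have hGs : ContDiff ℝ (⊤ : ℕ∞) G := (hu.pow 2).mul (hD.inner ℝ hD's)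
  have hGc : HasCompactSupport G := hs.mono fun t ht h0 => ht (by simp [hG, h0])
  have i1 : Integrable (fun x => fderiv ℝ u x e ^ 2 * ‖D x‖ ^ 2) μ :=
    ((hu'.continuous.pow 2).mul (hD.continuous.norm.pow 2)).integrable_of_hasCompactSupport
      (hasCompactSupport_fderiv_sq_mul hs e _)
  have i2 : Integrable (fun x => u x ^ 2 * ⟪D x, fderiv ℝ D' x e⟫) μ :=
    ((hu.continuous.pow 2).mul
      (hD.continuous.inner hD''.continuous)).integrable_of_hasCompactSupport
      (hs.mono fun t ht h0 => ht (by simp [h0]))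
  have i3 : Integrable (fun x => fderiv ℝ G x e) μ :=
    (contDiff_fderiv_apply hGs e).continuous.integrable_of_hasCompactSupport
      ((hGc.fderiv ℝ).mono fun t ht h0 => ht (by simp [h0]))
  have hpt : ∀ x, ‖fderiv ℝ (fun y => u y • D y) x e‖ ^ 2 =
      fderiv ℝ u x e ^ 2 * ‖D x‖ ^ 2 + fderiv ℝ G x e -
        u x ^ 2 * ⟪D x, fderiv ℝ D' x e⟫ := fun x => by
    have e1 : fderiv ℝ (fun y => u y • D y) x e = u x • D' x + fderiv ℝ u x e • D x := by
      rw [fderiv_fun_smul (hud x) (hDd x)]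
      rfl
    have e2 : fderiv ℝ G x e = u x ^ 2 * (⟪D x, fderiv ℝ D' x e⟫ + ⟪D' x, D' x⟫) +
        2 * u x * fderiv ℝ u x e * ⟪D x, D' x⟫ := by
      rw [hG, fderiv_fun_mul ((hud x).fun_pow 2) ((hDd x).inner ℝ (hD'd x)),
        fderiv_fun_pow 2 (hud x)]
      simp only [add_apply, smul_apply, smul_eq_mul,
        fderiv_inner_apply ℝ (hDd x) (hD'd x)]
      simp only [hD', pow_one, Nat.cast_ofNat, Nat.add_one_sub_one]
      ring
    rw [e1, e2, norm_add_sq_real, norm_smul, norm_smul, mul_pow, mul_pow, Real.norm_eq_abs,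
      Real.norm_eq_abs, sq_abs, sq_abs, inner_smul_left, inner_smul_right, real_inner_comm (D x),
      real_inner_self_eq_norm_sq]
    simp only [conj_trivial]
    ring
  simp_rw [hpt]
  have i13 : Integrable (fun x => fderiv ℝ u x e ^ 2 * ‖D x‖ ^ 2 + fderiv ℝ G x e) μ := i1.add i3
  rw [integral_sub i13 i2, integral_add i1 i3,
    integral_fderiv_eq_zero (hGs.of_le (by simp)) hGc, add_zero]

/-- Kinetic energy of a real amplitude times an eigenfunction of the Laplacian. -/
theorem sum_integral_norm_fderiv_smul_sq {u : V → ℝ} (hu : ContDiff ℝ (⊤ : ℕ∞) u)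
    (hs : HasCompactSupport u) {D : V → ℂ} (hD : ContDiff ℝ (⊤ : ℕ∞) D) {J : Type*} [Fintype J]
    (e : J → V) {E : ℝ}
    (hE : ∀ x, ∑ j, fderiv ℝ (fun y => fderiv ℝ D y (e j)) x (e j) = (-E) • D x) :
    ∑ j, ∫ x, ‖fderiv ℝ (fun y => u y • D y) x (e j)‖ ^ 2 ∂μ =
      E * (∫ x, u x ^ 2 * ‖D x‖ ^ 2 ∂μ) +
        ∫ x, (∑ j, fderiv ℝ u x (e j) ^ 2) * ‖D x‖ ^ 2 ∂μ := by
  have hD'' : ∀ j, ContDiff ℝ (⊤ : ℕ∞) fun x => fderiv ℝ (fun y => fderiv ℝ D y (e j)) x (e j) :=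
    fun j => contDiff_fderiv_apply (contDiff_fderiv_apply hD _) _
  have i2 : ∀ j, Integrable (fun x => u x ^ 2 *
      ⟪D x, fderiv ℝ (fun y => fderiv ℝ D y (e j)) x (e j)⟫) μ := fun j =>
    ((hu.continuous.pow 2).mul
      (hD.continuous.inner (hD'' j).continuous)).integrable_of_hasCompactSupport
      (hs.mono fun t ht h0 => ht (by simp [h0]))
  have i1 : ∀ j, Integrable (fun x => fderiv ℝ u x (e j) ^ 2 * ‖D x‖ ^ 2) μ := fun j =>
    (((contDiff_fderiv_apply hu (e j)).continuous.pow 2).mul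
      (hD.continuous.norm.pow 2)).integrable_of_hasCompactSupport
      (hasCompactSupport_fderiv_sq_mul hs (e j) _)
  simp_rw [integral_norm_fderiv_smul_sq hu hs hD, Finset.sum_sub_distrib, Finset.sum_mul]
  rw [← integral_finsetSum _ fun j _ => i1 j, ← integral_finsetSum _ fun j _ => i2 j]
  have : ∀ x, ∑ j, u x ^ 2 * ⟪D x, fderiv ℝ (fun y => fderiv ℝ D y (e j)) x (e j)⟫ =
      -(E * (u x ^ 2 * ‖D x‖ ^ 2)) := fun x => by
    rw [← Finset.mul_sum, ← inner_sum, hE, inner_smul_right, real_inner_self_eq_norm_sq]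
    ring
  simp_rw [this]
  rw [integral_neg, integral_const_mul]
  ring

/-- The coordinate directions of a configuration space. -/
def coordDir {ι : Type*} [DecidableEq ι] (p : ι × Fin 3) : ι → R3 :=
  Pi.single p.1 (EuclideanSpace.single p.2 1)

theorem gradSq_update {ι : Type*} [Fintype ι] [DecidableEq ι] {Φ : (ι → R3) → ℂ}
    (hΦ : Differentiable ℝ Φ) (X : ι → R3) (i : ι) :
    gradSq (fun y => Φ (Function.update X i y)) (X i) =
      ∑ j : Fin 3, ‖fderiv ℝ Φ X (coordDir (i, j))‖ ^ 2 := by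
  unfold gradSq coordDir
  refine Finset.sum_congr rfl fun j _ => ?_
  have h : HasFDerivAt (fun y => Φ (Function.update X i y))
      ((fderiv ℝ Φ X).comp (ContinuousLinearMap.pi (Pi.single i (ContinuousLinearMap.id ℝ R3))))
      (X i) := by
    have h1 : HasFDerivAt Φ (fderiv ℝ Φ X) (Function.update X i (X i)) := by
      rw [Function.update_eq_self]
      exact (hΦ X).hasFDerivAt
    exact h1.comp (X i) (hasFDerivAt_update X (X i))
  rw [h.fderiv]
  rw [ContinuousLinearMap.comp_apply]
  congr 3
  ext k l
  rcases eq_or_ne k i with rfl | hk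
  · simp
  · simp [Pi.single_eq_of_ne hk]

end KineticIdentity

section PlaneWaveSums

variable {V : Type*} [NormedAddCommGroup V] [NormedSpace ℝ V] {T : Type*} [Fintype T]

/-- A superposition of plane waves. -/
def waveSum (c : T → ℂ) (Λ : T → V →L[ℝ] ℝ) (x : V) : ℂ :=
  ∑ t, c t * Complex.exp ((Λ t x : ℝ) * Complex.I)

theorem contDiff_waveSum (c : T → ℂ) (Λ : T → V →L[ℝ] ℝ) : ContDiff ℝ (⊤ : ℕ∞) (waveSum c Λ) := by
  refine ContDiff.sum fun t _ => contDiff_const.mul (Complex.contDiff_exp.comp ?_)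
  exact (Complex.ofRealCLM.contDiff.comp (Λ t).contDiff).mul contDiff_const

theorem fderiv_waveSum (c : T → ℂ) (Λ : T → V →L[ℝ] ℝ) (x e : V) :
    fderiv ℝ (waveSum c Λ) x e = waveSum (fun t => c t * ((Λ t e : ℝ) * Complex.I)) Λ x := by
  have h : ∀ t ∈ Finset.univ, HasFDerivAt (fun x => c t * Complex.exp ((Λ t x : ℝ) * Complex.I))
      (c t • (Complex.exp ((Λ t x : ℝ) * Complex.I) •
        ((Complex.ofRealCLM.comp (Λ t)).smulRight Complex.I))) x := fun t _ => by
    refine HasFDerivAt.const_mul ?_ _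
    refine HasFDerivAt.cexp ?_
    have h1 : HasFDerivAt (fun y => ((Λ t y : ℝ) : ℂ)) (Complex.ofRealCLM.comp (Λ t)) x :=
      (Complex.ofRealCLM.comp (Λ t)).hasFDerivAt
    refine (h1.mul_const Complex.I).congr_fderiv ?_
    ext y
    simp [mul_comm]
  have := (HasFDerivAt.fun_sum h).fderiv
  rw [show waveSum c Λ = fun x => ∑ t, c t * Complex.exp ((Λ t x : ℝ) * Complex.I) from rfl, this]
  simp only [sum_apply, smul_apply, ContinuousLinearMap.smulRight_apply, waveSum, smul_eq_mul]
  refine Finset.sum_congr rfl fun t _ => ?_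
  simp
  ring

theorem sum_fderiv_fderiv_waveSum (c : T → ℂ) (Λ : T → V →L[ℝ] ℝ) {J : Type*} [Fintype J]
    (e : J → V) {E : ℝ} (hE : ∀ t, ∑ j, Λ t (e j) ^ 2 = E) (x : V) :
    ∑ j, fderiv ℝ (fun y => fderiv ℝ (waveSum c Λ) y (e j)) x (e j) = (-E) • waveSum c Λ x := by
  have h : ∀ e', (fun y => fderiv ℝ (waveSum c Λ) y e') =
      waveSum (fun t => c t * ((Λ t e' : ℝ) * Complex.I)) Λ := fun e' => by
    ext y
    exact fderiv_waveSum c Λ y e'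
  simp_rw [h, fderiv_waveSum, waveSum]
  rw [Finset.sum_comm, Finset.smul_sum]
  refine Finset.sum_congr rfl fun t _ => ?_
  rw [← Finset.sum_mul, ← hE t, Complex.real_smul, ← mul_assoc]
  congr 1
  push_cast
  rw [mul_comm (-_), ← Finset.sum_neg_distrib, Finset.mul_sum]
  refine Finset.sum_congr rfl fun j _ => ?_
  linear_combination c t * (Λ t (e j) : ℂ) ^ 2 * Complex.I_mul_I

end PlaneWaveSums

section FreeState

variable {S : Type*} [Fintype S] [DecidableEq S]

/-- The product over species of the Slater determinants of plane waves. -/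
def freeState (S : Type*) [Fintype S] (ℓ : ℝ) (K : Finset (Fin 3 → ℤ)) (X : S × K → R3) : ℂ :=
  ∏ α, slater (fun k : K => planeWave ℓ k.1) fun i => X (α, i)

/-- The phase of the product of plane waves with permuted momenta. -/
def phase (ℓ : ℝ) {K : Finset (Fin 3 → ℤ)} (σ : S → Equiv.Perm K) : (S × K → R3) →L[ℝ] ℝ :=
  ∑ a : S × K, ∑ j : Fin 3, (2 * π / ℓ * ((σ a.1 a.2).1 j : ℝ)) •
    ((EuclideanSpace.proj j : R3 →L[ℝ] ℝ).comp (ContinuousLinearMap.proj a))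

theorem phase_apply (ℓ : ℝ) {K : Finset (Fin 3 → ℤ)} (σ : S → Equiv.Perm K) (X : S × K → R3) :
    phase ℓ σ X = ∑ a : S × K, 2 * π / ℓ * ∑ j : Fin 3, ((σ a.1 a.2).1 j : ℝ) * X a j := by
  simp only [phase, sum_apply, smul_apply, ContinuousLinearMap.comp_apply,
    ContinuousLinearMap.proj_apply, smul_eq_mul, Finset.mul_sum, mul_assoc]
  rfl

theorem phase_coordDir (ℓ : ℝ) {K : Finset (Fin 3 → ℤ)} (σ : S → Equiv.Perm K)
    (p : (S × K) × Fin 3) :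
    phase ℓ σ (coordDir p) = 2 * π / ℓ * ((σ p.1.1 p.1.2).1 p.2 : ℝ) := by
  rw [phase_apply, Finset.sum_eq_single p.1, Finset.sum_eq_single p.2]
  · simp [coordDir]
  · intro j _ hj
    simp [coordDir, PiLp.single_apply, hj]
  · simp
  · intro b _ hb
    simp [coordDir, Pi.single_eq_of_ne hb]
  · simp

theorem sum_phase_sq (ℓ : ℝ) {K : Finset (Fin 3 → ℤ)} (σ : S → Equiv.Perm K) :
    ∑ p : (S × K) × Fin 3, phase ℓ σ (coordDir p) ^ 2 =
      Fintype.card S * ((2 * π / ℓ) ^ 2 * ∑ k ∈ K, ∑ j, (k j : ℝ) ^ 2) := by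
  simp_rw [phase_coordDir, mul_pow]
  rw [Fintype.sum_prod_type, Fintype.sum_prod_type]
  have : ∀ α : S, ∑ i : K, ∑ j : Fin 3, (2 * π / ℓ) ^ 2 * ((σ α i).1 j : ℝ) ^ 2 =
      (2 * π / ℓ) ^ 2 * ∑ k ∈ K, ∑ j, (k j : ℝ) ^ 2 := fun α => by
    rw [Equiv.sum_comp (σ α) fun i : K => ∑ j : Fin 3, (2 * π / ℓ) ^ 2 * (i.1 j : ℝ) ^ 2,
      ← Finset.sum_coe_sort K, Finset.mul_sum]
    exact Finset.sum_congr rfl fun i _ => (Finset.mul_sum _ _ _).symm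
  simp_rw [this]
  rw [Finset.sum_const, Finset.card_univ, nsmul_eq_mul]

theorem freeState_eq_waveSum (ℓ : ℝ) (K : Finset (Fin 3 → ℤ)) :
    freeState S ℓ K = waveSum (fun σ : S → Equiv.Perm K => ∏ α, ((Equiv.Perm.sign (σ α) : ℤ) : ℂ))
      (phase ℓ) := by
  ext X
  unfold freeState waveSum slater
  simp_rw [Matrix.det_apply', Finset.prod_univ_sum]
  rw [Fintype.piFinset_univ]
  refine Finset.sum_congr rfl fun σ _ => ?_
  rw [Finset.prod_mul_distrib, phase_apply]
  congr 1
  push_cast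
  rw [Finset.sum_mul, Complex.exp_sum, Fintype.prod_prod_type]
  refine Finset.prod_congr rfl fun α _ => Finset.prod_congr rfl fun i _ => ?_
  simp only [Matrix.of_apply, planeWave]
  push_cast
  rfl

theorem contDiff_freeState (ℓ : ℝ) (K : Finset (Fin 3 → ℤ)) :
    ContDiff ℝ (⊤ : ℕ∞) (freeState S ℓ K) := by
  rw [freeState_eq_waveSum]
  exact contDiff_waveSum _ _

theorem laplacian_freeState (ℓ : ℝ) (K : Finset (Fin 3 → ℤ)) (X : S × K → R3) :
    ∑ p, fderiv ℝ (fun Y => fderiv ℝ (freeState S ℓ K) Y (coordDir p)) X (coordDir p) =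
      (-(Fintype.card S * ((2 * π / ℓ) ^ 2 * ∑ k ∈ K, ∑ j, (k j : ℝ) ^ 2))) •
        freeState S ℓ K X := by
  have h := freeState_eq_waveSum (S := S) ℓ K
  generalize (fun σ : S → Equiv.Perm K => ∏ α, ((Equiv.Perm.sign (σ α) : ℤ) : ℂ)) = c at h
  rw [h]
  exact sum_fderiv_fderiv_waveSum c (phase ℓ) (coordDir (ι := S × K))
    (fun σ => sum_phase_sq ℓ σ) X

theorem freeState_swap (ℓ : ℝ) (K : Finset (Fin 3 → ℤ)) {a b : S × K} (hab : a ≠ b)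
    (hs : a.1 = b.1) (X : S × K → R3) :
    freeState S ℓ K (X ∘ Equiv.swap a b) = -freeState S ℓ K X := by
  obtain ⟨α, i⟩ := a
  obtain ⟨β, j⟩ := b
  obtain rfl : α = β := hs
  have hij : i ≠ j := fun h => hab (by rw [h])
  unfold freeState
  rw [← Finset.mul_prod_erase _ _ (Finset.mem_univ α), ← Finset.mul_prod_erase _ _
    (Finset.mem_univ α), neg_mul_eq_neg_mul]
  congr 1
  · have : (fun k => (X ∘ Equiv.swap (α, i) (α, j)) (α, k)) =
        (fun k => X (α, k)) ∘ Equiv.swap i j := by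
      ext1 k
      simp only [Function.comp_apply]
      congr 1
      rcases eq_or_ne k i with rfl | hi
      · simp
      · rcases eq_or_ne k j with rfl | hj
        · simp
        · rw [Equiv.swap_apply_of_ne_of_ne hi hj, Equiv.swap_apply_of_ne_of_ne (by simp [hi])
            (by simp [hj])]
    rw [this]
    unfold slater
    have h := Matrix.det_permute' (Equiv.swap i j)
      (Matrix.of fun (k : K) (i : K) => planeWave ℓ k.1 (X (α, i)))
    rw [Equiv.Perm.sign_swap hij] at h
    simp only [Units.val_neg, Units.val_one, Int.cast_neg, Int.cast_one, neg_mul, one_mul] at h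
    rw [← h]
    rfl
  · refine Finset.prod_congr rfl fun β hβ => ?_
    have hβ : β ≠ α := Finset.ne_of_mem_erase hβ
    congr 1
    ext1 k
    simp only [Function.comp_apply]
    rw [Equiv.swap_apply_of_ne_of_ne (by simp [hβ]) (by simp [hβ])]

end FreeState

section JastrowGradient

variable {S O : Type*} [Fintype S] [DecidableEq S] [Fintype O] [DecidableEq O]

/-- The sum of a translation-invariant pair function over pairs of different species. -/
def pairSum (ω : R3 → ℝ) (X : S × O → R3) : ℝ :=
  ∑ a : S × O, ∑ b : S × O, if a.1 ≠ b.1 then ω (X a - X b) else 0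

/-- The square root of the Jastrow factor. -/
def jastrowRoot (ω : R3 → ℝ) (X : S × O → R3) : ℝ := exp (-((1 / 4) * pairSum ω X))

/-- The force on the particle `a` exerted by the particles of the other species. -/
def force (ω : R3 → ℝ) (X : S × O → R3) (a : S × O) (j : Fin 3) : ℝ :=
  ∑ b : S × O, if b.1 ≠ a.1 then fderiv ℝ ω (X a - X b) (EuclideanSpace.single j 1) else 0

theorem jastrowRoot_sq (ω : R3 → ℝ) (X : S × O → R3) :
    jastrowRoot ω X ^ 2 = jastrow (fun x y => ω (x - y)) fun α i => X (α, i) := by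
  rw [jastrowRoot, ← exp_nat_mul, jastrow]
  congr 1
  have : crossSum (fun x y => ω (x - y)) (fun α i => X (α, i)) = pairSum ω X := rfl
  rw [this]
  push_cast
  ring

theorem contDiff_pairSum {ω : R3 → ℝ} (hω : ContDiff ℝ (⊤ : ℕ∞) ω) :
    ContDiff ℝ (⊤ : ℕ∞) (pairSum (S := S) (O := O) ω) := by
  refine ContDiff.sum fun a _ => ContDiff.sum fun b _ => ?_
  split_ifs
  · exact hω.comp ((contDiff_apply ℝ R3 a).sub (contDiff_apply ℝ R3 b))
  · exact contDiff_const

theorem contDiff_jastrowRoot {ω : R3 → ℝ} (hω : ContDiff ℝ (⊤ : ℕ∞) ω) :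
    ContDiff ℝ (⊤ : ℕ∞) (jastrowRoot (S := S) (O := O) ω) :=
  Real.contDiff_exp.comp (contDiff_const.mul (contDiff_pairSum hω)).neg

theorem fderiv_pairSum {ω : R3 → ℝ} (hω : ContDiff ℝ (⊤ : ℕ∞) ω) (X V : S × O → R3) :
    fderiv ℝ (pairSum ω) X V =
      ∑ a : S × O, ∑ b : S × O, if a.1 ≠ b.1 then fderiv ℝ ω (X a - X b) (V a - V b) else 0 := by
  have h : HasFDerivAt (pairSum ω) (∑ a : S × O, ∑ b : S × O,
      if a.1 ≠ b.1 then (fderiv ℝ ω (X a - X b)).comp ((ContinuousLinearMap.proj a :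
        (S × O → R3) →L[ℝ] R3) - ContinuousLinearMap.proj b) else 0) X := by
    refine HasFDerivAt.fun_sum fun a _ => HasFDerivAt.fun_sum fun b _ => ?_
    split_ifs
    · have h1 : HasFDerivAt (fun X : S × O → R3 => X a - X b) ((ContinuousLinearMap.proj a :
        (S × O → R3) →L[ℝ] R3) - ContinuousLinearMap.proj b) X :=
        ((ContinuousLinearMap.proj a : (S × O → R3) →L[ℝ] R3) -
          ContinuousLinearMap.proj b).hasFDerivAt
      exact ((hω.differentiable (by simp) (X a - X b)).hasFDerivAt).comp X h1
    · exact hasFDerivAt_const _ _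
  rw [h.fderiv]
  simp only [sum_apply]
  refine Finset.sum_congr rfl fun a _ => Finset.sum_congr rfl fun b _ => ?_
  split_ifs <;> simp

theorem fderiv_neg_of_even {ω : R3 → ℝ} (hω : Differentiable ℝ ω) (hs : ∀ x, ω (-x) = ω x)
    (x e : R3) : fderiv ℝ ω (-x) e = -fderiv ℝ ω x e := by
  have h := (hω (- -x)).hasFDerivAt.comp (-x) (hasFDerivAt_id (𝕜 := ℝ) (-x)).neg
  have h2 : (ω ∘ fun y : R3 => -y) = ω := funext hs
  have h3 : HasFDerivAt (ω ∘ fun y : R3 => -y) _ (-x) := h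
  rw [h2] at h3
  rw [h3.fderiv]
  simp

theorem fderiv_pairSum_coordDir {ω : R3 → ℝ} (hω : ContDiff ℝ (⊤ : ℕ∞) ω)
    (hs : ∀ x, ω (-x) = ω x) (X : S × O → R3) (p : (S × O) × Fin 3) :
    fderiv ℝ (pairSum ω) X (coordDir p) = 2 * force ω X p.1 p.2 := by
  obtain ⟨c, j⟩ := p
  set e : R3 := EuclideanSpace.single j 1
  have hsplit : ∀ a b : S × O, (if a.1 ≠ b.1 then
      fderiv ℝ ω (X a - X b) (coordDir (c, j) a - coordDir (c, j) b) else 0) =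
      (if a = c then (if b.1 ≠ c.1 then fderiv ℝ ω (X c - X b) e else 0) else 0) +
      (if b = c then (if a.1 ≠ c.1 then fderiv ℝ ω (X c - X a) e else 0) else 0) := fun a b => by
    have hd : ∀ a : S × O, coordDir (c, j) a = if a = c then e else 0 := fun a => by
      unfold coordDir
      rw [Pi.single_apply]
    rw [map_sub, hd, hd]
    by_cases hab : a.1 = b.1
    · rw [if_neg (by simp [hab])]
      split_ifs with h1 h2 h3 h4 h5 h6 <;> simp_all
    · rw [if_pos hab]
      split_ifs with h1 h2 h3 h4 h5 h6 <;> simp_all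
      rw [← neg_sub, fderiv_neg_of_even (hω.differentiable (by simp)) hs, neg_neg]
  rw [fderiv_pairSum hω]
  simp_rw [hsplit, Finset.sum_add_distrib]
  rw [Finset.sum_eq_single c (fun a _ h => by simp [h]) (by simp)]
  simp only [Finset.sum_ite_eq', Finset.mem_univ, if_true]
  rw [force, two_mul]

theorem fderiv_jastrowRoot_coordDir {ω : R3 → ℝ} (hω : ContDiff ℝ (⊤ : ℕ∞) ω)
    (hs : ∀ x, ω (-x) = ω x) (X : S × O → R3) (p : (S × O) × Fin 3) :
    fderiv ℝ (jastrowRoot ω) X (coordDir p) = -(1 / 2) * jastrowRoot ω X * force ω X p.1 p.2 := by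
  have h1 := ((contDiff_pairSum (S := S) (O := O) hω).differentiable (by simp) X).hasFDerivAt
  have h : HasFDerivAt (jastrowRoot ω) _ X := ((h1.const_mul (1 / 4)).neg).exp
  rw [h.fderiv]
  simp only [smul_apply, neg_apply, smul_eq_mul]
  rw [fderiv_pairSum_coordDir hω hs]
  have h0 : rexp ((-fun y => 1 / 4 * pairSum ω y) X) = jastrowRoot ω X := rfl
  rw [h0]
  ring

theorem sum_force_sq_le (ω : R3 → ℝ) (X : S × O → R3) :
    ∑ p : (S × O) × Fin 3, force ω X p.1 p.2 ^ 2 ≤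
      crossSum (fun x y => realGradSq ω (x - y)) (fun α i => X (α, i)) +
      triSum (fun x y => √(realGradSq ω (x - y))) (fun α i => X (α, i)) := by
  rw [Fintype.sum_prod_type]
  unfold crossSum triSum
  rw [← Finset.sum_add_distrib]
  refine Finset.sum_le_sum fun a _ => ?_
  simp only [force, pow_two, Finset.sum_mul_sum]
  rw [Finset.sum_comm, ← Finset.sum_add_distrib]
  refine Finset.sum_le_sum fun b _ => ?_
  rw [Finset.sum_comm]
  set f : S × O → Fin 3 → ℝ := fun b j => fderiv ℝ ω (X a - X b) (EuclideanSpace.single j 1)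
  have hf : ∀ b, realGradSq ω (X a - X b) = ∑ j, f b j ^ 2 := fun b => rfl
  have hsum : ∀ g : S × O → ℝ, ∑ c, g c = g b + ∑ c, if b ≠ c then g c else 0 := fun g => by
    rw [← Finset.add_sum_erase _ _ (Finset.mem_univ b)]
    congr 1
    rw [← Finset.sum_filter]
    refine Finset.sum_congr ?_ fun _ _ => rfl
    ext c
    simp [eq_comm]
  rw [hsum]
  refine add_le_add ?_ (Finset.sum_le_sum fun c _ => ?_)
  · by_cases hb : b.1 = a.1
    · simp [hb]
    · simp only [ne_eq, hb, Ne.symm hb, not_false_eq_true, if_true]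
      exact le_of_eq (Finset.sum_congr rfl fun j _ => (pow_two _).symm)
  · by_cases hbc : b = c
    · simp [hbc]
    · by_cases hb : b.1 = a.1
      · simp [hb]
      · by_cases hc : c.1 = a.1
        · simp [hc]
        · simp only [ne_eq, hbc, hb, hc, not_false_eq_true, if_true, and_self]
          exact Real.sum_mul_le_sqrt_mul_sqrt Finset.univ (f b) (f c)

theorem sum_fderiv_jastrowRoot_sq_le {ω : R3 → ℝ} (hω : ContDiff ℝ (⊤ : ℕ∞) ω)
    (hs : ∀ x, ω (-x) = ω x) (X : S × O → R3) :
    ∑ p, fderiv ℝ (jastrowRoot ω) X (coordDir p) ^ 2 ≤ (1 / 4) * jastrowRoot ω X ^ 2 *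
      (crossSum (fun x y => realGradSq ω (x - y)) (fun α i => X (α, i)) +
      triSum (fun x y => √(realGradSq ω (x - y))) (fun α i => X (α, i))) := by
  refine le_trans (le_of_eq ?_) (mul_le_mul_of_nonneg_left (sum_force_sq_le ω X) (by positivity))
  rw [Finset.mul_sum]
  refine Finset.sum_congr rfl fun p _ => ?_
  rw [fderiv_jastrowRoot_coordDir hω hs]
  ring

end JastrowGradient

section CutoffGradient

variable {ι : Type*} [Fintype ι] [DecidableEq ι]

theorem cut_nonneg (ℓ d t : ℝ) : 0 ≤ cut ℓ d t := by
  have h : ∀ s, 0 ≤ π / 2 * smoothTransition s ∧ π / 2 * smoothTransition s ≤ π / 2 := fun s =>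
    ⟨mul_nonneg (by positivity) (smoothTransition.nonneg s),
      mul_le_of_le_one_right (by positivity) (smoothTransition.le_one s)⟩
  exact mul_nonneg (sin_nonneg_of_nonneg_of_le_pi (h _).1 ((h _).2.trans (by linarith [pi_pos])))
    (cos_nonneg_of_neg_pi_div_two_le_of_le ((by linarith [pi_pos] : -(π / 2) ≤ 0).trans (h _).1)
      (h _).2)

theorem boxCut_nonneg (ℓ d : ℝ) (x : R3) : 0 ≤ boxCut ℓ d x :=
  Finset.prod_nonneg fun _ _ => cut_nonneg _ _ _

theorem realGradSq_boxCut (ℓ d : ℝ) (x : R3) :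
    realGradSq (boxCut ℓ d) x = boxCut ℓ d x ^ 2 * boxKinetic ℓ d x := by
  rcases eq_or_ne (boxCut ℓ d x) 0 with h | h
  · have hm : IsLocalMin (boxCut ℓ d) x :=
      Filter.Eventually.of_forall fun y => by rw [h]; exact boxCut_nonneg ℓ d y
    rw [h, realGradSq, hm.fderiv_eq_zero]
    simp
  · rw [boxKinetic]
    field_simp

/-- The product of the one-particle cutoffs. -/
def cutProd (ℓ d : ℝ) (X : ι → R3) : ℝ := ∏ a, boxCut ℓ d (X a)

theorem contDiff_cutProd (ℓ d : ℝ) : ContDiff ℝ (⊤ : ℕ∞) (cutProd (ι := ι) ℓ d) :=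
  contDiff_prod fun a _ => (contDiff_boxCut ℓ d).comp (contDiff_apply ℝ R3 a)

theorem fderiv_cutProd (ℓ d : ℝ) (X : ι → R3) (a : ι) (j : Fin 3) :
    fderiv ℝ (cutProd ℓ d) X (coordDir (a, j)) = (∏ b ∈ Finset.univ.erase a, boxCut ℓ d (X b)) *
      fderiv ℝ (boxCut ℓ d) (X a) (EuclideanSpace.single j 1) := by
  have h : ∀ b ∈ Finset.univ, HasFDerivAt (fun X : ι → R3 => boxCut ℓ d (X b))
      ((fderiv ℝ (boxCut ℓ d) (X b)).comp (ContinuousLinearMap.proj b)) X := fun b _ => by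
    have h1 : HasFDerivAt (fun X : ι → R3 => X b)
      (ContinuousLinearMap.proj b : (ι → R3) →L[ℝ] R3) X :=
      (ContinuousLinearMap.proj b : (ι → R3) →L[ℝ] R3).hasFDerivAt
    exact (((contDiff_boxCut ℓ d).differentiable (by simp) (X b)).hasFDerivAt).comp X h1
  have h2 : HasFDerivAt (cutProd ℓ d) _ X := HasFDerivAt.finsetProd h
  rw [h2.fderiv, sum_apply, Finset.sum_eq_single a]
  · simp [coordDir]
  · intro b _ hb
    simp [coordDir, Pi.single_eq_of_ne hb]
  · simp

theorem sum_fderiv_cutProd_sq (ℓ d : ℝ) (X : ι → R3) :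
    ∑ p, fderiv ℝ (cutProd ℓ d) X (coordDir p) ^ 2 =
      cutProd ℓ d X ^ 2 * ∑ a, boxKinetic ℓ d (X a) := by
  rw [Fintype.sum_prod_type, Finset.mul_sum]
  refine Finset.sum_congr rfl fun a _ => ?_
  simp_rw [fderiv_cutProd, mul_pow]
  rw [← Finset.mul_sum, cutProd, ← Finset.mul_prod_erase _ _ (Finset.mem_univ a), mul_pow,
    mul_comm (boxCut ℓ d (X a) ^ 2), mul_assoc, ← realGradSq_boxCut]
  rfl

end CutoffGradient

section StateEnergy

variable {ι : Type*} [Fintype ι] [DecidableEq ι]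

/-- The total pair interaction. -/
def pairPotential (v : R3 → ℝ) (X : ι → R3) : ℝ :=
  (1 / 2) * ∑ a, ∑ b, if a ≠ b then v (X a - X b) else 0

/-- The energy of a spinless wave function. -/
def stateEnergy (v : R3 → ℝ) (Φ : (ι → R3) → ℂ) : ℝ :=
  ∫ X, (∑ i, gradSq (fun y => Φ (Function.update X i y)) (X i)) + pairPotential v X * ‖Φ X‖ ^ 2

theorem pairPotential_nonneg {v : R3 → ℝ} (hv : ∀ x, 0 ≤ v x) (X : ι → R3) :
    0 ≤ pairPotential v X :=
  mul_nonneg (by norm_num) (Finset.sum_nonneg fun a _ => Finset.sum_nonneg fun b _ => by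
    split_ifs
    exacts [hv _, le_rfl])

theorem measurable_pairPotential {v : R3 → ℝ} (hm : Measurable v) :
    Measurable (pairPotential (ι := ι) v) := by
  refine measurable_const.mul (Finset.measurable_sum _ fun a _ =>
    Finset.measurable_sum _ fun b _ => ?_)
  split_ifs
  exacts [hm.comp ((measurable_pi_apply a).sub (measurable_pi_apply b)), measurable_const]

theorem pairPotential_le {v : R3 → ℝ} {C : ℝ} (h0 : 0 ≤ C) (hC : ∀ x, v x ≤ C) (X : ι → R3) :
    pairPotential v X ≤ (1 / 2) * ∑ _a : ι, ∑ _b : ι, C :=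
  mul_le_mul_of_nonneg_left (Finset.sum_le_sum fun a _ => Finset.sum_le_sum fun b _ => by
    split_ifs
    exacts [hC _, h0]) (by norm_num)

theorem integrable_norm_sq {Φ : (ι → R3) → ℂ} (hΦ : Continuous Φ) (hc : HasCompactSupport Φ) :
    Integrable fun X => ‖Φ X‖ ^ 2 :=
  (hΦ.norm.pow 2).integrable_of_hasCompactSupport (hc.mono fun t ht h0 => ht (by simp [h0]))

theorem integrable_pairPotential_mul {v : R3 → ℝ} (hm : Measurable v) (hv : ∀ x, 0 ≤ v x)
    (hb : ∃ C, ∀ x, v x ≤ C) {f : (ι → R3) → ℝ} (hf : Integrable f) :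
    Integrable fun X => pairPotential v X * f X := by
  obtain ⟨C, hC⟩ := hb
  refine hf.bdd_mul (c := (1 / 2) * ∑ _a : ι, ∑ _b : ι, C)
    (measurable_pairPotential hm).aestronglyMeasurable (Filter.Eventually.of_forall fun X => ?_)
  rw [Real.norm_of_nonneg (pairPotential_nonneg hv X)]
  exact pairPotential_le ((hv 0).trans (hC 0)) hC X

theorem integrable_norm_fderiv_sq {Φ : (ι → R3) → ℂ} (hΦ : ContDiff ℝ (⊤ : ℕ∞) Φ)
    (hc : HasCompactSupport Φ) (V : ι → R3) : Integrable fun X => ‖fderiv ℝ Φ X V‖ ^ 2 := by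
  refine (((hΦ.continuous_fderiv (by simp)).clm_apply
    continuous_const).norm.pow 2).integrable_of_hasCompactSupport ((hc.fderiv ℝ).mono
      fun t ht h0 => ht ?_)
  simp [h0]

theorem stateEnergy_eq {v : R3 → ℝ} (hm : Measurable v) (hv : ∀ x, 0 ≤ v x)
    (hb : ∃ C, ∀ x, v x ≤ C) {Φ : (ι → R3) → ℂ} (hΦ : ContDiff ℝ (⊤ : ℕ∞) Φ)
    (hc : HasCompactSupport Φ) :
    stateEnergy v Φ = (∑ p, ∫ X, ‖fderiv ℝ Φ X (coordDir p)‖ ^ 2) +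
      ∫ X, pairPotential v X * ‖Φ X‖ ^ 2 := by
  unfold stateEnergy
  simp_rw [gradSq_update (hΦ.differentiable (by simp))]
  have hsum : ∀ X, ∑ i, ∑ j : Fin 3, ‖fderiv ℝ Φ X (coordDir (i, j))‖ ^ 2 =
      ∑ p, ‖fderiv ℝ Φ X (coordDir p)‖ ^ 2 := fun X => (Fintype.sum_prod_type
      (f := fun p : ι × Fin 3 => ‖fderiv ℝ Φ X (coordDir p)‖ ^ 2)).symm
  simp_rw [hsum]
  rw [integral_add, integral_finsetSum]
  · exact fun p _ => integrable_norm_fderiv_sq hΦ hc _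
  · exact integrable_finsetSum _ fun p _ => integrable_norm_fderiv_sq hΦ hc _
  · exact integrable_pairPotential_mul hm hv hb (integrable_norm_sq hΦ.continuous hc)

end StateEnergy

section SpeciesIntegrable

variable {E : Type*} [MeasurableSpace E] {S O : Type*} [Fintype S] [DecidableEq S] [Fintype O]
  [DecidableEq O] {μ : Measure E} [SigmaFinite μ]

theorem speciesDensity_nonneg {ρ : E → ℝ} (hρ0 : ∀ x, 0 ≤ ρ x) (e : O → E → ℂ) (X : S × O → E) :
    0 ≤ speciesDensity ρ e X :=
  mul_nonneg (Finset.prod_nonneg fun a _ => hρ0 _) (Finset.prod_nonneg fun α _ => by positivity)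

theorem Orbitals.measurable_speciesDensity {γ : Measure E} [IsProbabilityMeasure γ] {ρ : E → ℝ} (hρm : Measurable ρ)
    {e : O → E → ℂ} (he : Orbitals γ e) : Measurable (speciesDensity (S := S) ρ e) := by
  refine (Finset.measurable_prod _ fun a _ => hρm.comp (measurable_pi_apply a)).mul
    (Finset.measurable_prod _ fun α _ => ?_)
  exact he.measurable_density.comp (measurable_pi_lambda _ fun i => measurable_pi_apply _)

theorem Orbitals.integrable_speciesMeasure {ρ : E → ℝ} (hρ0 : ∀ x, 0 ≤ ρ x) (hρm : Measurable ρ)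
    (hρ : Integrable ρ μ) {e : O → E → ℂ}
    [IsProbabilityMeasure (μ.withDensity fun x => ENNReal.ofReal (ρ x))]
    (he : Orbitals (μ.withDensity fun x => ENNReal.ofReal (ρ x)) e) {f : (S → O → E) → ℝ}
    (hf : Integrable f (speciesMeasure S (μ.withDensity fun x => ENNReal.ofReal (ρ x)) e)) :
    Integrable (fun X : S × O → E => speciesDensity ρ e X * f (fun α i => X (α, i)))
      (Measure.pi fun _ => μ) := by
  rw [he.speciesMeasure_eq hρ0 hρm hρ, integrable_map_equiv,
    integrable_withDensity_iff_integrable_smul' (he.measurable_speciesDensity hρm).ennreal_ofReal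
      (by simp)] at hf
  refine hf.congr (Filter.Eventually.of_forall fun X => ?_)
  simp only [ENNReal.toReal_ofReal (speciesDensity_nonneg hρ0 e X), smul_eq_mul]
  rfl

end SpeciesIntegrable

section BoxState

variable {S : Type*} [Fintype S] [DecidableEq S]

/-- The correlated Slater state in a box. -/
def boxState (S : Type*) [Fintype S] [DecidableEq S] (ℓ d : ℝ) (K : Finset (Fin 3 → ℤ))
    (ω : R3 → ℝ) (c : ℝ) (X : S × K → R3) : ℂ :=
  (c * (jastrowRoot ω X * cutProd ℓ d X)) • freeState S ℓ K X

theorem contDiff_boxFactor (ℓ d : ℝ) {K : Finset (Fin 3 → ℤ)} {ω : R3 → ℝ}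
    (hω : ContDiff ℝ (⊤ : ℕ∞) ω) (c : ℝ) :
    ContDiff ℝ (⊤ : ℕ∞) fun X : S × K → R3 => c * (jastrowRoot ω X * cutProd ℓ d X) :=
  contDiff_const.mul ((contDiff_jastrowRoot hω).mul (contDiff_cutProd ℓ d))

theorem contDiff_boxState (ℓ d : ℝ) (K : Finset (Fin 3 → ℤ)) {ω : R3 → ℝ}
    (hω : ContDiff ℝ (⊤ : ℕ∞) ω) (c : ℝ) : ContDiff ℝ (⊤ : ℕ∞) (boxState S ℓ d K ω c) :=
  (contDiff_boxFactor ℓ d hω c).smul (contDiff_freeState ℓ K)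

theorem hasCompactSupport_cutProd {ι : Type*} [Fintype ι] (ℓ : ℝ) {d : ℝ} (hd : 0 < d) :
    HasCompactSupport (cutProd (ι := ι) ℓ d) := by
  refine HasCompactSupport.intro (isCompact_univ_pi fun _ : ι =>
    (hasCompactSupport_boxCut (ℓ := ℓ) hd).isCompact) fun X hX => ?_
  simp only [Set.mem_pi, Set.mem_univ, true_imp_iff, not_forall] at hX
  obtain ⟨a, ha⟩ := hX
  exact Finset.prod_eq_zero (Finset.mem_univ a) (image_eq_zero_of_notMem_tsupport ha)

theorem hasCompactSupport_boxFactor (ℓ : ℝ) {d : ℝ} (hd : 0 < d) {K : Finset (Fin 3 → ℤ)}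
    (ω : R3 → ℝ) (c : ℝ) :
    HasCompactSupport fun X : S × K → R3 => c * (jastrowRoot ω X * cutProd ℓ d X) :=
  (hasCompactSupport_cutProd ℓ hd).mono fun X hX h0 => hX (by simp [h0])

theorem jastrowRoot_swap {O : Type*} [Fintype O] [DecidableEq O] (ω : R3 → ℝ) {a b : S × O}
    (hs : a.1 = b.1) (X : S × O → R3) :
    jastrowRoot ω (X ∘ Equiv.swap a b) = jastrowRoot ω X := by
  have h1 : ∀ c : S × O, (Equiv.swap a b c).1 = c.1 := fun c => by
    rw [Equiv.swap_apply_def]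
    split_ifs with h h
    · rw [h, hs]
    · rw [h, hs]
    · rfl
  unfold jastrowRoot pairSum
  congr 3
  rw [← Equiv.sum_comp (Equiv.swap a b) fun c => ∑ c', if c.1 ≠ c'.1 then ω (X c - X c') else 0]
  refine Finset.sum_congr rfl fun c _ => ?_
  rw [← Equiv.sum_comp (Equiv.swap a b) fun c' => if (Equiv.swap a b c).1 ≠ c'.1 then
    ω (X (Equiv.swap a b c) - X c') else 0]
  simp only [h1, Function.comp_apply]

theorem cutProd_comp {ι : Type*} [Fintype ι] (ℓ d : ℝ) (σ : Equiv.Perm ι) (X : ι → R3) :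
    cutProd ℓ d (X ∘ σ) = cutProd ℓ d X :=
  Equiv.prod_comp σ fun a => boxCut ℓ d (X a)

theorem boxState_swap (ℓ d : ℝ) (K : Finset (Fin 3 → ℤ)) (ω : R3 → ℝ) (c : ℝ) {a b : S × K}
    (hab : a ≠ b) (hs : a.1 = b.1) (X : S × K → R3) :
    boxState S ℓ d K ω c (X ∘ Equiv.swap a b) = -boxState S ℓ d K ω c X := by
  unfold boxState
  rw [freeState_swap ℓ K hab hs, jastrowRoot_swap ω hs, cutProd_comp, smul_neg]

theorem mem_Ioo_of_boxState_ne_zero {ℓ d : ℝ} (hd : 0 < d) {K : Finset (Fin 3 → ℤ)} {ω : R3 → ℝ}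
    {c : ℝ} {X : S × K → R3} (h : boxState S ℓ d K ω c X ≠ 0) (a : S × K) (j : Fin 3) :
    X a j ∈ Set.Ioo 0 (ℓ + d) := by
  refine mem_Ioo_of_boxCut_ne_zero hd (fun h0 => h ?_) j
  rw [boxState, cutProd, Finset.prod_eq_zero (Finset.mem_univ a) h0]
  simp

theorem speciesDensity_box (ℓ d : ℝ) (K : Finset (Fin 3 → ℤ)) (X : S × K → R3) :
    speciesDensity (fun x => boxCut ℓ d x ^ 2 / ℓ ^ 3) (fun k : K => planeWave ℓ k.1) X =
      ((∏ _a : S × K, ℓ ^ 3) * ∏ _α : S, ((Fintype.card K).factorial : ℝ))⁻¹ *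
        (cutProd ℓ d X ^ 2 * ‖freeState S ℓ K X‖ ^ 2) := by
  rw [speciesDensity, Finset.prod_div_distrib, Finset.prod_div_distrib, Finset.prod_pow,
    Finset.prod_pow, Finset.prod_pow, freeState, norm_prod, cutProd, mul_inv]
  ring

theorem crossSum_add_smul {E O : Type*} [Fintype O] [DecidableEq O] (A B : E → E → ℝ) (s t : ℝ)
    (Y : S → O → E) :
    crossSum (fun x y => s * A x y + t * B x y) Y = s * crossSum A Y + t * crossSum B Y := by
  unfold crossSum
  simp only [Finset.mul_sum]
  simp only [← Finset.sum_add_distrib]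
  refine Finset.sum_congr rfl fun a _ => Finset.sum_congr rfl fun b _ => ?_
  split_ifs <;> simp

theorem pairPotential_prod {O : Type*} [Fintype O] [DecidableEq O] (v : R3 → ℝ)
    (X : S × O → R3) :
    pairPotential v X = (1 / 2) * crossSum (fun x y => v (x - y)) (fun α i => X (α, i)) +
      (1 / 2) * selfSum (fun x y => v (x - y)) fun α i => X (α, i) := by
  have h : selfSum (fun x y => v (x - y)) (fun α i => X (α, i)) =
      ∑ a : S × O, ∑ b : S × O, if a.1 = b.1 ∧ a ≠ b then v (X a - X b) else 0 := by
    unfold selfSum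
    rw [Fintype.sum_prod_type]
    refine Finset.sum_congr rfl fun α _ => Finset.sum_congr rfl fun i _ => ?_
    rw [Fintype.sum_prod_type, Finset.sum_eq_single α]
    · refine Finset.sum_congr rfl fun j _ => ?_
      simp
    · intro β _ hβ
      refine Finset.sum_eq_zero fun j _ => ?_
      simp [hβ.symm]
    · simp
  rw [h, ← mul_add, pairPotential]
  unfold crossSum
  congr 1
  rw [← Finset.sum_add_distrib]
  refine Finset.sum_congr rfl fun a _ => ?_
  rw [← Finset.sum_add_distrib]
  refine Finset.sum_congr rfl fun b _ => ?_
  by_cases h1 : a.1 = b.1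
  · simp [h1]
  · have : a ≠ b := fun h => h1 (by rw [h])
    simp [h1, this]

theorem sum_fderiv_boxFactor_sq_le (ℓ d : ℝ) {K : Finset (Fin 3 → ℤ)} {ω : R3 → ℝ}
    (hω : ContDiff ℝ (⊤ : ℕ∞) ω) (hs : ∀ x, ω (-x) = ω x) (c : ℝ) {η : ℝ} (hη : 0 < η)
    (X : S × K → R3) :
    ∑ p, fderiv ℝ (fun X : S × K → R3 => c * (jastrowRoot ω X * cutProd ℓ d X)) X (coordDir p) ^ 2 ≤
      (c * cutProd ℓ d X) ^ 2 * (jastrowRoot ω X ^ 2 * ((1 + η) * (1 / 4) *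
        (crossSum (fun x y => realGradSq ω (x - y)) (fun α i => X (α, i)) +
          triSum (fun x y => √(realGradSq ω (x - y))) (fun α i => X (α, i))) +
        (1 + 1 / η) * ∑ a, boxKinetic ℓ d (X a))) := by
  have hF := (contDiff_jastrowRoot (S := S) (O := K) hω).differentiable (by simp) X
  have hθ := (contDiff_cutProd (ι := S × K) ℓ d).differentiable (by simp) X
  have hd : ∀ p, fderiv ℝ (fun X : S × K → R3 => c * (jastrowRoot ω X * cutProd ℓ d X)) X
      (coordDir p) = c * (cutProd ℓ d X * fderiv ℝ (jastrowRoot ω) X (coordDir p) +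
        jastrowRoot ω X * fderiv ℝ (cutProd ℓ d) X (coordDir p)) := fun p => by
    have h : HasFDerivAt (fun X : S × K → R3 => c * (jastrowRoot ω X * cutProd ℓ d X)) _ X :=
      (hF.hasFDerivAt.mul hθ.hasFDerivAt).const_mul c
    rw [h.fderiv]
    simp only [smul_apply, add_apply, smul_eq_mul]
    ring
  have hpt : ∀ x y : ℝ, (x + y) ^ 2 ≤ (1 + η) * x ^ 2 + (1 + 1 / η) * y ^ 2 := fun x y => by
    have := norm_add_sq_le_weighted x y hη
    simpa only [Real.norm_eq_abs, sq_abs] using this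
  calc _ ≤ ∑ p, c ^ 2 * ((1 + η) * (cutProd ℓ d X * fderiv ℝ (jastrowRoot ω) X (coordDir p)) ^ 2 +
        (1 + 1 / η) * (jastrowRoot ω X * fderiv ℝ (cutProd ℓ d) X (coordDir p)) ^ 2) := by
        refine Finset.sum_le_sum fun p _ => ?_
        rw [hd, mul_pow]
        exact mul_le_mul_of_nonneg_left (hpt _ _) (sq_nonneg _)
    _ = c ^ 2 * ((1 + η) * (cutProd ℓ d X ^ 2 *
          ∑ p, fderiv ℝ (jastrowRoot ω) X (coordDir p) ^ 2) + (1 + 1 / η) *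
          (jastrowRoot ω X ^ 2 * ∑ p, fderiv ℝ (cutProd ℓ d) X (coordDir p) ^ 2)) := by
        simp only [mul_pow, Finset.mul_sum, ← Finset.sum_add_distrib]
    _ ≤ c ^ 2 * ((1 + η) * (cutProd ℓ d X ^ 2 * ((1 / 4) * jastrowRoot ω X ^ 2 *
      (crossSum (fun x y => realGradSq ω (x - y)) (fun α i => X (α, i)) +
      triSum (fun x y => √(realGradSq ω (x - y))) (fun α i => X (α, i))))) + (1 + 1 / η) *
          (jastrowRoot ω X ^ 2 * (cutProd ℓ d X ^ 2 * ∑ a, boxKinetic ℓ d (X a)))) := by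
        rw [sum_fderiv_cutProd_sq]
        have := sum_fderiv_jastrowRoot_sq_le hω hs X
        gcongr
    _ = _ := by ring

end BoxState

section BoxEnergy

variable {S : Type*} [Fintype S] [DecidableEq S]

theorem realGradSq_neg {ω : R3 → ℝ} (hω : Differentiable ℝ ω) (hs : ∀ x, ω (-x) = ω x) (x : R3) :
    realGradSq ω (-x) = realGradSq ω x := by
  unfold realGradSq
  refine Finset.sum_congr rfl fun j _ => ?_
  rw [fderiv_neg_of_even hω hs, neg_sq]

theorem hasCompactSupport_realGradSq {ω : R3 → ℝ} (hc : HasCompactSupport ω) :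
    HasCompactSupport (realGradSq ω) :=
  (hc.fderiv ℝ).mono fun x hx h0 => hx (by simp [realGradSq, h0])

theorem exists_le_of_hasCompactSupport {f : R3 → ℝ} (hf : Continuous f)
    (hc : HasCompactSupport f) : ∃ C, ∀ x, f x ≤ C := by
  obtain ⟨C, hC⟩ := hf.bounded_above_of_compact_support hc
  exact ⟨C, fun x => (le_abs_self _).trans (hC x)⟩

theorem integrable_boxDensity {ℓ d : ℝ} (hd : 0 < d) :
    Integrable fun x => boxCut ℓ d x ^ 2 / ℓ ^ 3 :=
  Integrable.div_const (Continuous.integrable_of_hasCompactSupport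
    ((contDiff_boxCut ℓ d).continuous.pow 2)
    ((hasCompactSupport_boxCut (ℓ := ℓ) hd).mono fun t ht h0 => ht (by simp [h0]))) _

/-- The interaction observable whose expectation bounds the energy of the box state. -/
def boxObservable (ℓ d : ℝ) {O : Type*} [Fintype O] [DecidableEq O] (v ω : R3 → ℝ) (η : ℝ)
    (Y : S → O → R3) : ℝ :=
  jastrow (fun x y => ω (x - y)) Y * (∑ a : S × O, (1 + 1 / η) * boxKinetic ℓ d (Y a.1 a.2) +
    (1 / 2) * crossSum (fun x y => (1 + η) * ((1 / 2) * realGradSq ω (x - y) + v (x - y))) Y) +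
  ((1 + η) / 4 * triSum (fun x y => √(realGradSq ω (x - y))) Y +
    (1 / 2) * selfSum (fun x y => v (x - y)) Y)

theorem selfSum_nonneg {E O : Type*} [Fintype O] [DecidableEq O] {A : E → E → ℝ}
    (hA : ∀ x y, 0 ≤ A x y) (Y : S → O → E) : 0 ≤ selfSum A Y :=
  Finset.sum_nonneg fun α _ => Finset.sum_nonneg fun i _ => Finset.sum_nonneg fun j _ => by
    split_ifs
    exacts [hA _ _, le_rfl]

theorem triSum_nonneg {E O : Type*} [Fintype O] [DecidableEq O] {A : E → E → ℝ}
    (hA : ∀ x y, 0 ≤ A x y) (Y : S → O → E) : 0 ≤ triSum A Y :=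
  Finset.sum_nonneg fun α _ => Finset.sum_nonneg fun i _ => Finset.sum_nonneg fun j _ => by
    split_ifs
    exacts [mul_nonneg (hA _ _) (hA _ _), le_rfl]

theorem boxFactor_energy_le (ℓ d : ℝ) {K : Finset (Fin 3 → ℤ)} {v ω : R3 → ℝ}
    (hv : ∀ x, 0 ≤ v x) (hω : ContDiff ℝ (⊤ : ℕ∞) ω) (h0 : ∀ x, 0 ≤ ω x)
    (hs : ∀ x, ω (-x) = ω x) (c : ℝ) {η : ℝ} (hη : 0 < η) (X : S × K → R3) :
    ∑ p, fderiv ℝ (fun X : S × K → R3 => c * (jastrowRoot ω X * cutProd ℓ d X)) X (coordDir p) ^ 2 +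
      pairPotential v X * (c * (jastrowRoot ω X * cutProd ℓ d X)) ^ 2 ≤
      (c * cutProd ℓ d X) ^ 2 * boxObservable ℓ d v ω η fun α i => X (α, i) := by
  set Y : S → K → R3 := fun α i => X (α, i) with hY
  have hX : ∑ a : S × K, (1 + 1 / η) * boxKinetic ℓ d (Y a.1 a.2) =
      (1 + 1 / η) * ∑ a, boxKinetic ℓ d (X a) := (Finset.mul_sum _ _ _).symm
  have hg : crossSum (fun x y => (1 + η) * ((1 / 2) * realGradSq ω (x - y) + v (x - y))) Y =
      (1 + η) * (1 / 2) * crossSum (fun x y => realGradSq ω (x - y)) Y +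
        (1 + η) * crossSum (fun x y => v (x - y)) Y := by
    rw [← crossSum_add_smul]
    congr 1
    ext x y
    ring
  have hJ1 : jastrow (fun x y => ω (x - y)) Y ≤ 1 := jastrow_le_one (fun x y => h0 _) Y
  have hJ0 : 0 ≤ jastrow (fun x y => ω (x - y)) Y := jastrow_nonneg _ Y
  have hcv : 0 ≤ crossSum (fun x y => v (x - y)) Y := crossSum_nonneg (fun x y => hv _) Y
  have hself : 0 ≤ selfSum (fun x y => v (x - y)) Y := selfSum_nonneg (fun x y => hv _) Y
  have htri : 0 ≤ triSum (fun x y => √(realGradSq ω (x - y))) Y :=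
    triSum_nonneg (fun x y => Real.sqrt_nonneg _) Y
  have hmain := add_le_add (sum_fderiv_boxFactor_sq_le ℓ d hω hs c hη X)
    (le_refl (pairPotential v X * (c * (jastrowRoot ω X * cutProd ℓ d X)) ^ 2))
  rw [← mul_left_comm (jastrowRoot ω X), mul_pow (jastrowRoot ω X), pairPotential_prod,
    jastrowRoot_sq] at hmain
  rw [← mul_left_comm (jastrowRoot ω X), mul_pow (jastrowRoot ω X), pairPotential_prod,
    jastrowRoot_sq]
  refine hmain.trans ?_
  refine (le_of_eq ?_ : _ ≤ (c * cutProd ℓ d X) ^ 2 *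
    (jastrow (fun x y => ω (x - y)) Y * ((1 + η) * (1 / 4) *
    (crossSum (fun x y => realGradSq ω (x - y)) Y + triSum (fun x y => √(realGradSq ω (x - y))) Y) +
      (1 + 1 / η) * ∑ a, boxKinetic ℓ d (X a)) + jastrow (fun x y => ω (x - y)) Y *
      ((1 / 2) * crossSum (fun x y => v (x - y)) Y +
        (1 / 2) * selfSum (fun x y => v (x - y)) Y))).trans ?_
  · ring
  refine mul_le_mul_of_nonneg_left ?_ (sq_nonneg _)
  unfold boxObservable
  rw [hX, hg]
  have h1 := mul_le_mul_of_nonneg_right hJ1 (mul_nonneg (by positivity : 0 ≤ (1 + η) / 4) htri)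
  have h2 := mul_le_mul_of_nonneg_right hJ1 (mul_nonneg (by norm_num : (0:ℝ) ≤ 1 / 2) hself)
  have h3 := mul_nonneg hJ0 (mul_nonneg (mul_nonneg hη.le (by norm_num : (0:ℝ) ≤ 1 / 2)) hcv)
  linear_combination h1 + h2 + h3

end BoxEnergy

section BoxEnergyBound

variable {S : Type*} [Fintype S] [DecidableEq S]

theorem norm_boxState_sq (ℓ d : ℝ) (K : Finset (Fin 3 → ℤ)) (ω : R3 → ℝ) (c : ℝ)
    (X : S × K → R3) : ‖boxState S ℓ d K ω c X‖ ^ 2 =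
      (c * (jastrowRoot ω X * cutProd ℓ d X)) ^ 2 * ‖freeState S ℓ K X‖ ^ 2 := by
  rw [boxState, norm_smul, mul_pow, Real.norm_eq_abs, sq_abs]

/-- The normalisation of the Slater densities in a box. -/
def boxNorm (S : Type*) [Fintype S] (ℓ : ℝ) (K : Finset (Fin 3 → ℤ)) : ℝ :=
  (∏ _a : S × K, ℓ ^ 3) * ∏ _α : S, ((Fintype.card K).factorial : ℝ)

theorem integral_species_box {ℓ d : ℝ} (hd : 0 < d) (hdl : d ≤ ℓ) (K : Finset (Fin 3 → ℤ))
    (f : (S → K → R3) → ℝ) :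
    ∫ Y, f Y ∂speciesMeasure S (boxMeasure ℓ d) (fun (k : K) => planeWave ℓ k.1) =
      ∫ X : S × K → R3, (boxNorm S ℓ K)⁻¹ * (cutProd ℓ d X ^ 2 * ‖freeState S ℓ K X‖ ^ 2) *
        f (fun α i => X (α, i)) := by
  have hl : 0 < ℓ := hd.trans_le hdl
  have hp : IsProbabilityMeasure (volume.withDensity fun x : R3 =>
      ENNReal.ofReal (boxCut ℓ d x ^ 2 / ℓ ^ 3)) := isProbabilityMeasure_boxMeasure hd hdl
  have he := orbitals_planeWave hd hdl K
  have h := he.integral_speciesMeasure (S := S) (fun x => by positivity)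
    (((measurable_boxCut ℓ d).pow_const 2).div_const _) (integrable_boxDensity hd) f
  simp only [speciesDensity_box] at h
  exact h

theorem integrable_species_box {ℓ d : ℝ} (hd : 0 < d) (hdl : d ≤ ℓ) (K : Finset (Fin 3 → ℤ))
    {f : (S → K → R3) → ℝ}
    (hf : Integrable f (speciesMeasure S (boxMeasure ℓ d) (fun (k : K) => planeWave ℓ k.1))) :
    Integrable fun X : S × K → R3 => (boxNorm S ℓ K)⁻¹ *
      (cutProd ℓ d X ^ 2 * ‖freeState S ℓ K X‖ ^ 2) * f (fun α i => X (α, i)) := by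
  have hl : 0 < ℓ := hd.trans_le hdl
  have hp : IsProbabilityMeasure (volume.withDensity fun x : R3 =>
      ENNReal.ofReal (boxCut ℓ d x ^ 2 / ℓ ^ 3)) := isProbabilityMeasure_boxMeasure hd hdl
  have he := orbitals_planeWave hd hdl K
  have h := he.integrable_speciesMeasure (S := S) (fun x => by positivity)
    (((measurable_boxCut ℓ d).pow_const 2).div_const _) (integrable_boxDensity hd) hf
  simp only [speciesDensity_box] at h
  exact h

theorem pairBound_correlation {ω : R3 → ℝ} {ℓ : ℝ} (hl : 0 < ℓ) (d : ℝ)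
    (hω : ContDiff ℝ (⊤ : ℕ∞) ω) (hc : HasCompactSupport ω) (h0 : ∀ x, 0 ≤ ω x)
    (hs : ∀ x, ω (-x) = ω x) :
    PairBound (boxMeasure ℓ d) (fun x y => ω (x - y)) ((∫ x, ω x) / ℓ ^ 3) :=
  pairBound_boxMeasure hl d hω.continuous.measurable h0 hs
    (exists_le_of_hasCompactSupport hω.continuous hc)
    (hω.continuous.integrable_of_hasCompactSupport hc)

theorem pairBound_gradient {ω : R3 → ℝ} {ℓ : ℝ} (hl : 0 < ℓ) (d : ℝ)
    (hω : ContDiff ℝ (⊤ : ℕ∞) ω) (hc : HasCompactSupport ω) (hs : ∀ x, ω (-x) = ω x) :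
    PairBound (boxMeasure ℓ d) (fun x y => √(realGradSq ω (x - y)))
      ((∫ x, √(realGradSq ω x)) / ℓ ^ 3) := by
  have hgc : Continuous (realGradSq ω) := continuous_realGradSq hω
  have hgs : HasCompactSupport fun x => √(realGradSq ω x) :=
    (hasCompactSupport_realGradSq hc).mono fun x hx h1 => hx (by simp [h1])
  exact pairBound_boxMeasure hl d (f := fun x => √(realGradSq ω x)) hgc.sqrt.measurable
    (fun x => Real.sqrt_nonneg _)
    (fun x => by rw [realGradSq_neg (hω.differentiable (by simp)) hs])
    (exists_le_of_hasCompactSupport hgc.sqrt hgs) (hgc.sqrt.integrable_of_hasCompactSupport hgs)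

theorem Scattering.pairBound_potential {v φ : R3 → ℝ} {R0 a : ℝ} (Sc : Scattering v φ R0 a)
    {ℓ : ℝ} (hl : 0 < ℓ) (d : ℝ) :
    PairBound (boxMeasure ℓ d) (fun x y => v (x - y)) ((∫ x, v x) / ℓ ^ 3) :=
  pairBound_boxMeasure hl d Sc.v_meas Sc.v_nonneg (fun x => Sc.v_radial _ _ (norm_neg x))
    Sc.v_bdd Sc.integrable_v

theorem Scattering.pairBound_energy {v φ ω : R3 → ℝ} {R0 a : ℝ} (Sc : Scattering v φ R0 a)
    {ℓ : ℝ} (hl : 0 < ℓ) (d : ℝ) (hω : ContDiff ℝ (⊤ : ℕ∞) ω) (hc : HasCompactSupport ω)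
    (hs : ∀ x, ω (-x) = ω x) {η : ℝ} (hη : 0 ≤ η) :
    PairBound (boxMeasure ℓ d)
      (fun x y => (1 + η) * ((1 / 2) * realGradSq ω (x - y) + v (x - y)))
      ((∫ x, (1 + η) * ((1 / 2) * realGradSq ω x + v x)) / ℓ ^ 3) := by
  have hgc : Continuous (realGradSq ω) := continuous_realGradSq hω
  have hgs := hasCompactSupport_realGradSq hc
  refine pairBound_boxMeasure hl d
    (f := fun x => (1 + η) * ((1 / 2) * realGradSq ω x + v x))
    (measurable_const.mul ((measurable_const.mul hgc.measurable).add Sc.v_meas))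
    (fun x => mul_nonneg (by positivity) (add_nonneg (mul_nonneg (by norm_num)
      (realGradSq_nonneg _ _)) (Sc.v_nonneg x)))
    (fun x => by rw [realGradSq_neg (hω.differentiable (by simp)) hs,
      Sc.v_radial _ _ (norm_neg x)]) ?_
    (((hgc.integrable_of_hasCompactSupport hgs).const_mul _).add Sc.integrable_v |>.const_mul _)
  obtain ⟨C, hC⟩ := Sc.v_bdd
  obtain ⟨C', hC'⟩ := exists_le_of_hasCompactSupport hgc hgs
  refine ⟨(1 + η) * ((1 / 2) * C' + C), fun x => ?_⟩
  have := hC x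
  have := hC' x
  gcongr

theorem exists_boxState_energy_le {v φ ω : R3 → ℝ} {R0 a : ℝ} (Sc : Scattering v φ R0 a)
    (hω : ContDiff ℝ (⊤ : ℕ∞) ω) (hc : HasCompactSupport ω) (h0 : ∀ x, 0 ≤ ω x)
    (hs : ∀ x, ω (-x) = ω x) {ℓ d : ℝ} (hd : 0 < d) (hdl : d ≤ ℓ) (K : Finset (Fin 3 → ℤ))
    {η : ℝ} (hη : 0 < η) :
    0 < ∫ Y, jastrow (fun x y => ω (x - y)) Y
      ∂speciesMeasure S (boxMeasure ℓ d) (fun (k : K) => planeWave ℓ k.1) ∧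
    Integrable (boxObservable (S := S) ℓ d v ω η)
      (speciesMeasure S (boxMeasure ℓ d) (fun (k : K) => planeWave ℓ k.1)) ∧
    ∃ c, ∫ X, ‖boxState S ℓ d K ω c X‖ ^ 2 = 1 ∧ stateEnergy v (boxState S ℓ d K ω c) ≤
      Fintype.card S * ((2 * π / ℓ) ^ 2 * ∑ k ∈ K, ∑ j, (k j : ℝ) ^ 2) +
      (∫ Y, jastrow (fun x y => ω (x - y)) Y
        ∂speciesMeasure S (boxMeasure ℓ d) (fun (k : K) => planeWave ℓ k.1))⁻¹ *
      ∫ Y, boxObservable ℓ d v ω η Y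
        ∂speciesMeasure S (boxMeasure ℓ d) (fun (k : K) => planeWave ℓ k.1) := by
  have hl : 0 < ℓ := hd.trans_le hdl
  have hprob := isProbabilityMeasure_boxMeasure hd hdl
  have he := orbitals_planeWave hd hdl K
  have hPω := pairBound_correlation hl d hω hc h0 hs
  have hPu := pairBound_gradient hl d hω hc hs
  have hPv := Sc.pairBound_potential hl d
  have hPg := Sc.pairBound_energy hl d hω hc hs hη.le
  set P := speciesMeasure S (boxMeasure ℓ d) (fun (k : K) => planeWave ℓ k.1) with hP
  set Z := ∫ Y, jastrow (fun x y => ω (x - y)) Y ∂P with hZ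
  have hZ0 : 0 < Z := (exp_pos _).trans_le (he.le_integral_jastrow hPω)
  have hobs : Integrable (boxObservable (S := S) ℓ d v ω η) P := by
    refine Integrable.add ?_ (((integrable_triSum he hPu).const_mul _).add
      ((integrable_selfSum he hPv).const_mul _))
    have h1 := fun a : S × K => integrable_mainTerm he hPω hPg
      ((integrable_boxKinetic hd hdl).const_mul (1 + 1 / η)) a
    refine (integrable_finsetSum Finset.univ fun a _ => h1 a).congr
      (Filter.Eventually.of_forall fun Y => ?_)
    simp only
    simp only [crossSum_eq_sum_nbSum, Finset.mul_sum, Finset.sum_add_distrib, mul_add]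
  refine ⟨hZ0, hobs, √((boxNorm S ℓ K)⁻¹ * Z⁻¹), ?_⟩
  set c := √((boxNorm S ℓ K)⁻¹ * Z⁻¹) with hcdef
  have hN : 0 < boxNorm S ℓ K := mul_pos (Finset.prod_pos fun _ _ => by positivity)
    (Finset.prod_pos fun _ _ => by positivity)
  have hc2 : c ^ 2 = (boxNorm S ℓ K)⁻¹ * Z⁻¹ := Real.sq_sqrt (by positivity)
  have hnorm : ∫ X, ‖boxState S ℓ d K ω c X‖ ^ 2 = 1 := by
    have h1 := integral_species_box (S := S) hd hdl K (jastrow fun x y => ω (x - y))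
    rw [← hP, ← hZ] at h1
    have h2 : ∀ X : S × K → R3, ‖boxState S ℓ d K ω c X‖ ^ 2 = Z⁻¹ * ((boxNorm S ℓ K)⁻¹ *
        (cutProd ℓ d X ^ 2 * ‖freeState S ℓ K X‖ ^ 2) *
        jastrow (fun x y => ω (x - y)) (fun α i => X (α, i))) := fun X => by
      rw [norm_boxState_sq, mul_pow, hc2, mul_pow, jastrowRoot_sq]
      ring
    simp_rw [h2]
    rw [integral_const_mul, ← h1, inv_mul_cancel₀ hZ0.ne']
  refine ⟨hnorm, ?_⟩
  have hcs : HasCompactSupport (boxState S ℓ d K ω c) :=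
    (hasCompactSupport_boxFactor ℓ hd ω c).smul_right
  rw [stateEnergy_eq Sc.v_meas Sc.v_nonneg Sc.v_bdd (contDiff_boxState ℓ d K hω c) hcs]
  have hkin := sum_integral_norm_fderiv_smul_sq (μ := (volume : Measure (S × K → R3)))
    (contDiff_boxFactor ℓ d hω c) (hasCompactSupport_boxFactor ℓ hd ω c)
    (contDiff_freeState (S := S) ℓ K) coordDir (laplacian_freeState ℓ K)
  have hone : ∫ X : S × K → R3, (c * (jastrowRoot ω X * cutProd ℓ d X)) ^ 2 *
      ‖freeState S ℓ K X‖ ^ 2 = 1 := by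
    rw [← hnorm]
    exact integral_congr_ae (Filter.Eventually.of_forall fun X => (norm_boxState_sq ℓ d K ω c X).symm)
  rw [hone, mul_one] at hkin
  have hkin' : ∑ p, ∫ X, ‖fderiv ℝ (boxState S ℓ d K ω c) X (coordDir p)‖ ^ 2 = _ := hkin
  rw [hkin', add_assoc]
  refine add_le_add le_rfl ?_
  have hu := contDiff_boxFactor (S := S) (K := K) ℓ d hω c
  have hus := hasCompactSupport_boxFactor (S := S) (K := K) ℓ hd ω c
  rw [← integral_add]
  · rw [integral_species_box hd hdl K, ← integral_const_mul]
    refine integral_mono_of_nonneg (Filter.Eventually.of_forall fun X => ?_)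
      ((integrable_species_box hd hdl K hobs).const_mul _) (Filter.Eventually.of_forall fun X => ?_)
    · exact add_nonneg (mul_nonneg (Finset.sum_nonneg fun _ _ => sq_nonneg _) (sq_nonneg _))
        (mul_nonneg (pairPotential_nonneg Sc.v_nonneg _) (sq_nonneg _))
    · simp only
      rw [norm_boxState_sq, ← mul_assoc, ← add_mul]
      refine (mul_le_mul_of_nonneg_right (boxFactor_energy_le ℓ d Sc.v_nonneg hω h0 hs c hη X)
        (sq_nonneg _)).trans (le_of_eq ?_)
      rw [mul_pow, hc2]
      ring
  · refine Continuous.integrable_of_hasCompactSupport ?_ ?_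
    · refine Continuous.mul (continuous_finsetSum _ fun p _ => ?_)
        ((contDiff_freeState ℓ K).continuous.norm.pow 2)
      exact ((hu.continuous_fderiv (by simp)).clm_apply continuous_const).pow 2
    · exact (hus.fderiv ℝ).mono fun X hX h1 => hX (by simp [h1])
  · exact integrable_pairPotential_mul Sc.v_meas Sc.v_nonneg Sc.v_bdd
      (integrable_norm_sq (contDiff_boxState ℓ d K hω c).continuous hcs)

end BoxEnergyBound

section BoxEnergyEstimate

variable {S : Type*} [Fintype S] [DecidableEq S]

theorem Scattering.integral_pairEnergy_le {v φ ω : R3 → ℝ} {R0 a : ℝ} (Sc : Scattering v φ R0 a)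
    (hω : ContDiff ℝ (⊤ : ℕ∞) ω) (hc : HasCompactSupport ω) (h0 : ∀ x, 0 ≤ ω x)
    {J₀ : ℝ} (hJ₀ : ∫ x, ((1 / 2) * realGradSq ω x + v x) * exp (-ω x) ≤ J₀)
    {ℓ : ℝ} (hl : 0 < ℓ) (d : ℝ) {η : ℝ} (hη : 0 ≤ η) (y : R3) :
    ∫ x, (1 + η) * ((1 / 2) * realGradSq ω (x - y) + v (x - y)) * exp (-ω (x - y))
      ∂boxMeasure ℓ d ≤ (1 + η) * J₀ / ℓ ^ 3 := by
  have hgc : Continuous (realGradSq ω) := continuous_realGradSq hω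
  have hgs := hasCompactSupport_realGradSq hc
  have hi : Integrable fun x => ((1 / 2) * realGradSq ω x + v x) * exp (-ω x) := by
    refine Integrable.mul_bdd (c := 1)
      (((hgc.integrable_of_hasCompactSupport hgs).const_mul _).add Sc.integrable_v)
      (hω.continuous.neg.rexp.aestronglyMeasurable) (Filter.Eventually.of_forall fun x => ?_)
    rw [Real.norm_eq_abs, abs_exp]
    exact exp_le_one_iff.2 (neg_nonpos.2 (h0 x))
  have hi2 : Integrable fun x =>
      (1 + η) * (((1 / 2) * realGradSq ω (x - y) + v (x - y)) * exp (-ω (x - y))) :=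
    (hi.comp_sub_right y).const_mul (1 + η)
  simp only [mul_assoc (1 + η)]
  refine (integral_boxMeasure_le hl d (fun x => ?_) hi2).trans ?_
  · exact mul_nonneg (by positivity) (mul_nonneg (add_nonneg (mul_nonneg (by norm_num)
      (realGradSq_nonneg _ _)) (Sc.v_nonneg _)) (exp_pos _).le)
  · rw [integral_const_mul, integral_sub_right_eq_self
      (fun x => ((1 / 2) * realGradSq ω x + v x) * exp (-ω x))]
    gcongr

theorem exists_boxState_energy_bound {v φ ω : R3 → ℝ} {R0 a : ℝ} (Sc : Scattering v φ R0 a)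
    (hω : ContDiff ℝ (⊤ : ℕ∞) ω) (hc : HasCompactSupport ω) (h0 : ∀ x, 0 ≤ ω x)
    (hs : ∀ x, ω (-x) = ω x) {J₀ : ℝ}
    (hJ₀ : ∫ x, ((1 / 2) * realGradSq ω x + v x) * exp (-ω x) ≤ J₀)
    {ℓ d : ℝ} (hd : 0 < d) (hdl : d ≤ ℓ) {K : Finset (Fin 3 → ℤ)} {R : ℝ}
    (hK : ∀ k ∈ K, ∑ j, (k j : ℝ) ^ 2 ≤ R ^ 2) {η δ q m N Ω : ℝ} (hη : 0 < η) (hδ : 0 < δ)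
    (hδ1 : δ < 1) (hq : q = Fintype.card S) (hq1 : 1 ≤ q) (hm : m = K.card) (hN : N = q * m)
    (hΩ : Ω = (∫ x, ω x) / ℓ ^ 3) :
    ∃ c, ∫ X, ‖boxState S ℓ d K ω c X‖ ^ 2 = 1 ∧ stateEnergy v (boxState S ℓ d K ω c) ≤
      q * ((2 * π / ℓ) ^ 2 * ∑ k ∈ K, ∑ j, (k j : ℝ) ^ 2) +
      N * ((1 + 1 / η) * (3 * π ^ 2 * stepEnergy / (d * ℓ)) +
          (1 / 2) * ((q - 1) * m) * ((1 + η) * J₀ / ℓ ^ 3)) *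
        ((1 - δ)⁻¹ + exp (N ^ 2 * Ω) * ((δ ^ 2)⁻¹ * (3 * N ^ 3 * Ω ^ 2))) +
      exp (N ^ 2 * Ω) * ((1 + η) / 4 * (2 * N ^ 3 * ((∫ x, √(realGradSq ω x)) / ℓ ^ 3) ^ 2) +
        (1 / 2) * (N * m * (2 * (2 * π * R / ℓ) ^ 2 * R0 ^ 2 * (∫ x, v x) / ℓ ^ 3))) := by
  obtain ⟨hZ0, hobs, c, hc1, hcE⟩ := exists_boxState_energy_le Sc hω hc h0 hs hd hdl K hη (S := S)
  refine ⟨c, hc1, hcE.trans ?_⟩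
  have hl : 0 < ℓ := hd.trans_le hdl
  have hprob := isProbabilityMeasure_boxMeasure hd hdl
  have he := orbitals_planeWave hd hdl K
  have hPω := pairBound_correlation hl d hω hc h0 hs
  have hPu := pairBound_gradient hl d hω hc hs
  have hPv := Sc.pairBound_potential hl d
  have hPg := Sc.pairBound_energy hl d hω hc hs hη.le
  have hcard : (Fintype.card K : ℝ) = m := by rw [hm, Fintype.card_coe]
  have hZ := he.le_integral_jastrow hPω (S := S)
  have hw : Integrable (fun x => (1 + 1 / η) * boxKinetic ℓ d x) (boxMeasure ℓ d) :=
    (integrable_boxKinetic hd hdl).const_mul _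
  have hmain := he.integral_mainTerm_le hPω hPg hw (fun x => mul_nonneg (by positivity)
    (boxKinetic_nonneg ℓ d x)) (Sc.integral_pairEnergy_le hω hc h0 hJ₀ hl d hη.le) hδ hδ1 (S := S)
  have htri := he.integral_triSum_le hPu (S := S)
  obtain ⟨hvi, hvb⟩ := selfInteraction_boxMeasure_le hd hdl Sc.v_meas Sc.v_nonneg Sc.v_bdd
    Sc.v_supp Sc.integrable_v Sc.R0_pos.le
    (by positivity : 0 ≤ 2 * (2 * π * R / ℓ) ^ 2)
  have hself := he.integral_selfSum_le hPv hvi (fun z => by positivity)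
    (fun k l z => one_sub_exch_planeWave_le hl hK k l z) (S := S)
  have hmi : Integrable (fun Y : S → K → R3 => jastrow (fun x y => ω (x - y)) Y *
      (∑ a : S × K, (1 + 1 / η) * boxKinetic ℓ d (Y a.1 a.2) + (1 / 2) * crossSum
        (fun x y => (1 + η) * ((1 / 2) * realGradSq ω (x - y) + v (x - y))) Y))
      (speciesMeasure S (boxMeasure ℓ d) (fun (k : K) => planeWave ℓ k.1)) := by
    have h1 := fun a : S × K => integrable_mainTerm he hPω hPg hw a
    refine (integrable_finsetSum Finset.univ fun a _ => h1 a).congr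
      (Filter.Eventually.of_forall fun Y => ?_)
    simp only [crossSum_eq_sum_nbSum, Finset.mul_sum, Finset.sum_add_distrib, mul_add]
  rw [hcard, ← hq, ← hN, ← hΩ] at hZ
  rw [hcard, ← hq, ← hN] at htri
  rw [hcard, ← hq] at hself
  rw [hcard, ← hq, ← hN, ← hΩ, integral_const_mul] at hmain
  have hts : Integrable (fun Y : S → K → R3 =>
      (1 + η) / 4 * triSum (fun x y => √(realGradSq ω (x - y))) Y +
        (1 / 2) * selfSum (fun x y => v (x - y)) Y)
      (speciesMeasure S (boxMeasure ℓ d) (fun (k : K) => planeWave ℓ k.1)) :=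
    ((integrable_triSum he hPu).const_mul _).add ((integrable_selfSum he hPv).const_mul _)
  unfold boxObservable
  rw [integral_add hmi hts, integral_add
      ((integrable_triSum he hPu).const_mul _) ((integrable_selfSum he hPv).const_mul _),
    integral_const_mul, integral_const_mul, ← hq]
  set P := speciesMeasure S (boxMeasure ℓ d) (fun (k : K) => planeWave ℓ k.1) with hP
  set Z := ∫ Y, jastrow (fun x y => ω (x - y)) Y ∂P with hZd
  have hZi : Z⁻¹ ≤ exp (N ^ 2 * Ω) := by
    rw [← neg_neg (N ^ 2 * Ω), exp_neg]
    exact inv_anti₀ (exp_pos _) hZ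
  have hm0 : 0 ≤ m := by rw [hm]; positivity
  have hN0 : 0 ≤ N := by rw [hN]; positivity
  have hJpos : 0 ≤ J₀ := le_trans (integral_nonneg fun x => mul_nonneg (add_nonneg
    (mul_nonneg (by norm_num) (realGradSq_nonneg _ _)) (Sc.v_nonneg _)) (exp_pos _).le) hJ₀
  have hstep : 0 ≤ stepEnergy := integral_nonneg fun t => sq_nonneg _
  have hV0 : 0 ≤ ∫ x, v x := integral_nonneg Sc.v_nonneg
  have hkin := integral_boxKinetic_le hd hdl
  have hZ0' : 0 ≤ Z⁻¹ := inv_nonneg.2 hZ0.le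
  have hq0 : 0 ≤ q - 1 := by linarith
  have hδ' : 0 ≤ (1 - δ)⁻¹ := inv_nonneg.2 (by linarith)
  rw [mul_add, add_assoc]
  refine add_le_add le_rfl (add_le_add ?_ ?_)
  · calc _ ≤ Z⁻¹ * (q * (m * ((1 + 1 / η) * (3 * π ^ 2 * stepEnergy / (d * ℓ)) +
          1 / 2 * ((q - 1) * m) * ((1 + η) * J₀ / ℓ ^ 3)) *
            ((1 - δ)⁻¹ * Z + (δ ^ 2)⁻¹ * (3 * N ^ 3 * Ω ^ 2)))) := by
          refine mul_le_mul_of_nonneg_left (hmain.trans ?_) hZ0'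
          gcongr
      _ = N * ((1 + 1 / η) * (3 * π ^ 2 * stepEnergy / (d * ℓ)) +
          1 / 2 * ((q - 1) * m) * ((1 + η) * J₀ / ℓ ^ 3)) *
            ((1 - δ)⁻¹ + Z⁻¹ * ((δ ^ 2)⁻¹ * (3 * N ^ 3 * Ω ^ 2))) := by
          rw [hN]
          field_simp
      _ ≤ _ := by gcongr
  · refine mul_le_mul hZi (add_le_add (mul_le_mul_of_nonneg_left htri (by positivity))
      (mul_le_mul_of_nonneg_left (hself.trans ?_) (by norm_num))) ?_ (exp_pos _).le
    · rw [hN]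
      calc _ ≤ q * m ^ 2 * (2 * (2 * π * R / ℓ) ^ 2 * R0 ^ 2 * (∫ x, v x) / ℓ ^ 3) := by
            gcongr
        _ = _ := by ring
    · exact add_nonneg (mul_nonneg (by positivity) (integral_nonneg fun Y => triSum_nonneg
        (fun x y => Real.sqrt_nonneg _) Y)) (mul_nonneg (by norm_num)
        (integral_nonneg fun Y => selfSum_nonneg (fun x y => Sc.v_nonneg _) Y))

end BoxEnergyEstimate

section LabelledStates

variable {ι κ : Type*} [Fintype ι] [DecidableEq ι] [Fintype κ] [DecidableEq κ]

/-- The energy density of a spinless wave function. -/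
def energyDensity (v : R3 → ℝ) (Φ : (ι → R3) → ℂ) (X : ι → R3) : ℝ :=
  (∑ i, gradSq (fun y => Φ (Function.update X i y)) (X i)) + pairPotential v X * ‖Φ X‖ ^ 2

theorem stateEnergy_eq_integral (v : R3 → ℝ) (Φ : (ι → R3) → ℂ) :
    stateEnergy v Φ = ∫ X, energyDensity v Φ X := rfl

theorem gradSq_nonneg (f : R3 → ℂ) (x : R3) : 0 ≤ gradSq f x :=
  Finset.sum_nonneg fun _ _ => sq_nonneg _

theorem energyDensity_nonneg {v : R3 → ℝ} (hv : ∀ x, 0 ≤ v x) (Φ : (ι → R3) → ℂ) (X : ι → R3) :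
    0 ≤ energyDensity v Φ X :=
  add_nonneg (Finset.sum_nonneg fun _ _ => gradSq_nonneg _ _)
    (mul_nonneg (pairPotential_nonneg hv X) (sq_nonneg _))

theorem integrable_energyDensity {v : R3 → ℝ} (hm : Measurable v) (hv : ∀ x, 0 ≤ v x)
    (hb : ∃ C, ∀ x, v x ≤ C) {Φ : (ι → R3) → ℂ} (hΦ : ContDiff ℝ (⊤ : ℕ∞) Φ)
    (hc : HasCompactSupport Φ) : Integrable (energyDensity v Φ) := by
  unfold energyDensity
  simp_rw [gradSq_update (hΦ.differentiable (by simp))]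
  exact (integrable_finsetSum _ fun i _ => integrable_finsetSum _ fun j _ =>
    integrable_norm_fderiv_sq hΦ hc _).add
      (integrable_pairPotential_mul hm hv hb (integrable_norm_sq hΦ.continuous hc))

theorem integral_comp_equiv (e : ι ≃ κ) (f : (ι → R3) → ℝ) :
    ∫ X : κ → R3, f (X ∘ e) = ∫ X, f X := by
  have h := (volume_measurePreserving_piCongrLeft (fun _ : ι => R3) e.symm).integral_comp'
    (g := f)
  rw [← h]
  refine integral_congr_ae (Filter.Eventually.of_forall fun X => ?_)
  simp only
  congr 1
  ext1 i
  have := MeasurableEquiv.piCongrLeft_apply_apply e.symm (β := fun _ : ι => R3) X (e i)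
  simp only [Equiv.symm_apply_apply] at this
  exact this.symm

theorem integrable_comp_equiv (e : ι ≃ κ) {f : (ι → R3) → ℝ} (hf : Integrable f) :
    Integrable fun X : κ → R3 => f (X ∘ e) := by
  have h := (volume_measurePreserving_piCongrLeft (fun _ : ι => R3) e.symm).integrable_comp_of_integrable hf
  refine h.congr (Filter.Eventually.of_forall fun X => ?_)
  simp only [Function.comp]
  congr 1
  ext1 i
  have := MeasurableEquiv.piCongrLeft_apply_apply e.symm (β := fun _ : ι => R3) X (e i)
  simp only [Equiv.symm_apply_apply] at this
  exact this

theorem pairPotential_comp_equiv (v : R3 → ℝ) (e : ι ≃ κ) (X : κ → R3) :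
    pairPotential v (X ∘ e) = pairPotential v X := by
  unfold pairPotential
  congr 1
  refine Fintype.sum_equiv e _ _ fun a => Fintype.sum_equiv e _ _ fun b => ?_
  simp

theorem energyDensity_comp_equiv (v : R3 → ℝ) (e : ι ≃ κ) (Φ : (ι → R3) → ℂ) (X : κ → R3) :
    energyDensity v (fun X => Φ (X ∘ e)) X = energyDensity v Φ (X ∘ e) := by
  unfold energyDensity
  rw [pairPotential_comp_equiv]
  congr 1
  refine (Fintype.sum_equiv e _ _ fun i => ?_).symm
  have h : ∀ y, Function.update X (e i) y ∘ e = Function.update (X ∘ e) i y := fun y => by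
    rw [Function.update_comp_equiv, Equiv.symm_apply_apply]
  simp only [h, Function.comp]

/-- A normalised wave function whose particles carry labels, are localised in a region depending
on the label, and are antisymmetric under the exchange of particles with equal labels. -/
structure LabelledState {Λ : Type*} (reg : Λ → Set R3) (lab : ι → Λ) (Φ : (ι → R3) → ℂ) : Prop where
  smooth : ContDiff ℝ (⊤ : ℕ∞) Φ
  compact : HasCompactSupport Φ
  supp : ∀ X, Φ X ≠ 0 → ∀ i, X i ∈ reg (lab i)
  anti : ∀ i j, i ≠ j → lab i = lab j → ∀ X, Φ (X ∘ Equiv.swap i j) = -Φ X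
  norm : ∫ X, ‖Φ X‖ ^ 2 = 1

theorem gradSq_mul_const (f : R3 → ℂ) (c : ℂ) (hf : Differentiable ℝ f) (x : R3) :
    gradSq (fun y => f y * c) x = gradSq f x * ‖c‖ ^ 2 := by
  unfold gradSq
  rw [Finset.sum_mul]
  refine Finset.sum_congr rfl fun j _ => ?_
  rw [fderiv_mul_const' (hf x)]
  simp [mul_pow, mul_comm]

theorem differentiable_update {Φ : (ι → R3) → ℂ} (hΦ : Differentiable ℝ Φ) (X : ι → R3) (i : ι) :
    Differentiable ℝ fun y => Φ (Function.update X i y) :=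
  fun y => (hΦ _).comp y (hasFDerivAt_update X y).differentiableAt

/-- The product of two states of distinguishable groups of particles. -/
def mergeState (Φ : (ι → R3) → ℂ) (Φ' : (κ → R3) → ℂ) (X : ι ⊕ κ → R3) : ℂ :=
  Φ (X ∘ Sum.inl) * Φ' (X ∘ Sum.inr)

theorem pairPotential_sum {v : R3 → ℝ} (hs : ∀ x, v (-x) = v x) (X : ι ⊕ κ → R3) :
    pairPotential v X = pairPotential v (X ∘ Sum.inl) + pairPotential v (X ∘ Sum.inr) +
      ∑ i, ∑ k, v (X (Sum.inl i) - X (Sum.inr k)) := by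
  have hsw : ∑ k : κ, ∑ i : ι, v (X (Sum.inr k) - X (Sum.inl i)) =
      ∑ i, ∑ k, v (X (Sum.inl i) - X (Sum.inr k)) := by
    rw [Finset.sum_comm]
    refine Finset.sum_congr rfl fun i _ => Finset.sum_congr rfl fun k _ => ?_
    rw [← hs, neg_sub]
  unfold pairPotential
  simp only [Fintype.sum_sum_type, ne_eq, Sum.inl.injEq, Sum.inr.injEq, reduceCtorEq,
    not_false_eq_true, if_true, Finset.sum_add_distrib, Function.comp, hsw]
  ring

theorem energyDensity_merge {v : R3 → ℝ} (hs : ∀ x, v (-x) = v x) {Φ : (ι → R3) → ℂ}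
    {Φ' : (κ → R3) → ℂ} (hΦ : Differentiable ℝ Φ) (hΦ' : Differentiable ℝ Φ') (X : ι ⊕ κ → R3)
    (hsep : Φ (X ∘ Sum.inl) ≠ 0 → Φ' (X ∘ Sum.inr) ≠ 0 →
      ∀ i k, v (X (Sum.inl i) - X (Sum.inr k)) = 0) :
    energyDensity v (mergeState Φ Φ') X =
      energyDensity v Φ (X ∘ Sum.inl) * ‖Φ' (X ∘ Sum.inr)‖ ^ 2 +
      ‖Φ (X ∘ Sum.inl)‖ ^ 2 * energyDensity v Φ' (X ∘ Sum.inr) := by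
  have h1 : ∀ i, gradSq (fun y => mergeState Φ Φ' (Function.update X (Sum.inl i) y)) (X (Sum.inl i)) =
      gradSq (fun y => Φ (Function.update (X ∘ Sum.inl) i y)) ((X ∘ Sum.inl) i) *
        ‖Φ' (X ∘ Sum.inr)‖ ^ 2 := fun i => by
    have h : ∀ y, mergeState Φ Φ' (Function.update X (Sum.inl i) y) =
        Φ (Function.update (X ∘ Sum.inl) i y) * Φ' (X ∘ Sum.inr) := fun y => by
      simp [mergeState, Sum.update_inl_comp_inl, Sum.update_inl_comp_inr]
    simp only [h]
    exact gradSq_mul_const _ _ (differentiable_update hΦ _ i) _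
  have h2 : ∀ k, gradSq (fun y => mergeState Φ Φ' (Function.update X (Sum.inr k) y)) (X (Sum.inr k)) =
      gradSq (fun y => Φ' (Function.update (X ∘ Sum.inr) k y)) ((X ∘ Sum.inr) k) *
        ‖Φ (X ∘ Sum.inl)‖ ^ 2 := fun k => by
    have h : ∀ y, mergeState Φ Φ' (Function.update X (Sum.inr k) y) =
        Φ' (Function.update (X ∘ Sum.inr) k y) * Φ (X ∘ Sum.inl) := fun y => by
      simp [mergeState, Sum.update_inr_comp_inl, Sum.update_inr_comp_inr, mul_comm]
    simp only [h]
    exact gradSq_mul_const _ _ (differentiable_update hΦ' _ k) _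
  have h3 : (∑ i, ∑ k, v (X (Sum.inl i) - X (Sum.inr k))) * ‖mergeState Φ Φ' X‖ ^ 2 = 0 := by
    by_cases hz : mergeState Φ Φ' X = 0
    · simp [hz]
    · have hz1 : Φ (X ∘ Sum.inl) ≠ 0 := left_ne_zero_of_mul hz
      have hz2 : Φ' (X ∘ Sum.inr) ≠ 0 := right_ne_zero_of_mul hz
      simp [hsep hz1 hz2]
  unfold energyDensity
  rw [Fintype.sum_sum_type, pairPotential_sum hs, add_mul, h3]
  simp only [h1, h2, ← Finset.sum_mul]
  rw [mergeState, norm_mul]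
  ring

theorem integral_merge (f : (ι → R3) → ℝ) (g : (κ → R3) → ℝ) :
    ∫ X : ι ⊕ κ → R3, f (X ∘ Sum.inl) * g (X ∘ Sum.inr) = (∫ X, f X) * ∫ X, g X := by
  have h := (volume_measurePreserving_sumPiEquivProdPi (fun _ : ι ⊕ κ => R3)).integral_comp'
    (g := fun z => f z.1 * g z.2)
  rw [← integral_prod_mul]
  exact h

theorem integrable_merge {f : (ι → R3) → ℝ} {g : (κ → R3) → ℝ} (hf : Integrable f)
    (hg : Integrable g) : Integrable fun X : ι ⊕ κ → R3 => f (X ∘ Sum.inl) * g (X ∘ Sum.inr) :=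
  (volume_measurePreserving_sumPiEquivProdPi (fun _ : ι ⊕ κ => R3)).integrable_comp_of_integrable
    (hf.mul_prod hg)

theorem stateEnergy_merge {v : R3 → ℝ} (hm : Measurable v) (hv : ∀ x, 0 ≤ v x)
    (hb : ∃ C, ∀ x, v x ≤ C) (hs : ∀ x, v (-x) = v x) {Λ : Type*} {reg : Λ → Set R3}
    {lab : ι → Λ} {lab' : κ → Λ} {Φ : (ι → R3) → ℂ} {Φ' : (κ → R3) → ℂ}
    (h : LabelledState reg lab Φ) (h' : LabelledState reg lab' Φ')
    (hsep : ∀ i k, ∀ x ∈ reg (lab i), ∀ y ∈ reg (lab' k), v (x - y) = 0) :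
    stateEnergy v (mergeState Φ Φ') = stateEnergy v Φ + stateEnergy v Φ' := by
  simp only [stateEnergy_eq_integral]
  rw [integral_congr_ae (Filter.Eventually.of_forall fun X => energyDensity_merge hs
    (h.smooth.differentiable (by simp)) (h'.smooth.differentiable (by simp)) X
    fun h1 h2 i k => hsep i k _ (h.supp _ h1 i) _ (h'.supp _ h2 k))]
  have hd := integrable_energyDensity hm hv hb h.smooth h.compact
  have hd' := integrable_energyDensity hm hv hb h'.smooth h'.compact
  have hn := integrable_norm_sq h.smooth.continuous h.compact
  have hn' := integrable_norm_sq h'.smooth.continuous h'.compact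
  rw [integral_add (integrable_merge hd hn') (integrable_merge hn hd'),
    integral_merge (energyDensity v Φ) fun X => ‖Φ' X‖ ^ 2,
    integral_merge (fun X => ‖Φ X‖ ^ 2) (energyDensity v Φ'), h.norm, h'.norm, mul_one, one_mul]

theorem LabelledState.merge {Λ : Type*} {reg : Λ → Set R3}
    {lab : ι → Λ} {lab' : κ → Λ} {Φ : (ι → R3) → ℂ} {Φ' : (κ → R3) → ℂ}
    (h : LabelledState reg lab Φ) (h' : LabelledState reg lab' Φ')
    (hne : ∀ i k, lab i ≠ lab' k) : LabelledState reg (Sum.elim lab lab') (mergeState Φ Φ') where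
  smooth := by
    have hl : ContDiff ℝ (⊤ : ℕ∞) fun X : ι ⊕ κ → R3 => X ∘ Sum.inl :=
      contDiff_pi.2 fun i => contDiff_apply ℝ R3 (Sum.inl i)
    have hr : ContDiff ℝ (⊤ : ℕ∞) fun X : ι ⊕ κ → R3 => X ∘ Sum.inr :=
      contDiff_pi.2 fun i => contDiff_apply ℝ R3 (Sum.inr i)
    exact (h.smooth.comp hl).mul (h'.smooth.comp hr)
  compact := by
    have hK : IsCompact ((Homeomorph.sumArrowHomeomorphProdArrow (ι := ι) (ι' := κ) (X := R3)) ⁻¹'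
        (tsupport Φ ×ˢ tsupport Φ')) := by
      rw [Homeomorph.isCompact_preimage]
      exact h.compact.isCompact.prod h'.compact.isCompact
    refine HasCompactSupport.intro hK fun X hX => ?_
    by_contra hz
    exact hX ⟨subset_tsupport _ (left_ne_zero_of_mul hz), subset_tsupport _ (right_ne_zero_of_mul hz)⟩
  supp X hX := by
    rintro (i | k)
    · exact h.supp _ (left_ne_zero_of_mul hX) i
    · exact h'.supp _ (right_ne_zero_of_mul hX) k
  anti := by
    rintro (i | i) (j | j) hij hl X
    · have h1 : (X ∘ Equiv.swap (Sum.inl i) (Sum.inl j)) ∘ Sum.inl =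
          (X ∘ Sum.inl) ∘ Equiv.swap i j := by
        ext1 a
        simp only [Function.comp, Equiv.swap_apply_def, Sum.inl.injEq]
        split_ifs <;> rfl
      have h2 : (X ∘ Equiv.swap (Sum.inl i) (Sum.inl j)) ∘ Sum.inr = X ∘ (Sum.inr : κ → ι ⊕ κ) := by
        ext1 a
        simp [Function.comp, Equiv.swap_apply_def]
      rw [mergeState, h1, h2, h.anti i j (fun h => hij (h ▸ rfl)) hl, mergeState, neg_mul]
    · exact absurd hl (hne i j)
    · exact absurd hl.symm (hne j i)
    · have h1 : (X ∘ Equiv.swap (Sum.inr i) (Sum.inr j)) ∘ Sum.inr =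
          (X ∘ Sum.inr) ∘ Equiv.swap i j := by
        ext1 a
        simp only [Function.comp, Equiv.swap_apply_def, Sum.inr.injEq]
        split_ifs <;> rfl
      have h2 : (X ∘ Equiv.swap (Sum.inr i) (Sum.inr j)) ∘ Sum.inl = X ∘ (Sum.inl : ι → ι ⊕ κ) := by
        ext1 a
        simp [Function.comp, Equiv.swap_apply_def]
      rw [mergeState, h1, h2, h'.anti i j (fun h => hij (h ▸ rfl)) hl, mergeState, mul_neg]
  norm := by
    simp only [mergeState, norm_mul, mul_pow]
    rw [integral_merge (fun X => ‖Φ X‖ ^ 2) fun X => ‖Φ' X‖ ^ 2, h.norm, h'.norm, one_mul]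

end LabelledStates

section Antisymmetrisation

theorem norm_sum_sq_of_coset {G : Type*} [Group G] [Fintype G] (H : Finset G) (f : G → ℂ)
    (h1 : ∀ g, ∀ h ∈ H, f (g * h) = f g) (h2 : ∀ g g', f g ≠ 0 → f g' ≠ 0 → g⁻¹ * g' ∈ H) :
    ‖∑ g, f g‖ ^ 2 = H.card * ∑ g, ‖f g‖ ^ 2 := by
  by_cases hz : ∀ g, f g = 0
  · simp [hz]
  push Not at hz
  obtain ⟨g₀, hg⟩ := hz
  have hout : ∀ h, h ∉ H → f (g₀ * h) = 0 := fun h hh => by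
    by_contra h0
    exact hh (by simpa using h2 g₀ (g₀ * h) hg h0)
  have hs1 : ∑ g, f g = H.card * f g₀ := by
    rw [← Equiv.sum_comp (Equiv.mulLeft g₀)]
    simp only [Equiv.coe_mulLeft]
    rw [← Finset.sum_subset (Finset.subset_univ H) fun h _ hh => hout h hh,
      Finset.sum_congr rfl fun h hh => h1 g₀ h hh, Finset.sum_const, nsmul_eq_mul]
  have hs2 : ∑ g, ‖f g‖ ^ 2 = H.card * ‖f g₀‖ ^ 2 := by
    rw [← Equiv.sum_comp (Equiv.mulLeft g₀)]
    simp only [Equiv.coe_mulLeft]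
    rw [← Finset.sum_subset (Finset.subset_univ H) fun h _ hh => by simp [hout h hh],
      Finset.sum_congr rfl fun h hh => by
        rw [h1 g₀ h hh], Finset.sum_const, nsmul_eq_mul]
  rw [hs1, hs2, norm_mul, mul_pow]
  simp
  ring

theorem LabelledState.comp_perm {ι : Type*} [Fintype ι] [DecidableEq ι] {Λ : Type*}
    {reg : Λ → Set R3} {lab : ι → Λ} {Φ : (ι → R3) → ℂ} (hΦ : LabelledState reg lab Φ)
    (h : Equiv.Perm ι) (hl : lab ∘ h = lab) (X : ι → R3) :
    Φ (X ∘ h) = ((Equiv.Perm.sign h : ℤ) : ℂ) * Φ X := by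
  induction hn : h.support.card using Nat.strong_induction_on generalizing h X with
  | _ n ih =>
    by_cases h1 : h = 1
    · subst h1
      simp
    obtain ⟨i, hi⟩ : ∃ i, h i ≠ i := by
      by_contra hc
      push Not at hc
      exact h1 (Equiv.ext hc)
    have hli : lab i = lab (h i) := (congrFun hl i).symm
    have hlt := Equiv.Perm.card_support_swap_mul hi
    have hlab : lab ∘ (Equiv.swap i (h i) * h : Equiv.Perm ι) = lab := by
      ext1 j
      simp only [Function.comp, Equiv.Perm.coe_mul]
      rw [Equiv.swap_apply_def]
      have hj := congrFun hl j
      simp only [Function.comp] at hj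
      split_ifs with ha hb
      · rw [← hli, ← ha, hj]
      · rw [hli, ← hb, hj]
      · exact hj
    have hdec : X ∘ h = (X ∘ Equiv.swap i (h i)) ∘ (Equiv.swap i (h i) * h : Equiv.Perm ι) := by
      ext1 j
      simp [Function.comp]
    rw [hdec, ih _ (hn ▸ hlt) _ hlab _ rfl, hΦ.anti i (h i) (Ne.symm hi) hli,
      Equiv.Perm.sign_mul, Equiv.Perm.sign_swap (Ne.symm hi)]
    simp

variable {N q : ℕ}

/-- The coefficient of a permutation in the antisymmetrisation of a labelled state. -/
def spinSign (lab : Fin N → ℕ × Fin q) (p : Equiv.Perm (Fin N)) (σ : Fin N → Fin q) : ℂ :=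
  if σ ∘ p = Prod.snd ∘ lab then ((Equiv.Perm.sign p : ℤ) : ℂ) else 0

/-- The antisymmetrisation of a labelled state. -/
def antiState (lab : Fin N → ℕ × Fin q) (Φ : (Fin N → R3) → ℂ) (c : ℝ) (X : Fin N → R3)
    (σ : Fin N → Fin q) : ℂ :=
  c * ∑ p : Equiv.Perm (Fin N), spinSign lab p σ * Φ (X ∘ p)

/-- The permutations preserving the labels. -/
def labelPerms (lab : Fin N → ℕ × Fin q) : Finset (Equiv.Perm (Fin N)) :=
  Finset.univ.filter fun h => lab ∘ h = lab

theorem norm_sign (p : Equiv.Perm (Fin N)) : ‖((Equiv.Perm.sign p : ℤ) : ℂ)‖ = 1 := by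
  rcases Int.units_eq_one_or (Equiv.Perm.sign p) with h | h <;> simp [h]

theorem sum_norm_spinSign_sq (lab : Fin N → ℕ × Fin q) (p : Equiv.Perm (Fin N)) :
    ∑ σ, ‖spinSign lab p σ‖ ^ 2 = 1 := by
  rw [Finset.sum_eq_single (Prod.snd ∘ lab ∘ p.symm)]
  · have : (Prod.snd ∘ lab ∘ p.symm) ∘ p = Prod.snd ∘ lab := by
      ext1 j
      simp
    rw [spinSign, if_pos this, norm_sign, one_pow]
  · intro σ _ hσ
    rw [spinSign, if_neg, norm_zero, zero_pow two_ne_zero]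
    intro h
    refine hσ ?_
    ext1 j
    have := congrFun h (p.symm j)
    simpa using this
  · simp

variable {lab : Fin N → ℕ × Fin q} {D : ℕ → Set R3} {Φ : (Fin N → R3) → ℂ}

theorem spinSign_mul_comp (h : LabelledState (fun l : ℕ × Fin q => D l.1) lab Φ)
    (p : Equiv.Perm (Fin N)) {τ : Equiv.Perm (Fin N)} (hτ : τ ∈ labelPerms lab)
    (X : Fin N → R3) (σ : Fin N → Fin q) :
    spinSign lab (p * τ) σ * Φ (X ∘ (p * τ : Equiv.Perm (Fin N))) =
      spinSign lab p σ * Φ (X ∘ p) := by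
  have hl : lab ∘ τ = lab := (Finset.mem_filter.1 hτ).2
  have h1 : X ∘ (p * τ : Equiv.Perm (Fin N)) = (X ∘ p) ∘ τ := rfl
  have h2 : σ ∘ (p * τ : Equiv.Perm (Fin N)) = Prod.snd ∘ lab ↔ σ ∘ p = Prod.snd ∘ lab := by
    have h3 : σ ∘ (p * τ : Equiv.Perm (Fin N)) = (σ ∘ p) ∘ τ := rfl
    have h4 : Prod.snd ∘ lab = (Prod.snd ∘ lab) ∘ τ := by rw [Function.comp_assoc, hl]
    rw [h3, h4, τ.surjective.right_cancellable, ← h4]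
  unfold spinSign
  simp only [h2]
  rw [h1, h.comp_perm τ hl]
  split_ifs
  · rw [Equiv.Perm.sign_mul]
    rcases Int.units_eq_one_or (Equiv.Perm.sign τ) with h | h <;> simp [h]
  · simp

theorem LabelledState.tsupport_subset {ι : Type*} [Fintype ι] [DecidableEq ι] {Λ : Type*}
    {reg : Λ → Set R3} {lab : ι → Λ} {Φ : (ι → R3) → ℂ} (h : LabelledState reg lab Φ)
    (hD : ∀ l, IsClosed (reg l)) {X : ι → R3} (hX : X ∈ tsupport Φ) (i : ι) : X i ∈ reg (lab i) := by
  have hcl : IsClosed {X : ι → R3 | ∀ i, X i ∈ reg (lab i)} := by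
    simp only [Set.ofPred_forall]
    exact isClosed_iInter fun i => (hD _).preimage (continuous_apply i)
  exact closure_minimal (fun X hX => h.supp X hX) hcl hX i

theorem mem_labelPerms_of_tsupport (h : LabelledState (fun l : ℕ × Fin q => D l.1) lab Φ)
    (hD : ∀ c, IsClosed (D c)) (hdis : ∀ c c', c ≠ c' → Disjoint (D c) (D c'))
    {p p' : Equiv.Perm (Fin N)} {X : Fin N → R3} {σ : Fin N → Fin q}
    (hs : spinSign lab p σ ≠ 0) (hs' : spinSign lab p' σ ≠ 0)
    (hX : X ∘ p ∈ tsupport Φ) (hX' : X ∘ p' ∈ tsupport Φ) : p⁻¹ * p' ∈ labelPerms lab := by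
  refine Finset.mem_filter.2 ⟨Finset.mem_univ _, ?_⟩
  have e : σ ∘ p = Prod.snd ∘ lab := by
    by_contra hc
    exact hs (if_neg hc)
  have e' : σ ∘ p' = Prod.snd ∘ lab := by
    by_contra hc
    exact hs' (if_neg hc)
  ext1 j
  have hj : p ((p⁻¹ * p') j) = p' j := by simp
  have m1 := h.tsupport_subset (fun l => hD l.1) hX ((p⁻¹ * p') j)
  have m2 := h.tsupport_subset (fun l => hD l.1) hX' j
  simp only [Function.comp, hj] at m1 m2 ⊢
  refine Prod.ext ?_ ?_
  · by_contra hc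
    exact Set.disjoint_left.1 (hdis _ _ hc) m1 m2
  · have t1 := congrFun e ((p⁻¹ * p') j)
    have t2 := congrFun e' j
    simp only [Function.comp, hj] at t1 t2
    rw [← t1, t2]

theorem norm_antiState_sq (h : LabelledState (fun l : ℕ × Fin q => D l.1) lab Φ)
    (hD : ∀ c, IsClosed (D c)) (hdis : ∀ c c', c ≠ c' → Disjoint (D c) (D c')) (c : ℝ)
    (X : Fin N → R3) (σ : Fin N → Fin q) :
    ‖antiState lab Φ c X σ‖ ^ 2 =
      c ^ 2 * (labelPerms lab).card * ∑ p, ‖spinSign lab p σ‖ ^ 2 * ‖Φ (X ∘ p)‖ ^ 2 := by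
  unfold antiState
  rw [norm_mul, mul_pow, norm_sum_sq_of_coset (labelPerms lab)]
  · simp [mul_pow, mul_assoc]
  · exact fun p τ hτ => spinSign_mul_comp h p hτ X σ
  · exact fun p p' hz hz' => mem_labelPerms_of_tsupport h hD hdis (left_ne_zero_of_mul hz)
      (left_ne_zero_of_mul hz') (subset_tsupport _ (right_ne_zero_of_mul hz))
      (subset_tsupport _ (right_ne_zero_of_mul hz'))

theorem contDiff_comp_perm (h : ContDiff ℝ (⊤ : ℕ∞) Φ) (p : Equiv.Perm (Fin N)) :
    ContDiff ℝ (⊤ : ℕ∞) fun X : Fin N → R3 => Φ (X ∘ p) :=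
  h.comp (contDiff_pi.2 fun i => contDiff_apply ℝ R3 (p i))

theorem gradSq_antiState (h : LabelledState (fun l : ℕ × Fin q => D l.1) lab Φ)
    (hD : ∀ c, IsClosed (D c)) (hdis : ∀ c c', c ≠ c' → Disjoint (D c) (D c')) (c : ℝ)
    (X : Fin N → R3) (σ : Fin N → Fin q) (i : Fin N) :
    gradSq (fun y => antiState lab Φ c (Function.update X i y) σ) (X i) =
      c ^ 2 * (labelPerms lab).card * ∑ p : Equiv.Perm (Fin N), ‖spinSign lab p σ‖ ^ 2 *
        gradSq (fun y => Φ (Function.update X i y ∘ p)) (X i) := by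
  have hdiff : ∀ p : Equiv.Perm (Fin N),
      Differentiable ℝ fun y => Φ (Function.update X i y ∘ p) := fun p =>
    differentiable_update ((contDiff_comp_perm h.smooth p).differentiable (by simp)) X i
  set F : Equiv.Perm (Fin N) → R3 → ℂ := fun p y => spinSign lab p σ * Φ (Function.update X i y ∘ p)
    with hF
  have hFd : ∀ p, Differentiable ℝ (F p) := fun p => (hdiff p).const_mul _
  have hFe : ∀ p V, fderiv ℝ (F p) (X i) V =
      spinSign lab p σ * fderiv ℝ (fun y => Φ (Function.update X i y ∘ p)) (X i) V := fun p V => by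
    rw [hF]
    simp only
    rw [fderiv_const_mul (hdiff p _)]
    rfl
  have hzero : ∀ p V, fderiv ℝ (F p) (X i) V ≠ 0 → spinSign lab p σ ≠ 0 ∧ X ∘ p ∈ tsupport Φ := by
    intro p V hV
    rw [hFe] at hV
    refine ⟨left_ne_zero_of_mul hV, ?_⟩
    by_contra hc
    refine right_ne_zero_of_mul hV ?_
    have ht : Filter.Tendsto (fun y => Function.update X i y ∘ p) (nhds (X i)) (nhds (X ∘ p)) := by
      have hcont : Continuous fun y : R3 => Function.update X i y ∘ p :=
        continuous_pi fun j => (continuous_apply (p j)).comp (continuous_const.update i continuous_id)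
      have := hcont.tendsto (X i)
      simpa using this
    have he : (fun y => Φ (Function.update X i y ∘ p)) =ᶠ[nhds (X i)] fun _ => 0 :=
      ht.eventually (notMem_tsupport_iff_eventuallyEq.1 hc)
    rw [he.fderiv_eq]
    simp
  unfold gradSq
  simp_rw [Finset.mul_sum (s := (Finset.univ : Finset (Fin 3)))]
  rw [Finset.sum_comm, Finset.mul_sum]
  refine Finset.sum_congr rfl fun j _ => ?_
  set V : R3 := EuclideanSpace.single j 1
  have hsum : fderiv ℝ (fun y => antiState lab Φ c (Function.update X i y) σ) (X i) V =
      c * ∑ p, fderiv ℝ (F p) (X i) V := by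
    have hd : HasFDerivAt (fun y => antiState lab Φ c (Function.update X i y) σ)
        ((c : ℂ) • ∑ p, fderiv ℝ (F p) (X i)) (X i) :=
      (HasFDerivAt.fun_sum fun p _ => (hFd p _).hasFDerivAt).const_mul (c : ℂ)
    rw [hd.fderiv]
    simp [sum_apply]
  rw [hsum, norm_mul, mul_pow, norm_sum_sq_of_coset (labelPerms lab)]
  · simp only [hFe, norm_mul, mul_pow, Complex.norm_real, Real.norm_eq_abs, sq_abs, mul_assoc]
  · intro p τ hτ
    have : F (p * τ) = F p := by
      ext1 y
      exact spinSign_mul_comp h p hτ _ σ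
    rw [this]
  · intro p p' hz hz'
    obtain ⟨a1, a2⟩ := hzero p V hz
    obtain ⟨b1, b2⟩ := hzero p' V hz'
    exact mem_labelPerms_of_tsupport h hD hdis a1 b1 a2 b2

theorem energyDensity_antiState (h : LabelledState (fun l : ℕ × Fin q => D l.1) lab Φ)
    (hD : ∀ c, IsClosed (D c)) (hdis : ∀ c c', c ≠ c' → Disjoint (D c) (D c')) (c : ℝ)
    (v : R3 → ℝ) (X : Fin N → R3) (σ : Fin N → Fin q) :
    energyDensity v (fun X => antiState lab Φ c X σ) X =
      c ^ 2 * (labelPerms lab).card *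
        ∑ p : Equiv.Perm (Fin N), ‖spinSign lab p σ‖ ^ 2 * energyDensity v Φ (X ∘ p) := by
  have h1 : ∀ p : Equiv.Perm (Fin N), energyDensity v Φ (X ∘ p) =
      (∑ i, gradSq (fun y => Φ (Function.update X i y ∘ p)) (X i)) +
        pairPotential v X * ‖Φ (X ∘ p)‖ ^ 2 := fun p =>
    (energyDensity_comp_equiv v p Φ X).symm
  simp only [h1]
  unfold energyDensity
  simp only [gradSq_antiState h hD hdis, norm_antiState_sq h hD hdis]
  rw [← Finset.mul_sum, Finset.sum_comm]
  simp only [mul_add, Finset.sum_add_distrib, Finset.mul_sum]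
  congr 1
  refine Finset.sum_congr rfl fun p _ => ?_
  ring

end Antisymmetrisation

section GroundEnergy

theorem energyForm_nonneg {v : R3 → ℝ} (hv : ∀ x, 0 ≤ v x) (N q : ℕ)
    (Ψ : (Fin N → R3) → (Fin N → Fin q) → ℂ) : 0 ≤ energyForm N q v Ψ :=
  Finset.sum_nonneg fun σ _ => integral_nonneg fun X =>
    add_nonneg (Finset.sum_nonneg fun _ _ => gradSq_nonneg _ _)
      (Finset.sum_nonneg fun i _ => Finset.sum_nonneg fun j _ => by
        split_ifs
        exacts [mul_nonneg (hv _) (sq_nonneg _), le_rfl])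

theorem groundEnergy_nonneg {v : R3 → ℝ} (hv : ∀ x, 0 ≤ v x) (N q : ℕ) (L : ℝ) :
    0 ≤ groundEnergy N q L v := by
  refine Real.sInf_nonneg ?_
  rintro E ⟨Ψ, -, rfl⟩
  exact energyForm_nonneg hv N q Ψ

theorem energyForm_eq {v : R3 → ℝ} (hs : ∀ x, v (-x) = v x) {N q : ℕ}
    (Ψ : (Fin N → R3) → (Fin N → Fin q) → ℂ) :
    energyForm N q v Ψ = ∑ σ, ∫ X, energyDensity v (fun X => Ψ X σ) X := by
  unfold energyForm energyDensity pairPotential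
  refine Finset.sum_congr rfl fun σ _ => integral_congr_ae (Filter.Eventually.of_forall fun X => ?_)
  simp only
  congr 1
  have h1 : ∑ i, ∑ j, (if i ≠ j then v (X i - X j) else 0) =
      (∑ i, ∑ j, if i < j then v (X i - X j) else 0) +
        ∑ j, ∑ i, if i < j then v (X i - X j) else 0 := by
    rw [← Finset.sum_add_distrib]
    refine Finset.sum_congr rfl fun i _ => ?_
    rw [← Finset.sum_add_distrib]
    refine Finset.sum_congr rfl fun j _ => ?_
    rcases lt_trichotomy i j with h | h | h
    · rw [if_pos h.ne, if_pos h, if_neg h.asymm, add_zero]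
    · simp [h]
    · rw [if_pos h.ne', if_neg h.asymm, if_pos h, zero_add, ← hs, neg_sub]
  rw [h1, Finset.sum_comm (s := (Finset.univ : Finset (Fin N)))
    (f := fun j i => if i < j then v (X i - X j) else 0), ← two_mul, ← mul_assoc,
    one_div, inv_mul_cancel₀ two_ne_zero, one_mul, Finset.sum_mul]
  refine Finset.sum_congr rfl fun i _ => ?_
  rw [Finset.sum_mul]
  exact Finset.sum_congr rfl fun j _ => by split_ifs <;> simp

variable {N q : ℕ} {lab : Fin N → ℕ × Fin q} {D : ℕ → Set R3} {Φ : (Fin N → R3) → ℂ}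

theorem sum_spinSign_mul (f : (Fin N → R3) → ℝ) (I : ℝ) (hI : ∫ X, f X = I)
    (hf : Integrable f) :
    ∑ σ : Fin N → Fin q, ∫ X, ∑ p : Equiv.Perm (Fin N), ‖spinSign lab p σ‖ ^ 2 * f (X ∘ p) =
      N.factorial * I := by
  have h : ∀ σ : Fin N → Fin q, ∫ X, ∑ p : Equiv.Perm (Fin N), ‖spinSign lab p σ‖ ^ 2 * f (X ∘ p) =
      ∑ p : Equiv.Perm (Fin N), ‖spinSign lab p σ‖ ^ 2 * I := fun σ => by
    rw [integral_finsetSum _ fun p _ => (integrable_comp_equiv p hf).const_mul _]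
    simp only [integral_const_mul, integral_comp_equiv, hI]
  simp only [h]
  rw [Finset.sum_comm]
  simp only [← Finset.sum_mul, sum_norm_spinSign_sq]
  simp [Fintype.card_perm]

theorem groundEnergy_le_stateEnergy {v : R3 → ℝ} (hm : Measurable v) (hv : ∀ x, 0 ≤ v x)
    (hb : ∃ C, ∀ x, v x ≤ C) (hs : ∀ x, v (-x) = v x) {L : ℝ}
    (h : LabelledState (fun l : ℕ × Fin q => D l.1) lab Φ) (hD : ∀ c, IsClosed (D c))
    (hdis : ∀ c c', c ≠ c' → Disjoint (D c) (D c')) (hL : ∀ i, D (lab i).1 ⊆ openCube L) :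
    groundEnergy N q L v ≤ stateEnergy v Φ := by
  have hk : (0 : ℝ) < (labelPerms lab).card := by
    refine Nat.cast_pos.2 (Finset.card_pos.2 ⟨1, Finset.mem_filter.2 ⟨Finset.mem_univ _, rfl⟩⟩)
  have hN : (0 : ℝ) < N.factorial := Nat.cast_pos.2 N.factorial_pos
  set c := √(((labelPerms lab).card * N.factorial : ℝ)⁻¹) with hc
  have hc2 : c ^ 2 * (labelPerms lab).card * N.factorial = 1 := by
    rw [hc, Real.sq_sqrt (by positivity)]
    field_simp
  have hsum : ∀ (f : (Fin N → R3) → ℝ) (I : ℝ), ∫ X, f X = I → Integrable f →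
      ∑ σ : Fin N → Fin q, ∫ X, c ^ 2 * (labelPerms lab).card *
        ∑ p : Equiv.Perm (Fin N), ‖spinSign lab p σ‖ ^ 2 * f (X ∘ p) = I := fun f I hI hf => by
    simp only [integral_const_mul]
    rw [← Finset.mul_sum, sum_spinSign_mul f I hI hf, ← mul_assoc, hc2, one_mul]
  refine csInf_le ⟨0, ?_⟩ ⟨antiState lab Φ c, ⟨fun σ => ?_, fun σ => ?_, fun i j hij X σ => ?_, ?_⟩, ?_⟩
  · rintro E ⟨Ψ, -, rfl⟩
    exact energyForm_nonneg hv N q Ψ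
  · exact contDiff_const.mul (ContDiff.sum fun p _ =>
      contDiff_const.mul (contDiff_comp_perm h.smooth p))
  · have hcl : IsClosed (⋃ p : Equiv.Perm (Fin N), (fun X : Fin N → R3 => X ∘ p) ⁻¹' tsupport Φ) :=
      isClosed_iUnion_of_finite fun p => (isClosed_tsupport _).preimage
        (continuous_pi fun j => continuous_apply (p j))
    refine (closure_minimal (fun X hX => ?_) hcl).trans ?_
    · by_contra hn
      simp only [Set.mem_iUnion, Set.mem_preimage, not_exists] at hn
      refine hX ?_
      simp only [antiState]
      rw [Finset.sum_eq_zero fun p _ => by rw [image_eq_zero_of_notMem_tsupport (hn p), mul_zero],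
        mul_zero]
    · refine Set.iUnion_subset fun p X hX i => ?_
      have := hL _ (h.tsupport_subset (fun l => hD l.1) hX (p.symm i))
      simpa using this
  · simp only [antiState]
    rw [← mul_neg, ← Finset.sum_neg_distrib, ← Equiv.sum_comp (Equiv.mulLeft (Equiv.swap i j))]
    congr 1
    refine Finset.sum_congr rfl fun p _ => ?_
    rw [← neg_mul]
    have e1 : ∀ {α : Type} (Y : Fin N → α), (Y ∘ Equiv.swap i j) ∘
        ((Equiv.mulLeft (Equiv.swap i j)) p : Equiv.Perm (Fin N)) = Y ∘ p := fun Y => by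
      ext1 k
      simp
    rw [e1 X]
    congr 1
    unfold spinSign
    rw [e1 σ]
    split_ifs
    · simp [Equiv.Perm.sign_mul, Equiv.Perm.sign_swap hij]
    · simp
  · simp only [norm_antiState_sq h hD hdis]
    exact hsum _ _ h.norm (integrable_norm_sq h.smooth.continuous h.compact)
  · rw [energyForm_eq hs]
    simp only [energyDensity_antiState h hD hdis]
    exact hsum _ _ (stateEnergy_eq_integral v Φ).symm
      (integrable_energyDensity hm hv hb h.smooth h.compact)

end GroundEnergy

section Packing

variable {ι κ : Type*} [Fintype ι] [DecidableEq ι] [Fintype κ] [DecidableEq κ]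

theorem LabelledState.reindex {Λ : Type*} {reg : Λ → Set R3} {lab : ι → Λ} {Φ : (ι → R3) → ℂ}
    (h : LabelledState reg lab Φ) (e : ι ≃ κ) :
    LabelledState reg (lab ∘ e.symm) fun X : κ → R3 => Φ (X ∘ e) where
  smooth := h.smooth.comp (contDiff_pi.2 fun i => contDiff_apply ℝ R3 (e i))
  compact := by
    have := h.compact.comp_homeomorph (Homeomorph.piCongrLeft (Y := fun _ : ι => R3) e.symm)
    refine this.mono fun X hX h0 => hX ?_
    have hXe : X ∘ e = Homeomorph.piCongrLeft (Y := fun _ : ι => R3) e.symm X := by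
      ext1 i
      have := Equiv.piCongrLeft_apply_apply (fun _ : ι => R3) e.symm X (e i)
      simp only [Equiv.symm_apply_apply] at this
      exact this.symm
    exact (congrArg Φ hXe).trans h0
  supp X hX k := by simpa using h.supp _ hX (e.symm k)
  anti i j hij hl X := by
    have : (X ∘ Equiv.swap i j) ∘ e = (X ∘ e) ∘ Equiv.swap (e.symm i) (e.symm j) := by
      ext1 k
      simp only [Function.comp]
      rw [Equiv.swap_apply_def, Equiv.swap_apply_def]
      simp only [Equiv.eq_symm_apply]
      split_ifs <;> simp
    rw [this, h.anti _ _ (fun h => hij (e.symm.injective h)) hl]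
  norm := (integral_comp_equiv e fun X => ‖Φ X‖ ^ 2).trans h.norm

theorem stateEnergy_comp_equiv (v : R3 → ℝ) (e : ι ≃ κ) (Φ : (ι → R3) → ℂ) :
    stateEnergy v (fun X : κ → R3 => Φ (X ∘ e)) = stateEnergy v Φ := by
  simp only [stateEnergy_eq_integral, energyDensity_comp_equiv]
  exact integral_comp_equiv e _

theorem energyDensity_translate (v : R3 → ℝ) (Φ : (ι → R3) → ℂ) (τ : R3) (X : ι → R3) :
    energyDensity v (fun X => Φ (X - fun _ => τ)) X = energyDensity v Φ (X - fun _ => τ) := by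
  have h : ∀ i y, Function.update X i y - (fun _ => τ) =
      Function.update (X - fun _ => τ) i (y - τ) := fun i y => by
    ext1 k
    rcases eq_or_ne k i with rfl | hk
    · simp
    · simp [hk]
  unfold energyDensity pairPotential gradSq
  simp only [h, Pi.sub_apply, sub_sub_sub_cancel_right]
  congr 1
  refine Finset.sum_congr rfl fun i _ => Finset.sum_congr rfl fun j _ => ?_
  rw [fderiv_comp_sub (f := fun z => Φ (Function.update (X - fun _ => τ) i z)) τ]

theorem stateEnergy_translate (v : R3 → ℝ) (Φ : (ι → R3) → ℂ) (τ : R3) :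
    stateEnergy v (fun X => Φ (X - fun _ => τ)) = stateEnergy v Φ := by
  simp only [stateEnergy_eq_integral, energyDensity_translate]
  exact integral_sub_right_eq_self (energyDensity v Φ) (fun _ : ι => τ)

theorem LabelledState.translate {Λ Λ' : Type*} {reg : Λ → Set R3} {reg' : Λ' → Set R3}
    {lab : ι → Λ} {Φ : (ι → R3) → ℂ} (h : LabelledState reg lab Φ) {f : Λ → Λ'}
    (hf : Function.Injective f) {τ : R3} (hr : ∀ l x, x - τ ∈ reg l → x ∈ reg' (f l)) :
    LabelledState reg' (f ∘ lab) fun X => Φ (X - fun _ => τ) where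
  smooth := h.smooth.comp (contDiff_id.sub contDiff_const)
  compact := h.compact.comp_homeomorph (Homeomorph.subRight (fun _ : ι => τ))
  supp X hX i := hr _ _ (h.supp _ hX i)
  anti i j hij hl X := by
    have hX : X ∘ Equiv.swap i j - (fun _ => τ) = (X - fun _ => τ) ∘ Equiv.swap i j := rfl
    simp only [hX]
    exact h.anti i j hij (hf hl) (X - fun _ => τ)
  norm := (integral_sub_right_eq_self (fun X => ‖Φ X‖ ^ 2) (fun _ : ι => τ)).trans h.norm

/-- There is an `N`-particle state in the region `B` with energy at most `E`. -/
def HasCellState (v : R3 → ℝ) (q : ℕ) (B : Set R3) (N : ℕ) (E : ℝ) : Prop :=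
  ∃ (ι : Type) (_ : Fintype ι) (_ : DecidableEq ι) (lab : ι → Fin q) (Φ : (ι → R3) → ℂ),
    Fintype.card ι = N ∧ LabelledState (fun _ => B) lab Φ ∧ stateEnergy v Φ ≤ E

/-- There is an `N`-particle product state over the first `n` of the regions `D`, with energy at
most `E`. -/
def HasPackedState (v : R3 → ℝ) (q : ℕ) (D : ℕ → Set R3) (n N : ℕ) (E : ℝ) : Prop :=
  ∃ (ι : Type) (_ : Fintype ι) (_ : DecidableEq ι) (lab : ι → ℕ × Fin q) (Φ : (ι → R3) → ℂ),
    Fintype.card ι = N ∧ (∀ i, (lab i).1 < n) ∧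
    LabelledState (fun l : ℕ × Fin q => D l.1) lab Φ ∧ stateEnergy v Φ ≤ E

theorem hasPackedState_zero (v : R3 → ℝ) (q : ℕ) (D : ℕ → Set R3) :
    HasPackedState v q D 0 0 0 := by
  refine ⟨Fin 0, inferInstance, inferInstance, fun i => i.elim0, fun _ => 1, rfl,
    fun i => i.elim0, ⟨contDiff_const, ?_, fun _ _ i => i.elim0, fun i => i.elim0, ?_⟩, ?_⟩
  · exact HasCompactSupport.intro (isCompact_univ (X := Fin 0 → R3)) fun X hX =>
      absurd (Set.mem_univ X) hX
  · simp [Measure.volume_pi_eq_dirac (fun i : Fin 0 => i.elim0)]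
  · refine (integral_congr_ae (g := fun _ => 0) (Filter.Eventually.of_forall fun X => ?_)).trans_le
      (by simp)
    simp [pairPotential]

variable {v : R3 → ℝ} {q : ℕ}

theorem HasPackedState.succ (hm : Measurable v) (hv : ∀ x, 0 ≤ v x) (hb : ∃ C, ∀ x, v x ≤ C)
    (hs : ∀ x, v (-x) = v x) {D : ℕ → Set R3} {n N N' : ℕ} {E E' : ℝ} {B : Set R3} {τ : R3}
    (h : HasPackedState v q D n N E) (h' : HasCellState v q B N' E')
    (hτ : ∀ x, x - τ ∈ B → x ∈ D n) (hsep : ∀ c < n, ∀ x ∈ D c, ∀ y ∈ D n, v (x - y) = 0) :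
    HasPackedState v q D (n + 1) (N + N') (E + E') := by
  obtain ⟨ι, hι, hι', lab, Φ, hN, hlab, hΦ, hE⟩ := h
  obtain ⟨κ, hκ, hκ', lab', Φ', hN', hΦ', hE'⟩ := h'
  have ht : LabelledState (fun l : ℕ × Fin q => D l.1) ((fun σ => (n, σ)) ∘ lab')
      fun X => Φ' (X - fun _ => τ) :=
    hΦ'.translate (fun a b hab => (Prod.mk.inj hab).2) fun l x hx => hτ x hx
  refine ⟨ι ⊕ κ, inferInstance, inferInstance, Sum.elim lab ((fun σ => (n, σ)) ∘ lab'),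
    mergeState Φ fun X => Φ' (X - fun _ => τ), ?_, ?_, hΦ.merge ht fun i k hik => ?_, ?_⟩
  · rw [Fintype.card_sum, hN, hN']
  · rintro (i | k)
    · exact (hlab i).trans n.lt_succ_self
    · exact n.lt_succ_self
  · have := hlab i
    rw [hik] at this
    exact lt_irrefl _ this
  · rw [stateEnergy_merge hm hv hb hs hΦ ht fun i k x hx y hy => hsep _ (hlab i) x hx y hy,
      stateEnergy_translate]
    exact add_le_add hE hE'

theorem HasPackedState.groundEnergy_le (hm : Measurable v) (hv : ∀ x, 0 ≤ v x)
    (hb : ∃ C, ∀ x, v x ≤ C) (hs : ∀ x, v (-x) = v x) {D : ℕ → Set R3} {n N : ℕ} {E L : ℝ}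
    (h : HasPackedState v q D n N E) (hD : ∀ c, IsClosed (D c))
    (hdis : ∀ c c', c ≠ c' → Disjoint (D c) (D c')) (hL : ∀ c < n, D c ⊆ openCube L) :
    groundEnergy N q L v ≤ E := by
  obtain ⟨ι, hι, hι', lab, Φ, hN, hlab, hΦ, hE⟩ := h
  refine (groundEnergy_le_stateEnergy hm hv hb hs (hΦ.reindex (Fintype.equivFinOfCardEq hN)) hD
    hdis fun i => hL _ (hlab _)).trans ?_
  rw [stateEnergy_comp_equiv]
  exact hE

/-- The closed cube `[0,s]³`. -/
def closedCube (s : ℝ) : Set R3 := {x | ∀ j, x j ∈ Set.Icc 0 s}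

/-- The lattice coordinates of the `c`-th cell. -/
def cellCoord (M c : ℕ) : Fin 3 → ℕ := ![c % M, c / M % M, c / M / M]

theorem cellCoord_injective (M : ℕ) : Function.Injective (cellCoord M) := fun c c' h => by
  have h0 := congrFun h 0
  have h1 := congrFun h 1
  have h2 := congrFun h 2
  simp only [cellCoord, Matrix.cons_val] at h0 h1 h2
  have h3 : c / M = c' / M := by rw [← Nat.div_add_mod (c / M) M, h1, h2, Nat.div_add_mod]
  rw [← Nat.div_add_mod c M, h0, h3, Nat.div_add_mod]

theorem cellCoord_lt {M c : ℕ} (h : c < M ^ 3) (j : Fin 3) : cellCoord M c j < M := by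
  have hM : 0 < M := Nat.pos_of_ne_zero fun h0 => by simp [h0] at h
  fin_cases j
  · exact Nat.mod_lt _ hM
  · exact Nat.mod_lt _ hM
  · change c / M / M < M
    rw [Nat.div_div_eq_div_mul, Nat.div_lt_iff_lt_mul (by positivity)]
    calc c < M ^ 3 := h
      _ = M * (M * M) := by ring

/-- The corner of the `c`-th cell. -/
def cellCorner (M : ℕ) (s g : ℝ) (c : ℕ) : R3 :=
  WithLp.toLp 2 fun j => (s + 2 * g) * cellCoord M c j + g

theorem openCube_cell {M : ℕ} {s g : ℝ} (hs : 0 ≤ s) (hg : 0 < g) {c : ℕ} (hc : c < M ^ 3)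
    {L : ℝ} (hL : (s + 2 * g) * M ≤ L) {x : R3} (hx : x - cellCorner M s g c ∈ closedCube s) :
    x ∈ openCube L := fun j => by
  have h1 : (x - cellCorner M s g c) j = x j - ((s + 2 * g) * cellCoord M c j + g) := rfl
  have h2 := hx j
  rw [h1] at h2
  have h3 : (cellCoord M c j : ℝ) + 1 ≤ M := by exact_mod_cast cellCoord_lt hc j
  have h4 : (s + 2 * g) * (cellCoord M c j + 1) ≤ (s + 2 * g) * M :=
    mul_le_mul_of_nonneg_left h3 (by positivity)
  have h5 : 0 ≤ (s + 2 * g) * cellCoord M c j := by positivity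
  constructor
  · linarith [h2.1]
  · linarith [h2.2]

theorem lt_norm_sub_of_cell {M : ℕ} {s g : ℝ} (hs : 0 ≤ s) (hg : 0 < g) {c c' : ℕ} (hcc : c ≠ c')
    {x y : R3} (hx : x - cellCorner M s g c ∈ closedCube s)
    (hy : y - cellCorner M s g c' ∈ closedCube s) : 2 * g ≤ ‖x - y‖ := by
  obtain ⟨j, hj⟩ : ∃ j, cellCoord M c j ≠ cellCoord M c' j := by
    by_contra hn
    push Not at hn
    exact hcc (cellCoord_injective M (funext hn))
  have h1 : (x - cellCorner M s g c) j = x j - ((s + 2 * g) * cellCoord M c j + g) := rfl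
  have h2 : (y - cellCorner M s g c') j = y j - ((s + 2 * g) * cellCoord M c' j + g) := rfl
  have hxj := hx j
  have hyj := hy j
  rw [h1] at hxj
  rw [h2] at hyj
  refine le_trans ?_ (PiLp.norm_apply_le (x - y) j)
  rw [Real.norm_eq_abs]
  change 2 * g ≤ |x j - y j|
  rcases lt_or_gt_of_ne hj with h | h
  · have h3 : (cellCoord M c j : ℝ) + 1 ≤ cellCoord M c' j := by exact_mod_cast h
    have h4 := mul_le_mul_of_nonneg_left h3 (by positivity : 0 ≤ s + 2 * g)
    rw [abs_sub_comm]
    refine le_trans ?_ (le_abs_self _)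
    linarith [hxj.2, hyj.1]
  · have h3 : (cellCoord M c' j : ℝ) + 1 ≤ cellCoord M c j := by exact_mod_cast h
    have h4 := mul_le_mul_of_nonneg_left h3 (by positivity : 0 ≤ s + 2 * g)
    refine le_trans ?_ (le_abs_self _)
    linarith [hxj.1, hyj.2]

theorem isClosed_closedCube (s : ℝ) : IsClosed (closedCube s) := by
  unfold closedCube
  simp only [Set.ofPred_forall]
  exact isClosed_iInter fun j => isClosed_Icc.preimage (EuclideanSpace.proj j).continuous

theorem groundEnergy_le_packing (hm : Measurable v) (hv : ∀ x, 0 ≤ v x)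
    (hb : ∃ C, ∀ x, v x ≤ C) (hs : ∀ x, v (-x) = v x) {R0 : ℝ} (hR : 0 ≤ R0)
    (hv0 : ∀ x : R3, R0 < ‖x‖ → v x = 0) {s : ℝ} (hs0 : 0 ≤ s) {N : ℕ} {E E' : ℝ}
    (h : HasCellState v q (closedCube s) N E) (h' : HasCellState v q (closedCube s) 1 E')
    {M n r : ℕ} (hM : n + r ≤ M ^ 3) {L : ℝ} (hL : (s + R0 + 1) * M ≤ L) :
    groundEnergy (n * N + r) q L v ≤ n * E + r * E' := by
  set g := (R0 + 1) / 2 with hg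
  have hg0 : 0 < g := by positivity
  set D : ℕ → Set R3 := fun c => {x | x - cellCorner M s g c ∈ closedCube s} with hD
  have hvD : ∀ c c', c ≠ c' → ∀ x ∈ D c, ∀ y ∈ D c', R0 < ‖x - y‖ := fun c c' hcc x hx y hy =>
    lt_of_lt_of_le (by rw [hg]; linarith) (lt_norm_sub_of_cell hs0 hg0 hcc hx hy)
  have hstep : ∀ {n N N' : ℕ} {E E' : ℝ}, HasPackedState v q D n N E →
      HasCellState v q (closedCube s) N' E' → HasPackedState v q D (n + 1) (N + N') (E + E') :=
    fun {n _ _ _ _} h1 h2 => h1.succ hm hv hb hs h2 (τ := cellCorner M s g n) (fun x hx => hx)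
      fun c hc x hx y hy => hv0 _ (hvD c n hc.ne x hx y hy)
  have hn : ∀ n : ℕ, HasPackedState v q D n (n * N) (n * E) := fun n => by
    induction n with
    | zero => simpa using hasPackedState_zero v q D
    | succ n ih =>
      have := hstep ih h
      rw [add_mul, one_mul]
      push_cast
      rw [add_mul, one_mul]
      exact this
  have hr : ∀ r : ℕ, HasPackedState v q D (n + r) (n * N + r) (n * E + r * E') := fun r => by
    induction r with
    | zero => simpa using hn n
    | succ r ih =>
      have := hstep ih h'
      push_cast
      rw [add_mul, one_mul, ← add_assoc, ← add_assoc, ← add_assoc]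
      exact this
  refine (hr r).groundEnergy_le hm hv hb hs (fun c => ?_) (fun c c' hcc => ?_) fun c hc x hx => ?_
  · exact (isClosed_closedCube s).preimage (continuous_id.sub continuous_const)
  · refine Set.disjoint_left.2 fun x hx hx' => ?_
    have := hvD c c' hcc x hx x hx'
    rw [sub_self, norm_zero] at this
    exact absurd this (not_lt.2 hR)
  · refine openCube_cell hs0 hg0 (hc.trans_le hM) (le_trans (le_of_eq ?_) hL) hx
    rw [hg]
    ring

end Packing

section CellStates

variable {S : Type} [Fintype S] [DecidableEq S] {v φ ω : R3 → ℝ} {R0 a : ℝ}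

theorem hasCellState_boxState {q : ℕ} {lab : S → Fin q} (hlab : Function.Injective lab)
    (hω : ContDiff ℝ (⊤ : ℕ∞) ω) {ℓ d : ℝ} (hd : 0 < d) {K : Finset (Fin 3 → ℤ)} {c : ℝ} {N : ℕ}
    (hN : N = Fintype.card S * K.card) {E : ℝ} (h1 : ∫ X, ‖boxState S ℓ d K ω c X‖ ^ 2 = 1)
    (hE : stateEnergy v (boxState S ℓ d K ω c) ≤ E) :
    HasCellState v q (closedCube (ℓ + d)) N E := by
  refine ⟨S × K, inferInstance, inferInstance, fun p => lab p.1, boxState S ℓ d K ω c, ?_,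
    ⟨contDiff_boxState ℓ d K hω c, (hasCompactSupport_boxFactor ℓ hd ω c).smul_right,
      fun X hX i j => Set.Ioo_subset_Icc_self (mem_Ioo_of_boxState_ne_zero hd hX i j),
      fun i j hij hl X => boxState_swap ℓ d K ω c hij (hlab hl) X, h1⟩, hE⟩
  rw [Fintype.card_prod, Fintype.card_coe, hN]

end CellStates

section LatticeBall

/-- Lattice points in the closed ball of radius `k`. -/
def latticeBall (k : ℕ) : Finset (Fin 3 → ℤ) :=
  (Fintype.piFinset fun _ => Finset.Icc (-k : ℤ) k).filter fun z => ∑ j, z j ^ 2 ≤ (k : ℤ) ^ 2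

theorem mem_latticeBall {k : ℕ} {z : Fin 3 → ℤ} :
    z ∈ latticeBall k ↔ ∑ j, z j ^ 2 ≤ (k : ℤ) ^ 2 := by
  simp only [latticeBall, Finset.mem_filter, Fintype.mem_piFinset, Finset.mem_Icc,
    and_iff_right_iff_imp]
  intro h j
  have h1 : z j ^ 2 ≤ (k : ℤ) ^ 2 :=
    (Finset.single_le_sum (f := fun j => z j ^ 2) (fun _ _ => sq_nonneg _)
      (Finset.mem_univ j)).trans h
  exact abs_le.1 (abs_le_of_sq_le_sq h1 (by positivity))

/-- The lattice point as a vector. -/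
def latticeVec (z : Fin 3 → ℤ) : R3 := WithLp.toLp 2 fun j => (z j : ℝ)

theorem norm_latticeVec_sq (z : Fin 3 → ℤ) : ‖latticeVec z‖ ^ 2 = ∑ j, (z j : ℝ) ^ 2 := by
  rw [EuclideanSpace.real_norm_sq_eq]
  rfl

theorem mem_latticeBall_iff {k : ℕ} {z : Fin 3 → ℤ} :
    z ∈ latticeBall k ↔ ‖latticeVec z‖ ≤ k := by
  rw [mem_latticeBall, ← abs_of_nonneg (norm_nonneg (latticeVec z)),
    ← abs_of_nonneg (Nat.cast_nonneg (α := ℝ) k), ← sq_le_sq, norm_latticeVec_sq]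
  exact_mod_cast Iff.rfl

/-- The unit cell of points whose coordinates have integer parts `z`. -/
def unitCell (z : Fin 3 → ℤ) : Set R3 := {x | ∀ j, ⌊x j⌋ = z j}

theorem norm_sub_latticeVec_le {z : Fin 3 → ℤ} {x : R3} (hx : x ∈ unitCell z) :
    ‖x - latticeVec z‖ ≤ 2 := by
  refine abs_le_of_sq_le_sq' ?_ (by norm_num) |>.2
  rw [EuclideanSpace.real_norm_sq_eq, Fin.sum_univ_three]
  have h : ∀ j, (x j - z j) ^ 2 ≤ 1 := fun j => by
    have h1 := Int.floor_le (x j)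
    have h2 := Int.lt_floor_add_one (x j)
    rw [hx j] at h1 h2
    nlinarith
  have h0 := h 0
  have h1 := h 1
  have h2 := h 2
  change (x 0 - z 0) ^ 2 + (x 1 - z 1) ^ 2 + (x 2 - z 2) ^ 2 ≤ _
  linarith

theorem unitCell_eq (z : Fin 3 → ℤ) : unitCell z = WithLp.ofLp ⁻¹'
    Set.univ.pi fun j => Set.Ico (z j : ℝ) (z j + 1) := by
  ext x
  simp [unitCell, Int.floor_eq_iff]

theorem measurableSet_unitCell (z : Fin 3 → ℤ) : MeasurableSet (unitCell z) := by
  rw [unitCell_eq]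
  exact (PiLp.volume_preserving_ofLp (Fin 3)).measurable
    (MeasurableSet.univ_pi fun _ => measurableSet_Ico)

theorem volume_unitCell (z : Fin 3 → ℤ) : volume (unitCell z) = 1 := by
  rw [unitCell_eq, (PiLp.volume_preserving_ofLp (Fin 3)).measure_preimage
    (MeasurableSet.univ_pi fun _ => measurableSet_Ico).nullMeasurableSet, volume_pi_pi]
  simp

theorem pairwiseDisjoint_unitCell (s : Set (Fin 3 → ℤ)) : s.PairwiseDisjoint unitCell :=
  fun z _ z' _ hz => Set.disjoint_left.2 fun x hx hx' =>
    hz (funext fun j => (hx j).symm.trans (hx' j))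

theorem norm_le_of_mem_unitCell {z : Fin 3 → ℤ} {x : R3} (hx : x ∈ unitCell z) :
    ‖x‖ ≤ ‖latticeVec z‖ + 2 := by
  have := norm_sub_latticeVec_le hx
  have := norm_le_norm_add_norm_sub' x (latticeVec z)
  linarith

theorem norm_latticeVec_le {z : Fin 3 → ℤ} {x : R3} (hx : x ∈ unitCell z) :
    ‖latticeVec z‖ ≤ ‖x‖ + 2 := by
  have := norm_sub_latticeVec_le hx
  have := norm_le_norm_add_norm_sub x (latticeVec z)
  linarith

theorem volume_iUnion_unitCell (s : Finset (Fin 3 → ℤ)) :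
    volume (⋃ z ∈ s, unitCell z) = s.card := by
  rw [measure_biUnion_finset (pairwiseDisjoint_unitCell _) fun z _ => measurableSet_unitCell z]
  simp [volume_unitCell]

theorem iUnion_unitCell_subset (k : ℕ) :
    (⋃ z ∈ latticeBall k, unitCell z) ⊆ Metric.closedBall (0 : R3) (k + 2) := fun x hx => by
  simp only [Set.mem_iUnion] at hx
  obtain ⟨z, hz, hx⟩ := hx
  rw [mem_closedBall_zero_iff]
  linarith [norm_le_of_mem_unitCell hx, mem_latticeBall_iff.1 hz]

theorem card_latticeBall_le (k : ℕ) :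
    ((latticeBall k).card : ℝ) ≤ 4 * π / 3 * (k + 4) ^ 3 := by
  have h := measure_mono (μ := volume) (iUnion_unitCell_subset k)
  rw [volume_iUnion_unitCell, EuclideanSpace.volume_closedBall_fin_three,
    ← ENNReal.ofReal_pow (by positivity), ← ENNReal.ofReal_mul (by positivity),
    ← ENNReal.ofReal_natCast, ENNReal.ofReal_le_ofReal_iff (by positivity)] at h
  refine h.trans ?_
  rw [mul_comm, mul_comm π]
  gcongr
  norm_num

theorem le_card_latticeBall {k : ℕ} (hk : 4 ≤ k) :
    4 * π / 3 * (k - 4 : ℝ) ^ 3 ≤ (latticeBall k).card := by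
  have hk' : (4 : ℝ) ≤ k := by exact_mod_cast hk
  have hsub : Metric.closedBall (0 : R3) (k - 4) ⊆ ⋃ z ∈ latticeBall k, unitCell z := fun x hx => by
    rw [mem_closedBall_zero_iff] at hx
    simp only [Set.mem_iUnion]
    have hx' : x ∈ unitCell fun j => ⌊x j⌋ := fun j => rfl
    exact ⟨_, mem_latticeBall_iff.2 (by linarith [norm_latticeVec_le hx']), hx'⟩
  have h := measure_mono (μ := volume) hsub
  rw [volume_iUnion_unitCell, EuclideanSpace.volume_closedBall_fin_three,
    ← ENNReal.ofReal_pow (by linarith), ← ENNReal.ofReal_mul (pow_nonneg (by linarith) 3),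
    ← ENNReal.ofReal_natCast, ENNReal.ofReal_le_ofReal_iff (by positivity)] at h
  linarith

theorem sum_latticeBall_le (k : ℕ) :
    ∑ z ∈ latticeBall k, ∑ j, (z j : ℝ) ^ 2 ≤ 4 * π / 5 * (k + 4) ^ 5 := by
  set f : ℝ → ℝ := (Set.Iic ((k : ℝ) + 2)).indicator fun r => (r + 2) ^ 2 with hf
  have hf0 : ∀ r, 0 ≤ f r := fun r => Set.indicator_nonneg (fun _ _ => sq_nonneg _) r
  have hfeq : (fun x : R3 => f ‖x‖) =
      (Metric.closedBall (0 : R3) (k + 2)).indicator fun x => (‖x‖ + 2) ^ 2 := by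
    ext1 x
    by_cases hx : ‖x‖ ≤ (k : ℝ) + 2
    · rw [hf, Set.indicator_of_mem (Set.mem_Iic.2 hx),
        Set.indicator_of_mem (mem_closedBall_zero_iff.2 hx)]
    · rw [hf, Set.indicator_of_notMem (fun h => hx (Set.mem_Iic.1 h)),
        Set.indicator_of_notMem (fun h => hx (mem_closedBall_zero_iff.1 h))]
  have hfi : Integrable fun x : R3 => f ‖x‖ := by
    rw [hfeq, integrable_indicator_iff Metric.isClosed_closedBall.measurableSet]
    exact (by fun_prop : Continuous fun x : R3 => (‖x‖ + 2) ^ 2).continuousOn.integrableOn_compact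
      (isCompact_closedBall _ _)
  have h1 : ∑ z ∈ latticeBall k, ∑ j, (z j : ℝ) ^ 2 ≤
      ∑ z ∈ latticeBall k, ∫ x in unitCell z, f ‖x‖ := Finset.sum_le_sum fun z hz => by
    have h : ∫ x in unitCell z, ∑ j, (z j : ℝ) ^ 2 = ∑ j, (z j : ℝ) ^ 2 := by
      rw [setIntegral_const, Measure.real, volume_unitCell]
      simp
    rw [← h]
    refine setIntegral_mono_on (integrableOn_const (by simp [volume_unitCell])) hfi.integrableOn
      (measurableSet_unitCell z) fun x hx => ?_
    have hxk : ‖x‖ ∈ Set.Iic ((k : ℝ) + 2) := by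
      rw [Set.mem_Iic]
      linarith [norm_le_of_mem_unitCell hx, mem_latticeBall_iff.1 hz]
    rw [hf, Set.indicator_of_mem hxk, ← norm_latticeVec_sq]
    exact pow_le_pow_left₀ (norm_nonneg _) (norm_latticeVec_le hx) 2
  refine h1.trans ?_
  rw [← integral_biUnion_finset _ (fun z _ => measurableSet_unitCell z)
    (pairwiseDisjoint_unitCell _) fun z _ => hfi.integrableOn]
  refine (setIntegral_le_integral hfi (Filter.Eventually.of_forall fun x => hf0 _)).trans ?_
  rw [integral_fun_norm_addHaar volume f]
  have hvol : Measure.real volume (Metric.ball (0 : R3) 1) = π * 4 / 3 := by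
    rw [Measure.real, EuclideanSpace.volume_ball_fin_three]
    simp [Real.pi_nonneg]
    positivity
  have hinteg : ∫ y in Set.Ioi (0 : ℝ), y ^ 2 • f y ≤ ((k : ℝ) + 4) ^ 5 / 5 := by
    have h2 : ∀ y : ℝ, y ^ 2 • f y = (Set.Iic ((k : ℝ) + 2)).indicator
        (fun r => r ^ 2 * (r + 2) ^ 2) y := fun y => by
      simp only [hf, Set.indicator_apply, smul_eq_mul]
      split_ifs <;> simp
    simp only [h2]
    rw [setIntegral_indicator measurableSet_Iic, Set.Ioi_inter_Iic,
      ← intervalIntegral.integral_of_le (by positivity)]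
    have h3 : ∫ r in (0 : ℝ)..k + 2, (r + 2) ^ 4 = (((k : ℝ) + 4) ^ 5 - 2 ^ 5) / 5 := by
      rw [intervalIntegral.integral_comp_add_right (fun r => r ^ 4), integral_pow]
      norm_num [add_assoc]
    refine (intervalIntegral.integral_mono_on (g := fun r => (r + 2) ^ 4) (by positivity)
      ((by fun_prop : Continuous fun r : ℝ => r ^ 2 * (r + 2) ^ 2).intervalIntegrable _ _)
      ((by fun_prop : Continuous fun r : ℝ => (r + 2) ^ 4).intervalIntegrable _ _)
      fun r hr => ?_).trans (h3.trans_le (by linarith))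
    have := hr.1
    calc r ^ 2 * (r + 2) ^ 2 ≤ (r + 2) ^ 2 * (r + 2) ^ 2 := by gcongr; linarith
      _ = _ := by ring
  have hdim : Module.finrank ℝ R3 = 3 := by simp [R3]
  rw [hdim, hvol]
  simp only [nsmul_eq_mul, smul_eq_mul, Nat.cast_ofNat] at hinteg ⊢
  calc _ ≤ 3 * (π * 4 / 3 * (((k : ℝ) + 4) ^ 5 / 5)) := by gcongr
    _ = _ := by ring

end LatticeBall

section ThermodynamicLimit

variable {v : R3 → ℝ} {q : ℕ}

theorem limsup_groundEnergy_le (hm : Measurable v) (hv : ∀ x, 0 ≤ v x)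
    (hb : ∃ C, ∀ x, v x ≤ C) (hs : ∀ x, v (-x) = v x) {R0 : ℝ} (hR : 0 ≤ R0)
    (hv0 : ∀ x : R3, R0 < ‖x‖ → v x = 0) {s : ℝ} (hs0 : 0 ≤ s) {N : ℕ} (hN : 0 < N) {E E' : ℝ}
    (hE : 0 ≤ E) (h : HasCellState v q (closedCube s) N E)
    (h' : HasCellState v q (closedCube s) 1 E') {ρ : ℝ} (hρ : 0 < ρ)
    (hdens : ρ * (s + R0 + 1) ^ 3 < N) :
    limsup (fun L : ℝ => groundEnergy (⌊ρ * L ^ 3⌋₊) q L v / L ^ 3) atTop ≤ ρ * (E / N) := by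
  set T := s + R0 + 1 with hT
  have hT0 : 0 < T := by positivity
  have hN0 : (0 : ℝ) < N := by exact_mod_cast hN
  have hlim : Tendsto (fun L : ℝ => ρ * (E / N) + N * |E'| * (L⁻¹) ^ 3) atTop
      (nhds (ρ * (E / N))) := by
    have := ((tendsto_inv_atTop_zero (𝕜 := ℝ)).pow 3).const_mul (N * |E'|)
    simpa using this.const_add (ρ * (E / N))
  have hroom : ∀ᶠ L : ℝ in atTop, ρ / N + N * (L⁻¹) ^ 3 < (T⁻¹ - L⁻¹) ^ 3 := by
    have h1 : Tendsto (fun L : ℝ => ρ / N + N * (L⁻¹) ^ 3) atTop (nhds (ρ / N)) := by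
      have := ((tendsto_inv_atTop_zero (𝕜 := ℝ)).pow 3).const_mul (N : ℝ)
      simpa using this.const_add (ρ / N)
    have h2 : Tendsto (fun L : ℝ => (T⁻¹ - L⁻¹) ^ 3) atTop (nhds ((T⁻¹) ^ 3)) := by
      simpa using ((tendsto_inv_atTop_zero (𝕜 := ℝ)).const_sub T⁻¹).pow 3
    refine h1.eventually_lt h2 ?_
    rw [inv_pow, div_lt_iff₀ hN0, inv_mul_eq_div, lt_div_iff₀ (by positivity)]
    exact hdens
  refine (limsup_le_limsup (v := fun L : ℝ => ρ * (E / N) + N * |E'| * (L⁻¹) ^ 3) ?_ ?_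
    hlim.isBoundedUnder_le).trans_eq hlim.limsup_eq
  · filter_upwards [hroom, eventually_ge_atTop T] with L hL hLT
    have hL0 : 0 < L := hT0.trans_le hLT
    set Nt := ⌊ρ * L ^ 3⌋₊ with hNt
    have hNt_le : (Nt : ℝ) ≤ ρ * L ^ 3 := Nat.floor_le (by positivity)
    have hn : ((Nt / N : ℕ) : ℝ) ≤ ρ * L ^ 3 / N := Nat.cast_div_le.trans (by gcongr)
    have hr : ((Nt % N : ℕ) : ℝ) ≤ N := by exact_mod_cast (Nat.mod_lt _ hN).le
    have hM : Nt / N + Nt % N ≤ ⌊L / T⌋₊ ^ 3 := by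
      have h1 : L / T - 1 ≤ ⌊L / T⌋₊ := by linarith [Nat.lt_floor_add_one (L / T)]
      have h2 : 0 ≤ L / T - 1 := by
        rw [sub_nonneg, le_div_iff₀ hT0]
        linarith
      have h3 : ρ * L ^ 3 / N + N ≤ (L / T - 1) ^ 3 := by
        have := mul_le_mul_of_nonneg_left hL.le (by positivity : 0 ≤ L ^ 3)
        calc _ = L ^ 3 * (ρ / N + N * (L⁻¹) ^ 3) := by field_simp
          _ ≤ _ := this
          _ = _ := by field_simp
      have h4 := pow_le_pow_left₀ h2 h1 3
      exact_mod_cast (add_le_add hn hr).trans (h3.trans h4)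
    have hkey := groundEnergy_le_packing hm hv hb hs hR hv0 hs0 h h' hM (L := L) (by
      rw [← hT, ← le_div_iff₀' hT0]
      exact Nat.floor_le (by positivity))
    rw [Nat.div_add_mod'] at hkey
    rw [div_le_iff₀ (by positivity)]
    refine hkey.trans ?_
    have h5 : ((Nt / N : ℕ) : ℝ) * E ≤ ρ * L ^ 3 / N * E := by gcongr
    have h6 : ((Nt % N : ℕ) : ℝ) * E' ≤ N * |E'| :=
      (mul_le_mul_of_nonneg_left (le_abs_self E') (Nat.cast_nonneg _)).trans (by gcongr)
    refine (add_le_add h5 h6).trans_eq ?_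
    field_simp
  · exact isCoboundedUnder_le_of_eventually_le atTop (x := 0) <| by
      filter_upwards [eventually_ge_atTop 0] with L hL
      exact div_nonneg (groundEnergy_nonneg hv _ _ _) (by positivity)

end ThermodynamicLimit

section EnergyPerParticle

set_option maxHeartbeats 1000000 in
theorem energy_div_le {q m T ℓ k b r κ c η δ J₀ W w g V R0 N Ω : ℝ} (hq : 1 ≤ q) (hm : 0 < m)
    (hb : 0 < b) (hℓ : 0 < ℓ) (hk : 0 < k) (hr : 0 ≤ r) (hr2 : r ≤ 2) (hκ : 0 < κ) (hc : 0 < c)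
    (hη : 0 < η) (hδ : 0 < δ) (hδ1 : δ < 1) (hJ : 0 ≤ J₀) (hW : 0 ≤ W) (hw : 0 ≤ w) (hg : 0 ≤ g)
    (hV : 0 ≤ V) (hkℓ : c * k ≤ r * (b * ℓ)) (hkκ : κ ≤ k * b)
    (hN : N = q * m) (hΩ : Ω = w / ℓ ^ 3)
    (hmℓ : N ≤ (r * (b * ℓ)) ^ 3) (hmκ : N * b ^ 3 ≤ (4 * c * κ) ^ 3)
    (hT : T ≤ 3 / 5 * (b * ℓ / c) ^ 2 * r ^ 5 * m) :
    (q * ((2 * π / ℓ) ^ 2 * T) +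
      N * ((1 + 1 / η) * (3 * π ^ 2 * W / (1 / b * ℓ)) +
          (1 / 2) * ((q - 1) * m) * ((1 + η) * J₀ / ℓ ^ 3)) *
        ((1 - δ)⁻¹ + exp (N ^ 2 * Ω) * ((δ ^ 2)⁻¹ * (3 * N ^ 3 * Ω ^ 2))) +
      exp (N ^ 2 * Ω) * ((1 + η) / 4 * (2 * N ^ 3 * (g / ℓ ^ 3) ^ 2) +
        (1 / 2) * (N * m * (2 * (2 * π * k / ℓ) ^ 2 * R0 ^ 2 * V / ℓ ^ 3)))) / N ≤
    3 / 5 * (2 * π / c) ^ 2 * b ^ 2 * r ^ 5 + b ^ 3 *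
      (((1 + 1 / η) * (3 * π ^ 2 * W / (c * κ)) * r + 1 / 2 * (1 - 1 / q) * (1 + η) * J₀ * r ^ 3) *
        ((1 - δ)⁻¹ + exp (8 * w * (4 * c * κ) ^ 3) *
          ((δ ^ 2)⁻¹ * (192 * w ^ 2 * (4 * c * κ) ^ 3)) * b ^ 3) +
        exp (8 * w * (4 * c * κ) ^ 3) * (32 * (1 + η) * g ^ 2 * b ^ 3 +
          8 * (4 * π / c) ^ 2 * R0 ^ 2 * V * b ^ 2)) := by
  have hN0 : 0 < N := by rw [hN]; positivity
  have hq0 : 0 < q := by linarith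
  set p := N / ℓ ^ 3 with hp
  have hp0 : 0 < p := by positivity
  have hpr : p ≤ r ^ 3 * b ^ 3 := by
    rw [hp, div_le_iff₀ (by positivity)]
    exact hmℓ.trans_eq (by ring)
  have hp8 : p ≤ 8 * b ^ 3 := hpr.trans (by
    have : r ^ 3 ≤ 2 ^ 3 := by gcongr
    nlinarith [pow_pos hb 3])
  have hkin : (2 * π / ℓ) ^ 2 * T / m ≤ 3 / 5 * (2 * π / c) ^ 2 * b ^ 2 * r ^ 5 := by
    rw [div_le_iff₀ hm]
    refine (mul_le_mul_of_nonneg_left hT (by positivity)).trans_eq ?_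
    field_simp
  have hcut : 3 * π ^ 2 * W / (1 / b * ℓ) ≤ 3 * π ^ 2 * W / (c * κ) * r * b ^ 3 := by
    have h1 : c * κ ≤ r * (b * ℓ) * b := by
      have h2 := mul_le_mul_of_nonneg_left hkκ hc.le
      have h3 := mul_le_mul_of_nonneg_right hkℓ hb.le
      linarith
    have h2 : b / ℓ ≤ r * b ^ 3 / (c * κ) := by
      rw [div_le_div_iff₀ hℓ (by positivity)]
      calc b * (c * κ) ≤ b * (r * (b * ℓ) * b) := by gcongr
        _ = _ := by ring
    calc _ = 3 * π ^ 2 * W * (b / ℓ) := by field_simp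
      _ ≤ 3 * π ^ 2 * W * (r * b ^ 3 / (c * κ)) := by gcongr
      _ = _ := by ring
  have hinteg : (1 / 2) * ((q - 1) * m) * ((1 + η) * J₀ / ℓ ^ 3) ≤
      1 / 2 * (1 - 1 / q) * (1 + η) * J₀ * r ^ 3 * b ^ 3 := by
    have h0 : 0 ≤ 1 - 1 / q := by
      rw [sub_nonneg, div_le_one hq0]
      exact hq
    calc _ = 1 / 2 * (1 - 1 / q) * (1 + η) * J₀ * p := by
          rw [hp, hN]
          field_simp
      _ ≤ 1 / 2 * (1 - 1 / q) * (1 + η) * J₀ * (r ^ 3 * b ^ 3) := by gcongr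
      _ = _ := by ring
  have hNp : N * p ≤ 8 * (4 * c * κ) ^ 3 :=
    (mul_le_mul_of_nonneg_left hp8 hN0.le).trans (by linarith)
  have hexp : exp (N ^ 2 * Ω) ≤ exp (8 * w * (4 * c * κ) ^ 3) := by
    refine exp_le_exp.2 ?_
    calc N ^ 2 * Ω = w * (N * p) := by rw [hΩ, hp]; ring
      _ ≤ w * (8 * (4 * c * κ) ^ 3) := by gcongr
      _ = _ := by ring
  have hNΩ : 3 * N ^ 3 * Ω ^ 2 ≤ 192 * w ^ 2 * (4 * c * κ) ^ 3 * b ^ 3 := by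
    calc 3 * N ^ 3 * Ω ^ 2 = 3 * w ^ 2 * (N * p * p) := by rw [hΩ, hp]; field_simp
      _ ≤ 3 * w ^ 2 * (8 * (4 * c * κ) ^ 3 * (8 * b ^ 3)) := by gcongr
      _ = _ := by ring
  have hgrad : (1 + η) / 4 * (2 * N ^ 3 * (g / ℓ ^ 3) ^ 2) / N ≤ 32 * (1 + η) * g ^ 2 * b ^ 6 := by
    calc _ = (1 + η) / 2 * g ^ 2 * p ^ 2 := by rw [hp]; field_simp; ring
      _ ≤ (1 + η) / 2 * g ^ 2 * (8 * b ^ 3) ^ 2 := by gcongr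
      _ = _ := by ring
  have hsame : (1 / 2) * (N * m * (2 * (2 * π * k / ℓ) ^ 2 * R0 ^ 2 * V / ℓ ^ 3)) / N ≤
      8 * (4 * π / c) ^ 2 * R0 ^ 2 * V * b ^ 5 := by
    have h1 : k / ℓ ≤ 2 * b / c := by
      rw [div_le_div_iff₀ hℓ hc]
      have : r * (b * ℓ) ≤ 2 * (b * ℓ) := by gcongr
      linarith
    have h2 : m / ℓ ^ 3 ≤ 8 * b ^ 3 := by
      refine le_trans ?_ hp8
      rw [hp]
      gcongr
      rw [hN]
      nlinarith
    calc _ = (2 * π) ^ 2 * (k / ℓ) ^ 2 * R0 ^ 2 * V * (m / ℓ ^ 3) := by field_simp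
      _ ≤ (2 * π) ^ 2 * (2 * b / c) ^ 2 * R0 ^ 2 * V * (8 * b ^ 3) := by gcongr
      _ = _ := by ring
  have hδ' : 0 < 1 - δ := by linarith
  have hI0 : 0 ≤ (1 / 2) * ((q - 1) * m) * ((1 + η) * J₀ / ℓ ^ 3) := by
    have : 0 ≤ q - 1 := by linarith
    positivity
  have hΩ0 : 0 ≤ Ω := by rw [hΩ]; positivity
  have hm' : q * ((2 * π / ℓ) ^ 2 * T) / N = (2 * π / ℓ) ^ 2 * T / m := by
    rw [hN]
    field_simp
  rw [add_div, add_div, hm', mul_assoc N, mul_div_cancel_left₀ _ hN0.ne', mul_div_assoc (exp _),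
    add_div]
  have hA : (1 + 1 / η) * (3 * π ^ 2 * W / (1 / b * ℓ)) +
          (1 / 2) * ((q - 1) * m) * ((1 + η) * J₀ / ℓ ^ 3) ≤
      (1 + 1 / η) * (3 * π ^ 2 * W / (c * κ) * r * b ^ 3) +
        1 / 2 * (1 - 1 / q) * (1 + η) * J₀ * r ^ 3 * b ^ 3 :=
    add_le_add (mul_le_mul_of_nonneg_left hcut (by positivity)) hinteg
  have hF : (1 - δ)⁻¹ + exp (N ^ 2 * Ω) * ((δ ^ 2)⁻¹ * (3 * N ^ 3 * Ω ^ 2)) ≤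
      (1 - δ)⁻¹ + exp (8 * w * (4 * c * κ) ^ 3) *
        ((δ ^ 2)⁻¹ * (192 * w ^ 2 * (4 * c * κ) ^ 3 * b ^ 3)) :=
    add_le_add le_rfl (mul_le_mul hexp (mul_le_mul_of_nonneg_left hNΩ (by positivity))
      (by positivity) (exp_pos _).le)
  have hG := mul_le_mul hexp (add_le_add hgrad hsame) (by positivity) (exp_pos _).le
  have hAF := mul_le_mul hA hF (by positivity) ((add_nonneg (by positivity) hI0).trans hA)
  refine (add_le_add (add_le_add hkin hAF) hG).trans_eq ?_
  ring

end EnergyPerParticle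

section CellEnergy

variable {v φ : R3 → ℝ} {R0 a : ℝ}

theorem stateEnergy_nonneg {ι : Type*} [Fintype ι] [DecidableEq ι] (hv : ∀ x, 0 ≤ v x)
    (Φ : (ι → R3) → ℂ) : 0 ≤ stateEnergy v Φ := by
  rw [stateEnergy_eq_integral]
  exact integral_nonneg fun X => energyDensity_nonneg hv Φ X

theorem Scattering.hasCellState_one (Sc : Scattering v φ R0 a) {q : ℕ} (hq : 1 ≤ q) {ℓ d : ℝ}
    (hd : 0 < d) (hdl : d ≤ ℓ) : ∃ E, HasCellState v q (closedCube (ℓ + d)) 1 E := by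
  obtain ⟨ω, hω, hc, h0, hs, hJ⟩ := Sc.exists_correlation one_pos
  obtain ⟨c, hc1, -⟩ := exists_boxState_energy_bound (S := Unit) Sc hω hc h0 hs hJ hd hdl
    (K := {0}) (R := 0) (by simp) one_pos (δ := 1 / 2) (by norm_num) (by norm_num)
    (q := 1) (by simp) le_rfl rfl rfl rfl
  exact ⟨_, hasCellState_boxState (lab := fun _ : Unit => (⟨0, hq⟩ : Fin q))
    (Function.injective_of_subsingleton _) hω hd (by simp) hc1 le_rfl⟩

/-- Per-particle energy correction, in units of the density `b ^ 3`. -/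
def energyCorrection (A B C D t Z₁ Z₂ Z₃ b : ℝ) : ℝ :=
  93 * C * (D + b ^ 2) + ((A * (1 + 3 * (b * (D + b ^ 2))) + B * (1 + 3 * (b * (D + b ^ 2))) ^ 3) *
    ((1 - t)⁻¹ + Z₁ * b ^ 3) + (Z₂ * b ^ 3 + Z₃ * b ^ 2))

set_option maxHeartbeats 2000000 in
theorem Scattering.exists_cellEnergy (Sc : Scattering v φ R0 a) {q : ℕ} (hq : 1 ≤ q) {t κ c : ℝ}
    (ht : 0 < t) (ht1 : t < 1) (hκ : 0 < κ) (hc : 0 < c) (hcq : c ^ 3 = 4 * π * q / 3) :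
    ∃ Z₁ Z₂ Z₃, ∀ b k : ℝ, 0 < b → ∀ n : ℕ, k = n → κ ≤ k * b → k * b ≤ 2 * κ →
      b * (R0 + 1) ≤ 1 → 2 * b ≤ c * κ → b * ((4 + 2 / c) / κ + b ^ 2) ≤ 1 / 3 →
      ∃ (N : ℕ) (s E E' : ℝ), 0 < N ∧ 0 ≤ s ∧ 0 ≤ E ∧ HasCellState v q (closedCube s) N E ∧
        HasCellState v q (closedCube s) 1 E' ∧ b ^ 3 * (s + R0 + 1) ^ 3 < N ∧
        E / N ≤ 3 / 5 * (2 * π / c) ^ 2 * b ^ 2 + b ^ 3 *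
          energyCorrection ((1 + 1 / t) * (3 * π ^ 2 * stepEnergy / (c * κ)))
            (1 / 2 * (1 - 1 / q) * (1 + t) * (8 * π * a + t)) (3 / 5 * (2 * π / c) ^ 2)
            ((4 + 2 / c) / κ) t Z₁ Z₂ Z₃ b := by
  obtain ⟨ω, hω, hωc, h0, hs, hJ⟩ := Sc.exists_correlation ht
  obtain ⟨w, hw⟩ : ∃ w, w = ∫ x, ω x := ⟨_, rfl⟩
  obtain ⟨g, hg⟩ : ∃ g, g = ∫ x, √(realGradSq ω x) := ⟨_, rfl⟩
  obtain ⟨V, hV⟩ : ∃ V, V = ∫ x, v x := ⟨_, rfl⟩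
  refine ⟨exp (8 * w * (4 * c * κ) ^ 3) * ((t ^ 2)⁻¹ * (192 * w ^ 2 * (4 * c * κ) ^ 3)),
    exp (8 * w * (4 * c * κ) ^ 3) * (32 * (1 + t) * g ^ 2),
    exp (8 * w * (4 * c * κ) ^ 3) * (8 * (4 * π / c) ^ 2 * R0 ^ 2 * V),
    fun b k hb n hkn hκk hkκ hbR hbc hy3 => ?_⟩
  have hR := Sc.R0_pos
  have hq0 : (1 : ℝ) ≤ q := by exact_mod_cast hq
  obtain ⟨D, hD⟩ : ∃ D, D = (4 + 2 / c) / κ := ⟨_, rfl⟩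
  rw [← hD] at hy3 ⊢
  have hD0 : 0 < D := hD ▸ by positivity
  obtain ⟨y, hy⟩ : ∃ y, y = b * (D + b ^ 2) := ⟨_, rfl⟩
  rw [← hy] at hy3
  have hy0 : 0 < y := hy ▸ by positivity
  have hk0 : 0 < k := pos_of_mul_pos_left (hκ.trans_le hκk) hb.le
  have hcky : 4 * c + 2 + c * k * b ^ 3 ≤ c * k * y := by
    have h1 : κ * (c * D) ≤ k * b * (c * D) := by gcongr
    have h2 : κ * (c * D) = 4 * c + 2 := by
      rw [hD]
      field_simp
    rw [h2] at h1
    rw [hy]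
    linarith
  have hky : 4 ≤ k * y := by
    have : 0 < c * k * b ^ 3 := by positivity
    nlinarith
  have hk4 : 4 < k := by nlinarith
  have hk40 : 0 < k - 4 := by linarith
  obtain ⟨σ, hσ⟩ : ∃ σ, σ = c * (k - 4) / (b * (1 + b ^ 3)) := ⟨_, rfl⟩
  obtain ⟨ℓ, hℓ⟩ : ∃ ℓ, ℓ = σ - 1 / b - R0 - 1 := ⟨_, rfl⟩
  have hbℓ : c * (k * (1 - y)) ≤ b * ℓ := by
    have h1 : c * (k - 4) * (1 - b ^ 3) ≤ b * σ := by
      have : b * σ = c * (k - 4) / (1 + b ^ 3) := by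
        rw [hσ]
        field_simp
      rw [this, le_div_iff₀ (by positivity)]
      have : 0 ≤ c * (k - 4) * (b ^ 3) ^ 2 := by positivity
      linarith
    have h2 : b * ℓ = b * σ - 1 - b * (R0 + 1) := by
      rw [hℓ]
      field_simp
      ring
    have h3 : 0 ≤ c * b ^ 3 := by positivity
    linarith
  have hr : k * (1 + y) ≤ (1 + 3 * y) * (k * (1 - y)) := by nlinarith
  have hu : k * (2 / 3) ≤ k * (1 - y) := by
    gcongr
    linarith
  have hdl : 1 / b ≤ ℓ := by
    rw [div_le_iff₀ hb]
    have h1 : 2 * b ≤ c * k * b := by nlinarith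
    have h2 : 2 ≤ c * k := le_of_mul_le_mul_right h1 hb
    have h3 := mul_le_mul_of_nonneg_left hu hc.le
    linarith
  have hd : 0 < 1 / b := by positivity
  have hℓ0 : 0 < ℓ := hd.trans_le hdl
  obtain ⟨E', hE'⟩ := Sc.hasCellState_one hq hd hdl
  have hn4 : 4 ≤ n := by exact_mod_cast hkn ▸ hk4.le
  obtain ⟨m, hm⟩ : ∃ m : ℝ, m = (latticeBall n).card := ⟨_, rfl⟩
  have hm1 : 4 * π / 3 * (k - 4) ^ 3 ≤ m := by
    rw [hkn, hm]
    exact le_card_latticeBall hn4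
  have hm2 : m ≤ 4 * π / 3 * (k + 4) ^ 3 := by
    rw [hkn, hm]
    exact card_latticeBall_le n
  obtain ⟨T, hT⟩ : ∃ T, T = ∑ z ∈ latticeBall n, ∑ j, (z j : ℝ) ^ 2 := ⟨_, rfl⟩
  have hT1 : T ≤ 4 * π / 5 * (k + 4) ^ 5 := by
    rw [hkn, hT]
    exact sum_latticeBall_le n
  have hm0 : 0 < m := lt_of_lt_of_le (by positivity) hm1
  have hN1 : c ^ 3 * (k - 4) ^ 3 ≤ q * m := by
    rw [hcq]
    calc _ = q * (4 * π / 3 * (k - 4) ^ 3) := by ring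
      _ ≤ _ := by gcongr
  have hN2 : q * m ≤ c ^ 3 * (k + 4) ^ 3 := by
    rw [hcq]
    calc _ ≤ q * (4 * π / 3 * (k + 4) ^ 3) := by gcongr
      _ = _ := by ring
  have hrl : c * (k + 4) ≤ (1 + 3 * y) * (b * ℓ) :=
    calc c * (k + 4) ≤ c * (k * (1 + y)) := by gcongr; linarith
      _ ≤ c * ((1 + 3 * y) * (k * (1 - y))) := by gcongr
      _ = (1 + 3 * y) * (c * (k * (1 - y))) := by ring
      _ ≤ _ := by gcongr
  have hkb : (k + 4) * b ≤ 4 * κ := by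
    have := mul_le_mul_of_nonneg_right (show k + 4 ≤ 2 * k by linarith) hb.le
    linarith
  have hW : 0 ≤ stepEnergy := integral_nonneg fun _ => sq_nonneg _
  have ha := Sc.a_nonneg
  have hr5 : (1 + 3 * y) ^ 5 ≤ 1 + 93 * y := by
    have h1 : 3 * y ≤ 1 := by linarith
    have h2 : ∀ i : ℕ, (3 * y) ^ (i + 1) ≤ 3 * y := fun i =>
      pow_le_of_le_one (by positivity) h1 (by simp)
    have h3 := h2 1
    have h4 := h2 2
    have h5 := h2 3
    have h6 := h2 4
    norm_num at h3 h4 h5 h6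
    linarith
  have hsize : b * σ < c * (k - 4) := by
    have h2 : b * σ = c * (k - 4) / (1 + b ^ 3) := by
      rw [hσ]
      field_simp
    rw [h2]
    exact div_lt_self (by positivity) (by linarith [pow_pos hb 3])
  have hσ0 : 0 ≤ σ := hσ ▸ by positivity
  have hlead := mul_le_mul_of_nonneg_left hr5 (by positivity : 0 ≤ 3 / 5 * (2 * π / c) ^ 2 * b ^ 2)
  have hkm : q * m * b ^ 3 ≤ (4 * c * κ) ^ 3 :=
    calc q * m * b ^ 3 ≤ c ^ 3 * (k + 4) ^ 3 * b ^ 3 := by gcongr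
      _ = (c * ((k + 4) * b)) ^ 3 := by ring
      _ ≤ (c * (4 * κ)) ^ 3 := by gcongr
      _ = _ := by ring
  have hTm : T ≤ 3 / 5 * (b * ℓ / c) ^ 2 * (1 + 3 * y) ^ 5 * m := by
    have h1 : k * (1 - y) ≤ b * ℓ / c := by rwa [le_div_iff₀' hc]
    have hu0 : 0 ≤ k * (1 - y) := le_trans (by positivity) hu
    have h2 : k * (1 - y) ≤ k - 4 := by linarith
    calc _ ≤ 4 * π / 5 * (k + 4) ^ 5 := hT1
      _ ≤ 4 * π / 5 * ((1 + 3 * y) * (k * (1 - y))) ^ 5 := by gcongr; linarith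
      _ = 3 / 5 * (k * (1 - y)) ^ 2 * (1 + 3 * y) ^ 5 * (4 * π / 3 * (k * (1 - y)) ^ 3) := by
        ring
      _ ≤ 3 / 5 * (b * ℓ / c) ^ 2 * (1 + 3 * y) ^ 5 * (4 * π / 3 * (k - 4) ^ 3) := by gcongr
      _ ≤ _ := by gcongr
  obtain ⟨γ, hγ1, hγ⟩ := exists_boxState_energy_bound (S := Fin q) Sc hω hωc h0 hs hJ hd hdl
    (K := latticeBall n) (R := k) (fun z hz => by
      rw [hkn]
      exact_mod_cast mem_latticeBall.1 hz) ht ht ht1 (q := q) (by simp) hq0 hm rfl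
    rfl
  rw [← hw, ← hg, ← hV, ← hT] at hγ
  have hkey := energy_div_le (T := T) (r := 1 + 3 * y) (w := w) (g := g) (V := V)
    (R0 := R0) (J₀ := 8 * π * a + t) (κ := κ) (c := c) (δ := t) (η := t)
    hq0 hm0 hb hℓ0 hk0 (by positivity) (by linarith) hκ hc ht ht ht1 (by positivity) hW
    (hw ▸ integral_nonneg h0) (hg ▸ integral_nonneg fun _ => Real.sqrt_nonneg _)
    (hV ▸ integral_nonneg Sc.v_nonneg) (le_trans (by gcongr; linarith) hrl) hκk rfl rfl
    (hN2.trans (by rw [← mul_pow]; gcongr)) hkm hTm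
  refine ⟨q * (latticeBall n).card, ℓ + 1 / b, stateEnergy v (boxState (Fin q) ℓ (1 / b)
    (latticeBall n) ω γ), E', ?_, by positivity, stateEnergy_nonneg Sc.v_nonneg _,
    hasCellState_boxState (lab := id) Function.injective_id hω hd (by simp) hγ1 le_rfl, hE', ?_, ?_⟩
  · exact Nat.mul_pos hq (Nat.cast_pos.1 (hm ▸ hm0))
  · push_cast
    rw [← hm]
    refine lt_of_lt_of_le ?_ hN1
    have h1 : ℓ + 1 / b + R0 + 1 = σ := by rw [hℓ]; ring
    rw [h1, ← mul_pow, ← mul_pow]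
    exact pow_lt_pow_left₀ hsize (mul_nonneg hb.le hσ0) (by norm_num)
  · push_cast
    rw [← hm]
    refine (div_le_div_of_nonneg_right hγ (by positivity)).trans (hkey.trans ?_)
    refine (add_le_add hlead le_rfl).trans_eq ?_
    have hby : b ^ 2 * y = b ^ 3 * (D + b ^ 2) := by rw [hy]; ring
    rw [energyCorrection, ← hy]
    linear_combination (93 * (3 / 5 * (2 * π / c) ^ 2)) * hby

end CellEnergy

section DiluteLimit

variable {v φ : R3 → ℝ} {R0 a : ℝ}

theorem Scattering.exists_cell_of_density (Sc : Scattering v φ R0 a) {q : ℕ} (hq : 1 ≤ q) {c : ℝ}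
    (hc : 0 < c) (hcq : c ^ 3 = 4 * π * q / 3) {ε : ℝ} (hε : 0 < ε) :
    ∃ b₀ > (0 : ℝ), ∀ b, 0 < b → b < b₀ → ∃ (N : ℕ) (s E E' : ℝ), 0 < N ∧ 0 ≤ s ∧ 0 ≤ E ∧
      HasCellState v q (closedCube s) N E ∧ HasCellState v q (closedCube s) 1 E' ∧
      b ^ 3 * (s + R0 + 1) ^ 3 < N ∧
      E / N ≤ 3 / 5 * (2 * π / c) ^ 2 * b ^ 2 + b ^ 3 * (4 * π * (1 - 1 / q) * a + ε) := by
  set C := 3 / 5 * (2 * π / c) ^ 2 with hC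
  set F : ℝ → ℝ := fun t => 93 * C * ((4 + 2 / c) * t ^ 2) + ((t ^ 2 + t) *
    (3 * π ^ 2 * stepEnergy / c) + 1 / 2 * (1 - 1 / q) * (1 + t) * (8 * π * a + t)) * (1 - t)⁻¹
    with hF
  have hFc : ContinuousAt F 0 := by
    refine ContinuousAt.add (by fun_prop) (ContinuousAt.mul (by fun_prop)
      (ContinuousAt.inv₀ (by fun_prop) (by norm_num)))
  have hF0 : F 0 < 4 * π * (1 - 1 / q) * a + ε := by
    have : F 0 = 4 * π * (1 - 1 / q) * a := by
      simp only [hF]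
      norm_num
      ring
    linarith
  obtain ⟨t, htF, ht0, ht1⟩ : ∃ t, F t < 4 * π * (1 - 1 / q) * a + ε ∧ 0 < t ∧ t < 1 := by
    have h1 := (hFc.eventually_lt continuousAt_const hF0).filter_mono
      (nhdsWithin_le_nhds (s := Set.Ioi 0))
    obtain ⟨t, ht, ht'⟩ := (h1.and (Ioo_mem_nhdsGT one_pos)).exists
    exact ⟨t, ht, ht'.1, ht'.2⟩
  have hκ : 0 < (t ^ 2)⁻¹ := by positivity
  obtain ⟨Z₁, Z₂, Z₃, hZ⟩ := Sc.exists_cellEnergy hq ht0 ht1 hκ hc hcq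
  set A := (1 + 1 / t) * (3 * π ^ 2 * stepEnergy / (c * (t ^ 2)⁻¹)) with hA
  set B := 1 / 2 * (1 - 1 / (q : ℝ)) * (1 + t) * (8 * π * a + t) with hB
  set D := (4 + 2 / c) / (t ^ 2)⁻¹ with hD
  have hec : Continuous fun b => energyCorrection A B C D t Z₁ Z₂ Z₃ b := by
    unfold energyCorrection
    fun_prop
  have he0 : energyCorrection A B C D t Z₁ Z₂ Z₃ 0 < 4 * π * (1 - 1 / q) * a + ε := by
    refine lt_of_eq_of_lt ?_ htF
    have hA' : A = (t ^ 2 + t) * (3 * π ^ 2 * stepEnergy / c) := by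
      rw [hA]
      field_simp
      try ring
    have hD' : D = (4 + 2 / c) * t ^ 2 := by
      rw [hD, div_inv_eq_mul]
    simp only [energyCorrection, hF, hA', hD', ← hB]
    norm_num
  have hev : ∀ᶠ b : ℝ in nhds 0, energyCorrection A B C D t Z₁ Z₂ Z₃ b <
      4 * π * (1 - 1 / q) * a + ε ∧ b * (R0 + 1) < 1 ∧ 2 * b < c * (t ^ 2)⁻¹ ∧
      b * (D + b ^ 2) < 1 / 3 ∧ b < (t ^ 2)⁻¹ := by
    have hlt : ∀ {f : ℝ → ℝ} {y : ℝ}, Continuous f → f 0 < y → ∀ᶠ b in nhds 0, f b < y :=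
      fun hf h => hf.continuousAt.eventually_lt continuousAt_const h
    refine (hlt hec he0).and ((hlt (by fun_prop) (by norm_num)).and
      ((hlt (by fun_prop) (by rw [mul_zero]; positivity)).and
      ((hlt (by fun_prop) (by norm_num)).and (hlt continuous_id hκ))))
  obtain ⟨b₀, hb₀, hball⟩ := Metric.eventually_nhds_iff.1 hev
  refine ⟨b₀, hb₀, fun b hb hbb => ?_⟩
  obtain ⟨h1, h2, h3, h4, h5⟩ := hball (y := b) (by
    rwa [dist_zero_right, Real.norm_of_nonneg hb.le])
  have hk1 : (t ^ 2)⁻¹ ≤ (⌈(t ^ 2)⁻¹ / b⌉₊ : ℝ) * b := by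
    rw [← div_le_iff₀ hb]
    exact Nat.le_ceil _
  have hk2 : (⌈(t ^ 2)⁻¹ / b⌉₊ : ℝ) * b ≤ 2 * (t ^ 2)⁻¹ := by
    have := mul_le_mul_of_nonneg_right (Nat.ceil_lt_add_one (a := (t ^ 2)⁻¹ / b)
      (by positivity)).le hb.le
    rw [add_mul, div_mul_cancel₀ _ hb.ne'] at this
    linarith
  obtain ⟨N, s, E, E', hN, hs, hE, hE1, hE2, hd, hEN⟩ :=
    hZ b _ hb _ rfl hk1 hk2 h2.le h3.le h4.le
  exact ⟨N, s, E, E', hN, hs, hE, hE1, hE2, hd, hEN.trans (by gcongr)⟩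

end DiluteLimit

theorem dilute_fermi_gas_upper_bound
    (q : ℕ) (hq : 1 ≤ q)
    (v φ : R3 → ℝ) (R0 a : ℝ) (hR0 : 0 < R0)
    (hv_meas : Measurable v)
    (hv_nonneg : ∀ x, 0 ≤ v x)
    (hv_bdd : ∃ C, ∀ x, v x ≤ C)
    (hv_radial : ∀ x y : R3, ‖x‖ = ‖y‖ → v x = v y)
    (hv_supp : ∀ x : R3, R0 < ‖x‖ → v x = 0)
    (hφ_C1 : ContDiff ℝ 1 φ)
    (hφ_nonneg : ∀ x, 0 ≤ φ x)
    (hφ_le_one : ∀ x, φ x ≤ 1)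
    (hφ_eq : ∀ x : R3, R0 ≤ ‖x‖ → φ x = 1 - a / ‖x‖)
    (hφ_scatt : ∀ g : R3 → ℝ, ContDiff ℝ (⊤ : ℕ∞) g → HasCompactSupport g →
      (∫ x : R3, ⟪gradient φ x, gradient g x⟫) + (1/2) * ∫ x : R3, v x * φ x * g x = 0) :
    ∀ ε > (0:ℝ), ∃ ρ₀ > (0:ℝ), ∀ ρ : ℝ, 0 < ρ → ρ < ρ₀ →
      limsup (fun L : ℝ => groundEnergy (⌊ρ * L ^ 3⌋₊) q L v / L ^ 3) atTop ≤
        (3/5) * (6 * π ^ 2 / q) ^ ((2:ℝ)/3) * ρ ^ ((5:ℝ)/3)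
          + 4 * π * (1 - 1/q) * a * ρ ^ 2 + ε * ρ ^ 2 := by
  intro ε hε
  have Sc : Scattering v φ R0 a := ⟨hR0, hv_meas, hv_nonneg, hv_bdd, hv_radial, hv_supp, hφ_C1,
    hφ_nonneg, hφ_le_one, hφ_eq, hφ_scatt⟩
  have hq0 : (0 : ℝ) < q := by exact_mod_cast hq
  set c : ℝ := (4 * π * q / 3) ^ ((1 : ℝ) / 3) with hc
  have hc0 : 0 < c := by positivity
  have hcube : ∀ x : ℝ, 0 ≤ x → (x ^ ((1 : ℝ) / 3)) ^ 3 = x := fun x hx => by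
    rw [← Real.rpow_natCast, ← Real.rpow_mul hx]
    norm_num
  have hcq : c ^ 3 = 4 * π * q / 3 := hcube _ (by positivity)
  obtain ⟨b₀, hb₀, h⟩ := Sc.exists_cell_of_density hq hc0 hcq hε
  refine ⟨b₀ ^ 3, by positivity, fun ρ hρ hρ₀ => ?_⟩
  set b := ρ ^ ((1 : ℝ) / 3) with hb
  have hb0 : 0 < b := by positivity
  have hb3 : b ^ 3 = ρ := hcube ρ hρ.le
  obtain ⟨N, s, E, E', hN, hs, hE, hE1, hE2, hd, hEN⟩ :=
    h b hb0 (lt_of_pow_lt_pow_left₀ 3 hb₀.le (hb3.trans_lt hρ₀))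
  rw [hb3] at hd
  refine (limsup_groundEnergy_le hv_meas hv_nonneg hv_bdd
    (fun x => hv_radial _ _ (norm_neg x)) hR0.le hv_supp hs hN hE hE1 hE2 hρ hd).trans ?_
  have hfermi : (6 * π ^ 2 / q : ℝ) ^ ((2 : ℝ) / 3) = (2 * π / c) ^ 2 := by
    have h1 : (6 * π ^ 2 / q : ℝ) = (2 * π / c) ^ 3 := by
      rw [div_pow, hcq]
      field_simp
      ring
    rw [h1, ← Real.rpow_natCast (2 * π / c) 3, ← Real.rpow_mul (by positivity),
      ← Real.rpow_natCast (2 * π / c) 2]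
    norm_num
  have hρ5 : ρ ^ ((5 : ℝ) / 3) = b ^ 5 := by
    rw [hb, ← Real.rpow_natCast, ← Real.rpow_mul hρ.le]
    norm_num
  rw [hfermi, hρ5]
  refine (mul_le_mul_of_nonneg_left hEN hρ.le).trans_eq ?_
  rw [← hb3]
  ring
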